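/- Let δ₂ = 0.044560, δ₃ = 0.074267, δ₄ = 0.103974, and δ_ℓ = 0.124821 for ℓ ≥ 5, and set θ_ℓ = ℓ − δ_ℓ. Let ℓ ≥ 2 be an integer and let α ≥ 1/2 and β ≥ 0 be real numbers with α, β ≤ 1. If α/16 + β > 1, α/3 + β > 5/4, and max{ β/(α/16 + β − 1), β/(α/3 + β − 5/4) } ≤ θ_ℓ, then the triple (ℓ; α, β) is admissible: for every ε > 0 there exists M such that for every integer m ≥ M and every integer a with gcd(a,m) = 1, there exist a prime p ≤ m^{α+ε} and a positive integer s ≤ m^{β+ε} which is a product of at most ℓ primes (counted with multiplicity), such that p·s ≡ a (mod m). -/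

import Mathlib

/-- The Greaves sieve constants δ_ℓ. -/
noncomputable def greavesDelta (l : ℕ) : ℝ :=
  if l ≤ 2 then 0.044560
  else if l = 3 then 0.074267
  else if l = 4 then 0.103974
  else 0.124821

/-- θ_ℓ = ℓ - δ_ℓ. -/
noncomputable def greavesTheta (l : ℕ) : ℝ := l - greavesDelta l

section

theorem pa_local (ε : ℝ) (hε : 0 < ε) (p a : ℕ) (hp : 2 ≤ p) :
    ((a:ℝ) + 1) ≤ (1 + 1 / (ε * Real.log 2)) * ((p:ℝ) ^ a) ^ ε := by
  have hl : 0 < Real.log 2 := Real.log_pos (by norm_num)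
  have hp' : (2:ℝ) ≤ p := by exact_mod_cast hp
  have h1 : Real.exp (ε * a * Real.log 2) ≤ ((p:ℝ) ^ a) ^ ε := by
    rw [← Real.rpow_natCast, ← Real.rpow_mul (by linarith), Real.rpow_def_of_pos (by linarith)]
    apply Real.exp_le_exp.2
    have : Real.log 2 ≤ Real.log p := Real.log_le_log (by norm_num) hp'
    have h3 : 0 ≤ ε * a := by positivity
    nlinarith
  have h2 := Real.add_one_le_exp (ε * a * Real.log 2)
  have h3 : ((a:ℝ) + 1) ≤ (1 + 1 / (ε * Real.log 2)) * (1 + ε * a * Real.log 2) := by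
    have : (1 + 1 / (ε * Real.log 2)) * (1 + ε * a * Real.log 2) =
      1 + a + ε * a * Real.log 2 + 1 / (ε * Real.log 2) := by
      field_simp
      ring
    rw [this]
    have : 0 ≤ ε * a * Real.log 2 := by positivity
    have : 0 ≤ 1 / (ε * Real.log 2) := by positivity
    linarith
  refine h3.trans ?_
  gcongr
  linarith

theorem pa_local2 (ε : ℝ) (hε : 0 < ε) (p a : ℕ) (hp : (2:ℝ) ^ (1/ε) ≤ p) :
    ((a:ℝ) + 1) ≤ ((p:ℝ) ^ a) ^ ε := by
  have h0 : (0:ℝ) < p := lt_of_lt_of_le (by positivity) hp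
  have h1 : (2:ℝ) ≤ (p:ℝ) ^ ε := by
    have := Real.rpow_le_rpow (by positivity) hp hε.le
    rwa [← Real.rpow_mul (by norm_num), one_div_mul_cancel hε.ne', Real.rpow_one] at this
  have h2 : ((p:ℝ) ^ a) ^ ε = ((p:ℝ) ^ ε) ^ a := by
    rw [← Real.rpow_natCast, ← Real.rpow_mul h0.le, mul_comm, Real.rpow_mul h0.le, Real.rpow_natCast]
  rw [h2]
  have h3 : ((a:ℝ) + 1) ≤ 2 ^ a := by
    have : a + 1 ≤ 2 ^ a := Nat.succ_le_of_lt Nat.lt_two_pow_self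
    exact_mod_cast this
  exact h3.trans (by gcongr)

/-- divisor bound -/
theorem pa_divisor_bound (ε : ℝ) (hε : 0 < ε) :
    ∃ C : ℝ, 1 ≤ C ∧ ∀ n : ℕ, 0 < n → ((n.divisors.card : ℕ) : ℝ) ≤ C * (n:ℝ) ^ ε := by
  set K : ℝ := 1 + 1 / (ε * Real.log 2) with hK
  have hl : 0 < Real.log 2 := Real.log_pos (by norm_num)
  have hK1 : 1 ≤ K := by
    have : 0 ≤ 1 / (ε * Real.log 2) := by positivity
    linarith
  set P : ℕ := ⌈(2:ℝ) ^ (1/ε)⌉₊ with hP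
  refine ⟨K ^ P, one_le_pow₀ hK1, fun n hn => ?_⟩
  rw [Nat.card_divisors hn.ne']
  have hn2 : (n:ℝ) ^ ε = ∏ p ∈ n.primeFactors, ((p:ℝ) ^ (n.factorization p)) ^ ε := by
    conv_lhs => rw [← Nat.prod_factorization_pow_eq_self hn.ne']
    rw [Finsupp.prod, Nat.support_factorization]
    push_cast
    rw [Real.finsetProd_rpow]
    intros; positivity
  rw [hn2]
  push_cast
  have h1 : ∏ p ∈ n.primeFactors, ((n.factorization p : ℝ) + 1) ≤
      ∏ p ∈ n.primeFactors, ((if p < P then K else 1) * ((p:ℝ) ^ (n.factorization p)) ^ ε) := by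
    apply Finset.prod_le_prod
    · intros; positivity
    · intro p hp
      have hpp := Nat.prime_of_mem_primeFactors hp
      split_ifs with h
      · exact pa_local ε hε p _ hpp.two_le
      · rw [one_mul]
        apply pa_local2 ε hε
        exact (Nat.le_ceil _).trans (by exact_mod_cast not_lt.1 h)
  refine h1.trans ?_
  rw [Finset.prod_mul_distrib]
  gcongr
  rw [Finset.prod_ite, Finset.prod_const, Finset.prod_const_one, mul_one]
  apply pow_le_pow_right₀ hK1
  calc _ ≤ (Finset.range P).card := by
        apply Finset.card_le_card
        intro p hp
        simp only [Finset.mem_filter] at hp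
        simpa using hp.2
    _ = P := by simp

/-- for large `m`, all divisor counts up to `m^k` are at most `m^ε` -/
theorem pa_divisor_large (ε : ℝ) (hε : 0 < ε) (k : ℕ) :
    ∃ M : ℕ, ∀ m : ℕ, M ≤ m → ∀ n : ℕ, 0 < n → n ≤ m ^ k →
      ((n.divisors.card : ℕ) : ℝ) ≤ (m:ℝ) ^ ε := by
  obtain ⟨C, hC, h⟩ := pa_divisor_bound (ε / (2 * (k + 1))) (by positivity)
  have ht := (tendsto_rpow_atTop (show 0 < ε / 2 by positivity)).comp (tendsto_natCast_atTop_atTop (R := ℝ))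
  obtain ⟨M, hM⟩ := (ht.eventually_ge_atTop C).exists_forall_of_atTop
  refine ⟨max M 1, fun m hm n hn hnk => ?_⟩
  have hm1 : 1 ≤ m := le_trans (le_max_right _ _) hm
  have hm1' : (1:ℝ) ≤ m := by exact_mod_cast hm1
  have h1 := hM m (le_trans (le_max_left _ _) hm)
  simp only [Function.comp] at h1
  refine (h n hn).trans ?_
  have h2 : (n:ℝ) ^ (ε / (2 * (k + 1))) ≤ (m:ℝ) ^ (ε/2) := by
    calc (n:ℝ) ^ (ε / (2 * (k + 1))) ≤ ((m:ℝ)^k) ^ (ε / (2 * (k + 1))) := by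
          apply Real.rpow_le_rpow (by positivity) (by exact_mod_cast hnk) (by positivity)
      _ = (m:ℝ) ^ (k * (ε / (2 * (k + 1)))) := by
          rw [← Real.rpow_natCast, ← Real.rpow_mul (by positivity)]
      _ ≤ _ := by
          apply Real.rpow_le_rpow_of_exponent_le hm1'
          rw [mul_div_assoc', div_le_div_iff₀ (by positivity) (by positivity)]
          nlinarith
  calc C * (n:ℝ) ^ (ε / (2 * (k + 1))) ≤ (m:ℝ) ^ (ε/2) * (m:ℝ) ^ (ε/2) := by gcongr
    _ = (m:ℝ) ^ ε := by rw [← Real.rpow_add (by positivity)]; congr 1; ring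

end

section

open Finset

/-- orthogonality -/
theorem pb_orth (m : ℕ) [NeZero m] (b : ZMod m) :
    ∑ l : ZMod m, ZMod.stdAddChar (l * b) = if b = 0 then (m:ℂ) else 0 := by
  have h := AddChar.sum_mulShift b (ZMod.isPrimitive_stdAddChar m)
  simp only [ZMod.card] at h
  by_cases hb : b = 0 <;> simp only [hb, if_true, if_false, mul_comm] at h ⊢ <;> exact_mod_cast h

theorem pb_norm (m : ℕ) [NeZero m] (b : ZMod m) : ‖ZMod.stdAddChar b‖ = 1 := by
  exact AddChar.norm_apply _ _

theorem pb_conj (m : ℕ) [NeZero m] (b : ZMod m) :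
    (starRingEnd ℂ) (ZMod.stdAddChar b) = ZMod.stdAddChar (-b) := by
  rw [AddChar.map_neg_eq_conj]

theorem pb_L2gen {Λ I : Type*} [Fintype Λ] (s : Finset I) (f : I → ℂ)
    (hf : ∀ i ∈ s, ‖f i‖ ≤ 1) (χ : Λ → I → ℂ) (c : ℝ) (hc : 0 ≤ c) (r : I → I → Prop)
    [DecidableRel r]
    (h : ∀ i ∈ s, ∀ j ∈ s, ∑ l, χ l i * (starRingEnd ℂ) (χ l j) = if r i j then (c:ℂ) else 0) :
    ∑ l, ‖∑ i ∈ s, f i * χ l i‖ ^ 2 ≤ c * (#{x ∈ s ×ˢ s | r x.1 x.2} : ℝ) := by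
  have h1 : ((∑ l, ‖∑ i ∈ s, f i * χ l i‖ ^ 2 : ℝ) : ℂ) =
      ∑ x ∈ s ×ˢ s, f x.1 * (starRingEnd ℂ) (f x.2) * (if r x.1 x.2 then (c:ℂ) else 0) := by
    push_cast
    have : ∀ l, (‖∑ i ∈ s, f i * χ l i‖ ^ 2 : ℂ) =
        ∑ x ∈ s ×ˢ s, f x.1 * (starRingEnd ℂ) (f x.2) * (χ l x.1 * (starRingEnd ℂ) (χ l x.2)) := by
      intro l
      rw [← Complex.mul_conj', map_sum, Finset.sum_mul_sum, Finset.sum_product]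
      apply Finset.sum_congr rfl; intro i _
      apply Finset.sum_congr rfl; intro j _
      rw [map_mul]; ring
    rw [Finset.sum_congr rfl (fun l _ => this l), Finset.sum_comm]
    apply Finset.sum_congr rfl
    intro x hx
    rw [Finset.mem_product] at hx
    rw [← Finset.mul_sum, h _ hx.1 _ hx.2]
  have h2 : (∑ l, ‖∑ i ∈ s, f i * χ l i‖ ^ 2 : ℝ) =
      ‖((∑ l, ‖∑ i ∈ s, f i * χ l i‖ ^ 2 : ℝ) : ℂ)‖ := by
    rw [Complex.norm_real, Real.norm_of_nonneg]
    positivity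
  rw [h2, h1]
  refine (norm_sum_le _ _).trans ?_
  rw [Finset.card_filter]
  push_cast
  rw [Finset.mul_sum]
  apply Finset.sum_le_sum
  intro x hx
  rw [Finset.mem_product] at hx
  rw [norm_mul, norm_mul, RCLike.norm_conj]
  have h3 : ‖f x.1‖ * ‖f x.2‖ ≤ 1 := mul_le_one₀ (hf _ hx.1) (norm_nonneg _) (hf _ hx.2)
  split_ifs
  · rw [Complex.norm_real, Real.norm_of_nonneg hc]
    nlinarith
  · simp

theorem pb_L2 {I : Type*} (m : ℕ) [NeZero m] (s : Finset I) (f : I → ℂ)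
    (hf : ∀ i ∈ s, ‖f i‖ ≤ 1) (g : I → ZMod m) :
    ∑ l : ZMod m, ‖∑ i ∈ s, f i * ZMod.stdAddChar (l * g i)‖ ^ 2 ≤
      m * (#{x ∈ s ×ˢ s | g x.1 = g x.2} : ℝ) := by
  apply pb_L2gen s f hf (fun l i => ZMod.stdAddChar (l * g i)) (m:ℝ) (by positivity)
    (fun i j => g i = g j)
  intro i _ j _
  simp only [pb_conj, ← AddChar.map_add_eq_mul]
  have : ∀ l : ZMod m, l * g i + -(l * g j) = l * (g i - g j) := fun l => by ring
  simp only [this, pb_orth, sub_eq_zero]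
  simp

/-- fourth moment -/
theorem pb_L4 {I : Type*} (m : ℕ) [NeZero m] (s : Finset I) (f : I → ℂ)
    (hf : ∀ i ∈ s, ‖f i‖ ≤ 1) (g : I → ZMod m) :
    ∑ l : ZMod m, ‖∑ i ∈ s, f i * ZMod.stdAddChar (l * g i)‖ ^ 4 ≤
      m * (#{x ∈ (s ×ˢ s) ×ˢ (s ×ˢ s) | g x.1.1 + g x.1.2 = g x.2.1 + g x.2.2} : ℝ) := by
  have h := pb_L2 m (s ×ˢ s) (fun x => f x.1 * f x.2) (by
    intro x hx
    rw [Finset.mem_product] at hx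
    rw [norm_mul]
    exact mul_le_one₀ (hf _ hx.1) (norm_nonneg _) (hf _ hx.2)) (fun x => g x.1 + g x.2)
  refine le_trans (le_of_eq ?_) h
  apply Finset.sum_congr rfl
  intro l _
  rw [show (4:ℕ) = 2 * 2 from rfl, pow_mul, ← norm_pow]
  congr 2
  rw [sq, Finset.sum_mul_sum, Finset.sum_product]
  apply Finset.sum_congr rfl; intro i _
  apply Finset.sum_congr rfl; intro j _
  rw [mul_add, AddChar.map_add_eq_mul]
  ring

theorem pb_holder {I Λ : Type*} [Fintype Λ] [DecidableEq Λ] (s : Finset I) (lam : I → Λ)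
    (G : Λ → ℝ) (hG : ∀ l, 0 ≤ G l) :
    (∑ i ∈ s, G (lam i)) ^ 4 ≤
      (#s : ℝ) ^ 2 * (#{x ∈ s ×ˢ s | lam x.1 = lam x.2} : ℝ) * ∑ l, G l ^ 4 := by
  have h1 : (∑ i ∈ s, G (lam i)) ^ 2 ≤ (#s : ℝ) * ∑ i ∈ s, G (lam i) ^ 2 :=
    sq_sum_le_card_mul_sum_sq
  have h2 : ∑ i ∈ s, G (lam i) ^ 2 = ∑ l, (#{i ∈ s | lam i = l} : ℝ) * G l ^ 2 := by
    rw [← Finset.sum_fiberwise_of_maps_to (t := Finset.univ) (g := lam) (by simp)]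
    apply Finset.sum_congr rfl
    intro l _
    rw [Finset.sum_congr rfl (g := fun _ => G l ^ 2), Finset.sum_const, nsmul_eq_mul]
    intro i hi
    rw [(Finset.mem_filter.1 hi).2]
  have h3 : (∑ l, (#{i ∈ s | lam i = l} : ℝ) * G l ^ 2) ^ 2 ≤
      (∑ l, (#{i ∈ s | lam i = l} : ℝ) ^ 2) * ∑ l, (G l ^ 2) ^ 2 :=
    Finset.sum_mul_sq_le_sq_mul_sq _ _ _
  have h4 : ∑ l, (#{i ∈ s | lam i = l} : ℝ) ^ 2 = (#{x ∈ s ×ˢ s | lam x.1 = lam x.2} : ℝ) := by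
    rw [Finset.card_eq_sum_card_fiberwise (f := fun x : I × I => lam x.1) (t := Finset.univ)
      (s := {x ∈ s ×ˢ s | lam x.1 = lam x.2}) (by simp)]
    push_cast
    apply Finset.sum_congr rfl
    intro l _
    rw [sq, ← Nat.cast_mul, ← Finset.card_product]
    congr 2
    ext x
    simp only [Finset.mem_filter, Finset.mem_product]
    constructor
    · rintro ⟨⟨h1, h2⟩, h3, h4⟩; exact ⟨⟨⟨h1, h3⟩, h2.trans h4.symm⟩, h2⟩
    · rintro ⟨⟨⟨h1, h3⟩, h4⟩, h2⟩; exact ⟨⟨h1, h2⟩, h3, h4.symm.trans h2⟩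
  have h5 : (∑ i ∈ s, G (lam i)) ^ 4 = ((∑ i ∈ s, G (lam i)) ^ 2) ^ 2 := by ring
  rw [h5]
  have h6 : ∀ l, (G l ^ 2) ^ 2 = G l ^ 4 := fun l => by ring
  simp only [h6, h4] at h3
  have h7 : 0 ≤ (∑ i ∈ s, G (lam i)) ^ 2 := by positivity
  calc ((∑ i ∈ s, G (lam i)) ^ 2) ^ 2 ≤ ((#s : ℝ) * ∑ i ∈ s, G (lam i) ^ 2) ^ 2 := by gcongr
    _ = (#s : ℝ) ^ 2 * (∑ i ∈ s, G (lam i) ^ 2) ^ 2 := by ring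
    _ ≤ (#s : ℝ) ^ 2 * ((#{x ∈ s ×ˢ s | lam x.1 = lam x.2} : ℝ) * ∑ l, G l ^ 4) := by
        rw [h2]; gcongr
    _ = _ := by ring

theorem pb_geom (M : ℕ) [NeZero M] (j : ZMod M) (hj : j ≠ 0) (n : ℕ) :
    ‖∑ t ∈ Finset.Icc 1 n, ZMod.stdAddChar (j * (t : ZMod M))‖ ≤ M / (2 * (j.valMinAbs.natAbs : ℝ)) := by
  have hM : (0:ℝ) < M := by exact_mod_cast Nat.pos_of_ne_zero (NeZero.ne M)
  have hpi := Real.pi_pos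
  set v : ℤ := j.valMinAbs with hv
  have hv0 : v ≠ 0 := by
    intro h; apply hj; rwa [hv, ZMod.valMinAbs_eq_zero] at h
  have hvn : (0:ℝ) < (v.natAbs : ℝ) := by
    exact_mod_cast Int.natAbs_pos.2 hv0
  set z : ℂ := ZMod.stdAddChar j with hz
  have hzn : ‖z‖ = 1 := pb_norm M j
  have hz1 : 4 * (v.natAbs:ℝ) / M ≤ ‖z - 1‖ := by
    have hjv : ((v : ℤ) : ZMod M) = j := ZMod.coe_valMinAbs j
    have h1 : z = Complex.exp (Complex.I * ((2 * Real.pi * v / M : ℝ) : ℂ)) := by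
      rw [hz, ← hjv, ZMod.stdAddChar_coe]
      congr 1
      push_cast; ring
    rw [h1, Complex.norm_exp_I_mul_ofReal_sub_one]
    have h2 : 2 * Real.pi * v / M / 2 = Real.pi * v / M := by ring
    rw [h2, norm_mul, Real.norm_eq_abs, Real.norm_eq_abs]
    have h3 : |Real.sin (Real.pi * v / M)| = |Real.sin (Real.pi * (v.natAbs:ℝ) / M)| := by
      rw [Nat.cast_natAbs, Int.cast_abs]
      rcases abs_choice (v:ℝ) with h | h
      · rw [h]
      · rw [h, mul_neg, neg_div, Real.sin_neg, abs_neg]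
    have hle : (v.natAbs:ℝ) ≤ M / 2 := by
      have := ZMod.natAbs_valMinAbs_le j
      rw [← hv] at this
      calc (v.natAbs:ℝ) ≤ ((M/2 : ℕ):ℝ) := by exact_mod_cast this
        _ ≤ M/2 := Nat.cast_div_le
    have h4 := Real.mul_le_sin (x := Real.pi * (v.natAbs:ℝ) / M) (by positivity) (by
      rw [div_le_div_iff₀ hM (by norm_num)]; nlinarith)
    rw [h3]
    have h5 : 2 / Real.pi * (Real.pi * (v.natAbs:ℝ) / M) = 2 * (v.natAbs:ℝ) / M := by
      field_simp
    rw [h5] at h4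
    have h6 := le_abs_self (Real.sin (Real.pi * (v.natAbs:ℝ) / M))
    have h7 : 4 * (v.natAbs:ℝ) / M = 2 * (2 * (v.natAbs:ℝ) / M) := by ring
    rw [h7, abs_of_pos (by norm_num : (0:ℝ) < 2)]
    linarith
  have hpos : 0 < 4 * (v.natAbs:ℝ) / M := by positivity
  have hne : z - 1 ≠ 0 := by
    intro h; rw [h, norm_zero] at hz1; linarith
  have hs : ∑ t ∈ Finset.Icc 1 n, ZMod.stdAddChar (j * (t : ZMod M)) = z * ((z ^ n - 1) / (z - 1)) := by
    rw [← geom_sum_eq (sub_ne_zero.1 hne), Finset.mul_sum, Finset.range_eq_Ico,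
      ← Finset.Ico_add_one_right_eq_Icc, Finset.sum_Ico_eq_sum_range, Finset.range_eq_Ico]
    apply Finset.sum_congr (by simp)
    intro t _
    rw [← pow_succ', hz, mul_comm, ← nsmul_eq_mul, AddChar.map_nsmul_eq_pow, add_comm]
  rw [hs, norm_mul, hzn, one_mul, norm_div]
  have h8 : ‖z ^ n - 1‖ ≤ 2 := by
    refine (norm_sub_le _ _).trans ?_
    rw [norm_pow, hzn]; norm_num
  calc ‖z ^ n - 1‖ / ‖z - 1‖ ≤ 2 / (4 * (v.natAbs:ℝ) / M) := by gcongr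
    _ = _ := by field_simp; norm_num

end

section

open Finset

noncomputable def cw (M : ℕ) (U : ℝ) (j : ZMod M) : ℝ :=
  if j = 0 then U / M else min (U / M) (1 / (2 * (j.valMinAbs.natAbs : ℝ)))

theorem cw_nonneg (M : ℕ) (U : ℝ) (hU : 0 ≤ U) (j : ZMod M) : 0 ≤ cw M U j := by
  unfold cw; split_ifs <;> positivity

theorem pb_geom' (M : ℕ) [NeZero M] (j : ZMod M) (n : ℕ) (U : ℝ) (hn : (n:ℝ) ≤ U) :
    ‖∑ t ∈ Finset.Icc 1 n, ZMod.stdAddChar (j * (t : ZMod M))‖ ≤ M * cw M U j := by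
  have hM : (0:ℝ) < M := by exact_mod_cast Nat.pos_of_ne_zero (NeZero.ne M)
  have htriv : ‖∑ t ∈ Finset.Icc 1 n, ZMod.stdAddChar (j * (t : ZMod M))‖ ≤ U := by
    refine (norm_sum_le _ _).trans ?_
    simp only [pb_norm, Finset.sum_const, Nat.card_Icc]
    simpa using hn
  have hU : M * (U / M) = U := by field_simp
  unfold cw
  split_ifs with h
  · rw [hU]; exact htriv
  · rw [mul_min_of_nonneg _ _ hM.le, hU]
    refine le_min htriv ((pb_geom M j h n).trans (le_of_eq ?_))
    rw [mul_one_div]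

theorem pb_completion (M : ℕ) [NeZero M] (S : Finset ℕ) (hS : S ⊆ Finset.Icc 1 M) (z : ℕ → ℂ)
    (Y : ℕ) (hY : Y ≤ M) (U : ℝ) (hU : (Y:ℝ) ≤ U) :
    ‖∑ q ∈ S with q ≤ Y, z q‖ ≤
      ∑ j : ZMod M, cw M U j * ‖∑ q ∈ S, z q * ZMod.stdAddChar (j * (q : ZMod M))‖ := by
  have hM : (0:ℝ) < M := by exact_mod_cast Nat.pos_of_ne_zero (NeZero.ne M)
  have hMc : (M:ℂ) ≠ 0 := by exact_mod_cast hM.ne'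
  have key : (M:ℂ) * ∑ q ∈ S with q ≤ Y, z q =
      ∑ j : ZMod M, (∑ t ∈ Finset.Icc 1 Y, ZMod.stdAddChar (-j * (t : ZMod M))) *
        ∑ q ∈ S, z q * ZMod.stdAddChar (j * (q : ZMod M)) := by
    simp only [Finset.sum_mul_sum]
    rw [Finset.sum_comm]
    simp only [Finset.sum_comm (s := (Finset.univ : Finset (ZMod M)))]
    rw [Finset.sum_comm, Finset.mul_sum, Finset.sum_filter]
    apply Finset.sum_congr rfl
    intro q hq
    have hq' := Finset.mem_Icc.1 (hS hq)
    have h1 : ∀ t ∈ Finset.Icc 1 Y, ∑ j : ZMod M, ZMod.stdAddChar (-j * (t : ZMod M)) *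
        (z q * ZMod.stdAddChar (j * (q : ZMod M))) = if q = t then M * z q else 0 := by
      intro t ht
      have ht' := Finset.mem_Icc.1 ht
      have h2 : ∀ j : ZMod M, ZMod.stdAddChar (-j * (t : ZMod M)) *
        (z q * ZMod.stdAddChar (j * (q : ZMod M))) =
          z q * ZMod.stdAddChar (j * ((q : ZMod M) - (t : ZMod M))) := by
        intro j
        rw [show j * ((q : ZMod M) - (t : ZMod M)) = -j * (t : ZMod M) + j * q by ring,
          AddChar.map_add_eq_mul]
        ring
      simp only [h2]
      rw [← Finset.mul_sum, pb_orth]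
      have h3 : ((q:ZMod M) - (t : ZMod M) = 0) ↔ q = t := by
        rw [sub_eq_zero, ZMod.natCast_eq_natCast_iff']
        constructor
        · intro h
          rcases Nat.lt_or_ge q M with h4 | h4
          · rw [Nat.mod_eq_of_lt h4] at h
            rcases Nat.lt_or_ge t M with h5 | h5
            · rwa [Nat.mod_eq_of_lt h5] at h
            · have : t = M := by omega
              rw [this, Nat.mod_self] at h; omega
          · have : q = M := by omega
            rw [this, Nat.mod_self] at h
            rcases Nat.lt_or_ge t M with h5 | h5
            · rw [Nat.mod_eq_of_lt h5] at h; omega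
            · omega
        · rintro rfl; rfl
      by_cases h : q = t
      · rw [if_pos (h3.2 h), if_pos h]; ring
      · rw [if_neg (fun h' => h (h3.1 h')), if_neg h]; ring
    rw [Finset.sum_congr rfl h1, Finset.sum_ite_eq]
    simp only [Finset.mem_Icc, hq'.1, true_and]
  have h2 : ‖(M:ℂ) * ∑ q ∈ S with q ≤ Y, z q‖ = M * ‖∑ q ∈ S with q ≤ Y, z q‖ := by
    rw [norm_mul]; simp
  have h3 : M * ‖∑ q ∈ S with q ≤ Y, z q‖ ≤
      M * ∑ j : ZMod M, cw M U j * ‖∑ q ∈ S, z q * ZMod.stdAddChar (j * (q : ZMod M))‖ := by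
    rw [← h2, key, Finset.mul_sum]
    refine (norm_sum_le _ _).trans (Finset.sum_le_sum fun j _ => ?_)
    rw [norm_mul, ← mul_assoc]
    gcongr
    have := pb_geom' M (-j) Y U hU
    refine this.trans (le_of_eq ?_)
    congr 1
    unfold cw
    simp only [neg_eq_zero, ZMod.natAbs_valMinAbs_neg]
  exact le_of_mul_le_mul_left h3 hM

theorem pb_sum_zmod (M : ℕ) [NeZero M] (G : ZMod M → ℝ) (hG : ∀ j, 0 ≤ G j) :
    ∑ j ∈ Finset.univ.erase (0 : ZMod M), G j ≤
      ∑ v ∈ Finset.Icc 1 (M / 2), (G (v : ZMod M) + G (-(v : ZMod M))) := by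
  classical
  rw [Finset.sum_add_distrib]
  have h1 : Finset.univ.erase (0 : ZMod M) ⊆
      (Finset.Icc 1 (M/2)).image (fun v : ℕ => (v : ZMod M)) ∪
      (Finset.Icc 1 (M/2)).image (fun v : ℕ => -(v : ZMod M)) := by
    intro j hj
    have hj0 : j ≠ 0 := (Finset.mem_erase.1 hj).1
    have h2 := ZMod.natAbs_valMinAbs_le j
    have h3 : j.valMinAbs ≠ 0 := by rwa [Ne, ZMod.valMinAbs_eq_zero]
    have h4 := Int.natAbs_pos.2 h3
    have h5 : ((j.valMinAbs : ℤ) : ZMod M) = j := ZMod.coe_valMinAbs j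
    simp only [Finset.mem_union, Finset.mem_image, Finset.mem_Icc]
    rcases Int.natAbs_eq j.valMinAbs with h | h
    · left
      refine ⟨j.valMinAbs.natAbs, ⟨h4, h2⟩, ?_⟩
      conv_rhs => rw [← h5, h]
      simp
    · right
      refine ⟨j.valMinAbs.natAbs, ⟨h4, h2⟩, ?_⟩
      conv_rhs => rw [← h5, h]
      simp
  refine (Finset.sum_le_sum_of_subset_of_nonneg h1 (fun _ _ _ => hG _)).trans ?_
  have h6 := Finset.sum_union_inter (s₁ := (Finset.Icc 1 (M/2)).image (fun v : ℕ => (v : ZMod M)))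
    (s₂ := (Finset.Icc 1 (M/2)).image (fun v : ℕ => -(v : ZMod M))) (f := G)
  have h7 : 0 ≤ ∑ j ∈ (Finset.Icc 1 (M/2)).image (fun v : ℕ => (v : ZMod M)) ∩
    (Finset.Icc 1 (M/2)).image (fun v : ℕ => -(v : ZMod M)), G j := Finset.sum_nonneg fun _ _ => hG _
  have h8 := Finset.sum_image_le_of_nonneg (s := Finset.Icc 1 (M/2)) (g := fun v : ℕ => (v : ZMod M))
    (f := G) (fun _ _ => hG _)
  have h9 := Finset.sum_image_le_of_nonneg (s := Finset.Icc 1 (M/2))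
    (g := fun v : ℕ => -(v : ZMod M)) (f := G) (fun _ _ => hG _)
  linarith

/-- total weight in completion -/
theorem pb_cw_sum (M : ℕ) [NeZero M] : ∑ j : ZMod M, cw M M j ≤ 2 + Real.log M := by
  have hM : (0:ℝ) < M := by exact_mod_cast Nat.pos_of_ne_zero (NeZero.ne M)
  rw [← Finset.add_sum_erase _ _ (Finset.mem_univ (0 : ZMod M))]
  have h0 : cw M M (0 : ZMod M) = 1 := by
    unfold cw; rw [if_pos rfl]; field_simp
  have h1 := pb_sum_zmod M (fun j => cw M M j) (fun j => cw_nonneg M M (by positivity) j)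
  have h2 : ∑ v ∈ Finset.Icc 1 (M / 2), (cw M M (v : ZMod M) + cw M M (-(v : ZMod M))) ≤
      ∑ v ∈ Finset.Icc 1 (M / 2), ((v:ℝ))⁻¹ := by
    apply Finset.sum_le_sum
    intro v hv
    have hv' := Finset.mem_Icc.1 hv
    have h3 : (v : ZMod M) ≠ 0 := by
      intro h
      rw [ZMod.natCast_eq_zero_iff] at h
      have := Nat.le_of_dvd (by omega) h
      omega
    have h4 : ((v : ZMod M)).valMinAbs.natAbs = v := by
      rw [ZMod.valMinAbs_natCast_of_le_half hv'.2]; simp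
    have h5 : (0:ℝ) < v := by exact_mod_cast hv'.1
    have h6 : cw M M (v : ZMod M) ≤ 1 / (2 * v) := by
      unfold cw; rw [if_neg h3, h4]; exact min_le_right _ _
    have h7 : cw M M (-(v : ZMod M)) ≤ 1 / (2 * v) := by
      unfold cw; rw [if_neg (neg_ne_zero.2 h3), ZMod.natAbs_valMinAbs_neg, h4]
      exact min_le_right _ _
    calc _ ≤ 1 / (2 * (v:ℝ)) + 1 / (2 * v) := add_le_add h6 h7
      _ = _ := by field_simp; norm_num
  have h8 : ∑ v ∈ Finset.Icc 1 (M / 2), ((v:ℝ))⁻¹ ≤ 1 + Real.log M := by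
    have h9 := harmonic_le_one_add_log M
    rw [harmonic_eq_sum_Icc] at h9
    push_cast at h9
    refine le_trans ?_ h9
    apply Finset.sum_le_sum_of_subset_of_nonneg
    · apply Finset.Icc_subset_Icc_right; omega
    · intros; positivity
  linarith

end

section

open Finset

/-- units up to `R` -/
def US (m R : ℕ) : Finset ℕ := {r ∈ Finset.Icc 1 R | Nat.Coprime r m}

theorem mem_US {m R r : ℕ} : r ∈ US m R ↔ 1 ≤ r ∧ r ≤ R ∧ Nat.Coprime r m := by
  simp [US, and_assoc]

def DivB (m T : ℕ) : Prop := ∀ n : ℕ, 0 < n → n ≤ m ^ 20 → n.divisors.card ≤ T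

def sdiv (n : ℤ) : Finset ℤ :=
  (n.natAbs.divisors.image (fun d : ℕ => (d : ℤ))) ∪ (n.natAbs.divisors.image (fun d : ℕ => -(d : ℤ)))

theorem mem_sdiv {n e : ℤ} (hn : n ≠ 0) (he : e ∣ n) : e ∈ sdiv n := by
  unfold sdiv
  have h1 : e.natAbs ∈ n.natAbs.divisors := by
    rw [Nat.mem_divisors]
    exact ⟨Int.natAbs_dvd_natAbs.2 he, by simpa using hn⟩
  simp only [Finset.mem_union, Finset.mem_image]
  rcases Int.natAbs_eq e with h | h
  · left; exact ⟨_, h1, h.symm⟩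
  · right; exact ⟨_, h1, h.symm⟩

theorem card_sdiv (n : ℤ) : (sdiv n).card ≤ 2 * n.natAbs.divisors.card := by
  unfold sdiv
  refine (Finset.card_union_le _ _).trans ?_
  have h1 := Finset.card_image_le (s := n.natAbs.divisors) (f := fun d : ℕ => (d : ℤ))
  have h2 := Finset.card_image_le (s := n.natAbs.divisors) (f := fun d : ℕ => -(d : ℤ))
  omega

theorem zm_unit {m r : ℕ} (h : Nat.Coprime r m) : (r : ZMod m) * (r : ZMod m)⁻¹ = 1 :=
  ZMod.coe_mul_inv_eq_one r h

theorem pc_rep (m R T : ℕ) [NeZero m] (hT : DivB m T) (hm : 2 ≤ m) (hR : R ≤ m) (lam : ZMod m)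
    (t c : ℤ) (htc : (t : ZMod m) * lam = c) (hc : c ≠ 0) (ht : (t : ZMod m) ≠ 0)
    (htm : |t| ≤ m) (hcm : |c| ≤ m) (K : ℕ) (hK : 2 * |t| * R + |c| * R ^ 2 < m * (K + 1)) :
    #{x ∈ US m R ×ˢ US m R | (x.1 : ZMod m)⁻¹ + (x.2 : ZMod m)⁻¹ = lam} ≤ (2 * T) * (2 * K + 1) := by
  set s := {x ∈ US m R ×ˢ US m R | (x.1 : ZMod m)⁻¹ + (x.2 : ZMod m)⁻¹ = lam} with hs
  have hm0 : (0:ℤ) < m := by exact_mod_cast (by omega : 0 < m)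
  set f : ℕ × ℕ → ℤ := fun x => (t * (x.1 + x.2) - c * x.1 * x.2) / m with hf
  have hmem : ∀ x ∈ s, (1 ≤ x.1 ∧ x.1 ≤ R ∧ Nat.Coprime x.1 m) ∧
      (1 ≤ x.2 ∧ x.2 ≤ R ∧ Nat.Coprime x.2 m) ∧ (x.1 : ZMod m)⁻¹ + (x.2 : ZMod m)⁻¹ = lam := by
    intro x hx
    rw [hs, Finset.mem_filter, Finset.mem_product, mem_US, mem_US] at hx
    exact ⟨hx.1.1, hx.1.2, hx.2⟩
  have hdiv : ∀ x ∈ s, t * (x.1 + x.2) - c * x.1 * x.2 = m * f x := by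
    intro x hx
    obtain ⟨h1, h2, h3⟩ := hmem x hx
    have u1 := zm_unit h1.2.2
    have u2 := zm_unit h2.2.2
    have : ((m:ℕ):ℤ) ∣ t * (x.1 + x.2) - c * x.1 * x.2 := by
      rw [← ZMod.intCast_zmod_eq_zero_iff_dvd]
      push_cast
      rw [← htc, ← h3]
      linear_combination (-(t : ZMod m) * x.2) * u1 + (-(t : ZMod m) * x.1) * u2
    rw [hf]
    exact (Int.mul_ediv_cancel' this).symm
  have hprod : ∀ x ∈ s, (c * x.1 - t) * (c * x.2 - t) = t ^ 2 - c * m * f x := by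
    intro x hx
    have := hdiv x hx
    linear_combination (-c) * this
  have hnz : ∀ x ∈ s, c * (x.1:ℤ) - t ≠ 0 ∧ c * (x.2:ℤ) - t ≠ 0 := by
    intro x hx
    obtain ⟨h1, h2, h3⟩ := hmem x hx
    have u1 := zm_unit h1.2.2
    have u2 := zm_unit h2.2.2
    constructor
    · intro h
      have h4 : (c : ZMod m) * x.1 - t = 0 := by exact_mod_cast congrArg (Int.cast : ℤ → ZMod m) h
      rw [← htc, ← h3] at h4
      apply ht
      have h5 : (t : ZMod m) * (x.1 * (x.2 : ZMod m)⁻¹) = 0 := by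
        linear_combination h4 - (t : ZMod m) * u1
      have h6 : (t : ZMod m) * (x.1 * (x.2 : ZMod m)⁻¹) * ((x.1 : ZMod m)⁻¹ * x.2) = 0 := by
        rw [h5, zero_mul]
      linear_combination h6 - (t:ZMod m) * x.2 * (x.2 : ZMod m)⁻¹ * u1 - (t:ZMod m) * u2
    · intro h
      have h4 : (c : ZMod m) * x.2 - t = 0 := by exact_mod_cast congrArg (Int.cast : ℤ → ZMod m) h
      rw [← htc, ← h3] at h4
      apply ht
      have h5 : (t : ZMod m) * (x.2 * (x.1 : ZMod m)⁻¹) = 0 := by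
        linear_combination h4 - (t : ZMod m) * u2
      have h6 : (t : ZMod m) * (x.2 * (x.1 : ZMod m)⁻¹) * ((x.2 : ZMod m)⁻¹ * x.1) = 0 := by
        rw [h5, zero_mul]
      linear_combination h6 - (t:ZMod m) * x.1 * (x.1 : ZMod m)⁻¹ * u2 - (t:ZMod m) * u1
  have himg : #(s.image f) ≤ 2 * K + 1 := by
    have : s.image f ⊆ Finset.Icc (-(K:ℤ)) K := by
      intro k hk
      obtain ⟨x, hx, rfl⟩ := Finset.mem_image.1 hk
      obtain ⟨h1, h2, h3⟩ := hmem x hx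
      have h4 := hdiv x hx
      rw [Finset.mem_Icc, ← abs_le]
      have a1 : (x.1:ℤ) ≤ R := by exact_mod_cast h1.2.1
      have a2 : (x.2:ℤ) ≤ R := by exact_mod_cast h2.2.1
      have h5 : |(m:ℤ) * f x| ≤ 2 * |t| * R + |c| * R ^ 2 := by
        rw [← h4]
        refine (abs_sub _ _).trans ?_
        rw [abs_mul, abs_mul, abs_mul, abs_of_nonneg (by positivity : (0:ℤ) ≤ (x.1:ℤ) + x.2),
          abs_of_nonneg (by positivity : (0:ℤ) ≤ (x.1:ℤ)), abs_of_nonneg (by positivity : (0:ℤ) ≤ (x.2:ℤ))]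
        have b1 : |t| * ((x.1:ℤ) + x.2) ≤ |t| * (R + R) := by gcongr
        have b2 : |c| * (x.1:ℤ) * x.2 ≤ |c| * R * R := by gcongr
        nlinarith
      rw [abs_mul, abs_of_pos hm0] at h5
      have h6 : (m:ℤ) * |f x| < m * (K + 1) := lt_of_le_of_lt h5 hK
      have := lt_of_mul_lt_mul_left h6 hm0.le
      omega
    refine (Finset.card_le_card this).trans ?_
    rw [Int.card_Icc]
    omega
  have hfib : ∀ k ∈ s.image f, #{x ∈ s | f x = k} ≤ 2 * T := by
    intro k hk
    obtain ⟨x0, hx0, hk0⟩ := Finset.mem_image.1 hk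
    have hn0 : t ^ 2 - c * m * k ≠ 0 := by
      rw [← hk0, ← hprod x0 hx0]
      exact mul_ne_zero (hnz x0 hx0).1 (hnz x0 hx0).2
    have hsize : (t ^ 2 - c * m * k).natAbs ≤ m ^ 20 := by
      obtain ⟨h1, h2, h3⟩ := hmem x0 hx0
      have hb : ∀ r : ℕ, r ≤ R → |c * (r:ℤ) - t| ≤ m ^ 3 := by
        intro r hr
        refine (abs_sub _ _).trans ?_
        rw [abs_mul, abs_of_nonneg (by positivity : (0:ℤ) ≤ (r:ℤ))]
        have : (r:ℤ) ≤ m := by exact_mod_cast hr.trans hR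
        have hm2 : (2:ℤ) ≤ m := by exact_mod_cast hm
        calc |c| * (r:ℤ) + |t| ≤ m * m + m := by gcongr
          _ ≤ (m:ℤ)^3 := by nlinarith [sq_nonneg ((m:ℤ))]
      have : |t ^ 2 - c * m * k| ≤ (m:ℤ) ^ 20 := by
        rw [← hk0, ← hprod x0 hx0, abs_mul]
        calc _ ≤ (m:ℤ)^3 * m^3 := by gcongr; exacts [hb _ h1.2.1, hb _ h2.2.1]
          _ = (m:ℤ) ^ 6 := by ring
          _ ≤ (m:ℤ) ^ 20 := pow_le_pow_right₀ (by omega) (by norm_num)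
      zify
      exact this
    calc #{x ∈ s | f x = k} ≤ #(sdiv (t ^ 2 - c * m * k)) := by
          apply Finset.card_le_card_of_injOn (fun x => c * x.1 - t)
          · intro x hx
            simp only [Finset.coe_filter, Set.mem_ofPred_eq] at hx
            apply mem_sdiv hn0
            rw [← hx.2, ← hprod x hx.1]
            exact Dvd.intro _ rfl
          · intro x hx y hy hxy
            simp only [Finset.coe_filter, Set.mem_ofPred_eq] at hx hy
            simp only at hxy
            have e1 : (x.1:ℤ) = y.1 := mul_left_cancel₀ hc (by linarith)
            have e2 : (c * x.1 - t) * (c * (x.2:ℤ) - t) = (c * x.1 - t) * (c * (y.2:ℤ) - t) := by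
              rw [hprod x hx.1, e1, hprod y hy.1, hx.2, hy.2]
            have e3 := mul_left_cancel₀ (hnz x hx.1).1 e2
            have e4 : (x.2:ℤ) = y.2 := mul_left_cancel₀ hc (by linarith)
            exact Prod.ext (by exact_mod_cast e1) (by exact_mod_cast e4)
      _ ≤ 2 * (t ^ 2 - c * m * k).natAbs.divisors.card := card_sdiv _
      _ ≤ 2 * T := by
          gcongr
          exact hT _ (Int.natAbs_pos.2 hn0) hsize
  calc #s ≤ 2 * T * #(s.image f) := Finset.card_le_mul_card_image s _ hfib
    _ ≤ _ := by gcongr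

end

section

open Finset

theorem pc_residue (g N : ℕ) (v : ZMod g) :
    #{n ∈ (Finset.Icc 1 N : Finset ℕ) | ((n : ℕ) : ZMod g) = v} ≤ N / g + 1 := by
  calc _ ≤ #(Finset.range (N / g + 1)) := by
        apply Finset.card_le_card_of_injOn (fun n => n / g)
        · intro n hn
          simp only [Finset.coe_filter, Finset.mem_Icc, Set.mem_ofPred_eq] at hn
          simp only [Finset.coe_range, Set.mem_Iio]
          exact Nat.lt_succ_of_le (Nat.div_le_div_right hn.1.2)
        · intro n hn k hk h
          simp only [Finset.coe_filter, Finset.mem_Icc, Set.mem_ofPred_eq] at hn hk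
          simp only at h
          have h1 : (n : ZMod g) = k := hn.2.trans hk.2.symm
          rw [ZMod.natCast_eq_natCast_iff'] at h1
          rw [← Nat.div_add_mod n g, ← Nat.div_add_mod k g, h, h1]
    _ = _ := by simp

theorem pc_rep_real (m R T : ℕ) [NeZero m] (hT : DivB m T) (hm : 2 ≤ m) (hR : R ≤ m) (lam : ZMod m)
    (t c : ℤ) (htc : (t : ZMod m) * lam = c) (hc : c ≠ 0) (ht : (t : ZMod m) ≠ 0)
    (htm : |t| ≤ m) (hcm : |c| ≤ m) (X : ℝ) (hX0 : 0 ≤ X)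
    (hX : 2 * (|t| : ℤ) * (R:ℝ) + (|c| : ℤ) * (R:ℝ) ^ 2 ≤ m * X) :
    (#{x ∈ US m R ×ˢ US m R | (x.1 : ZMod m)⁻¹ + (x.2 : ZMod m)⁻¹ = lam} : ℝ) ≤
      2 * T * (2 * X + 1) := by
  have hm0 : (0:ℝ) < m := by exact_mod_cast (by omega : 0 < m)
  have h := pc_rep m R T hT hm hR lam t c htc hc ht htm hcm ⌊X⌋₊ (by
    have h1 : (2 * (|t| : ℤ) * (R:ℝ) + (|c| : ℤ) * (R:ℝ) ^ 2) < m * (⌊X⌋₊ + 1) := by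
      refine lt_of_le_of_lt hX ?_
      have := Nat.lt_floor_add_one X
      gcongr
    exact_mod_cast h1)
  have h2 := Nat.floor_le hX0
  calc _ ≤ (((2 * T) * (2 * ⌊X⌋₊ + 1) : ℕ) : ℝ) := by exact_mod_cast h
    _ = 2 * T * (2 * (⌊X⌋₊:ℝ) + 1) := by push_cast; ring
    _ ≤ _ := by gcongr

/-- the set of `g` in the degenerate case -/
def gset (m R n : ℕ) : Finset ℕ := {g ∈ m.divisors | g ∣ n ∧ m ≤ g ^ 2 * R}

set_option maxHeartbeats 1000000 in
theorem pc_point (m R T : ℕ) [NeZero m] (hT : DivB m T) (hR1 : 1 ≤ R) (hR : 2 * R < m)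
    (r1 r2 : ℕ) (h1 : r1 ∈ US m R) (h2 : r2 ∈ US m R) :
    (#{x ∈ US m R ×ˢ US m R | (x.1 : ZMod m)⁻¹ + (x.2 : ZMod m)⁻¹ =
      (r1 : ZMod m)⁻¹ + (r2 : ZMod m)⁻¹} : ℝ) ≤
      2 * T * (2 * (3 * R * √(R / m)) + 1) +
      ∑ g ∈ gset m R (r1 + r2), 2 * T * (2 * (2 * R / g + g * R ^ 2 / m) + 1 : ℝ) := by
  rw [mem_US] at h1 h2
  have u1 := zm_unit h1.2.2
  have u2 := zm_unit h2.2.2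
  set lam : ZMod m := (r1 : ZMod m)⁻¹ + (r2 : ZMod m)⁻¹ with hlam
  have hm0 : (0:ℝ) < m := by exact_mod_cast (by omega : 0 < m)
  have hm0z : (0:ℤ) < m := by exact_mod_cast (by omega : 0 < m)
  have hR0 : (0:ℝ) < R := by exact_mod_cast hR1
  have hRm : (R:ℝ) < m := by exact_mod_cast (by omega : R < m)
  set l : ℕ := lam.val with hl
  have hll : (l : ZMod m) = lam := ZMod.natCast_zmod_val lam
  set W : ℝ := √(R * m) with hW
  have hWpos : 0 < W := Real.sqrt_pos.2 (by positivity)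
  have hW2 : W ^ 2 = R * m := Real.sq_sqrt (by positivity)
  have hWm : W < m := by nlinarith
  have hW1 : 1 ≤ W := by
    have : (1:ℝ) ≤ R := by exact_mod_cast hR1
    rw [hW, Real.one_le_sqrt]; nlinarith
  have hsum0 : ∀ g ∈ gset m R (r1 + r2), (0:ℝ) ≤ 2 * T * (2 * (2 * R / g + g * R ^ 2 / m) + 1) := by
    intros; positivity
  have hA0 : (0:ℝ) ≤ 2 * T * (2 * (3 * R * √(R / m)) + 1) := by positivity
  obtain ⟨j, t, ht0, htn, hjt⟩ := Real.exists_int_int_abs_mul_sub_le ((l:ℝ) / m)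
    (n := ⌊W⌋₊) (Nat.floor_pos.2 hW1)
  have htW : (t:ℝ) ≤ W := by
    calc (t:ℝ) ≤ ((⌊W⌋₊ : ℤ) : ℝ) := by exact_mod_cast htn
      _ = (⌊W⌋₊ : ℝ) := by norm_cast
      _ ≤ W := Nat.floor_le hWpos.le
  have htm : t < m := by
    have : (t:ℝ) < (m:ℤ) := by push_cast; linarith
    exact_mod_cast this
  have htz : ((t:ℤ) : ZMod m) ≠ 0 := by
    rw [Ne, ZMod.intCast_zmod_eq_zero_iff_dvd]
    intro h
    have := Int.le_of_dvd ht0 h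
    omega
  set c : ℤ := t * l - j * m with hc
  have hcz : (t : ZMod m) * lam = c := by
    rw [hc, ← hll]; push_cast; simp
  have hcW : |(c:ℝ)| * W ≤ m := by
    have e1 : (c:ℝ) = m * (t * ((l:ℝ) / m) - j) := by
      rw [hc]; push_cast; field_simp
    rw [e1, abs_mul, abs_of_pos hm0]
    have e2 : |t * ((l:ℝ) / m) - j| * W ≤ 1 := by
      have e3 : W ≤ (⌊W⌋₊ : ℝ) + 1 := (Nat.lt_floor_add_one W).le
      calc _ ≤ 1 / ((⌊W⌋₊ : ℝ) + 1) * ((⌊W⌋₊ : ℝ) + 1) := by gcongr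
        _ = 1 := by field_simp
    nlinarith
  by_cases hc0 : c = 0
  · -- degenerate case
    set g : ℕ := Nat.gcd l m with hg
    have hgm : g ∣ m := Nat.gcd_dvd_right _ _
    have hgl : g ∣ l := Nat.gcd_dvd_left _ _
    have hgpos : 0 < g := Nat.gcd_pos_of_pos_right _ (by omega)
    obtain ⟨m', hm'⟩ := hgm
    have hm'pos : 0 < m' := by
      rcases Nat.eq_zero_or_pos m' with h | h
      · rw [h] at hm'; omega
      · exact h
    obtain ⟨l', hl'⟩ := hgl
    have hcop : IsCoprime (m' : ℤ) (l' : ℤ) := by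
      rw [Nat.isCoprime_iff_coprime]
      have h4 : Nat.gcd (g * l') (g * m') = g * Nat.gcd l' m' := Nat.gcd_mul_left _ _ _
      rw [← hl', ← hm', ← hg] at h4
      have : Nat.gcd l' m' = 1 := Nat.eq_of_mul_eq_mul_left hgpos (by linarith)
      exact Nat.Coprime.symm this
    have hm't : (m':ℤ) ≤ t := by
      apply Int.le_of_dvd ht0
      apply hcop.dvd_of_dvd_mul_right
      have e : t * l = j * m := by linarith
      rw [hl', hm'] at e
      push_cast at e
      have e' : (g:ℤ) * (t * l') = g * (j * m') := by linarith
      have hgz : (g:ℤ) ≠ 0 := by exact_mod_cast hgpos.ne'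
      rw [mul_left_cancel₀ hgz e']
      exact Dvd.intro_left _ rfl
    have hgR : m ≤ g ^ 2 * R := by
      have e1 : (m':ℝ) ≤ W := by
        refine le_trans ?_ htW
        exact_mod_cast hm't
      have e2 : (m':ℝ) ^ 2 ≤ R * m := by rw [← hW2]; gcongr
      have e3 : m' ^ 2 ≤ R * m := by exact_mod_cast e2
      have e4 : m' * m' ≤ (R * g) * m' := by rw [hm'] at e3; nlinarith
      have e5 := Nat.le_of_mul_le_mul_right e4 hm'pos
      rw [hm']; nlinarith
    have hgr : g ∣ r1 + r2 := by
      have e1 : ((r1 + r2 : ℕ) : ZMod m) = ((l * r1 * r2 : ℕ) : ZMod m) := by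
        push_cast
        rw [hll, hlam]
        linear_combination (-(r2:ZMod m)) * u1 - (r1:ZMod m) * u2
      rw [ZMod.natCast_eq_natCast_iff] at e1
      have e3 : (r1 + r2) ≡ l * r1 * r2 [MOD g] := by
        apply Nat.ModEq.of_dvd _ e1
        exact ⟨m', hm'⟩
      refine (Nat.ModEq.dvd_iff e3 dvd_rfl).2 ?_
      rw [mul_assoc]
      exact Dvd.dvd.mul_right ⟨l', hl'⟩ _
    have hgmem : g ∈ gset m R (r1 + r2) := by
      simp only [gset, Finset.mem_filter, Nat.mem_divisors]
      exact ⟨⟨⟨m', hm'⟩, by omega⟩, hgr, hgR⟩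
    have hg2R : g ≤ 2 * R := (Nat.le_of_dvd (by omega) hgr).trans (by omega)
    obtain ⟨u0, w0, huw⟩ := hcop.symm
    set u : ℤ := u0 % m' with hu
    have hm'z : (0:ℤ) < m' := by exact_mod_cast hm'pos
    have hu0 : 0 ≤ u := Int.emod_nonneg _ hm'z.ne'
    have hum : u < m' := Int.emod_lt_of_pos _ hm'z
    have hug : (u : ZMod m) * lam = ((g:ℤ) : ZMod m) := by
      have e1 : u0 = u + m' * (u0 / m') := (Int.emod_add_mul_ediv u0 m').symm
      have e2 : u * l = g + m * (-w0 - (u0 / m') * l') := by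
        have : (l:ℤ) = g * l' := by exact_mod_cast hl'
        have h3 : (m:ℤ) = g * m' := by exact_mod_cast hm'
        rw [this, h3]
        have : u = u0 - m' * (u0 / m') := by linarith
        rw [this]
        linear_combination (g:ℤ) * huw
      rw [← hll]
      have e3 := congrArg (Int.cast : ℤ → ZMod m) e2
      push_cast at e3
      rw [e3]; simp
    have huz : (u : ZMod m) ≠ 0 := by
      intro h
      rw [h, zero_mul] at hug
      have := (ZMod.intCast_zmod_eq_zero_iff_dvd _ _).1 hug.symm
      have := Int.le_of_dvd (by exact_mod_cast hgpos) this
      have : m ≤ g := by exact_mod_cast this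
      omega
    have hg0 : (0:ℝ) < g := by exact_mod_cast hgpos
    have hrep := pc_rep_real m R T hT (by omega) (by omega) lam u g hug (by exact_mod_cast hgpos.ne')
      huz (by
        rw [abs_of_nonneg hu0]
        have : m' ≤ m := Nat.le_of_dvd (by omega) ⟨g, by rw [hm']; ring⟩
        have : (m':ℤ) ≤ m := by exact_mod_cast this
        omega) (by
        rw [abs_of_nonneg (by positivity)]
        have : g ≤ m := by omega
        exact_mod_cast this) (2 * R / g + g * R ^ 2 / m) (by positivity) (by
        rw [abs_of_nonneg hu0, abs_of_nonneg (by positivity : (0:ℤ) ≤ (g:ℤ))]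
        have e1 : (u:ℝ) ≤ m / g := by
          rw [le_div_iff₀ hg0]
          have : (m:ℝ) = g * m' := by exact_mod_cast hm'
          rw [this]
          have : (u:ℝ) ≤ m' := by exact_mod_cast hum.le
          nlinarith
        have e2 : (m:ℝ) * (2 * R / g + g * R ^ 2 / m) = 2 * (m / g) * R + g * R ^ 2 := by
          field_simp
        rw [e2]
        push_cast
        gcongr)
    refine hrep.trans ?_
    have := Finset.single_le_sum hsum0 hgmem
    linarith
  · have hcm : |c| ≤ m := by
      have : |(c:ℝ)| ≤ m := by nlinarith [abs_nonneg (c:ℝ)]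
      exact_mod_cast this
    have hrep := pc_rep_real m R T hT (by omega) (by omega) lam t c hcz hc0 htz
      (by rw [abs_of_pos ht0]; omega) hcm (3 * R * √(R / m)) (by positivity) (by
        rw [abs_of_pos ht0]
        have e1 : (m:ℝ) * (3 * R * √(R / m)) = 3 * R * W := by
          have : √((R:ℝ) / m) = W / m := by
            rw [hW, Real.sqrt_eq_iff_mul_self_eq (by positivity) (by positivity)]
            field_simp
            rw [Real.sq_sqrt (by positivity)]
          rw [this]; field_simp
        rw [e1]
        push_cast
        have e2 : |(c:ℝ)| * R ^ 2 ≤ R * W := by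
          have : |(c:ℝ)| * R ≤ W := by
            have : |(c:ℝ)| * R * m ≤ W * m := by
              calc |(c:ℝ)| * R * m = |(c:ℝ)| * W * W := by
                    rw [mul_assoc, ← hW2, sq, mul_assoc]
                _ ≤ m * W := by gcongr
                _ = W * m := by ring
            exact le_of_mul_le_mul_right this hm0
          calc |(c:ℝ)| * R ^ 2 = R * (|(c:ℝ)| * R) := by ring
            _ ≤ R * W := by gcongr
        have e3 : 2 * (t:ℝ) * R ≤ 2 * W * R := by gcongr
        linarith)
    have := Finset.sum_nonneg hsum0
    linarith

theorem pc_gcount (m R g : ℕ) (hg : 0 < g) :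
    (#{x ∈ US m R ×ˢ US m R | g ∣ x.1 + x.2} : ℝ) * g ≤ 3 * R ^ 2 := by
  have hg0 : (0:ℝ) < g := by exact_mod_cast hg
  by_cases h : g ≤ 2 * R
  · have h1 : #{x ∈ US m R ×ˢ US m R | g ∣ x.1 + x.2} ≤ R * (R / g + 1) := by
      rw [Finset.card_filter, Finset.sum_product]
      calc _ ≤ ∑ r ∈ US m R, (R / g + 1) := by
            apply Finset.sum_le_sum
            intro r _
            rw [← Finset.card_filter]
            refine le_trans (Finset.card_le_card ?_) (pc_residue g R (-(r : ZMod g)))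
            intro y hy
            simp only [Finset.mem_filter, mem_US] at hy
            simp only [Finset.mem_filter, Finset.mem_Icc]
            refine ⟨⟨hy.1.1, hy.1.2.1⟩, ?_⟩
            have := (ZMod.natCast_eq_zero_iff (r + y) g).2 hy.2
            push_cast at this
            exact (neg_eq_of_add_eq_zero_right this).symm
        _ = #(US m R) * (R / g + 1) := by rw [Finset.sum_const, smul_eq_mul]
        _ ≤ R * (R / g + 1) := by
            gcongr
            refine (Finset.card_filter_le _ _).trans ?_
            simp
    have h2 : (#{x ∈ US m R ×ˢ US m R | g ∣ x.1 + x.2} : ℝ) ≤ R * (R / g + 1) := by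
      calc _ ≤ ((R * (R / g + 1) : ℕ) : ℝ) := by exact_mod_cast h1
        _ ≤ R * (R / g + 1) := by
          push_cast
          have := Nat.cast_div_le (α := ℝ) (m := R) (n := g)
          gcongr
    have h3 : (g:ℝ) ≤ 2 * R := by exact_mod_cast h
    calc _ ≤ (R * (R / g + 1)) * (g:ℝ) := by gcongr
      _ = R * R + R * g := by field_simp
      _ ≤ 3 * R ^ 2 := by nlinarith [(Nat.cast_nonneg R : (0:ℝ) ≤ R)]
  · have : #{x ∈ US m R ×ˢ US m R | g ∣ x.1 + x.2} = 0 := by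
      rw [Finset.card_eq_zero, Finset.filter_eq_empty_iff]
      intro x hx hd
      rw [Finset.mem_product, mem_US, mem_US] at hx
      have := Nat.le_of_dvd (by omega) hd
      omega
    rw [this]
    simp

theorem pc_J2 (m R T : ℕ) [NeZero m] (hT : DivB m T) (hR1 : 1 ≤ R) (hR : 2 * R < m) :
    (#{x ∈ (US m R ×ˢ US m R) ×ˢ (US m R ×ˢ US m R) |
      (x.1.1 : ZMod m)⁻¹ + (x.1.2 : ZMod m)⁻¹ = (x.2.1 : ZMod m)⁻¹ + (x.2.2 : ZMod m)⁻¹} : ℝ) ≤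
      60 * T ^ 2 * (R ^ 2 + R ^ 3 * √(R / m)) := by
  have hm0 : (0:ℝ) < m := by exact_mod_cast (by omega : 0 < m)
  have hR0 : (0:ℝ) < R := by exact_mod_cast hR1
  have hRm : (R:ℝ) < m := by exact_mod_cast (by omega : R < m)
  have hT1 : 1 ≤ T := by
    have := hT 1 (by norm_num) (Nat.one_le_pow _ _ (by omega))
    simpa using this
  have hT1' : (1:ℝ) ≤ T := by exact_mod_cast hT1
  set q : ℝ := √(R / m) with hq
  have hq0 : 0 < q := Real.sqrt_pos.2 (by positivity)
  have hq2 : q ^ 2 = R / m := Real.sq_sqrt (by positivity)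
  have hq1 : q ≤ 1 := by
    exact Real.sqrt_le_iff.2 ⟨zero_le_one, by rw [one_pow, div_le_one hm0]; exact hRm.le⟩
  have hcard : (#(US m R ×ˢ US m R) : ℝ) ≤ R ^ 2 := by
    have : #(US m R) ≤ R := by
      refine (Finset.card_filter_le _ _).trans ?_
      simp
    rw [Finset.card_product]
    push_cast
    have : (#(US m R) : ℝ) ≤ R := by exact_mod_cast this
    nlinarith [(Nat.cast_nonneg #(US m R) : (0:ℝ) ≤ #(US m R))]
  have h1 : (#{x ∈ (US m R ×ˢ US m R) ×ˢ (US m R ×ˢ US m R) |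
      (x.1.1 : ZMod m)⁻¹ + (x.1.2 : ZMod m)⁻¹ = (x.2.1 : ZMod m)⁻¹ + (x.2.2 : ZMod m)⁻¹} : ℝ) =
      ∑ y ∈ US m R ×ˢ US m R, (#{x ∈ US m R ×ˢ US m R | (x.1 : ZMod m)⁻¹ + (x.2 : ZMod m)⁻¹ =
      (y.1 : ZMod m)⁻¹ + (y.2 : ZMod m)⁻¹} : ℝ) := by
    rw [Finset.card_filter, Finset.sum_product_right]
    push_cast
    apply Finset.sum_congr rfl
    intro y _
    rw [Finset.card_filter]
    push_cast
    rfl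
  rw [h1]
  have h2 : ∀ y ∈ US m R ×ˢ US m R, (#{x ∈ US m R ×ˢ US m R | (x.1 : ZMod m)⁻¹ + (x.2 : ZMod m)⁻¹ =
      (y.1 : ZMod m)⁻¹ + (y.2 : ZMod m)⁻¹} : ℝ) ≤ 2 * T * (2 * (3 * R * q) + 1) +
      ∑ g ∈ m.divisors, if g ∣ y.1 + y.2 then (if m ≤ g ^ 2 * R then
        2 * T * (2 * (2 * R / g + g * R ^ 2 / m) + 1 : ℝ) else 0) else 0 := by
    intro y hy
    rw [Finset.mem_product] at hy
    refine (pc_point m R T hT hR1 hR y.1 y.2 hy.1 hy.2).trans (le_of_eq ?_)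
    congr 1
    unfold gset
    rw [Finset.sum_filter]
    apply Finset.sum_congr rfl
    intro g _
    by_cases a : g ∣ y.1 + y.2 <;> by_cases b : m ≤ g ^ 2 * R <;> simp [a, b]
  refine (Finset.sum_le_sum h2).trans ?_
  rw [Finset.sum_add_distrib, Finset.sum_comm, Finset.sum_const, nsmul_eq_mul]
  have h3 : ∀ g ∈ m.divisors, ∑ y ∈ US m R ×ˢ US m R, (if g ∣ y.1 + y.2 then (if m ≤ g ^ 2 * R then
        2 * T * (2 * (2 * R / g + g * R ^ 2 / m) + 1 : ℝ) else 0) else 0) ≤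
        2 * T * (18 * (R ^ 3 * q) + 3 * R ^ 2) := by
    intro g hg
    have hgpos : 0 < g := Nat.pos_of_mem_divisors hg
    have hg0 : (1:ℝ) ≤ g := by exact_mod_cast hgpos
    rw [← Finset.sum_filter, Finset.sum_const, nsmul_eq_mul]
    split_ifs with h
    · have h4 := pc_gcount m R g hgpos
      set N : ℝ := (#{x ∈ US m R ×ˢ US m R | g ∣ x.1 + x.2} : ℝ) with hN
      have hN0 : 0 ≤ N := by positivity
      have h5 : (m:ℝ) ≤ g ^ 2 * R := by exact_mod_cast h
      have h6 : N ≤ 3 * R ^ 2 := by nlinarith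
      have h7 : R ^ 4 / m ≤ R ^ 3 * q := by
        have : (R:ℝ) ^ 4 / m = R ^ 3 * q ^ 2 := by rw [hq2]; ring
        rw [this]
        gcongr
        nlinarith
      have h8 : N * (2 * R / g) ≤ 6 * (R ^ 4 / m) := by
        rw [mul_div_assoc', mul_div_assoc', div_le_div_iff₀ (by positivity) hm0]
        have : N * (2 * R) * m ≤ N * (2 * R) * (g ^ 2 * R) := by gcongr
        have h9 : N * (2 * R) * (g ^ 2 * R) = (N * g) * (2 * R ^ 2 * g) := by ring
        have : (N * g) * (2 * R ^ 2 * g) ≤ (3 * R ^ 2) * (2 * R ^ 2 * g) := by gcongr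
        nlinarith
      have h10 : N * (g * R ^ 2 / m) ≤ 3 * (R ^ 4 / m) := by
        have : N * (g * R ^ 2 / m) = (N * g) * (R ^ 2 / m) := by ring
        rw [this]
        calc _ ≤ (3 * R ^ 2) * ((R:ℝ) ^ 2 / m) := by gcongr
          _ = _ := by ring
      have : N * (2 * T * (2 * (2 * R / g + g * R ^ 2 / m) + 1)) =
        2 * T * (2 * (N * (2 * R / g) + N * (g * R ^ 2 / m)) + N) := by ring
      rw [this]
      apply mul_le_mul_of_nonneg_left _ (by positivity)
      linarith
    · rw [mul_zero]; positivity
  have h4 := Finset.sum_le_sum h3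
  rw [Finset.sum_const, nsmul_eq_mul] at h4
  have h5 : (#m.divisors : ℝ) ≤ T := by
    have := hT m (by omega) (Nat.le_self_pow (by norm_num) _)
    exact_mod_cast this
  have h6 : (#m.divisors : ℝ) * (2 * T * (18 * (R ^ 3 * q) + 3 * R ^ 2)) ≤
    T * (2 * T * (18 * (R ^ 3 * q) + 3 * R ^ 2)) := by gcongr
  have h7 : (#(US m R ×ˢ US m R) : ℝ) * (2 * T * (2 * (3 * R * q) + 1)) ≤
      R ^ 2 * (2 * T * (2 * (3 * R * q) + 1)) := by gcongr
  have h8 : (T:ℝ) ≤ T ^ 2 := by nlinarith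
  have h9 : (T:ℝ) * (12 * (R ^ 3 * q) + 2 * R ^ 2) ≤ T ^ 2 * (12 * (R ^ 3 * q) + 2 * R ^ 2) := by
    gcongr
  have h10 : 0 ≤ (T:ℝ) ^ 2 * (R ^ 3 * q) := by positivity
  have h11 : 0 ≤ (T:ℝ) ^ 2 * R ^ 2 := by positivity
  nlinarith

end

section

open Finset

/-- Kloosterman sums -/
noncomputable def KS (m : ℕ) [NeZero m] (l v : ZMod m) : ℂ :=
  ∑ x : (ZMod m)ˣ, ZMod.stdAddChar (l * ((x⁻¹ : (ZMod m)ˣ) : ZMod m) + v * (x : ZMod m))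

theorem KS_inv (m : ℕ) [NeZero m] (l v : ZMod m) (c : (ZMod m)ˣ) :
    KS m ((c : ZMod m) * l) (((c⁻¹ : (ZMod m)ˣ) : ZMod m) * v) = KS m l v := by
  unfold KS
  refine Fintype.sum_equiv (Equiv.mulLeft c⁻¹) _ _ fun x => ?_
  congr 1
  simp only [Equiv.coe_mulLeft, mul_inv_rev, inv_inv, Units.val_mul]
  ring

theorem KS_neg (m : ℕ) [NeZero m] (l v : ZMod m) : ‖KS m (-l) (-v)‖ = ‖KS m l v‖ := by
  rw [← RCLike.norm_conj (KS m l v)]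
  unfold KS
  rw [map_sum]
  congr 1
  apply Finset.sum_congr rfl
  intro x _
  rw [pb_conj]
  congr 1
  ring

theorem pd_class (m L : ℕ) (hL : 0 < L) (hLm : L ∣ m) (s : Finset ℕ) (hs : s ⊆ Finset.range m)
    (h : ∀ x ∈ s, ∀ y ∈ s, x ≡ y [MOD L]) : #s ≤ m / L := by
  calc #s ≤ #(Finset.range (m / L)) := by
        apply Finset.card_le_card_of_injOn (fun n => n / L)
        · intro n hn
          have := Finset.mem_range.1 (hs hn)
          simp only [Finset.coe_range, Set.mem_Iio]
          exact Nat.div_lt_div_of_lt_of_dvd hLm this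
        · intro n hn k hk hh
          simp only at hh
          have h1 := h n hn k hk
          unfold Nat.ModEq at h1
          rw [← Nat.div_add_mod n L, ← Nat.div_add_mod k L, hh, h1]
    _ = _ := by simp

theorem pd_triple (m e1 e2 e3 : ℕ) (hm : 0 < m) (he : m = e1 * e2 * e3) :
    #{x ∈ Finset.range m ×ˢ Finset.range m | e1 ∣ x.1 ∧ e2 ∣ x.2 ∧ e3 ∣ x.1 + x.2 + 2} ≤ 2 * m := by
  have he1 : 0 < e1 := by rcases Nat.eq_zero_or_pos e1 with h | h; · simp [h] at he; omega
                          · exact h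
  have he2 : 0 < e2 := by rcases Nat.eq_zero_or_pos e2 with h | h; · simp [h] at he; omega
                          · exact h
  have he3 : 0 < e3 := by rcases Nat.eq_zero_or_pos e3 with h | h; · simp [h] at he; omega
                          · exact h
  set h := Nat.gcd e2 e3 with hh
  have hpos : 0 < h := Nat.gcd_pos_of_pos_left _ he2
  have d1 : e1 ∣ m := ⟨e2 * e3, by rw [he]; ring⟩
  have d2 : e2 ∣ m := ⟨e1 * e3, by rw [he]; ring⟩
  have d3 : e3 ∣ m := ⟨e1 * e2, by rw [he]; ring⟩
  have dh : h ∣ m := (Nat.gcd_dvd_left _ _).trans d2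
  set L1 := Nat.lcm e1 h with hL1
  set L2 := Nat.lcm e2 e3 with hL2
  have L1pos : 0 < L1 := Nat.lcm_pos he1 hpos
  have L2pos : 0 < L2 := Nat.lcm_pos he2 he3
  set sa : Finset ℕ := {a ∈ Finset.range m | e1 ∣ a ∧ h ∣ a + 2} with hsa
  have hsa_card : #sa ≤ m / L1 := by
    apply pd_class m L1 L1pos (Nat.lcm_dvd d1 dh) sa (Finset.filter_subset _ _)
    intro x hx y hy
    simp only [hsa, Finset.mem_filter] at hx hy
    rw [Nat.modEq_iff_dvd]
    have a1 : (e1:ℤ) ∣ (y:ℤ) - x := dvd_sub (by exact_mod_cast hy.2.1) (by exact_mod_cast hx.2.1)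
    have a2 : (h:ℤ) ∣ (y:ℤ) - x := by
      have b1 : (h:ℤ) ∣ (y:ℤ) + 2 := by exact_mod_cast hy.2.2
      have b2 : (h:ℤ) ∣ (x:ℤ) + 2 := by exact_mod_cast hx.2.2
      have := dvd_sub b1 b2
      simpa using this
    have := Int.coe_lcm_dvd a1 a2
    exact this
  have hfib : ∀ a ∈ sa, #{b ∈ Finset.range m | e2 ∣ b ∧ e3 ∣ a + b + 2} ≤ m / L2 := by
    intro a _
    apply pd_class m L2 L2pos (Nat.lcm_dvd d2 d3) _ (Finset.filter_subset _ _)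
    intro x hx y hy
    simp only [Finset.mem_filter] at hx hy
    rw [Nat.modEq_iff_dvd]
    have a1 : (e2:ℤ) ∣ (y:ℤ) - x := dvd_sub (by exact_mod_cast hy.2.1) (by exact_mod_cast hx.2.1)
    have a2 : (e3:ℤ) ∣ (y:ℤ) - x := by
      have b1 : (e3:ℤ) ∣ (a:ℤ) + (y:ℤ) + 2 := by exact_mod_cast hy.2.2
      have b2 : (e3:ℤ) ∣ (a:ℤ) + (x:ℤ) + 2 := by exact_mod_cast hx.2.2
      have := dvd_sub b1 b2
      rw [show (a:ℤ) + (y:ℤ) + 2 - (a + x + 2) = y - x by ring] at this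
      exact this
    exact Int.coe_lcm_dvd a1 a2
  have htot : #{x ∈ Finset.range m ×ˢ Finset.range m | e1 ∣ x.1 ∧ e2 ∣ x.2 ∧ e3 ∣ x.1 + x.2 + 2} ≤
      #sa * (m / L2) := by
    calc _ ≤ #(sa.sigma fun a => {b ∈ Finset.range m | e2 ∣ b ∧ e3 ∣ a + b + 2}) := by
          apply Finset.card_le_card_of_injOn (fun x => (⟨x.1, x.2⟩ : Σ _ : ℕ, ℕ))
          · intro x hx
            simp only [Finset.coe_filter, Finset.mem_product, Set.mem_ofPred_eq] at hx
            simp only [Finset.coe_sigma, Set.mem_sigma_iff, Finset.mem_coe, hsa, Finset.mem_filter]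
            refine ⟨⟨hx.1.1, hx.2.1, ?_⟩, hx.1.2, hx.2.2⟩
            have b1 : h ∣ x.2 := (Nat.gcd_dvd_left _ _).trans hx.2.2.1
            have b2 : h ∣ x.1 + x.2 + 2 := (Nat.gcd_dvd_right _ _).trans hx.2.2.2
            have : x.1 + x.2 + 2 = x.2 + (x.1 + 2) := by ring
            rw [this] at b2
            exact (Nat.dvd_add_right b1).1 b2
          · intro x _ y _ hxy
            simp only [Sigma.mk.injEq, heq_eq_eq] at hxy
            exact Prod.ext hxy.1 hxy.2
      _ = ∑ a ∈ sa, #{b ∈ Finset.range m | e2 ∣ b ∧ e3 ∣ a + b + 2} := Finset.card_sigma _ _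
      _ ≤ ∑ a ∈ sa, m / L2 := Finset.sum_le_sum hfib
      _ = _ := by rw [Finset.sum_const, smul_eq_mul]
  refine htot.trans ?_
  rcases sa.eq_empty_or_nonempty with hse | ⟨a, ha⟩
  · rw [hse]; simp
  · simp only [hsa, Finset.mem_filter] at ha
    have g2 : Nat.gcd e1 h ∣ 2 := by
      have b1 : Nat.gcd e1 h ∣ a := (Nat.gcd_dvd_left _ _).trans ha.2.1
      have b2 : Nat.gcd e1 h ∣ a + 2 := (Nat.gcd_dvd_right _ _).trans ha.2.2
      exact (Nat.dvd_add_right b1).1 b2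
    have g2' := Nat.le_of_dvd (by norm_num) g2
    have i1 : Nat.gcd e1 h * L1 = e1 * h := Nat.gcd_mul_lcm e1 h
    have i2 : h * L2 = e2 * e3 := Nat.gcd_mul_lcm e2 e3
    have i3 : m ≤ 2 * (L1 * L2) := by
      have : m * h = (Nat.gcd e1 h * L1) * (h * L2) := by rw [i1, i2, he]; ring
      have h5 : m * h ≤ (2 * (L1 * L2)) * h := by
        rw [this]
        calc (Nat.gcd e1 h * L1) * (h * L2) ≤ (2 * L1) * (h * L2) := by gcongr
          _ = _ := by ring
      exact Nat.le_of_mul_le_mul_right h5 hpos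
    have j1 : #sa * L1 ≤ m := (Nat.mul_le_mul_right _ hsa_card).trans (Nat.div_mul_le_self _ _)
    have j2 : (m / L2) * L2 ≤ m := Nat.div_mul_le_self _ _
    have j3 : (#sa * (m / L2)) * m ≤ (2 * m) * m := by
      calc (#sa * (m / L2)) * m ≤ (#sa * (m / L2)) * (2 * (L1 * L2)) := by gcongr
        _ = 2 * ((#sa * L1) * ((m / L2) * L2)) := by ring
        _ ≤ 2 * (m * m) := by gcongr
        _ = _ := by ring
    exact Nat.le_of_mul_le_mul_right j3 hm

theorem pd_AB (m T : ℕ) (hm : 0 < m) (hT : DivB m T) :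
    #{x ∈ Finset.range m ×ˢ Finset.range m | m ∣ x.1 * x.2 * (x.1 + x.2 + 2)} ≤ T ^ 2 * (2 * m) := by
  calc _ ≤ #((m.divisors ×ˢ m.divisors).biUnion (fun e =>
        if e.1 * e.2 ∣ m then {x ∈ Finset.range m ×ˢ Finset.range m |
          e.1 ∣ x.1 ∧ e.2 ∣ x.2 ∧ m / (e.1 * e.2) ∣ x.1 + x.2 + 2} else ∅)) := by
        apply Finset.card_le_card
        intro x hx
        simp only [Finset.mem_filter] at hx
        obtain ⟨hx1, hx2⟩ := hx
        obtain ⟨m1, hm1⟩ := Nat.gcd_dvd_right x.1 m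
        set e1 := Nat.gcd x.1 m with he1
        have e1pos : 0 < e1 := Nat.gcd_pos_of_pos_right _ hm
        have m1pos : 0 < m1 := by
          rcases Nat.eq_zero_or_pos m1 with h | h
          · simp [h] at hm1; omega
          · exact h
        obtain ⟨m2, hm2⟩ := Nat.gcd_dvd_right x.2 m1
        set e2 := Nat.gcd x.2 m1 with he2
        have e2pos : 0 < e2 := Nat.gcd_pos_of_pos_right _ m1pos
        have hmm : m = e1 * e2 * m2 := by rw [hm1]; conv_lhs => rw [hm2]
                                          ring
        obtain ⟨a', ha'⟩ := Nat.gcd_dvd_left x.1 m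
        obtain ⟨b', hb'⟩ := Nat.gcd_dvd_left x.2 m1
        rw [← he1] at ha'
        rw [← he2] at hb'
        have c1 : Nat.Coprime m1 a' := by
          have h4 : Nat.gcd (e1 * a') (e1 * m1) = e1 * Nat.gcd a' m1 := Nat.gcd_mul_left _ _ _
          rw [← ha', ← hm1, ← he1] at h4
          have : Nat.gcd a' m1 = 1 := Nat.eq_of_mul_eq_mul_left e1pos (by linarith)
          exact Nat.Coprime.symm this
        have c2 : Nat.Coprime m2 b' := by
          have h4 : Nat.gcd (e2 * b') (e2 * m2) = e2 * Nat.gcd b' m2 := Nat.gcd_mul_left _ _ _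
          rw [← hb', ← hm2, ← he2] at h4
          have : Nat.gcd b' m2 = 1 := Nat.eq_of_mul_eq_mul_left e2pos (by linarith)
          exact Nat.Coprime.symm this
        have s1 : m1 ∣ x.2 * (x.1 + x.2 + 2) := by
          apply c1.dvd_of_dvd_mul_left
          apply Nat.dvd_of_mul_dvd_mul_left e1pos
          rw [← hm1]
          refine hx2.trans (dvd_of_eq ?_)
          rw [← mul_assoc e1, ← ha']; ring
        have s2 : m2 ∣ x.1 + x.2 + 2 := by
          apply c2.dvd_of_dvd_mul_left
          apply Nat.dvd_of_mul_dvd_mul_left e2pos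
          rw [← hm2]
          refine s1.trans (dvd_of_eq ?_)
          rw [← mul_assoc, ← hb']
        rw [Finset.mem_biUnion]
        refine ⟨(e1, e2), ?_, ?_⟩
        · rw [Finset.mem_product, Nat.mem_divisors, Nat.mem_divisors]
          exact ⟨⟨⟨m1, hm1⟩, hm.ne'⟩, ⟨⟨e1 * m2, by rw [hmm]; ring⟩, hm.ne'⟩⟩
        · have : m / (e1 * e2) = m2 := by
            conv_lhs => rw [hmm]
            exact Nat.mul_div_cancel_left _ (by positivity)
          simp only
          rw [if_pos ⟨m2, hmm⟩, Finset.mem_filter, this]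
          exact ⟨hx1, ⟨a', ha'⟩, ⟨b', hb'⟩, s2⟩
    _ ≤ ∑ e ∈ m.divisors ×ˢ m.divisors, 2 * m := by
        refine Finset.card_biUnion_le.trans (Finset.sum_le_sum fun e _ => ?_)
        split_ifs with h
        · exact pd_triple m e.1 e.2 _ hm (Nat.mul_div_cancel' h).symm
        · simp
    _ ≤ T ^ 2 * (2 * m) := by
        rw [Finset.sum_const, smul_eq_mul, Finset.card_product, sq]
        have := hT m hm (Nat.le_self_pow (by norm_num) _)
        gcongr

theorem pd_count (m T : ℕ) [NeZero m] (hT : DivB m T) :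
    #{x ∈ (Finset.univ : Finset (((ZMod m)ˣ × (ZMod m)ˣ) × ((ZMod m)ˣ × (ZMod m)ˣ))) |
      ((x.1.1⁻¹ : (ZMod m)ˣ) : ZMod m) + ((x.1.2⁻¹ : (ZMod m)ˣ) : ZMod m) =
        ((x.2.1⁻¹ : (ZMod m)ˣ) : ZMod m) + ((x.2.2⁻¹ : (ZMod m)ˣ) : ZMod m) ∧
      (x.1.1 : ZMod m) + x.1.2 = x.2.1 + x.2.2} ≤ Fintype.card (ZMod m)ˣ * (T ^ 2 * (2 * m)) := by
  have hm : 0 < m := Nat.pos_of_ne_zero (NeZero.ne m)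
  calc _ ≤ #((Finset.univ : Finset (ZMod m)ˣ) ×ˢ
      {x ∈ Finset.range m ×ˢ Finset.range m | m ∣ x.1 * x.2 * (x.1 + x.2 + 2)}) := by
        apply Finset.card_le_card_of_injOn (fun x => (x.1.1,
          ((((x.2.1 * x.1.1⁻¹ : (ZMod m)ˣ) : ZMod m) - 1).val,
           (((x.2.2 * x.1.1⁻¹ : (ZMod m)ˣ) : ZMod m) - 1).val)))
        · rintro ⟨⟨x1, x2⟩, ⟨x3, x4⟩⟩ hx
          simp only [Finset.coe_filter, Finset.mem_univ, true_and, Set.mem_ofPred_eq] at hx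
          simp only [Finset.coe_product, Set.mem_prod, Finset.coe_univ, Set.mem_univ, true_and,
            Finset.mem_coe, Finset.mem_filter, Finset.mem_product, Finset.mem_range]
          refine ⟨⟨ZMod.val_lt _, ZMod.val_lt _⟩, ?_⟩
          rw [← ZMod.natCast_eq_zero_iff]
          push_cast
          simp only [ZMod.natCast_val, ZMod.cast_id', id_eq]
          obtain ⟨hx1, hx2⟩ := hx
          have v1 : (x1 : ZMod m) * ((x1⁻¹ : (ZMod m)ˣ) : ZMod m) = 1 := Units.mul_inv x1
          have v2 : (x2 : ZMod m) * ((x2⁻¹ : (ZMod m)ˣ) : ZMod m) = 1 := Units.mul_inv x2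
          have v3 : (x3 : ZMod m) * ((x3⁻¹ : (ZMod m)ˣ) : ZMod m) = 1 := Units.mul_inv x3
          have v4 : (x4 : ZMod m) * ((x4⁻¹ : (ZMod m)ˣ) : ZMod m) = 1 := Units.mul_inv x4
          generalize ((x1⁻¹ : (ZMod m)ˣ) : ZMod m) = i1 at *
          generalize ((x2⁻¹ : (ZMod m)ˣ) : ZMod m) = i2 at *
          generalize ((x3⁻¹ : (ZMod m)ˣ) : ZMod m) = i3 at *
          generalize ((x4⁻¹ : (ZMod m)ˣ) : ZMod m) = i4 at *
          generalize (x1 : ZMod m) = y1 at *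
          generalize (x2 : ZMod m) = y2 at *
          generalize (x3 : ZMod m) = y3 at *
          generalize (x4 : ZMod m) = y4 at *
          -- (y3+y4)(y3 - y1)(y4 - y1) = 0
          have k1 : (y1 + y2) * (y3 * y4) = (y3 + y4) * (y1 * y2) := by
            have : (i1 + i2) * (y1 * y2 * y3 * y4) = (i3 + i4) * (y1 * y2 * y3 * y4) := by rw [hx1]
            linear_combination this - (y2 * y3 * y4) * v1 - (y1 * y3 * y4) * v2 +
              (y1 * y2 * y4) * v3 + (y1 * y2 * y3) * v4
          have k2 : (y3 + y4) * ((y3 - y1) * (y4 - y1)) = 0 := by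
            have : y2 = y3 + y4 - y1 := by linear_combination hx2
            rw [this] at k1
            linear_combination k1
          have k3 : i1 ^ 3 * ((y3 + y4) * ((y3 - y1) * (y4 - y1))) = 0 := by rw [k2, mul_zero]
          have : (y3 * i1 - 1) * (y4 * i1 - 1) * (y3 * i1 - 1 + (y4 * i1 - 1) + 2) =
              i1 ^ 3 * ((y3 + y4) * ((y3 - y1) * (y4 - y1))) := by
            have w1 : (y3 * i1 - 1) = i1 * (y3 - y1) := by linear_combination v1
            have w2 : (y4 * i1 - 1) = i1 * (y4 - y1) := by linear_combination v1
            have w3 : (y3 * i1 - 1 + (y4 * i1 - 1) + 2) = i1 * (y3 + y4) := by ring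
            rw [w3, w1, w2]; ring
          rw [this]; exact k3
        · rintro ⟨⟨x1, x2⟩, ⟨x3, x4⟩⟩ hx ⟨⟨y1, y2⟩, ⟨y3, y4⟩⟩ hy hxy
          simp only [Finset.coe_filter, Finset.mem_univ, true_and, Set.mem_ofPred_eq] at hx hy
          simp only [Prod.mk.injEq] at hxy
          obtain ⟨h1, h3, h4⟩ := hxy
          subst h1
          have h3' := mul_right_cancel (Units.ext (sub_left_injective (ZMod.val_injective m h3)))
          have h4' := mul_right_cancel (Units.ext (sub_left_injective (ZMod.val_injective m h4)))
          subst h3' h4'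
          have : (x2 : ZMod m) = y2 := by
            have := hx.2.trans hy.2.symm
            exact add_left_cancel this
          rw [Units.ext this]
    _ ≤ _ := by
        rw [Finset.card_product, Finset.card_univ]
        have := pd_AB m T hm hT
        gcongr

theorem pd_K4 (m T : ℕ) [NeZero m] (hT : DivB m T) :
    ∑ l : ZMod m × ZMod m, ‖KS m l.1 l.2‖ ^ 4 ≤
      (m : ℝ) ^ 2 * (Fintype.card (ZMod m)ˣ * (T ^ 2 * (2 * m))) := by
  have key := pb_L2gen (Λ := ZMod m × ZMod m) (Finset.univ : Finset ((ZMod m)ˣ × (ZMod m)ˣ))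
    (fun _ => (1:ℂ)) (by simp)
    (fun l x => ZMod.stdAddChar (l.1 * (((x.1⁻¹ : (ZMod m)ˣ) : ZMod m) + ((x.2⁻¹ : (ZMod m)ˣ) : ZMod m))
      + l.2 * ((x.1 : ZMod m) + (x.2 : ZMod m)))) ((m:ℝ)^2) (by positivity)
    (fun x y => ((x.1⁻¹ : (ZMod m)ˣ) : ZMod m) + ((x.2⁻¹ : (ZMod m)ˣ) : ZMod m) =
        ((y.1⁻¹ : (ZMod m)ˣ) : ZMod m) + ((y.2⁻¹ : (ZMod m)ˣ) : ZMod m) ∧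
      (x.1 : ZMod m) + (x.2 : ZMod m) = (y.1 : ZMod m) + (y.2 : ZMod m)) (by
    intro x _ y _
    simp only [pb_conj, ← AddChar.map_add_eq_mul]
    have : ∀ l : ZMod m × ZMod m,
        (ZMod.stdAddChar (l.1 * (((x.1⁻¹ : (ZMod m)ˣ) : ZMod m) + ((x.2⁻¹ : (ZMod m)ˣ) : ZMod m))
      + l.2 * ((x.1 : ZMod m) + (x.2 : ZMod m)) +
       -(l.1 * (((y.1⁻¹ : (ZMod m)ˣ) : ZMod m) + ((y.2⁻¹ : (ZMod m)ˣ) : ZMod m))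
      + l.2 * ((y.1 : ZMod m) + (y.2 : ZMod m)))) : ℂ) =
      ZMod.stdAddChar (l.1 * ((((x.1⁻¹ : (ZMod m)ˣ) : ZMod m) + ((x.2⁻¹ : (ZMod m)ˣ) : ZMod m))
        - (((y.1⁻¹ : (ZMod m)ˣ) : ZMod m) + ((y.2⁻¹ : (ZMod m)ˣ) : ZMod m)))) *
      ZMod.stdAddChar (l.2 * (((x.1 : ZMod m) + (x.2 : ZMod m)) - ((y.1 : ZMod m) + (y.2 : ZMod m)))) := by
      intro l
      rw [← AddChar.map_add_eq_mul]
      congr 1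
      ring
    rw [Finset.sum_congr rfl (fun l _ => this l), Fintype.sum_prod_type]
    simp only
    rw [← Finset.sum_mul_sum, pb_orth, pb_orth]
    simp only [sub_eq_zero]
    by_cases h1 : ((x.1⁻¹ : (ZMod m)ˣ) : ZMod m) + ((x.2⁻¹ : (ZMod m)ˣ) : ZMod m) =
        ((y.1⁻¹ : (ZMod m)ˣ) : ZMod m) + ((y.2⁻¹ : (ZMod m)ˣ) : ZMod m)
    · by_cases h2 : (x.1 : ZMod m) + (x.2 : ZMod m) = (y.1 : ZMod m) + (y.2 : ZMod m)
      · rw [if_pos h1, if_pos h2, if_pos ⟨h1, h2⟩]; push_cast; ring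
      · simp [h2]
    · simp [h1])
  have e1 : ∀ l : ZMod m × ZMod m, ‖KS m l.1 l.2‖ ^ 4 = ‖∑ x : (ZMod m)ˣ × (ZMod m)ˣ, (1:ℂ) *
    ZMod.stdAddChar (l.1 * (((x.1⁻¹ : (ZMod m)ˣ) : ZMod m) + ((x.2⁻¹ : (ZMod m)ˣ) : ZMod m))
      + l.2 * ((x.1 : ZMod m) + (x.2 : ZMod m)))‖ ^ 2 := by
    intro l
    rw [show (4:ℕ) = 2 * 2 from rfl, pow_mul, ← norm_pow]
    congr 2
    unfold KS
    rw [sq, Finset.sum_mul_sum, Fintype.sum_prod_type]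
    apply Finset.sum_congr rfl; intro i _
    apply Finset.sum_congr rfl; intro j _
    rw [one_mul, ← AddChar.map_add_eq_mul]
    congr 1
    ring
  rw [Finset.sum_congr rfl (fun l _ => e1 l)]
  refine key.trans ?_
  have := pd_count m T hT
  rw [Finset.univ_product_univ]
  have h2 : (#{x ∈ (Finset.univ : Finset (((ZMod m)ˣ × (ZMod m)ˣ) × ((ZMod m)ˣ × (ZMod m)ˣ))) |
      ((x.1.1⁻¹ : (ZMod m)ˣ) : ZMod m) + ((x.1.2⁻¹ : (ZMod m)ˣ) : ZMod m) =
        ((x.2.1⁻¹ : (ZMod m)ˣ) : ZMod m) + ((x.2.2⁻¹ : (ZMod m)ˣ) : ZMod m) ∧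
      (x.1.1 : ZMod m) + x.1.2 = x.2.1 + x.2.2} : ℝ) ≤
      (Fintype.card (ZMod m)ˣ : ℝ) * ((T:ℝ) ^ 2 * (2 * m)) := by exact_mod_cast this
  exact mul_le_mul_of_nonneg_left h2 (by positivity)

end

section

open Finset

theorem pe_gcdsum (m V T : ℕ) (hm : 0 < m) (hT : DivB m T) :
    ∑ v ∈ Icc 1 V, Nat.gcd v m ≤ T * V := by
  calc ∑ v ∈ Icc 1 V, Nat.gcd v m ≤ ∑ v ∈ Icc 1 V, ∑ e ∈ m.divisors, (if e ∣ v then e else 0) := by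
        apply Finset.sum_le_sum
        intro v _
        have h := Finset.single_le_sum (f := fun e => if e ∣ v then e else 0) (s := m.divisors)
          (fun _ _ => Nat.zero_le _) (Nat.mem_divisors.2 ⟨Nat.gcd_dvd_right v m, hm.ne'⟩)
        simp only [Nat.gcd_dvd_left, if_true] at h
        exact h
    _ = ∑ e ∈ m.divisors, ∑ v ∈ Icc 1 V, (if e ∣ v then e else 0) := Finset.sum_comm
    _ ≤ ∑ e ∈ m.divisors, V := by
        apply Finset.sum_le_sum
        intro e he
        rw [← Finset.sum_filter, Finset.sum_const, smul_eq_mul]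
        have : #{v ∈ Icc 1 V | e ∣ v} = V / e := by
          have := Nat.Ioc_filter_dvd_card_eq_div V e
          rwa [← Finset.Icc_add_one_left_eq_Ioc] at this
        rw [this]
        exact Nat.div_mul_le_self _ _
    _ ≤ T * V := by
        rw [Finset.sum_const, smul_eq_mul]
        have := hT m hm (Nat.le_self_pow (by norm_num) _)
        gcongr

theorem pe_fib (m T H V E B : ℕ) (hT : DivB m T) (hX : H * V * (E * B) ≤ m ^ 20)
    (Dd : Finset ℕ) (hD : Dd ⊆ Icc 1 E) (c : ZMod m) :
    #{z ∈ (Icc 1 H ×ˢ Icc 1 V) ×ˢ (Dd ×ˢ US m B) | (((z.1.1 * z.1.2) * (z.2.1 * z.2.2) : ℕ) : ZMod m) = c}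
      ≤ (H * V * (E * B) / m + 1) * T ^ 4 := by
  set X := H * V * (E * B)
  calc _ ≤ #(({n ∈ Icc 1 X | ((n:ℕ) : ZMod m) = c} : Finset ℕ).biUnion
        fun n => (n.divisors ×ˢ n.divisors) ×ˢ (n.divisors ×ˢ n.divisors)) := by
        apply Finset.card_le_card
        rintro ⟨⟨k, v⟩, ⟨d, b⟩⟩ hz
        simp only [Finset.mem_filter, Finset.mem_product] at hz
        obtain ⟨⟨⟨hk, hv⟩, hd, hb⟩, hc⟩ := hz
        have hd := hD hd
        have hb' := (mem_US.1 hb)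
        rw [Finset.mem_Icc] at hk hv hd
        have hpos : 0 < k * v * (d * b) := by
          have := hb'.1
          have h1 : 0 < k := hk.1
          have h2 : 0 < v := hv.1
          have h3 : 0 < d := hd.1
          have h4 : 0 < b := by omega
          positivity
        simp only [Finset.mem_biUnion, Finset.mem_filter, Finset.mem_product, Nat.mem_divisors,
          Finset.mem_Icc]
        refine ⟨k * v * (d * b), ⟨⟨hpos, ?_⟩, hc⟩, ⟨⟨⟨v * (d * b), by ring⟩, hpos.ne'⟩, ⟨⟨k * (d * b), by ring⟩, hpos.ne'⟩⟩,
          ⟨⟨k * v * b, by ring⟩, hpos.ne'⟩, ⟨⟨k * v * d, by ring⟩, hpos.ne'⟩⟩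
        have := hk.2
        have := hv.2
        have := hd.2
        have : b ≤ B := hb'.2.1
        change k * v * (d * b) ≤ H * V * (E * B)
        gcongr
    _ ≤ ∑ n ∈ ({n ∈ Icc 1 X | ((n:ℕ) : ZMod m) = c} : Finset ℕ), T ^ 4 := by
        refine Finset.card_biUnion_le.trans (Finset.sum_le_sum fun n hn => ?_)
        rw [Finset.mem_filter, Finset.mem_Icc] at hn
        have := hT n hn.1.1 (hn.1.2.trans hX)
        simp only [Finset.card_product]
        calc _ ≤ (T * T) * (T * T) := by gcongr
          _ = T ^ 4 := by ring
    _ ≤ _ := by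
        rw [Finset.sum_const, smul_eq_mul]
        have := pc_residue m X c
        gcongr

theorem pe_G (m T H V E B : ℕ) (hm : 0 < m) (hT : DivB m T) (hX : H * V * (E * B) ≤ m ^ 20)
    (Dd : Finset ℕ) (hD : Dd ⊆ Icc 1 E) :
    ∑ x ∈ (Icc 1 H ×ˢ Icc 1 V) ×ˢ (Dd ×ˢ US m B), ∑ y ∈ (Icc 1 H ×ˢ Icc 1 V) ×ˢ (Dd ×ˢ US m B),
      (if (((x.1.1 * x.1.2) * (y.2.1 * y.2.2) : ℕ) : ZMod m) = (((y.1.1 * y.1.2) * (x.2.1 * x.2.2) : ℕ) : ZMod m)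
        then Nat.gcd x.1.2 m else 0) ≤
      (H * V * (#Dd * B)) * ((H * V * (E * B) / m + 1) * T ^ 5) := by
  have hswap : ∀ (f : ℕ × ℕ → ℕ × ℕ → ℕ × ℕ → ℕ × ℕ → ℕ) (s t : Finset (ℕ × ℕ)),
      ∑ x ∈ s ×ˢ t, ∑ y ∈ s ×ˢ t, f x.1 x.2 y.1 y.2 = ∑ x ∈ s ×ˢ t, ∑ y ∈ s ×ˢ t, f x.1 y.2 y.1 x.2 := by
    intro f s t
    simp only [Finset.sum_product]
    apply Finset.sum_congr rfl; intro a _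
    rw [Finset.sum_comm]
    rw [Finset.sum_comm (s := t) (t := s)]
    apply Finset.sum_congr rfl; intro b _
    rw [Finset.sum_comm]
  have := hswap (fun x1 x2 y1 y2 => (if (((x1.1 * x1.2) * (y2.1 * y2.2) : ℕ) : ZMod m) = (((y1.1 * y1.2) * (x2.1 * x2.2) : ℕ) : ZMod m)
        then Nat.gcd x1.2 m else 0)) (Icc 1 H ×ˢ Icc 1 V) (Dd ×ˢ US m B)
  rw [this]
  have hUS : #(US m B) ≤ B := by
    calc #(US m B) ≤ #(Icc 1 B) := Finset.card_le_card (Finset.filter_subset _ _)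
      _ = B := by simp
  calc _ ≤ ∑ x ∈ (Icc 1 H ×ˢ Icc 1 V) ×ˢ (Dd ×ˢ US m B), Nat.gcd x.1.2 m * ((H * V * (E * B) / m + 1) * T ^ 4) := by
        apply Finset.sum_le_sum
        intro x _
        rw [← Finset.sum_filter, Finset.sum_const, smul_eq_mul, mul_comm]
        gcongr
        refine le_trans (le_of_eq ?_) (pe_fib m T H V E B hT hX Dd hD (((x.1.1 * x.1.2) * (x.2.1 * x.2.2) : ℕ) : ZMod m))
        congr 1
        apply Finset.filter_congr
        intro y _
        constructor <;> intro h <;> exact h.symm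
    _ = (∑ v ∈ Icc 1 V, Nat.gcd v m) * (H * (#Dd * #(US m B))) * ((H * V * (E * B) / m + 1) * T ^ 4) := by
        rw [← Finset.sum_mul]
        congr 1
        simp only [Finset.sum_product, Finset.sum_const, smul_eq_mul, Nat.card_Icc, ← Finset.mul_sum, Finset.card_product]
        simp only [Nat.add_sub_cancel]
        ring
    _ ≤ (T * V) * (H * (#Dd * B)) * ((H * V * (E * B) / m + 1) * T ^ 4) := by
        have := pe_gcdsum m V T hm hT
        gcongr
    _ = _ := by ring

noncomputable def lam (m : ℕ) (a : ZMod m) (i : ℕ × ℕ) : ZMod m :=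
  (i.1 : ZMod m) * a * (i.2 : ZMod m)⁻¹

theorem card_US_le (m B : ℕ) : #(US m B) ≤ B := by
  calc #(US m B) ≤ #(Icc 1 B) := Finset.card_le_card (Finset.filter_subset _ _)
    _ = B := by simp

/-- collision: from equality of fractions -/
theorem pe_cross {m : ℕ} {a x y d b d' b' : ZMod m} (ha : IsUnit a)
    (hd : d * d⁻¹ = 1) (hb : b * b⁻¹ = 1) (hd' : d' * d'⁻¹ = 1) (hb' : b' * b'⁻¹ = 1)
    (h : x * a * d⁻¹ * b⁻¹ = y * a * d'⁻¹ * b'⁻¹) : x * (d' * b') = y * (d * b) := by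
  have h2 : a * (x * (d' * b')) = a * (y * (d * b)) := by
    have : x * a * d⁻¹ * b⁻¹ * (d * b * d' * b') = y * a * d'⁻¹ * b'⁻¹ * (d * b * d' * b') := by rw [h]
    have e1 : x * a * d⁻¹ * b⁻¹ * (d * b * d' * b') = a * (x * (d' * b')) * ((d * d⁻¹) * (b * b⁻¹)) := by ring
    have e2 : y * a * d'⁻¹ * b'⁻¹ * (d * b * d' * b') = a * (y * (d * b)) * ((d' * d'⁻¹) * (b' * b'⁻¹)) := by ring
    rw [e1, e2, hd, hb, hd', hb'] at this
    simpa using this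
  exact ha.mul_left_cancel h2

theorem t2a_core (m T H E R Q : ℕ) [NeZero m] (hT : DivB m T) (hX : H * (E * R) ≤ m ^ 20)
    (Dd : Finset ℕ) (hD : Dd ⊆ US m E) (a : ZMod m) (ha : IsUnit a) (hQ : 1 ≤ Q) (hQm : 2 * Q < m)
    (f : ℕ → ℂ) (hf : ∀ q, ‖f q‖ ≤ 1) :
    (∑ i ∈ Icc 1 H ×ˢ Dd, ∑ r ∈ US m R, ‖∑ q ∈ US m Q, f q *
      ZMod.stdAddChar (lam m a i * (r : ZMod m)⁻¹ * (q : ZMod m)⁻¹)‖) ^ 4 ≤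
      ((H:ℝ) * #Dd * R) ^ 3 * ((H:ℝ) * E * R / m + 1) * T ^ 5 *
        (m * (60 * T ^ 2 * ((Q:ℝ) ^ 2 + (Q:ℝ) ^ 3 * √((Q:ℝ) / m)))) := by
  have hm : 0 < m := Nat.pos_of_ne_zero (NeZero.ne m)
  have hmR : (0:ℝ) < m := by exact_mod_cast hm
  set G : ZMod m → ℝ := fun l => ‖∑ q ∈ US m Q, f q * ZMod.stdAddChar (l * (q : ZMod m)⁻¹)‖ with hG
  have h1 := pb_holder ((Icc 1 H ×ˢ Dd) ×ˢ US m R)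
    (fun z => lam m a z.1 * (z.2 : ZMod m)⁻¹) G (fun l => norm_nonneg _)
  have h4 := pb_L4 m (US m Q) f (fun q _ => hf q) (fun q => (q : ZMod m)⁻¹)
  have hJ := pc_J2 m Q T hT hQ hQm
  rw [Finset.sum_product] at h1
  refine h1.trans ?_
  have hDE : Dd ⊆ Icc 1 E := hD.trans (Finset.filter_subset _ _)
  have hcount : #{x ∈ ((Icc 1 H ×ˢ Dd) ×ˢ US m R) ×ˢ ((Icc 1 H ×ˢ Dd) ×ˢ US m R) |
      lam m a x.1.1 * (x.1.2 : ZMod m)⁻¹ = lam m a x.2.1 * (x.2.2 : ZMod m)⁻¹} ≤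
      (H * (#Dd * R)) * ((H * (E * R) / m + 1) * T ^ 5) := by
    have hg := pe_G m T H 1 E R hm hT (by simpa using hX) Dd hDE
    simp only [mul_one] at hg
    refine le_trans ?_ hg
    rw [← Finset.sum_product', ← Finset.sum_filter]
    rw [Finset.card_eq_sum_ones]
    rw [← Finset.card_eq_sum_ones]
    calc _ ≤ #{x ∈ ((Icc 1 H ×ˢ Icc 1 1) ×ˢ (Dd ×ˢ US m R)) ×ˢ ((Icc 1 H ×ˢ Icc 1 1) ×ˢ (Dd ×ˢ US m R)) |
          (((x.1.1.1 * x.1.1.2) * (x.2.2.1 * x.2.2.2) : ℕ) : ZMod m) = (((x.2.1.1 * x.2.1.2) * (x.1.2.1 * x.1.2.2) : ℕ) : ZMod m)} := by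
          apply Finset.card_le_card_of_injOn
            (fun x => (((x.1.1.1, 1), (x.1.1.2, x.1.2)), ((x.2.1.1, 1), (x.2.1.2, x.2.2))))
          · rintro ⟨⟨⟨k, d⟩, r⟩, ⟨⟨k', d'⟩, r'⟩⟩ hx
            simp only [Finset.coe_filter, Finset.mem_product, Set.mem_ofPred_eq] at hx
            obtain ⟨⟨⟨⟨hk, hd⟩, hr⟩, ⟨hk', hd'⟩, hr'⟩, hx⟩ := hx
            simp only [Finset.coe_filter, Finset.mem_product, Set.mem_ofPred_eq, mul_one]
            refine ⟨⟨⟨⟨hk, by simp⟩, hd, hr⟩, ⟨hk', by simp⟩, hd', hr'⟩, ?_⟩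
            push_cast
            exact pe_cross ha (zm_unit (mem_US.1 (hD hd)).2.2) (zm_unit (mem_US.1 hr).2.2)
              (zm_unit (mem_US.1 (hD hd')).2.2) (zm_unit (mem_US.1 hr').2.2) hx
          · rintro ⟨⟨⟨k, d⟩, r⟩, ⟨⟨k', d'⟩, r'⟩⟩ _ ⟨⟨⟨k2, d2⟩, r2⟩, ⟨⟨k2', d2'⟩, r2'⟩⟩ _ hh
            simp only [Prod.mk.injEq] at hh ⊢
            tauto
      _ ≤ _ := by
          rw [Finset.card_eq_sum_ones]
          apply le_trans (Finset.sum_le_sum (g := fun x => Nat.gcd x.1.1.2 m) ?_) (le_of_eq ?_)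
          · intro x hx
            exact Nat.gcd_pos_of_pos_right _ hm
          · rfl
  have hcR : (#{x ∈ ((Icc 1 H ×ˢ Dd) ×ˢ US m R) ×ˢ ((Icc 1 H ×ˢ Dd) ×ˢ US m R) |
      lam m a x.1.1 * (x.1.2 : ZMod m)⁻¹ = lam m a x.2.1 * (x.2.2 : ZMod m)⁻¹} : ℝ) ≤
      ((H:ℝ) * #Dd * R) * (((H:ℝ) * E * R / m + 1) * T ^ 5) := by
    have : ((H * (E * R) / m : ℕ) : ℝ) ≤ (H:ℝ) * E * R / m := by
      refine Nat.cast_div_le.trans (le_of_eq ?_)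
      push_cast; ring
    calc _ ≤ (((H * (#Dd * R)) * ((H * (E * R) / m + 1) * T ^ 5) : ℕ) : ℝ) := by exact_mod_cast hcount
      _ = ((H:ℝ) * #Dd * R) * ((((H * (E * R) / m : ℕ) : ℝ) + 1) * T ^ 5) := by
          push_cast [Nat.cast_mul, Nat.cast_add]; ring
      _ ≤ _ := by gcongr
  have hs : (#((Icc 1 H ×ˢ Dd) ×ˢ US m R) : ℝ) ≤ (H:ℝ) * #Dd * R := by
    rw [Finset.card_product, Finset.card_product]
    push_cast
    have : (#(US m R) : ℝ) ≤ R := by exact_mod_cast card_US_le m R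
    simp only [Nat.card_Icc, Nat.add_sub_cancel]
    gcongr
  have hG4 : ∑ l, G l ^ 4 ≤ m * (60 * T ^ 2 * ((Q:ℝ) ^ 2 + (Q:ℝ) ^ 3 * √((Q:ℝ) / m))) := by
    refine h4.trans ?_
    gcongr
  calc _ ≤ ((H:ℝ) * #Dd * R) ^ 2 * (((H:ℝ) * #Dd * R) * (((H:ℝ) * E * R / m + 1) * T ^ 5)) *
        (m * (60 * T ^ 2 * ((Q:ℝ) ^ 2 + (Q:ℝ) ^ 3 * √((Q:ℝ) / m)))) := by
        gcongr
    _ = _ := by ring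

end

section

open Finset

theorem pf_KS (m : ℕ) [NeZero m] (hm : 2 ≤ m) (l j : ZMod m) :
    ∑ q ∈ US m m, (ZMod.stdAddChar (l * (q : ZMod m)⁻¹) : ℂ) * ZMod.stdAddChar (j * (q : ZMod m)) = KS m l j := by
  unfold KS
  refine Finset.sum_bij (fun q hq => ZMod.unitOfCoprime q (mem_US.1 hq).2.2) ?_ ?_ ?_ ?_
  · intro q hq; exact Finset.mem_univ _
  · intro q hq q' hq' h
    have h2 := congrArg (fun u : (ZMod m)ˣ => (u : ZMod m)) h
    simp only [ZMod.coe_unitOfCoprime] at h2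
    rw [ZMod.natCast_eq_natCast_iff] at h2
    have lt : ∀ q ∈ US m m, q < m := by
      intro q hq
      have := mem_US.1 hq
      rcases this.2.1.lt_or_eq with h | h
      · exact h
      · rw [h] at this; have := this.2.2; simp at this; omega
    exact Nat.ModEq.eq_of_lt_of_lt h2 (lt q hq) (lt q' hq')
  · intro u _
    have hc := ZMod.val_coe_unit_coprime u
    refine ⟨(u : ZMod m).val, mem_US.2 ⟨?_, (ZMod.val_lt _).le, hc⟩, ?_⟩
    · rcases Nat.eq_zero_or_pos (u : ZMod m).val with h | h
      · rw [h] at hc; simp at hc; omega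
      · exact h
    · ext; simp
  · intro q hq
    rw [← AddChar.map_add_eq_mul]
    congr 1

/-- completed majorant -/
noncomputable def ZZ (m : ℕ) [NeZero m] (U : ℝ) (l : ZMod m) : ℝ :=
  ∑ j : ZMod m, cw m U j * ‖KS m l j‖

theorem pf_complete (m : ℕ) [NeZero m] (hm : 2 ≤ m) (l : ZMod m) (Y : ℕ) (hY : Y ≤ m) (U : ℝ)
    (hU : (Y:ℝ) ≤ U) : ‖∑ q ∈ US m Y, (ZMod.stdAddChar (l * (q : ZMod m)⁻¹) : ℂ)‖ ≤ ZZ m U l := by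
  have h := pb_completion m (US m m) (Finset.filter_subset _ _)
    (fun q => (ZMod.stdAddChar (l * (q : ZMod m)⁻¹) : ℂ)) Y hY U hU
  unfold ZZ
  have e : ({q ∈ US m m | q ≤ Y} : Finset ℕ) = US m Y := by
    ext q
    simp only [Finset.mem_filter, mem_US]
    constructor
    · rintro ⟨⟨h1, h2, h3⟩, h4⟩; exact ⟨h1, h4, h3⟩
    · rintro ⟨h1, h2, h3⟩; exact ⟨⟨h1, h2.trans hY, h3⟩, h2⟩
  rw [e] at h
  refine h.trans (le_of_eq ?_)
  apply Finset.sum_congr rfl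
  intro j _
  rw [pf_KS m hm l j]

theorem pf_log (m : ℕ) [NeZero m] (hm : 2 ≤ m) (l : ZMod m) (Y : ℕ) (hY : Y ≤ m) (U : ℝ)
    (hU : (Y:ℝ) ≤ U) : ‖∑ q ∈ US m Y, (Real.log q : ℂ) * (ZMod.stdAddChar (l * (q : ZMod m)⁻¹) : ℂ)‖ ≤
      2 * Real.log m * ZZ m U l := by
  set A : ℕ → ℂ := fun n => ∑ q ∈ US m n, (ZMod.stdAddChar (l * (q : ZMod m)⁻¹) : ℂ) with hA
  have hrec : ∀ n : ℕ, ∑ q ∈ US m (n+1), (Real.log q : ℂ) * (ZMod.stdAddChar (l * (q : ZMod m)⁻¹) : ℂ) =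
      ∑ q ∈ US m n, (Real.log q : ℂ) * (ZMod.stdAddChar (l * (q : ZMod m)⁻¹) : ℂ) + (Real.log (n+1:ℕ) : ℂ) * (A (n+1) - A n) := by
    intro n
    have e : US m (n+1) = if Nat.Coprime (n+1) m then insert (n+1) (US m n) else US m n := by
      ext q
      split_ifs with h
      · simp only [mem_US, Finset.mem_insert]
        constructor
        · rintro ⟨h1, h2, h3⟩
          by_cases hq : q = n + 1
          · left; exact hq
          · right; exact ⟨h1, by omega, h3⟩
        · rintro (h1 | ⟨h1, h2, h3⟩)
          · subst h1; exact ⟨by omega, le_rfl, h⟩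
          · exact ⟨h1, by omega, h3⟩
      · simp only [mem_US]
        constructor
        · rintro ⟨h1, h2, h3⟩
          refine ⟨h1, ?_, h3⟩
          by_contra hh
          have : q = n + 1 := by omega
          subst this; exact h h3
        · rintro ⟨h1, h2, h3⟩; exact ⟨h1, by omega, h3⟩
    have hn : n + 1 ∉ US m n := by simp [mem_US]
    simp only [hA]
    rw [e]
    split_ifs with h
    · rw [Finset.sum_insert hn, Finset.sum_insert hn]; ring
    · ring
  have hsum : ∀ n : ℕ, ∑ q ∈ US m n, (Real.log q : ℂ) * (ZMod.stdAddChar (l * (q : ZMod m)⁻¹) : ℂ) =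
      (Real.log n : ℂ) * A n - ∑ t ∈ Finset.range n, ((Real.log (t+1:ℕ) - Real.log t : ℝ) : ℂ) * A t := by
    intro n
    induction n with
    | zero => simp [US]
    | succ n ih =>
      rw [hrec, ih, Finset.sum_range_succ]
      push_cast
      ring
  have hZ : ∀ n ≤ Y, ‖A n‖ ≤ ZZ m U l := fun n hn =>
    pf_complete m hm l n (hn.trans hY) U (le_trans (by exact_mod_cast hn) hU)
  have hZ0 : 0 ≤ ZZ m U l := (norm_nonneg _).trans (hZ 0 (by omega))
  rw [hsum]
  refine (norm_sub_le _ _).trans ?_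
  have hlogY : Real.log Y ≤ Real.log m := by
    rcases Nat.eq_zero_or_pos Y with h | h
    · rw [h]; simp only [Nat.cast_zero, Real.log_zero]; exact Real.log_natCast_nonneg m
    · exact Real.log_le_log (by exact_mod_cast h) (by exact_mod_cast hY)
  have hlY0 : 0 ≤ Real.log Y := Real.log_natCast_nonneg _
  have b1 : ‖(Real.log Y : ℂ) * A Y‖ ≤ Real.log m * ZZ m U l := by
    rw [norm_mul, Complex.norm_real, Real.norm_of_nonneg hlY0]
    have := hZ Y le_rfl
    gcongr
  have b2 : ‖∑ t ∈ Finset.range Y, ((Real.log (t+1:ℕ) - Real.log t : ℝ) : ℂ) * A t‖ ≤ Real.log m * ZZ m U l := by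
    calc _ ≤ ∑ t ∈ Finset.range Y, (Real.log (t+1:ℕ) - Real.log t) * ZZ m U l := by
          refine (norm_sum_le _ _).trans (Finset.sum_le_sum fun t ht => ?_)
          have h0 : 0 ≤ Real.log (t+1:ℕ) - Real.log t := by
            rcases Nat.eq_zero_or_pos t with h | h
            · rw [h]; simp
            · rw [sub_nonneg]
              exact Real.log_le_log (by exact_mod_cast h) (by push_cast; linarith)
          rw [norm_mul, Complex.norm_real, Real.norm_of_nonneg h0]
          exact mul_le_mul_of_nonneg_left (hZ t (Finset.mem_range.1 ht).le) h0
      _ = (Real.log Y - Real.log (0:ℕ)) * ZZ m U l := by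
          rw [← Finset.sum_mul, Finset.sum_range_sub (fun t : ℕ => Real.log (t:ℝ))]
      _ ≤ _ := by
          simp only [Nat.cast_zero, Real.log_zero, sub_zero]
          gcongr
  linarith

theorem pf_sol (m : ℕ) [NeZero m] (v : ℕ) (w : ZMod m) :
    #{e : (ZMod m)ˣ | (e : ZMod m) * v = w} ≤ Nat.gcd v m := by
  have hm : 0 < m := Nat.pos_of_ne_zero (NeZero.ne m)
  have gpos : 0 < Nat.gcd v m := Nat.gcd_pos_of_pos_right _ hm
  obtain ⟨L, hL⟩ := Nat.gcd_dvd_right v m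
  obtain ⟨v', hv⟩ := Nat.gcd_dvd_left v m
  set g := Nat.gcd v m with hg
  have Lpos : 0 < L := by
    rcases Nat.eq_zero_or_pos L with h | h
    · rw [h] at hL; omega
    · exact h
  have hcop : Nat.Coprime L v' := by
    have h4 : Nat.gcd (g * v') (g * L) = g * Nat.gcd v' L := Nat.gcd_mul_left _ _ _
    rw [← hv, ← hL, ← hg] at h4
    have : Nat.gcd v' L = 1 := Nat.eq_of_mul_eq_mul_left gpos (by linarith)
    exact Nat.Coprime.symm this
  have hd : m / L = g := by
    conv_lhs => rw [hL]
    exact Nat.mul_div_cancel _ Lpos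
  have key := pd_class m L Lpos ⟨g, by rw [mul_comm]; exact hL⟩
    (Finset.image (fun e : (ZMod m)ˣ => (e : ZMod m).val) {e : (ZMod m)ˣ | (e : ZMod m) * v = w})
    (by
      intro n hn
      rw [Finset.mem_image] at hn
      obtain ⟨e, _, rfl⟩ := hn
      exact Finset.mem_range.2 (ZMod.val_lt _)) (by
      intro x hx y hy
      rw [Finset.mem_image] at hx hy
      obtain ⟨e, he, rfl⟩ := hx
      obtain ⟨e', he', rfl⟩ := hy
      simp only [Finset.mem_filter, Finset.mem_univ, true_and] at he he'
      have h1 : (((e : ZMod m).val * v : ℕ) : ZMod m) = (((e' : ZMod m).val * v : ℕ) : ZMod m) := by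
        push_cast
        simp only [ZMod.natCast_val, ZMod.cast_id', id_eq]
        rw [he, he']
      rw [ZMod.natCast_eq_natCast_iff] at h1
      have h2 : (e : ZMod m).val * v' ≡ (e' : ZMod m).val * v' [MOD L] := by
        have h3 : g * ((e : ZMod m).val * v') ≡ g * ((e' : ZMod m).val * v') [MOD g * L] := by
          rw [← hL]
          have a1 : g * ((e : ZMod m).val * v') = (e : ZMod m).val * v := by rw [mul_left_comm, ← hv]
          have a2 : g * ((e' : ZMod m).val * v') = (e' : ZMod m).val * v := by rw [mul_left_comm, ← hv]
          rw [a1, a2]; exact h1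
        exact Nat.ModEq.mul_left_cancel' gpos.ne' h3
      exact Nat.ModEq.cancel_right_of_coprime hcop h2)
  rw [hd, Finset.card_image_of_injective] at key
  · exact key
  · intro e e' h
    exact Units.ext (ZMod.val_injective m h)

theorem ti_S (m T H V E B : ℕ) [NeZero m] (hT : DivB m T) (hX : H * V * (E * B) ≤ m ^ 20)
    (Dd : Finset ℕ) (hD : Dd ⊆ US m E) (a : ZMod m) (ha : IsUnit a) :
    (∑ x ∈ (Icc 1 H ×ˢ Icc 1 V) ×ˢ (Dd ×ˢ US m B),
      ‖KS m (lam m a (x.1.1, x.2.1) * (x.2.2 : ZMod m)⁻¹) (x.1.2 : ZMod m)‖) ^ 4 ≤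
      ((H:ℝ) * V * (#Dd * B)) ^ 3 * (((H:ℝ) * V * (E * B) / m + 1) * T ^ 5) *
        ((m:ℝ) ^ 2 * (T ^ 2 * (2 * m))) := by
  classical
  have hm : 0 < m := Nat.pos_of_ne_zero (NeZero.ne m)
  have hmR : (0:ℝ) < m := by exact_mod_cast hm
  set s := (Icc 1 H ×ˢ Icc 1 V) ×ˢ (Dd ×ˢ US m B) with hs
  set φ : ℝ := (Fintype.card (ZMod m)ˣ : ℝ) with hφ
  have φpos : 0 < φ := by rw [hφ]; exact_mod_cast Fintype.card_pos
  set L : (ℕ × ℕ) × (ℕ × ℕ) → ZMod m := fun x => lam m a (x.1.1, x.2.1) * (x.2.2 : ZMod m)⁻¹ with hL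
  have hDE : Dd ⊆ Icc 1 E := hD.trans (Finset.filter_subset _ _)
  have h1 := pb_holder ((Finset.univ : Finset (ZMod m)ˣ) ×ˢ s)
    (fun z => ((z.1 : ZMod m) * L z.2, ((z.1⁻¹ : (ZMod m)ˣ) : ZMod m) * (z.2.1.2 : ZMod m)))
    (fun l : ZMod m × ZMod m => ‖KS m l.1 l.2‖) (fun l => norm_nonneg _)
  have e1 : ∑ z ∈ (Finset.univ : Finset (ZMod m)ˣ) ×ˢ s,
      ‖KS m ((z.1 : ZMod m) * L z.2) (((z.1⁻¹ : (ZMod m)ˣ) : ZMod m) * (z.2.1.2 : ZMod m))‖ =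
      φ * ∑ x ∈ s, ‖KS m (L x) (x.1.2 : ZMod m)‖ := by
    rw [Finset.sum_product]
    simp only [KS_inv]
    rw [Finset.sum_const, nsmul_eq_mul, Finset.card_univ]
  simp only [] at h1
  rw [e1] at h1
  have hK := pd_K4 m T hT
  have hsc : (#((Finset.univ : Finset (ZMod m)ˣ) ×ˢ s) : ℝ) ≤ φ * ((H:ℝ) * V * (#Dd * B)) := by
    rw [Finset.card_product, Finset.card_univ, hs, Finset.card_product, Finset.card_product, Finset.card_product]
    push_cast
    have : (#(US m B) : ℝ) ≤ B := by exact_mod_cast card_US_le m B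
    simp only [Nat.card_Icc, Nat.add_sub_cancel]
    gcongr
  have hcount : #{x ∈ ((Finset.univ : Finset (ZMod m)ˣ) ×ˢ s) ×ˢ ((Finset.univ : Finset (ZMod m)ˣ) ×ˢ s) |
      ((x.1.1 : ZMod m) * L x.1.2, ((x.1.1⁻¹ : (ZMod m)ˣ) : ZMod m) * (x.1.2.1.2 : ZMod m)) =
      ((x.2.1 : ZMod m) * L x.2.2, ((x.2.1⁻¹ : (ZMod m)ˣ) : ZMod m) * (x.2.2.1.2 : ZMod m))} ≤
      Fintype.card (ZMod m)ˣ * ((H * V * (#Dd * B)) * ((H * V * (E * B) / m + 1) * T ^ 5)) := by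
    have hg := pe_G m T H V E B hm hT hX Dd hDE
    rw [← hs] at hg
    refine le_trans ?_ (Nat.mul_le_mul_left _ hg)
    calc _ ≤ #((Finset.univ : Finset (ZMod m)ˣ) ×ˢ ((s ×ˢ s).sigma fun x : ((ℕ × ℕ) × (ℕ × ℕ)) × ((ℕ × ℕ) × (ℕ × ℕ)) =>
          if (((x.1.1.1 * x.1.1.2) * (x.2.2.1 * x.2.2.2) : ℕ) : ZMod m) = (((x.2.1.1 * x.2.1.2) * (x.1.2.1 * x.1.2.2) : ℕ) : ZMod m)
          then ({e : (ZMod m)ˣ | (e : ZMod m) * (x.1.1.2 : ZMod m) = (x.2.1.2 : ZMod m)} : Finset (ZMod m)ˣ) else ∅)) := by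
          apply Finset.card_le_card_of_injOn
            (fun x => (x.1.1, (⟨(x.1.2, x.2.2), x.2.1 * x.1.1⁻¹⟩ : Σ _ : (((ℕ × ℕ) × (ℕ × ℕ)) × ((ℕ × ℕ) × (ℕ × ℕ))), (ZMod m)ˣ)))
          · rintro ⟨⟨c, x⟩, ⟨c', y⟩⟩ hx
            simp only [Finset.coe_filter, Finset.mem_product, Finset.mem_univ, true_and, Set.mem_ofPred_eq,
              Prod.mk.injEq] at hx
            obtain ⟨⟨hxs, hys⟩, h1, h2⟩ := hx
            have hxs' := hxs
            have hys' := hys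
            rw [hs] at hxs' hys'
            simp only [Finset.mem_product] at hxs' hys'
            simp only [Finset.coe_product, Set.mem_prod, Finset.coe_univ, Set.mem_univ, true_and, Finset.mem_coe,
              Finset.mem_sigma, Finset.mem_product]
            refine ⟨⟨hxs, hys⟩, ?_⟩
            have hrel : (((x.1.1 * x.1.2) * (y.2.1 * y.2.2) : ℕ) : ZMod m) =
                (((y.1.1 * y.1.2) * (x.2.1 * x.2.2) : ℕ) : ZMod m) := by
              have h3 : L x * (x.1.2 : ZMod m) = L y * (y.1.2 : ZMod m) := by
                have v1 : (c : ZMod m) * ((c⁻¹ : (ZMod m)ˣ) : ZMod m) = 1 := Units.mul_inv c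
                have v2 : (c' : ZMod m) * ((c'⁻¹ : (ZMod m)ˣ) : ZMod m) = 1 := Units.mul_inv c'
                have := congrArg₂ (· * ·) h1 h2
                linear_combination this - (L x * (x.1.2 : ZMod m)) * v1 + (L y * (y.1.2 : ZMod m)) * v2
              push_cast
              apply pe_cross ha (zm_unit (mem_US.1 (hD hxs'.2.1)).2.2) (zm_unit (mem_US.1 hxs'.2.2).2.2)
                (zm_unit (mem_US.1 (hD hys'.2.1)).2.2) (zm_unit (mem_US.1 hys'.2.2).2.2)
              simp only [hL, lam] at h3
              linear_combination h3
            rw [if_pos hrel]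
            simp only [Finset.mem_filter, Finset.mem_univ, true_and, Units.val_mul]
            have v2 : (c' : ZMod m) * ((c'⁻¹ : (ZMod m)ˣ) : ZMod m) = 1 := Units.mul_inv c'
            linear_combination (c' : ZMod m) * h2 + (y.1.2 : ZMod m) * v2
          · rintro ⟨⟨c, x⟩, ⟨c', y⟩⟩ _ ⟨⟨c2, x2⟩, ⟨c2', y2⟩⟩ _ hh
            simp only [Prod.mk.injEq, Sigma.mk.injEq, heq_eq_eq] at hh
            obtain ⟨h1, ⟨h2, h3⟩, h4⟩ := hh
            subst h1 h2 h3
            rw [mul_right_cancel h4]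
      _ ≤ _ := by
          rw [Finset.card_product, Finset.card_univ, Finset.card_sigma, Finset.sum_product]
          gcongr with x hx y hy
          split_ifs with h
          · exact pf_sol m _ _
          · simp
  have hcR : (#{x ∈ ((Finset.univ : Finset (ZMod m)ˣ) ×ˢ s) ×ˢ ((Finset.univ : Finset (ZMod m)ˣ) ×ˢ s) |
      ((x.1.1 : ZMod m) * L x.1.2, ((x.1.1⁻¹ : (ZMod m)ˣ) : ZMod m) * (x.1.2.1.2 : ZMod m)) =
      ((x.2.1 : ZMod m) * L x.2.2, ((x.2.1⁻¹ : (ZMod m)ˣ) : ZMod m) * (x.2.2.1.2 : ZMod m))} : ℝ) ≤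
      φ * (((H:ℝ) * V * (#Dd * B)) * (((H:ℝ) * V * (E * B) / m + 1) * T ^ 5)) := by
    have : ((H * V * (E * B) / m : ℕ) : ℝ) ≤ (H:ℝ) * V * (E * B) / m := by
      refine Nat.cast_div_le.trans (le_of_eq ?_)
      push_cast; ring
    calc _ ≤ ((Fintype.card (ZMod m)ˣ * ((H * V * (#Dd * B)) * ((H * V * (E * B) / m + 1) * T ^ 5)) : ℕ) : ℝ) := by exact_mod_cast hcount
      _ = φ * (((H:ℝ) * V * (#Dd * B)) * ((((H * V * (E * B) / m : ℕ) : ℝ) + 1) * T ^ 5)) := by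
          rw [hφ]; generalize (H * V * (E * B) / m) = N0; push_cast; ring
      _ ≤ _ := by gcongr
  have h2 : (φ * ∑ x ∈ s, ‖KS m (L x) (x.1.2 : ZMod m)‖) ^ 4 ≤
      (φ * ((H:ℝ) * V * (#Dd * B))) ^ 2 *
      (φ * (((H:ℝ) * V * (#Dd * B)) * (((H:ℝ) * V * (E * B) / m + 1) * T ^ 5))) *
      ((m : ℝ) ^ 2 * (φ * (T ^ 2 * (2 * m)))) := by
    refine h1.trans ?_
    gcongr
  have h3 : φ ^ 4 * (∑ x ∈ s, ‖KS m (L x) (x.1.2 : ZMod m)‖) ^ 4 ≤ φ ^ 4 *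
     (((H:ℝ) * V * (#Dd * B)) ^ 3 * (((H:ℝ) * V * (E * B) / m + 1) * T ^ 5) *
        ((m:ℝ) ^ 2 * (T ^ 2 * (2 * m)))) := by
    calc _ = (φ * ∑ x ∈ s, ‖KS m (L x) (x.1.2 : ZMod m)‖) ^ 4 := by ring
      _ ≤ _ := h2
      _ = _ := by ring
  exact le_of_mul_le_mul_left h3 (by positivity)

end

section

open Finset

theorem pg_ram (m : ℕ) [NeZero m] (k : ℕ) : ‖KS m (k : ZMod m) 0‖ ^ 2 ≤ (m:ℝ) * Nat.gcd k m := by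
  classical
  set φ : ℝ := (Fintype.card (ZMod m)ˣ : ℝ) with hφ
  have φpos : 0 < φ := by rw [hφ]; exact_mod_cast Fintype.card_pos
  have h1 : ∑ l : ZMod m, ‖KS m l 0‖ ^ 2 ≤ m * φ := by
    have h := pb_L2 m (Finset.univ : Finset (ZMod m)ˣ) (fun _ => (1:ℂ)) (by simp)
      (fun x => ((x⁻¹ : (ZMod m)ˣ) : ZMod m))
    have e : #{x ∈ (Finset.univ : Finset (ZMod m)ˣ) ×ˢ (Finset.univ : Finset (ZMod m)ˣ) |
        ((x.1⁻¹ : (ZMod m)ˣ) : ZMod m) = ((x.2⁻¹ : (ZMod m)ˣ) : ZMod m)} ≤ Fintype.card (ZMod m)ˣ := by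
      rw [← Finset.card_univ]
      apply Finset.card_le_card_of_injOn (fun x => x.1) (by simp)
      rintro ⟨x, y⟩ hx ⟨x', y'⟩ hx' h
      simp only [Finset.coe_filter, Finset.mem_product, Finset.mem_univ, true_and, Set.mem_ofPred_eq] at hx hx'
      have h1 := inv_injective (Units.ext hx)
      have h2 := inv_injective (Units.ext hx')
      simp only at h
      rw [← h1, ← h2, h]
    have e' : (#{x ∈ (Finset.univ : Finset (ZMod m)ˣ) ×ˢ (Finset.univ : Finset (ZMod m)ˣ) |
        ((x.1⁻¹ : (ZMod m)ˣ) : ZMod m) = ((x.2⁻¹ : (ZMod m)ˣ) : ZMod m)} : ℝ) ≤ φ := by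
      rw [hφ]; exact_mod_cast e
    calc _ = ∑ l : ZMod m, ‖∑ x : (ZMod m)ˣ, (1:ℂ) * ZMod.stdAddChar (l * ((x⁻¹ : (ZMod m)ˣ) : ZMod m))‖ ^ 2 := by
          simp only [KS, zero_mul, add_zero, one_mul]
      _ ≤ _ := h
      _ ≤ _ := by gcongr
  have h2 : φ * ‖KS m (k : ZMod m) 0‖ ^ 2 = ∑ c : (ZMod m)ˣ, ‖KS m ((c : ZMod m) * k) 0‖ ^ 2 := by
    have : ∀ c : (ZMod m)ˣ, KS m ((c : ZMod m) * k) 0 = KS m k 0 := by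
      intro c
      have := KS_inv m (k : ZMod m) 0 c
      rwa [mul_zero] at this
    simp only [this, Finset.sum_const, nsmul_eq_mul, Finset.card_univ, hφ]
  have h3 : ∑ c : (ZMod m)ˣ, ‖KS m ((c : ZMod m) * k) 0‖ ^ 2 ≤ Nat.gcd k m * (m * φ) := by
    calc _ = ∑ l : ZMod m, ∑ c ∈ (Finset.univ.filter fun c : (ZMod m)ˣ => (c : ZMod m) * k = l), ‖KS m ((c : ZMod m) * k) 0‖ ^ 2 := by
          rw [Finset.sum_fiberwise]
      _ = ∑ l : ZMod m, (#(Finset.univ.filter fun c : (ZMod m)ˣ => (c : ZMod m) * k = l) : ℝ) * ‖KS m l 0‖ ^ 2 := by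
          apply Finset.sum_congr rfl
          intro l _
          rw [← nsmul_eq_mul, ← Finset.sum_const]
          apply Finset.sum_congr rfl
          intro c hc
          rw [(Finset.mem_filter.1 hc).2]
      _ ≤ ∑ l : ZMod m, (Nat.gcd k m : ℝ) * ‖KS m l 0‖ ^ 2 := by
          gcongr with l _
          exact pf_sol m k l
      _ = (Nat.gcd k m : ℝ) * ∑ l : ZMod m, ‖KS m l 0‖ ^ 2 := by rw [Finset.mul_sum]
      _ ≤ _ := by gcongr
  rw [← h2] at h3
  have : φ * ‖KS m (k : ZMod m) 0‖ ^ 2 ≤ φ * ((m:ℝ) * Nat.gcd k m) := by linarith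
  exact le_of_mul_le_mul_left this φpos

theorem pg_ram' (m : ℕ) [NeZero m] (k : ℕ) : ‖KS m (k : ZMod m) 0‖ ≤ √(m:ℝ) * Nat.gcd k m := by
  have h := pg_ram m k
  have hm : 0 < m := Nat.pos_of_ne_zero (NeZero.ne m)
  have g1 : (1:ℝ) ≤ Nat.gcd k m := by exact_mod_cast Nat.gcd_pos_of_pos_right _ hm
  apply le_of_sq_le_sq _ (by positivity)
  rw [mul_pow, Real.sq_sqrt (by positivity)]
  nlinarith [mul_le_mul_of_nonneg_left g1 (by positivity : (0:ℝ) ≤ m * Nat.gcd k m)]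

theorem pg_dyadic (m : ℕ) (U C : ℝ) (hU : 1 ≤ U) (hUm : U ≤ m) (hC : 0 ≤ C) (g : ℕ → ℝ) (hg : ∀ v, 0 ≤ g v)
    (h : ∀ V : ℕ, V ≤ m → (m:ℝ) / U ≤ V → ∑ v ∈ Icc 1 V, g v ≤ V * C) :
    ∑ v ∈ Icc 1 (m / 2), min (U / m) (1 / (2 * (v:ℝ))) * g v ≤ (Nat.log 2 m + 1) * (2 * C) := by
  have hmR : (0:ℝ) < m := by linarith
  have hm : 0 < m := by exact_mod_cast hmR
  rw [← Finset.sum_fiberwise_of_maps_to (t := Finset.range (Nat.log 2 m + 1)) (g := fun v => Nat.log 2 v)]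
  · calc _ ≤ ∑ j ∈ Finset.range (Nat.log 2 m + 1), 2 * C := by
          apply Finset.sum_le_sum
          intro j _
          by_cases hj : 2 ^ (j+1) ≤ m
          swap
          · rw [Finset.sum_eq_zero]
            · positivity
            · intro v hv
              exfalso
              simp only [Finset.mem_filter, Finset.mem_Icc] at hv
              have : 2 ^ j ≤ v := by rw [← hv.2]; exact Nat.pow_log_le_self 2 (by omega)
              rw [pow_succ] at hj
              omega
          have hsub : ∀ V, 2 ^ (j+1) ≤ V → ({v ∈ Icc 1 (m/2) | Nat.log 2 v = j} : Finset ℕ) ⊆ Icc 1 V := by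
            intro V hV v hv
            simp only [Finset.mem_filter, Finset.mem_Icc] at hv ⊢
            refine ⟨hv.1.1, ?_⟩
            have := Nat.lt_pow_succ_log_self (b := 2) (by norm_num) v
            rw [hv.2] at this
            omega
          by_cases hc : (m:ℝ) / U ≤ (2 ^ (j+1) : ℕ)
          · calc _ ≤ ∑ v ∈ Icc 1 (m/2) with Nat.log 2 v = j, (1 / (2:ℝ) ^ (j+1)) * g v := by
                  apply Finset.sum_le_sum
                  intro v hv
                  apply mul_le_mul_of_nonneg_right _ (hg v)
                  refine (min_le_right _ _).trans ?_
                  simp only [Finset.mem_filter, Finset.mem_Icc] at hv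
                  have : 2 ^ j ≤ v := by rw [← hv.2]; exact Nat.pow_log_le_self 2 (by omega)
                  have : (2:ℝ) ^ j ≤ v := by exact_mod_cast this
                  apply one_div_le_one_div_of_le (by positivity)
                  rw [pow_succ]; linarith
              _ = (1 / (2:ℝ) ^ (j+1)) * ∑ v ∈ Icc 1 (m/2) with Nat.log 2 v = j, g v := by rw [Finset.mul_sum]
              _ ≤ (1 / (2:ℝ) ^ (j+1)) * ∑ v ∈ Icc 1 (2 ^ (j+1)), g v := by
                  gcongr
                  · exact fun i _ _ => hg i
                  · exact hsub _ le_rfl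
              _ ≤ (1 / (2:ℝ) ^ (j+1)) * ((2 ^ (j+1) : ℕ) * C) := by
                  gcongr
                  exact h _ hj hc
              _ = C := by push_cast; field_simp
              _ ≤ 2 * C := by linarith
          · push Not at hc
            have hV1 : ⌈(m:ℝ) / U⌉₊ ≤ m := by
              rw [Nat.ceil_le]
              exact div_le_self hmR.le hU
            have hV2 : 2 ^ (j+1) ≤ ⌈(m:ℝ) / U⌉₊ := by
              exact_mod_cast hc.le.trans (Nat.le_ceil _)
            calc _ ≤ ∑ v ∈ Icc 1 (m/2) with Nat.log 2 v = j, (U / m) * g v := by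
                  apply Finset.sum_le_sum
                  intro v hv
                  exact mul_le_mul_of_nonneg_right (min_le_left _ _) (hg v)
              _ = (U / m) * ∑ v ∈ Icc 1 (m/2) with Nat.log 2 v = j, g v := by rw [Finset.mul_sum]
              _ ≤ (U / m) * ∑ v ∈ Icc 1 ⌈(m:ℝ) / U⌉₊, g v := by
                  gcongr
                  · exact fun i _ _ => hg i
                  · exact hsub _ hV2
              _ ≤ (U / m) * (⌈(m:ℝ) / U⌉₊ * C) := by
                  gcongr
                  exact h _ hV1 (Nat.le_ceil _)
              _ ≤ (U / m) * ((m / U + 1) * C) := by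
                  gcongr
                  exact (Nat.ceil_lt_add_one (by positivity)).le
              _ = (1 + U / m) * C := by field_simp
              _ ≤ 2 * C := by
                  have : U / m ≤ 1 := (div_le_one hmR).2 hUm
                  gcongr
                  linarith
      _ = _ := by
          rw [Finset.sum_const, nsmul_eq_mul, Finset.card_range]; push_cast; ring
  · intro v hv
    simp only [Finset.mem_Icc] at hv
    rw [Finset.mem_range]
    have := Nat.log_mono_right (b := 2) (show v ≤ m by omega)
    omega

theorem pg_cw (m : ℕ) [NeZero m] (U : ℝ) (v : ℕ) (hv : v ∈ Icc 1 (m/2)) :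
    cw m U (v : ZMod m) ≤ min (U / m) (1 / (2 * (v:ℝ))) ∧ cw m U (-(v : ZMod m)) ≤ min (U / m) (1 / (2 * (v:ℝ))) := by
  rw [Finset.mem_Icc] at hv
  have hm : 0 < m := Nat.pos_of_ne_zero (NeZero.ne m)
  have hne : (v : ZMod m) ≠ 0 := by
    intro h
    rw [ZMod.natCast_eq_zero_iff] at h
    have := Nat.le_of_dvd (by omega) h
    omega
  have h4 : ((v : ZMod m)).valMinAbs.natAbs = v := by
    rw [ZMod.valMinAbs_natCast_of_le_half hv.2]; simp
  constructor
  · unfold cw; rw [if_neg hne, h4]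
  · unfold cw; rw [if_neg (neg_ne_zero.2 hne), ZMod.natAbs_valMinAbs_neg, h4]

theorem ti_core (m T H E B : ℕ) [NeZero m] (hT : DivB m T) (hX : H * m * (E * B) ≤ m ^ 20)
    (Dd : Finset ℕ) (hD : Dd ⊆ US m E) (a : ZMod m) (ha : IsUnit a) (U C : ℝ) (hU : 1 ≤ U) (hUm : U ≤ m)
    (hC : 0 ≤ C)
    (hC4 : ((H:ℝ) * #Dd * B) ^ 3 * T ^ 7 * (2 * m ^ 3) * ((H:ℝ) * E * B / m + U / m) ≤ C ^ 4) :
    ∑ i ∈ Icc 1 H ×ˢ Dd, ∑ b ∈ US m B, ZZ m U (lam m a i * (b : ZMod m)⁻¹) ≤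
      U / m * (√m * (#Dd * B * (H * T))) + (Nat.log 2 m + 1) * (4 * C) := by
  have hm : 0 < m := Nat.pos_of_ne_zero (NeZero.ne m)
  have hmR : (0:ℝ) < m := by exact_mod_cast hm
  -- nonzero frequencies
  have hpart : ∀ a : ZMod m, IsUnit a → ∑ v ∈ Icc 1 (m / 2), min (U / m) (1 / (2 * (v:ℝ))) *
      (∑ i ∈ Icc 1 H ×ˢ Dd, ∑ b ∈ US m B, ‖KS m (lam m a i * (b : ZMod m)⁻¹) (v : ZMod m)‖) ≤
      (Nat.log 2 m + 1) * (2 * C) := by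
    intro a ha
    apply pg_dyadic m U C hU hUm hC
    · intro v; positivity
    · intro V hVm hV
      have hVpos : (0:ℝ) < V := lt_of_lt_of_le (by positivity) hV
      have h := ti_S m T H V E B hT (le_trans (by gcongr) hX) Dd hD a ha
      have e : ∑ v ∈ Icc 1 V, ∑ i ∈ Icc 1 H ×ˢ Dd, ∑ b ∈ US m B, ‖KS m (lam m a i * (b : ZMod m)⁻¹) (v : ZMod m)‖ =
          ∑ x ∈ (Icc 1 H ×ˢ Icc 1 V) ×ˢ (Dd ×ˢ US m B),
            ‖KS m (lam m a (x.1.1, x.2.1) * (x.2.2 : ZMod m)⁻¹) (x.1.2 : ZMod m)‖ := by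
        simp only [Finset.sum_product]
        rw [Finset.sum_comm]
      rw [e]
      refine le_of_pow_le_pow_left₀ (n := 4) (by norm_num) (by positivity) (h.trans ?_)
      have hk : (H:ℝ) * V * (E * B) / m + 1 ≤ V * ((H:ℝ) * E * B / m + U / m) := by
        have : 1 ≤ V * (U / m) := by
          rw [div_le_iff₀ (by linarith)] at hV
          rw [← mul_div_assoc, le_div_iff₀ hmR]; linarith
        calc _ ≤ (H:ℝ) * V * (E * B) / m + V * (U / m) := by linarith
          _ = _ := by ring
      calc _ ≤ ((H:ℝ) * V * (#Dd * B)) ^ 3 * ((V * ((H:ℝ) * E * B / m + U / m)) * T ^ 5) *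
            ((m:ℝ) ^ 2 * (T ^ 2 * (2 * m))) := by gcongr
        _ = (V:ℝ) ^ 4 * (((H:ℝ) * #Dd * B) ^ 3 * T ^ 7 * (2 * m ^ 3) * ((H:ℝ) * E * B / m + U / m)) := by ring
        _ ≤ (V:ℝ) ^ 4 * C ^ 4 := by gcongr
        _ = _ := by ring
  have h0 : ∑ i ∈ Icc 1 H ×ˢ Dd, ∑ b ∈ US m B, ‖KS m (lam m a i * (b : ZMod m)⁻¹) 0‖ ≤
      √m * (#Dd * B * (H * T)) := by
    calc _ ≤ ∑ i ∈ Icc 1 H ×ˢ Dd, ∑ b ∈ US m B, √m * (Nat.gcd i.1 m : ℝ) := by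
          gcongr with i hi b hb
          refine le_trans (le_of_eq ?_) (pg_ram' m i.1)
          rw [Finset.mem_product] at hi
          have u1 := ZMod.unitOfCoprime i.2 (mem_US.1 (hD hi.2)).2.2
          have hu : IsUnit (a * (i.2 : ZMod m)⁻¹ * (b : ZMod m)⁻¹) := by
            refine (ha.mul ?_).mul ?_
            · exact IsUnit.of_mul_eq_one (i.2 : ZMod m) (by rw [mul_comm]; exact zm_unit (mem_US.1 (hD hi.2)).2.2)
            · exact IsUnit.of_mul_eq_one (b : ZMod m) (by rw [mul_comm]; exact zm_unit (mem_US.1 hb).2.2)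
          obtain ⟨c, hc⟩ := hu
          have := KS_inv m (i.1 : ZMod m) 0 c
          rw [mul_zero] at this
          rw [← this, hc]
          unfold lam
          congr 2
          ring
      _ = √m * (#Dd * #(US m B) * ∑ k ∈ Icc 1 H, (Nat.gcd k m : ℝ)) := by
          simp only [Finset.sum_product, Finset.sum_const, nsmul_eq_mul, ← Finset.mul_sum]
          ring
      _ ≤ _ := by
          have h1 : (#(US m B) : ℝ) ≤ B := by exact_mod_cast card_US_le m B
          have h2 : ∑ k ∈ Icc 1 H, (Nat.gcd k m : ℝ) ≤ H * T := by
            have := pe_gcdsum m H T hm hT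
            rw [mul_comm]
            exact_mod_cast this
          gcongr
  have hZ : ∀ l : ZMod m, ZZ m U l ≤ U / m * ‖KS m l 0‖ + ∑ v ∈ Icc 1 (m/2),
      min (U / m) (1 / (2 * (v:ℝ))) * (‖KS m l (v : ZMod m)‖ + ‖KS m (-l) (v : ZMod m)‖) := by
    intro l
    unfold ZZ
    rw [← Finset.add_sum_erase _ _ (Finset.mem_univ (0 : ZMod m))]
    refine add_le_add (le_of_eq ?_) ?_
    · simp [cw]
    · refine (pb_sum_zmod m (fun j => cw m U j * ‖KS m l j‖) (fun j => mul_nonneg (cw_nonneg _ _ (by linarith) _) (norm_nonneg _))).trans ?_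
      apply Finset.sum_le_sum
      intro v hv
      have := pg_cw m U v hv
      have e : ‖KS m l (-(v : ZMod m))‖ = ‖KS m (-l) (v : ZMod m)‖ := by
        rw [← KS_neg m (-l), neg_neg]
      rw [e, mul_add]
      gcongr
      · exact this.1
      · exact this.2
  calc _ ≤ ∑ i ∈ Icc 1 H ×ˢ Dd, ∑ b ∈ US m B, (U / m * ‖KS m (lam m a i * (b : ZMod m)⁻¹) 0‖ + ∑ v ∈ Icc 1 (m/2),
      min (U / m) (1 / (2 * (v:ℝ))) * (‖KS m (lam m a i * (b : ZMod m)⁻¹) (v : ZMod m)‖ + ‖KS m (lam m (-a) i * (b : ZMod m)⁻¹) (v : ZMod m)‖)) := by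
        gcongr with i hi b hb
        refine (hZ _).trans (le_of_eq ?_)
        have : -(lam m a i * (b : ZMod m)⁻¹) = lam m (-a) i * (b : ZMod m)⁻¹ := by unfold lam; ring
        rw [this]
    _ = U / m * ∑ i ∈ Icc 1 H ×ˢ Dd, ∑ b ∈ US m B, ‖KS m (lam m a i * (b : ZMod m)⁻¹) 0‖ +
        (∑ v ∈ Icc 1 (m / 2), min (U / m) (1 / (2 * (v:ℝ))) *
      (∑ i ∈ Icc 1 H ×ˢ Dd, ∑ b ∈ US m B, ‖KS m (lam m a i * (b : ZMod m)⁻¹) (v : ZMod m)‖) +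
      ∑ v ∈ Icc 1 (m / 2), min (U / m) (1 / (2 * (v:ℝ))) *
      (∑ i ∈ Icc 1 H ×ˢ Dd, ∑ b ∈ US m B, ‖KS m (lam m (-a) i * (b : ZMod m)⁻¹) (v : ZMod m)‖)) := by
        simp only [Finset.sum_add_distrib, ← Finset.mul_sum, mul_add]
        have comm : ∀ f : ℕ × ℕ → ℕ → ℕ → ℝ, ∑ i ∈ Icc 1 H ×ˢ Dd, ∑ b ∈ US m B, ∑ v ∈ Icc 1 (m/2), f i b v =
            ∑ v ∈ Icc 1 (m/2), ∑ i ∈ Icc 1 H ×ˢ Dd, ∑ b ∈ US m B, f i b v := by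
          intro f
          rw [Finset.sum_congr rfl (fun i _ => Finset.sum_comm), Finset.sum_comm]
        rw [comm, comm]
        simp only [← Finset.mul_sum]
    _ ≤ U / m * (√m * (#Dd * B * (H * T))) + ((Nat.log 2 m + 1) * (2 * C) + (Nat.log 2 m + 1) * (2 * C)) := by
        gcongr
        · exact hpart a ha
        · exact hpart (-a) ha.neg
    _ = _ := by ring

end

section

open Finset

/-- arithmetic of the collision equation -/
theorem th_arith {k d' q1 q2 A c3 c4 g : ℕ} (hg : 0 < g) (hc : Nat.Coprime c3 c4)
    (h : (k:ℤ) * d' * ((q2:ℤ) - q1) * ((g * c3 : ℕ) * (g * c4 : ℕ)) = A * (((g * c4 : ℕ):ℤ) - (g * c3 : ℕ))) :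
    (k:ℤ) * d' * ((q2:ℤ) - q1) * g * c3 * c4 = A * ((c4:ℤ) - c3) ∧ c3 ∣ A ∧ c4 ∣ A := by
  have h1 : (k:ℤ) * d' * ((q2:ℤ) - q1) * g * c3 * c4 = A * ((c4:ℤ) - c3) := by
    have hg' : (g:ℤ) ≠ 0 := by exact_mod_cast hg.ne'
    apply mul_left_cancel₀ hg'
    push_cast at h
    linear_combination h
  have hc' : IsCoprime (c3:ℤ) (c4:ℤ) := Nat.isCoprime_iff_coprime.2 hc
  refine ⟨h1, ?_, ?_⟩
  · have : (c3:ℤ) ∣ A * ((c4:ℤ) - c3) := by rw [← h1]; exact ⟨k * d' * ((q2:ℤ) - q1) * g * c4, by ring⟩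
    have h2 : IsCoprime (c3:ℤ) ((c4:ℤ) - c3) := by
      have := hc'.add_mul_left_right (-1)
      rwa [mul_neg_one, ← sub_eq_add_neg] at this
    exact_mod_cast h2.dvd_of_dvd_mul_right this
  · have : (c4:ℤ) ∣ A * ((c4:ℤ) - c3) := by rw [← h1]; exact ⟨k * d' * ((q2:ℤ) - q1) * g * c3, by ring⟩
    have h2 : IsCoprime (c4:ℤ) ((c4:ℤ) - c3) := by
      have := (hc'.symm.neg_right).add_mul_left_right 1
      rwa [mul_one, neg_add_eq_sub] at this
    exact_mod_cast h2.dvd_of_dvd_mul_right this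

theorem th_cnt (m T H E Q : ℕ) (hT : DivB m T) (hX : H * E * Q ^ 3 ≤ m ^ 20)
    (Dd : Finset ℕ) (hD : Dd ⊆ Icc 1 E) :
    #{x ∈ ((Icc 1 H ×ˢ Dd) ×ˢ (US m Q ×ˢ US m Q)) ×ˢ ((Icc 1 H ×ˢ Dd) ×ˢ (US m Q ×ˢ US m Q)) |
      x.2.2.1 ≠ x.2.2.2 ∧
      (x.1.1.1:ℤ) * x.2.1.2 * ((x.1.2.2:ℤ) - x.1.2.1) * (x.2.2.1 * x.2.2.2) =
      ((x.2.1.1 * x.1.1.2 * x.1.2.1 * x.1.2.2 : ℕ) : ℤ) * ((x.2.2.2:ℤ) - x.2.2.1)} ≤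
      T ^ 5 * (H * #Dd * (Q * Q)) := by
  set s := {x ∈ ((Icc 1 H ×ˢ Dd) ×ˢ (US m Q ×ˢ US m Q)) ×ˢ ((Icc 1 H ×ˢ Dd) ×ˢ (US m Q ×ˢ US m Q)) |
      x.2.2.1 ≠ x.2.2.2 ∧
      (x.1.1.1:ℤ) * x.2.1.2 * ((x.1.2.2:ℤ) - x.1.2.1) * (x.2.2.1 * x.2.2.2) =
      ((x.2.1.1 * x.1.1.2 * x.1.2.1 * x.1.2.2 : ℕ) : ℤ) * ((x.2.2.2:ℤ) - x.2.2.1)} with hs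
  have hmem : ∀ k d q1 q2 k' d' q3 q4 : ℕ, (((k,d),(q1,q2)),((k',d'),(q3,q4))) ∈ s →
      k ∈ Icc 1 H ∧ d ∈ Dd ∧ q1 ∈ US m Q ∧ q2 ∈ US m Q ∧ k' ∈ Icc 1 H ∧ d' ∈ Dd ∧ q3 ∈ US m Q ∧ q4 ∈ US m Q ∧
      q3 ≠ q4 ∧ (k:ℤ) * d' * ((q2:ℤ) - q1) * (q3 * q4) = ((k' * d * q1 * q2 : ℕ) : ℤ) * ((q4:ℤ) - q3) := by
    intro k d q1 q2 k' d' q3 q4 h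
    rw [hs, Finset.mem_filter] at h
    simp only [Finset.mem_product] at h
    tauto
  have hcard : #((Icc 1 H ×ˢ Dd) ×ˢ (US m Q ×ˢ US m Q)) ≤ H * #Dd * (Q * Q) := by
    simp only [Finset.card_product, Nat.card_Icc, Nat.add_sub_cancel]
    have := card_US_le m Q
    gcongr
  refine le_trans (Finset.card_le_mul_card_image_of_maps_to
    (f := fun x => (((x.2.1.1, x.1.1.2), (x.1.2.1, x.1.2.2)) : (ℕ × ℕ) × (ℕ × ℕ)))
    (t := (Icc 1 H ×ˢ Dd) ×ˢ (US m Q ×ˢ US m Q)) ?_ (T ^ 5) ?_) (Nat.mul_le_mul_left _ hcard)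
  · rintro ⟨⟨⟨k, d⟩, q1, q2⟩, ⟨k', d'⟩, q3, q4⟩ hx
    have := hmem _ _ _ _ _ _ _ _ hx
    simp only [Finset.mem_product]
    tauto
  · rintro ⟨⟨k', d⟩, q1, q2⟩ hb
    simp only [Finset.mem_product] at hb
    obtain ⟨⟨hk', hd⟩, hq1, hq2⟩ := hb
    have hd := Finset.mem_Icc.1 (hD hd)
    rw [mem_US] at hq1 hq2
    rw [Finset.mem_Icc] at hk'
    set A := k' * d * q1 * q2 with hA
    have hA0 : 0 < A := by have := hk'.1; have := hd.1; have := hq1.1; have := hq2.1; positivity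
    have hAle : A * Q ≤ m ^ 20 := by
      refine le_trans ?_ hX
      calc A * Q = k' * d * (q1 * q2 * Q) := by rw [hA]; ring
        _ ≤ H * E * (Q * Q * Q) := by gcongr <;> tauto
        _ = _ := by ring
    have hQ1 : 1 ≤ Q := hq1.1.trans hq1.2.1
    have hAm : A ≤ m ^ 20 := le_trans (Nat.le_mul_of_pos_right _ hQ1) hAle
    refine le_trans (Finset.card_le_mul_card_image_of_maps_to
      (f := fun x => ((x.2.2.1 / Nat.gcd x.2.2.1 x.2.2.2, x.2.2.2 / Nat.gcd x.2.2.1 x.2.2.2) : ℕ × ℕ))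
      (t := A.divisors ×ˢ A.divisors) ?_ (T ^ 3) ?_) ?_
    · rintro ⟨⟨⟨k, d0⟩, q10, q20⟩, ⟨k0', d'⟩, q3, q4⟩ hx
      rw [Finset.mem_filter] at hx
      obtain ⟨hx, he⟩ := hx
      simp only [Prod.mk.injEq] at he
      obtain ⟨⟨rfl, rfl⟩, rfl, rfl⟩ := he
      obtain ⟨h1, h2, h3, h4, h5, h6, h7, h8, h9, h10⟩ := hmem _ _ _ _ _ _ _ _ hx
      rw [mem_US] at h7 h8
      have hg : 0 < Nat.gcd q3 q4 := Nat.gcd_pos_of_pos_left _ h7.1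
      have e3 : q3 = Nat.gcd q3 q4 * (q3 / Nat.gcd q3 q4) := (Nat.mul_div_cancel' (Nat.gcd_dvd_left _ _)).symm
      have e4 : q4 = Nat.gcd q3 q4 * (q4 / Nat.gcd q3 q4) := (Nat.mul_div_cancel' (Nat.gcd_dvd_right _ _)).symm
      have hc := Nat.coprime_div_gcd_div_gcd hg
      rw [← hA] at h10
      have := th_arith (k := k) (d' := d') (q1 := q10) (q2 := q20) (A := A) hg hc (by rw [← e3, ← e4]; exact h10)
      simp only [Finset.mem_product, Nat.mem_divisors]
      exact ⟨⟨this.2.1, hA0.ne'⟩, this.2.2, hA0.ne'⟩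
    · rintro ⟨c3, c4⟩ hc
      set N := ((A:ℤ) * ((c4:ℤ) - c3)).natAbs with hN
      by_cases hne : (Finset.filter (fun x => ((x.2.2.1 / Nat.gcd x.2.2.1 x.2.2.2, x.2.2.2 / Nat.gcd x.2.2.1 x.2.2.2) : ℕ × ℕ) = (c3, c4)) (Finset.filter (fun x => (((x.2.1.1, x.1.1.2), (x.1.2.1, x.1.2.2)) : (ℕ × ℕ) × (ℕ × ℕ)) = ((k', d), (q1, q2))) s)) = ∅
      · rw [hne]; simp
      have key : ∀ k d0 q10 q20 k0' d' q3 q4 : ℕ, (((k,d0),(q10,q20)),((k0',d'),(q3,q4))) ∈ (Finset.filter (fun x => ((x.2.2.1 / Nat.gcd x.2.2.1 x.2.2.2, x.2.2.2 / Nat.gcd x.2.2.1 x.2.2.2) : ℕ × ℕ) = (c3, c4)) (Finset.filter (fun x => (((x.2.1.1, x.1.1.2), (x.1.2.1, x.1.2.2)) : (ℕ × ℕ) × (ℕ × ℕ)) = ((k', d), (q1, q2))) s)) →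
          k0' = k' ∧ d0 = d ∧ q10 = q1 ∧ q20 = q2 ∧ q3 = Nat.gcd q3 q4 * c3 ∧ q4 = Nat.gcd q3 q4 * c4 ∧
          Nat.gcd q3 q4 ∈ N.divisors ∧ k ∈ N.divisors ∧ d' ∈ N.divisors ∧ N ≤ m ^ 20 ∧ 0 < N := by
        intro k d0 q10 q20 k0' d' q3 q4 hx
        rw [Finset.mem_filter, Finset.mem_filter] at hx
        obtain ⟨⟨hx, he⟩, he2⟩ := hx
        simp only [Prod.mk.injEq] at he he2
        obtain ⟨⟨rfl, rfl⟩, rfl, rfl⟩ := he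
        obtain ⟨rfl, rfl⟩ := he2
        obtain ⟨h1, h2, h3, h4, h5, h6, h7, h8, h9, h10⟩ := hmem _ _ _ _ _ _ _ _ hx
        rw [mem_US] at h7 h8
        have hg : 0 < Nat.gcd q3 q4 := Nat.gcd_pos_of_pos_left _ h7.1
        have e3 : q3 = Nat.gcd q3 q4 * (q3 / Nat.gcd q3 q4) := (Nat.mul_div_cancel' (Nat.gcd_dvd_left _ _)).symm
        have e4 : q4 = Nat.gcd q3 q4 * (q4 / Nat.gcd q3 q4) := (Nat.mul_div_cancel' (Nat.gcd_dvd_right _ _)).symm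
        have hcc := Nat.coprime_div_gcd_div_gcd hg
        rw [← hA] at h10
        have := (th_arith (k := k) (d' := d') (q1 := q10) (q2 := q20) (A := A) hg hcc (by rw [← e3, ← e4]; exact h10)).1
        have l3 : q3 / Nat.gcd q3 q4 ≤ Q := (Nat.div_le_self _ _).trans h7.2.1
        have l4 : q4 / Nat.gcd q3 q4 ≤ Q := (Nat.div_le_self _ _).trans h8.2.1
        have hne' : q3 / Nat.gcd q3 q4 ≠ q4 / Nat.gcd q3 q4 := by
          intro h; apply h9; rw [e3, h]; exact e4.symm
        set g := Nat.gcd q3 q4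
        set c3 := q3 / g
        set c4 := q4 / g
        have hNz : (A:ℤ) * ((c4:ℤ) - c3) ≠ 0 := by
          apply mul_ne_zero
          · exact_mod_cast hA0.ne'
          · intro h; apply hne'; omega
        have hN0 : N ≠ 0 := by rw [hN]; exact Int.natAbs_ne_zero.2 hNz
        refine ⟨rfl, rfl, rfl, rfl, e3, e4, ?_, ?_, ?_, ?_, Nat.pos_of_ne_zero hN0⟩
        · rw [Nat.mem_divisors]; refine ⟨?_, hN0⟩
          rw [hN, ← Int.natCast_dvd, ← this]
          exact ⟨k * d' * ((q20:ℤ) - q10) * c3 * c4, by ring⟩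
        · rw [Nat.mem_divisors]; refine ⟨?_, hN0⟩
          rw [hN, ← Int.natCast_dvd, ← this]
          exact ⟨d' * ((q20:ℤ) - q10) * g * c3 * c4, by ring⟩
        · rw [Nat.mem_divisors]; refine ⟨?_, hN0⟩
          rw [hN, ← Int.natCast_dvd, ← this]
          exact ⟨k * ((q20:ℤ) - q10) * g * c3 * c4, by ring⟩
        · refine le_trans ?_ hAle
          rw [hN, Int.natAbs_mul, Int.natAbs_natCast]
          apply Nat.mul_le_mul_left
          have aux : ∀ c3 c4 Q : ℕ, c3 ≤ Q → c4 ≤ Q → ((c4:ℤ) - c3).natAbs ≤ Q := by intros; omega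
          exact aux _ _ _ l3 l4
      obtain ⟨⟨⟨⟨k, d0⟩, q10, q20⟩, ⟨k0', d'⟩, q3, q4⟩, hx0⟩ := Finset.nonempty_iff_ne_empty.2 hne
      obtain ⟨-, -, -, -, -, -, -, -, -, hNm, hNp⟩ := key _ _ _ _ _ _ _ _ hx0
      have hNT := hT N hNp hNm
      calc _ ≤ #(N.divisors ×ˢ (N.divisors ×ˢ N.divisors)) := by
            apply Finset.card_le_card_of_injOn (fun x => (Nat.gcd x.2.2.1 x.2.2.2, x.1.1.1, x.2.1.2))
            · rintro ⟨⟨⟨k, d0⟩, q10, q20⟩, ⟨k0', d'⟩, q3, q4⟩ hx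
              have := key _ _ _ _ _ _ _ _ hx
              simp only [Finset.coe_product, Set.mem_prod, Finset.mem_coe]
              tauto
            · rintro ⟨⟨⟨k, d0⟩, q10, q20⟩, ⟨k0', d'⟩, q3, q4⟩ hx ⟨⟨⟨k2, d02⟩, q12, q22⟩, ⟨k2', d2'⟩, q32, q42⟩ hx2 hh
              have h1 := key _ _ _ _ _ _ _ _ hx
              have h2 := key _ _ _ _ _ _ _ _ hx2
              simp only [Prod.mk.injEq] at hh
              obtain ⟨a1, a2, a3, a4, a5, a6, -⟩ := h1
              obtain ⟨b1, b2, b3, b4, b5, b6, -⟩ := h2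
              obtain ⟨hg, hk, hdd⟩ := hh
              rw [hg] at a5 a6
              rw [← b5] at a5
              rw [← b6] at a6
              rw [a1, a2, a3, a4, b1, b2, b3, b4, hk, hdd, a5, a6]
        _ ≤ T * (T * T) := by
            rw [Finset.card_product, Finset.card_product]
            gcongr
        _ = T ^ 3 := by ring
    · rw [Finset.card_product]
      have := hT A hA0 hAm
      calc _ ≤ T ^ 3 * (T * T) := by gcongr
        _ = _ := by ring

end

section

open Finset

theorem th_sq (m : ℕ) [NeZero m] {I J : Type*} (A : Finset I) (B : Finset J) (f : J → ℂ) (hf : ∀ q, ‖f q‖ ≤ 1)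
    (l : ZMod m) (u : I → ZMod m) (v : J → ZMod m) :
    ∑ r ∈ A, ‖∑ q ∈ B, f q * ZMod.stdAddChar (l * u r * v q)‖ ^ 2 ≤
      ∑ x ∈ B ×ˢ B, ‖∑ r ∈ A, (1:ℂ) * ZMod.stdAddChar (l * (v x.1 - v x.2) * u r)‖ := by
  have h1 : ((∑ r ∈ A, ‖∑ q ∈ B, f q * ZMod.stdAddChar (l * u r * v q)‖ ^ 2 : ℝ) : ℂ) =
      ∑ x ∈ B ×ˢ B, f x.1 * (starRingEnd ℂ) (f x.2) * ∑ r ∈ A, (1:ℂ) * ZMod.stdAddChar (l * (v x.1 - v x.2) * u r) := by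
    push_cast
    simp only [Finset.mul_sum]
    rw [Finset.sum_comm]
    apply Finset.sum_congr rfl
    intro r _
    rw [← Complex.mul_conj', map_sum, Finset.sum_mul_sum, ← Finset.sum_product']
    apply Finset.sum_congr rfl
    intro x _
    rw [map_mul (starRingEnd ℂ), pb_conj, one_mul, mul_mul_mul_comm, ← AddChar.map_add_eq_mul]
    congr 2
    ring
  have h2 := congrArg norm h1
  rw [Complex.norm_real, Real.norm_of_nonneg (by positivity)] at h2
  rw [h2]
  refine (norm_sum_le _ _).trans ?_
  apply Finset.sum_le_sum
  intro x _
  rw [norm_mul, norm_mul, RCLike.norm_conj]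
  have := mul_le_one₀ (hf x.1) (norm_nonneg _) (hf x.2)
  exact mul_le_of_le_one_left (norm_nonneg _) this

theorem th_eqZ {m : ℕ} {a k d k' d' q1 q2 q3 q4 : ZMod m} (ha : IsUnit a)
    (hd : d * d⁻¹ = 1) (hd' : d' * d'⁻¹ = 1) (h1 : q1 * q1⁻¹ = 1) (h2 : q2 * q2⁻¹ = 1) (h3 : q3 * q3⁻¹ = 1)
    (h4 : q4 * q4⁻¹ = 1) (h : k * a * d⁻¹ * (q1⁻¹ - q2⁻¹) = k' * a * d'⁻¹ * (q3⁻¹ - q4⁻¹)) :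
    k * d' * (q2 - q1) * (q3 * q4) = k' * d * q1 * q2 * (q4 - q3) := by
  apply ha.mul_left_cancel
  set X := q1⁻¹ - q2⁻¹ with hX
  set Y := q3⁻¹ - q4⁻¹ with hY
  have eX : q2 - q1 = q1 * q2 * X := by rw [hX]; linear_combination (-q2) * h1 + q1 * h2
  have eY : q4 - q3 = q3 * q4 * Y := by rw [hY]; linear_combination (-q4) * h3 + q3 * h4
  rw [eX, eY]
  generalize d⁻¹ = e at *
  generalize d'⁻¹ = e' at *
  linear_combination (d * d' * q1 * q2 * q3 * q4) * h - (a * k * d' * X * q1 * q2 * q3 * q4) * hd + (a * k' * d * Y * q1 * q2 * q3 * q4) * hd'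

theorem t2b_core (m T H E R Q : ℕ) [NeZero m] (hT : DivB m T) (hX : 2 * (H * E * Q ^ 3) < m)
    (Dd : Finset ℕ) (hD : Dd ⊆ US m E) (a : ZMod m) (ha : IsUnit a) (hR : 1 ≤ R) (hRm : 2 * R < m)
    (f : ℕ → ℂ) (hf : ∀ q, ‖f q‖ ≤ 1) (C : ℝ) (hC : 0 ≤ C)
    (hC4 : ((H:ℝ) * #Dd * (Q * Q)) ^ 3 * T ^ 5 * (m * (60 * T ^ 2 * ((R:ℝ) ^ 2 + (R:ℝ) ^ 3 * √((R:ℝ) / m)))) ≤ C ^ 4) :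
    (∑ i ∈ Icc 1 H ×ˢ Dd, ∑ r ∈ US m R, ‖∑ q ∈ US m Q, f q *
      ZMod.stdAddChar (lam m a i * (r : ZMod m)⁻¹ * (q : ZMod m)⁻¹)‖) ^ 2 ≤
      ((H:ℝ) * #Dd * R) * ((H:ℝ) * #Dd * Q * R + C) := by
  have hm : 0 < m := Nat.pos_of_ne_zero (NeZero.ne m)
  have hmR : (0:ℝ) < m := by exact_mod_cast hm
  have hDE : Dd ⊆ Icc 1 E := hD.trans (Finset.filter_subset _ _)
  set G : ZMod m → ℝ := fun l => ‖∑ r ∈ US m R, (1:ℂ) * ZMod.stdAddChar (l * (r : ZMod m)⁻¹)‖ with hG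
  have hUR : (#(US m R) : ℝ) ≤ R := by exact_mod_cast card_US_le m R
  have hUQ : (#(US m Q) : ℝ) ≤ Q := by exact_mod_cast card_US_le m Q
  have hGle : ∀ l, G l ≤ R := by
    intro l
    refine (norm_sum_le _ _).trans ?_
    simp only [one_mul, pb_norm, Finset.sum_const, nsmul_eq_mul, mul_one]
    exact hUR
  set P := (Icc 1 H ×ˢ Dd) ×ˢ (US m Q ×ˢ US m Q) with hP
  set S := {x ∈ P | x.2.1 ≠ x.2.2} with hS
  set L : (ℕ × ℕ) × (ℕ × ℕ) → ZMod m := fun x => lam m a x.1 * ((x.2.1 : ZMod m)⁻¹ - (x.2.2 : ZMod m)⁻¹) with hL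
  have hoff : ∑ x ∈ S, G (L x) ≤ C := by
    have h1 := pb_holder S L G (fun l => norm_nonneg _)
    have h4 := pb_L4 m (US m R) (fun _ => (1:ℂ)) (by simp) (fun q => (q : ZMod m)⁻¹)
    have hJ := pc_J2 m R T hT hR hRm
    have hG4 : ∑ l, G l ^ 4 ≤ m * (60 * T ^ 2 * ((R:ℝ) ^ 2 + (R:ℝ) ^ 3 * √((R:ℝ) / m))) := by
      refine h4.trans ?_
      gcongr
    have hs : (#S : ℝ) ≤ (H:ℝ) * #Dd * (Q * Q) := by
      have : (#S : ℝ) ≤ #P := by exact_mod_cast Finset.card_filter_le _ _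
      refine this.trans ?_
      rw [hP]
      simp only [Finset.card_product, Nat.card_Icc, Nat.add_sub_cancel]
      push_cast
      gcongr
    have hcol : (#{x ∈ S ×ˢ S | L x.1 = L x.2} : ℝ) ≤ T ^ 5 * ((H:ℝ) * #Dd * (Q * Q)) := by
      have := th_cnt m T H E Q hT (by
        have : m ≤ m ^ 20 := Nat.le_self_pow (by norm_num) m
        omega) Dd hDE
      have h2 : #{x ∈ S ×ˢ S | L x.1 = L x.2} ≤ T ^ 5 * (H * #Dd * (Q * Q)) := by
        refine le_trans (Finset.card_le_card ?_) this
        rintro ⟨⟨⟨k, d⟩, q1, q2⟩, ⟨k', d'⟩, q3, q4⟩ hx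
        simp only [Finset.mem_filter, Finset.mem_product, hS, hP] at hx ⊢
        obtain ⟨⟨⟨⟨⟨hk, hd⟩, hq1, hq2⟩, n1⟩, ⟨⟨hk', hd'⟩, hq3, hq4⟩, n2⟩, he⟩ := hx
        refine ⟨⟨⟨⟨hk, hd⟩, hq1, hq2⟩, ⟨hk', hd'⟩, hq3, hq4⟩, n2, ?_⟩
        have hz := th_eqZ ha (zm_unit (mem_US.1 (hD hd)).2.2) (zm_unit (mem_US.1 (hD hd')).2.2)
          (zm_unit (mem_US.1 hq1).2.2) (zm_unit (mem_US.1 hq2).2.2) (zm_unit (mem_US.1 hq3).2.2)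
          (zm_unit (mem_US.1 hq4).2.2) he
        have hz2 : (((k:ℤ) * d' * ((q2:ℤ) - q1) * (q3 * q4) - ((k' * d * q1 * q2 : ℕ) : ℤ) * ((q4:ℤ) - q3) : ℤ) : ZMod m) = 0 := by
          push_cast
          rw [hz]; ring
        rw [ZMod.intCast_zmod_eq_zero_iff_dvd] at hz2
        rw [← sub_eq_zero]
        apply Int.eq_zero_of_abs_lt_dvd hz2
        rw [mem_US] at hq1 hq2 hq3 hq4
        rw [Finset.mem_Icc] at hk hk'
        have hd := Finset.mem_Icc.1 (hDE hd)
        have hd' := Finset.mem_Icc.1 (hDE hd')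
        have b1 : |(k:ℤ) * d' * ((q2:ℤ) - q1) * (q3 * q4)| ≤ H * E * Q * (Q * Q) := by
          simp only [abs_mul, Nat.abs_cast]
          have : |(q2:ℤ) - q1| ≤ Q := by rw [abs_le]; constructor <;> omega
          have := hk.2; have := hd'.2; have := hq3.2.1; have := hq4.2.1
          gcongr
        have b2 : |((k' * d * q1 * q2 : ℕ) : ℤ) * ((q4:ℤ) - q3)| ≤ H * E * Q * Q * Q := by
          push_cast
          simp only [abs_mul, Nat.abs_cast]
          have : |(q4:ℤ) - q3| ≤ Q := by rw [abs_le]; constructor <;> omega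
          have := hk'.2; have := hd.2; have := hq1.2.1; have := hq2.2.1
          gcongr
        have hX' : 2 * ((H:ℤ) * E * Q ^ 3) < m := by exact_mod_cast hX
        calc _ ≤ _ := abs_sub _ _
          _ ≤ (H:ℤ) * E * Q * (Q * Q) + H * E * Q * Q * Q := add_le_add b1 b2
          _ = 2 * ((H:ℤ) * E * Q ^ 3) := by ring
          _ < m := hX'
      exact_mod_cast h2
    refine le_of_pow_le_pow_left₀ (n := 4) (by norm_num) hC (h1.trans (le_trans ?_ hC4))
    calc _ ≤ ((H:ℝ) * #Dd * (Q * Q)) ^ 2 * (T ^ 5 * ((H:ℝ) * #Dd * (Q * Q))) * (m * (60 * T ^ 2 * ((R:ℝ) ^ 2 + (R:ℝ) ^ 3 * √((R:ℝ) / m)))) := by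
          gcongr
      _ = _ := by ring
  have hdiag : ∑ x ∈ P with ¬ x.2.1 ≠ x.2.2, G (L x) ≤ (H:ℝ) * #Dd * Q * R := by
    have hc : #{x ∈ P | ¬ x.2.1 ≠ x.2.2} ≤ H * #Dd * Q := by
      calc _ ≤ #((Icc 1 H ×ˢ Dd) ×ˢ US m Q) := by
            apply Finset.card_le_card_of_injOn (fun x => (x.1, x.2.1))
            · rintro ⟨⟨k, d⟩, q1, q2⟩ hx
              simp only [hP, Finset.coe_filter, Finset.mem_product, Set.mem_ofPred_eq, Finset.mem_coe] at hx ⊢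
              tauto
            · rintro ⟨⟨k, d⟩, q1, q2⟩ hx ⟨⟨k', d'⟩, q1', q2'⟩ hx' hh
              simp only [Finset.coe_filter, Set.mem_ofPred_eq, not_not] at hx hx'
              simp only [Prod.mk.injEq] at hh ⊢
              refine ⟨hh.1, hh.2, ?_⟩
              rw [← hx.2, ← hx'.2]; exact hh.2
        _ ≤ _ := by
            simp only [Finset.card_product, Nat.card_Icc, Nat.add_sub_cancel]
            have := card_US_le m Q
            gcongr
    have hc' : (#{x ∈ P | ¬ x.2.1 ≠ x.2.2} : ℝ) ≤ (H:ℝ) * #Dd * Q := by exact_mod_cast hc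
    calc _ ≤ ∑ x ∈ P with ¬ x.2.1 ≠ x.2.2, (R:ℝ) := Finset.sum_le_sum (fun x _ => hGle _)
      _ = #{x ∈ P | ¬ x.2.1 ≠ x.2.2} * (R:ℝ) := by rw [Finset.sum_const, nsmul_eq_mul]
      _ ≤ _ := by gcongr
  have hsq : ∑ i ∈ Icc 1 H ×ˢ Dd, ∑ r ∈ US m R, ‖∑ q ∈ US m Q, f q *
      ZMod.stdAddChar (lam m a i * (r : ZMod m)⁻¹ * (q : ZMod m)⁻¹)‖ ^ 2 ≤ (H:ℝ) * #Dd * Q * R + C := by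
    calc _ ≤ ∑ i ∈ Icc 1 H ×ˢ Dd, ∑ x ∈ US m Q ×ˢ US m Q, G (L (i, x)) := by
          gcongr with i hi
          exact th_sq m (US m R) (US m Q) f hf (lam m a i) (fun r => (r : ZMod m)⁻¹) (fun q => (q : ZMod m)⁻¹)
      _ = ∑ x ∈ P, G (L x) := by rw [hP]; exact (Finset.sum_product (Icc 1 H ×ˢ Dd) (US m Q ×ˢ US m Q) (fun x => G (L x))).symm
      _ = ∑ x ∈ P with x.2.1 ≠ x.2.2, G (L x) + ∑ x ∈ P with ¬ x.2.1 ≠ x.2.2, G (L x) := by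
          rw [Finset.sum_filter_add_sum_filter_not]
      _ ≤ _ := by linarith
  rw [← Finset.sum_product'] at hsq ⊢
  refine sq_sum_le_card_mul_sum_sq.trans ?_
  have hc : (#((Icc 1 H ×ˢ Dd) ×ˢ US m R) : ℝ) ≤ (H:ℝ) * #Dd * R := by
    simp only [Finset.card_product, Nat.card_Icc, Nat.add_sub_cancel]
    push_cast
    gcongr
  gcongr

end

section

open Finset

/-- removing the coupling `q r ≤ x` in a dyadic block -/
theorem bil_block (m x R Q Q0 : ℕ) [NeZero m] (hQ0 : 1 ≤ Q0) (hQ : 1 ≤ Q) (hR : x / Q0 ≤ R)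
    (I : Finset (ℕ × ℕ)) (l : ℕ × ℕ → ZMod m) (Bd : ℝ)
    (h : ∀ f : ℕ → ℂ, (∀ q, ‖f q‖ ≤ 1) → ∑ i ∈ I, ∑ r ∈ US m R, ‖∑ q ∈ US m Q, f q *
      ZMod.stdAddChar (l i * (r : ZMod m)⁻¹ * (q : ZMod m)⁻¹)‖ ≤ Bd)
    (A1 A2 : ℝ) (hA1 : 0 < A1) (hA2 : 0 ≤ A2) (c b : ℕ → ℂ) (hc : ∀ q, ‖c q‖ ≤ A1) (hc0 : ∀ q, q < Q0 → c q = 0)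
    (hb : ∀ r ∈ US m R, ‖b r‖ ≤ A2) :
    ∑ i ∈ I, ‖∑ q ∈ US m Q, ∑ r ∈ US m (x / q), c q * b r *
      ZMod.stdAddChar (l i * (r : ZMod m)⁻¹ * (q : ZMod m)⁻¹)‖ ≤ A1 * A2 * ((2 + Real.log Q) * Bd) := by
  have : NeZero Q := ⟨by omega⟩
  have hswap : ∀ i, ∑ q ∈ US m Q, ∑ r ∈ US m (x / q), c q * b r *
      ZMod.stdAddChar (l i * (r : ZMod m)⁻¹ * (q : ZMod m)⁻¹) =
      ∑ r ∈ US m R, b r * ∑ q ∈ US m Q with q ≤ min (x / r) Q, c q *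
      ZMod.stdAddChar (l i * (r : ZMod m)⁻¹ * (q : ZMod m)⁻¹) := by
    intro i
    simp only [Finset.mul_sum, Finset.sum_filter, mul_ite, mul_zero]
    rw [Finset.sum_comm]
    apply Finset.sum_congr rfl
    intro q hq
    rw [mem_US] at hq
    rw [← Finset.sum_filter]
    by_cases hqq : q < Q0
    · simp [hc0 q hqq]
    push Not at hqq
    have : ({r ∈ US m R | q ≤ min (x / r) Q} : Finset ℕ) = US m (x / q) := by
      ext r
      simp only [Finset.mem_filter, mem_US, le_min_iff]
      constructor
      · rintro ⟨⟨h1, h2, h3⟩, h4, h5⟩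
        refine ⟨h1, ?_, h3⟩
        rw [Nat.le_div_iff_mul_le (by omega)] at h4 ⊢
        linarith
      · rintro ⟨h1, h2, h3⟩
        refine ⟨⟨h1, h2.trans (le_trans (Nat.div_le_div_left hqq (by omega)) hR), h3⟩, ?_, hq.2.1⟩
        rw [Nat.le_div_iff_mul_le (by omega)] at h2 ⊢
        linarith
    rw [this]
    apply Finset.sum_congr rfl
    intro r _
    ring
  have hcomp : ∀ i, ∀ r ∈ US m R, ‖∑ q ∈ US m Q with q ≤ min (x / r) Q, c q *
      ZMod.stdAddChar (l i * (r : ZMod m)⁻¹ * (q : ZMod m)⁻¹)‖ ≤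
      ∑ j : ZMod Q, cw Q Q j * (A1 * ‖∑ q ∈ US m Q, (((A1:ℂ)⁻¹ * c q) * ZMod.stdAddChar (j * (q : ZMod Q))) *
      ZMod.stdAddChar (l i * (r : ZMod m)⁻¹ * (q : ZMod m)⁻¹)‖) := by
    intro i r _
    refine (pb_completion Q (US m Q) (Finset.filter_subset _ _) (fun q => c q *
      ZMod.stdAddChar (l i * (r : ZMod m)⁻¹ * (q : ZMod m)⁻¹)) (min (x/r) Q) (min_le_right _ _) (Q:ℝ)
      (by exact_mod_cast min_le_right _ _)).trans ?_
    apply Finset.sum_le_sum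
    intro j _
    apply mul_le_mul_of_nonneg_left _ (cw_nonneg _ _ (by positivity) _)
    apply le_of_eq
    have hA : (A1:ℂ) ≠ 0 := by exact_mod_cast hA1.ne'
    have e : ∀ Z : ℂ, A1 * ‖Z‖ = ‖(A1:ℂ) * Z‖ := by intro Z; rw [norm_mul, Complex.norm_real, Real.norm_of_nonneg hA1.le]
    rw [e, Finset.mul_sum]
    congr 1
    apply Finset.sum_congr rfl
    intro q _
    field_simp
  calc _ ≤ ∑ i ∈ I, ∑ r ∈ US m R, A2 * ∑ j : ZMod Q, cw Q Q j * (A1 * ‖∑ q ∈ US m Q, (((A1:ℂ)⁻¹ * c q) * ZMod.stdAddChar (j * (q : ZMod Q))) *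
      ZMod.stdAddChar (l i * (r : ZMod m)⁻¹ * (q : ZMod m)⁻¹)‖) := by
        apply Finset.sum_le_sum
        intro i _
        rw [hswap]
        refine (norm_sum_le _ _).trans (Finset.sum_le_sum fun r hr => ?_)
        rw [norm_mul]
        exact mul_le_mul (hb r hr) (hcomp i r hr) (norm_nonneg _) hA2
    _ = A1 * A2 * ∑ j : ZMod Q, cw Q Q j * ∑ i ∈ I, ∑ r ∈ US m R, ‖∑ q ∈ US m Q, (((A1:ℂ)⁻¹ * c q) * ZMod.stdAddChar (j * (q : ZMod Q))) *
      ZMod.stdAddChar (l i * (r : ZMod m)⁻¹ * (q : ZMod m)⁻¹)‖ := by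
        simp only [Finset.mul_sum]
        rw [Finset.sum_congr rfl (fun i _ => Finset.sum_comm), Finset.sum_comm]
        apply Finset.sum_congr rfl; intro j _
        apply Finset.sum_congr rfl; intro i _
        apply Finset.sum_congr rfl; intro r _
        ring
    _ ≤ A1 * A2 * ∑ j : ZMod Q, cw Q Q j * Bd := by
        gcongr with j _
        · exact cw_nonneg _ _ (by positivity) _
        · apply h
          intro q
          rw [norm_mul, pb_norm, mul_one, norm_mul, norm_inv, Complex.norm_real, Real.norm_of_nonneg hA1.le]
          rw [inv_mul_le_iff₀ hA1, mul_one]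
          exact hc q
    _ ≤ _ := by
        rw [← Finset.sum_mul]
        have hBd : 0 ≤ Bd := le_trans (by positivity) (h 0 (by simp))
        gcongr
        exact pb_cw_sum Q

/-- dyadic decomposition -/
theorem bil_dyadic (I : Finset (ℕ × ℕ)) (S : Finset ℕ) (J : ℕ) (hS : ∀ q ∈ S, Nat.log 2 q < J)
    (F : ℕ × ℕ → ℕ → ℂ) (C : ℝ)
    (h : ∀ j < J, ∑ i ∈ I, ‖∑ q ∈ S with Nat.log 2 q = j, F i q‖ ≤ C) :
    ∑ i ∈ I, ‖∑ q ∈ S, F i q‖ ≤ J * C := by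
  calc _ ≤ ∑ i ∈ I, ∑ j ∈ Finset.range J, ‖∑ q ∈ S with Nat.log 2 q = j, F i q‖ := by
        apply Finset.sum_le_sum
        intro i _
        rw [← Finset.sum_fiberwise_of_maps_to (s := S) (t := Finset.range J) (g := fun q => Nat.log 2 q)]
        · exact norm_sum_le _ _
        · intro q hq; simpa using hS q hq
    _ = ∑ j ∈ Finset.range J, ∑ i ∈ I, ‖∑ q ∈ S with Nat.log 2 q = j, F i q‖ := Finset.sum_comm
    _ ≤ ∑ j ∈ Finset.range J, C := Finset.sum_le_sum fun j hj => h j (Finset.mem_range.1 hj)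
    _ = _ := by simp

end

section

open Finset

set_option linter.unusedVariables false

structure Ctx (m T x H E : ℕ) (Dd : Finset ℕ) (L t e n v w : ℝ) : Prop where
  hm : (m:ℝ) = Real.exp L
  hT : DivB m T
  hT3 : 1000 ≤ T
  hTL : L ≤ T
  hTe : (T:ℝ) ≤ Real.exp (e / 10000)
  ht : 0 ≤ t
  he : 0 < e
  h16 : 16 * (t + e) ≤ 3 / 4 * L + n
  hn : 3 * (t + e) ≤ n
  hnL : n ≤ L / 4
  hx : (x:ℝ) ≤ Real.exp (3 / 4 * L + n)
  hx2 : Real.exp (3 / 4 * L + n) ≤ 2 * x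
  hD : Dd ⊆ US m E
  hE : (E:ℝ) ≤ Real.exp v
  hF : (#Dd : ℝ) ≤ Real.exp w
  hv0 : 0 ≤ v
  hv : v ≤ 2.6 * e
  hw : w ≤ 1.3 * e
  hvw : 3 * w ≤ v + 2.6 * e
  hH : (H:ℝ) ≤ Real.exp (v + t + e / 1000)

variable {m T x H E : ℕ} {Dd : Finset ℕ} {L t e n v w : ℝ}

theorem Ctx.e_large (c : Ctx m T x H E Dd L t e n v w) : 60000 ≤ e := by
  have h1 : (1000:ℝ) ≤ Real.exp (e / 10000) := le_trans (by exact_mod_cast c.hT3) c.hTe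
  by_contra h
  push Not at h
  have : Real.exp (e / 10000) < Real.exp 6 := Real.exp_lt_exp.2 (by linarith)
  have h2 : Real.exp 6 = Real.exp 1 ^ 6 := by rw [← Real.exp_nat_mul]; norm_num
  have h3 := Real.exp_one_lt_d9
  have : Real.exp 1 ^ 6 ≤ 2.7182818286 ^ 6 := by gcongr
  norm_num at this
  linarith

theorem Ctx.Tpos (c : Ctx m T x H E Dd L t e n v w) : (1000:ℝ) ≤ T := by exact_mod_cast c.hT3

theorem Ctx.L_pos (c : Ctx m T x H E Dd L t e n v w) : 16 * (t + e) ≤ L := by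
  have := c.h16; have := c.hnL; linarith

theorem Ctx.ne (c : Ctx m T x H E Dd L t e n v w) : NeZero m := by
  refine ⟨fun h => ?_⟩
  have := c.hm
  rw [h] at this
  have := Real.exp_pos L
  simp at *
  linarith

theorem exp_le_m20 {m N : ℕ} {L y : ℝ} (hm : (m:ℝ) = Real.exp L) (hN : (N:ℝ) ≤ Real.exp y) (hy : y ≤ 20 * L) :
    N ≤ m ^ 20 := by
  have : (N:ℝ) ≤ (m:ℝ) ^ 20 := by
    rw [hm, ← Real.exp_nat_mul]
    exact hN.trans (Real.exp_le_exp.2 (by push_cast; linarith))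
  exact_mod_cast this

theorem sqrt_exp_le {Q m L q : ℝ} (hm : m = Real.exp L) (hQ : Q ≤ Real.exp q) : √(Q / m) ≤ Real.exp ((q - L) / 2) := by
  rw [Real.exp_half]
  apply Real.sqrt_le_sqrt
  rw [hm, Real.exp_sub]
  gcongr


theorem lin_t2a {L t e n v w q : ℝ} (ht : 0 ≤ t) (he : 0 < e) (h16 : 16 * (t + e) ≤ 3 / 4 * L + n)
    (hn : 3 * (t + e) ≤ n) (hnL : n ≤ L / 4) (hv0 : 0 ≤ v) (hv : v ≤ 2.6 * e) (hw : w ≤ 1.3 * e)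
    (hvw : 3 * w ≤ v + 2.6 * e) (hq1 : L / 4 ≤ q) (hq2 : q ≤ L / 2 + e / 10000) :
    3 * ((v + t + e / 1000) + w + (3 / 4 * L + n - q + 2 * (e / 10000))) +
      max ((v + t + e / 1000) + v + (3 / 4 * L + n - q + 2 * (e / 10000)) - L) 0 + L +
      max (2 * q) (3 * q + (q - L) / 2) + 10 * (e / 10000) ≤ 4 * (v + (3 / 4 * L + n) - e / 400) := by
  rcases max_cases ((v + t + e / 1000) + v + (3 / 4 * L + n - q + 2 * (e / 10000)) - L) 0 with h | h <;>
  rcases max_cases (2 * q) (3 * q + (q - L) / 2) with h' | h' <;> rw [h.1, h'.1] <;> linarith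

theorem lin_t2b {L t e n v w q : ℝ} (ht : 0 ≤ t) (he : 0 < e) (h16 : 16 * (t + e) ≤ 3 / 4 * L + n)
    (hn : 3 * (t + e) ≤ n) (hnL : n ≤ L / 4) (hv0 : 0 ≤ v) (hv : v ≤ 2.6 * e) (hw : w ≤ 1.3 * e)
    (hvw : 3 * w ≤ v + 2.6 * e) (hq1 : L / 8 + 1.5 * n - 1.5 * t - 1.3 * e - e / 100 ≤ q) (hq2 : q ≤ L / 4) :
    3 * ((v + t + e / 1000) + w + 2 * q) + 9 * (e / 10000) + L + (3 * (3 / 4 * L + n - q + 2 * (e / 10000)) +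
      ((3 / 4 * L + n - q + 2 * (e / 10000)) - L) / 2) ≤
     4 * (2 * (v + (3 / 4 * L + n) - e / 400) - ((v + t + e / 1000) + w + (3 / 4 * L + n - q + 2 * (e / 10000))) - e / 10000) := by
  linarith

theorem lin_t2b' {L t e n v w q : ℝ} (ht : 0 ≤ t) (he : 0 < e) (h16 : 16 * (t + e) ≤ 3 / 4 * L + n)
    (hn : 3 * (t + e) ≤ n) (hnL : n ≤ L / 4) (hv0 : 0 ≤ v) (hv : v ≤ 2.6 * e) (hw : w ≤ 1.3 * e)
    (hvw : 3 * w ≤ v + 2.6 * e) (hq1 : L / 8 + 1.5 * n - 1.5 * t - 1.3 * e - e / 100 ≤ q) (hq2 : q ≤ L / 4) :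
    (v + t + e / 1000) + w + q + (3 / 4 * L + n - q + 2 * (e / 10000)) ≤
     (2 * (v + (3 / 4 * L + n) - e / 400) - ((v + t + e / 1000) + w + (3 / 4 * L + n - q + 2 * (e / 10000))) - e / 10000) := by
  linarith

theorem lin_ti {L t e n v w b : ℝ} (ht : 0 ≤ t) (he : 0 < e) (h16 : 16 * (t + e) ≤ 3 / 4 * L + n)
    (hn : 3 * (t + e) ≤ n) (hnL : n ≤ L / 4) (hv0 : 0 ≤ v) (hv : v ≤ 2.6 * e) (hw : w ≤ 1.3 * e)
    (hvw : 3 * w ≤ v + 2.6 * e) (hb1 : b ≤ L / 8 + 1.5 * n - 1.5 * t - 1.3 * e - e / 100) (hb2 : b ≤ L / 4) :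
    3 * ((v + t + e / 1000) + w + b) + 9 * (e / 10000) + 3 * L +
      max ((v + t + e / 1000) + v + b - L) ((3 / 4 * L + n - b + 2 * (e / 10000)) - L) ≤
      4 * (v + (3 / 4 * L + n) - e / 400 - 4 * (e / 10000)) := by
  rcases max_cases ((v + t + e / 1000) + v + b - L) ((3 / 4 * L + n - b + 2 * (e / 10000)) - L) with h | h <;>
    rw [h.1] <;> linarith

theorem lin_ti' {L t e n v w b : ℝ} (ht : 0 ≤ t) (he : 0 < e) (h16 : 16 * (t + e) ≤ 3 / 4 * L + n)
    (hn : 3 * (t + e) ≤ n) (hnL : n ≤ L / 4) (hv0 : 0 ≤ v) (hv : v ≤ 2.6 * e) (hw : w ≤ 1.3 * e)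
    (hvw : 3 * w ≤ v + 2.6 * e) :
    (3 / 4 * L + n - b + 2 * (e / 10000)) - L + (L / 2 + (w + b + ((v + t + e / 1000) + e / 10000))) ≤
      v + (3 / 4 * L + n) - e / 400 - 4 * (e / 10000) := by
  linarith

theorem two_le_mul_exp {A B X Y : ℝ} (hX : 2 ≤ X) (hY : 0 ≤ Y) (hA : A ≤ Y) (hB : B ≤ Y) : A + B ≤ X * Y := by
  have := mul_le_mul_of_nonneg_right hX hY
  linarith

theorem t2a_exp (m T H E R Q : ℕ) [NeZero m] (hT : DivB m T)
    (Dd : Finset ℕ) (hD : Dd ⊆ US m E) (a : ZMod m) (ha : IsUnit a) (hQ1 : 1 ≤ Q)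
    (f : ℕ → ℂ) (hf : ∀ q, ‖f q‖ ≤ 1) (L h v w r q ν G : ℝ) (hm : (m:ℝ) = Real.exp L)
    (hH : (H:ℝ) ≤ Real.exp h) (hE : (E:ℝ) ≤ Real.exp v) (hF : (#Dd:ℝ) ≤ Real.exp w)
    (hR : (R:ℝ) ≤ Real.exp r) (hQ : (Q:ℝ) ≤ Real.exp q) (hTe : (T:ℝ) ≤ Real.exp ν) (h60 : (60:ℝ) ≤ Real.exp ν)
    (l1 : h + (v + r) ≤ 20 * L) (l2 : ν + q < L)
    (l3 : 3 * (h + w + r) + max (h + v + r - L) 0 + L + max (2 * q) (3 * q + (q - L) / 2) + 10 * ν ≤ 4 * G) :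
    ∑ i ∈ Icc 1 H ×ˢ Dd, ∑ r ∈ US m R, ‖∑ q ∈ US m Q, f q *
      ZMod.stdAddChar (lam m a i * (r : ZMod m)⁻¹ * (q : ZMod m)⁻¹)‖ ≤ Real.exp G := by
  have hmp : (0:ℝ) < m := by rw [hm]; exact Real.exp_pos _
  have h2 : (2:ℝ) ≤ Real.exp ν := by linarith only [h60]
  have hX : H * (E * R) ≤ m ^ 20 := by
    apply exp_le_m20 (y := h + (v + r)) hm ?_ l1
    push_cast
    rw [Real.exp_add, Real.exp_add v]
    gcongr
  have hQm : 2 * Q < m := by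
    have : (2 * Q : ℝ) < m := by
      calc (2 * Q : ℝ) ≤ Real.exp ν * Real.exp q := by gcongr
        _ = Real.exp (ν + q) := (Real.exp_add _ _).symm
        _ < m := by rw [hm]; exact Real.exp_lt_exp.2 l2
    exact_mod_cast this
  have key := t2a_core m T H E R Q hT hX Dd hD a ha hQ1 hQm f hf
  have hS := sqrt_exp_le hm hQ
  refine le_of_pow_le_pow_left₀ (n := 4) (by norm_num) (Real.exp_pos _).le (key.trans ?_)
  generalize hu : max (h + v + r - L) 0 = u at l3
  generalize hp : max (2 * q) (3 * q + (q - L) / 2) = p at l3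
  have e1 : (H:ℝ) * E * R / m + 1 ≤ Real.exp ν * Real.exp u := by
    refine two_le_mul_exp h2 (Real.exp_pos _).le ?_ (Real.one_le_exp (hu ▸ le_max_right _ _))
    calc _ ≤ Real.exp h * Real.exp v * Real.exp r / Real.exp L := by rw [hm]; gcongr
      _ = Real.exp (h + v + r - L) := by simp only [← Real.exp_add, ← Real.exp_sub]
      _ ≤ _ := Real.exp_le_exp.2 (hu ▸ le_max_left _ _)
  have e2 : (Q:ℝ) ^ 2 + (Q:ℝ) ^ 3 * √((Q:ℝ) / m) ≤ Real.exp ν * Real.exp p := by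
    refine two_le_mul_exp h2 (Real.exp_pos _).le ?_ ?_
    · calc (Q:ℝ) ^ 2 ≤ Real.exp q ^ 2 := by gcongr
        _ = Real.exp (2 * q) := by rw [← Real.exp_nat_mul]; norm_num
        _ ≤ _ := Real.exp_le_exp.2 (hp ▸ le_max_left _ _)
    · calc (Q:ℝ) ^ 3 * √((Q:ℝ) / m) ≤ Real.exp q ^ 3 * Real.exp ((q - L) / 2) := by gcongr
        _ = Real.exp (3 * q + (q - L) / 2) := by rw [← Real.exp_nat_mul, ← Real.exp_add]; norm_num
        _ ≤ _ := Real.exp_le_exp.2 (hp ▸ le_max_right _ _)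
  calc _ ≤ (Real.exp h * Real.exp w * Real.exp r) ^ 3 * (Real.exp ν * Real.exp u) * Real.exp ν ^ 5 *
        (Real.exp L * (Real.exp ν * Real.exp ν ^ 2 * (Real.exp ν * Real.exp p))) := by
        gcongr
        exact hm.le
    _ = Real.exp (3 * (h + w + r) + u + L + p + 10 * ν) := by
        simp only [← Real.exp_add, ← Real.exp_nat_mul]
        congr 1; push_cast; ring
    _ ≤ Real.exp G ^ 4 := by
        rw [← Real.exp_nat_mul]
        exact Real.exp_le_exp.2 (by push_cast; exact l3)

theorem t2b_exp (m T H E R Q : ℕ) [NeZero m] (hT : DivB m T)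
    (Dd : Finset ℕ) (hD : Dd ⊆ US m E) (a : ZMod m) (ha : IsUnit a) (hR1 : 1 ≤ R)
    (f : ℕ → ℂ) (hf : ∀ q, ‖f q‖ ≤ 1) (L h v w r q ν G : ℝ) (hm : (m:ℝ) = Real.exp L)
    (hH : (H:ℝ) ≤ Real.exp h) (hE : (E:ℝ) ≤ Real.exp v) (hF : (#Dd:ℝ) ≤ Real.exp w)
    (hR : (R:ℝ) ≤ Real.exp r) (hQ : (Q:ℝ) ≤ Real.exp q) (hTe : (T:ℝ) ≤ Real.exp ν) (h60 : (60:ℝ) ≤ Real.exp ν)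
    (l1 : ν + h + v + 3 * q < L) (l2 : ν + r < L) (hr1 : 2 * r ≤ 3 * r + (r - L) / 2)
    (l3 : h + w + q + r ≤ 2 * G - (h + w + r) - ν)
    (l4 : 3 * (h + w + 2 * q) + 9 * ν + L + (3 * r + (r - L) / 2) ≤ 4 * (2 * G - (h + w + r) - ν)) :
    ∑ i ∈ Icc 1 H ×ˢ Dd, ∑ r ∈ US m R, ‖∑ q ∈ US m Q, f q *
      ZMod.stdAddChar (lam m a i * (r : ZMod m)⁻¹ * (q : ZMod m)⁻¹)‖ ≤ Real.exp G := by
  have hmp : (0:ℝ) < m := by rw [hm]; exact Real.exp_pos _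
  have h2 : (2:ℝ) ≤ Real.exp ν := by linarith only [h60]
  have hX : 2 * (H * E * Q ^ 3) < m := by
    have : 2 * ((H:ℝ) * E * Q ^ 3) < m := by
      calc 2 * ((H:ℝ) * E * Q ^ 3) ≤ Real.exp ν * (Real.exp h * Real.exp v * Real.exp q ^ 3) := by gcongr
        _ = Real.exp (ν + h + v + 3 * q) := by
            simp only [← Real.exp_add, ← Real.exp_nat_mul]; congr 1; push_cast; ring
        _ < m := by rw [hm]; exact Real.exp_lt_exp.2 l1
    exact_mod_cast this
  have hRm : 2 * R < m := by
    have : (2 * R : ℝ) < m := by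
      calc (2 * R : ℝ) ≤ Real.exp ν * Real.exp r := by gcongr
        _ = Real.exp (ν + r) := (Real.exp_add _ _).symm
        _ < m := by rw [hm]; exact Real.exp_lt_exp.2 l2
    exact_mod_cast this
  have hS := sqrt_exp_le hm hR
  obtain ⟨C, hC⟩ : ∃ C, C = 2 * G - (h + w + r) - ν := ⟨_, rfl⟩
  rw [← hC] at l3 l4
  have key := t2b_core m T H E R Q hT hX Dd hD a ha hR1 hRm f hf (Real.exp C) (Real.exp_pos _).le ?_
  · refine le_of_pow_le_pow_left₀ (n := 2) (by norm_num) (Real.exp_pos _).le (key.trans ?_)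
    have e1 : (H:ℝ) * #Dd * Q * R + Real.exp C ≤ Real.exp ν * Real.exp C := by
      refine two_le_mul_exp h2 (Real.exp_pos _).le ?_ le_rfl
      calc (H:ℝ) * #Dd * Q * R ≤ Real.exp h * Real.exp w * Real.exp q * Real.exp r := by gcongr
          _ = Real.exp (h + w + q + r) := by simp only [← Real.exp_add]
          _ ≤ Real.exp C := Real.exp_le_exp.2 l3
    calc _ ≤ (Real.exp h * Real.exp w * Real.exp r) * (Real.exp ν * Real.exp C) := by gcongr
      _ = Real.exp (2 * G) := by
          simp only [← Real.exp_add]; congr 1; rw [hC]; ring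
      _ ≤ _ := by rw [← Real.exp_nat_mul]; norm_num
  · have e2 : (R:ℝ) ^ 2 + (R:ℝ) ^ 3 * √((R:ℝ) / m) ≤ Real.exp ν * Real.exp (3 * r + (r - L) / 2) := by
      refine two_le_mul_exp h2 (Real.exp_pos _).le ?_ ?_
      · calc (R:ℝ) ^ 2 ≤ Real.exp r ^ 2 := by gcongr
          _ = Real.exp (2 * r) := by rw [← Real.exp_nat_mul]; norm_num
          _ ≤ _ := Real.exp_le_exp.2 hr1
      · calc (R:ℝ) ^ 3 * √((R:ℝ) / m) ≤ Real.exp r ^ 3 * Real.exp ((r - L) / 2) := by gcongr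
          _ = Real.exp (3 * r + (r - L) / 2) := by rw [← Real.exp_nat_mul, ← Real.exp_add]; norm_num
          _ ≤ _ := le_rfl
    calc _ ≤ (Real.exp h * Real.exp w * (Real.exp q * Real.exp q)) ^ 3 * Real.exp ν ^ 5 *
        (Real.exp L * (Real.exp ν * Real.exp ν ^ 2 * (Real.exp ν * Real.exp (3 * r + (r - L) / 2)))) := by
          gcongr
          exact hm.le
      _ = Real.exp (3 * (h + w + 2 * q) + 9 * ν + L + (3 * r + (r - L) / 2)) := by
          simp only [← Real.exp_add, ← Real.exp_nat_mul]
          congr 1; push_cast; ring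
      _ ≤ Real.exp C ^ 4 := by
          rw [← Real.exp_nat_mul]
          exact Real.exp_le_exp.2 (by push_cast; exact l4)

theorem ti_exp (m T H E B : ℕ) [NeZero m] (hT : DivB m T)
    (Dd : Finset ℕ) (hD : Dd ⊆ US m E) (a : ZMod m) (ha : IsUnit a) (U : ℝ) (hU1 : 1 ≤ U) (hUm : U ≤ m)
    (L h v w r b ν G : ℝ) (hm : (m:ℝ) = Real.exp L) (hL : 1 ≤ L)
    (hH : (H:ℝ) ≤ Real.exp h) (hE : (E:ℝ) ≤ Real.exp v) (hF : (#Dd:ℝ) ≤ Real.exp w)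
    (hU : U ≤ Real.exp r) (hB : (B:ℝ) ≤ Real.exp b) (hTe : (T:ℝ) ≤ Real.exp ν) (h8 : (8:ℝ) ≤ Real.exp ν)
    (hTL : L ≤ T)
    (l1 : h + L + (v + b) ≤ 20 * L)
    (l2 : r - L + (L / 2 + (w + b + (h + ν))) ≤ G - 4 * ν)
    (l3 : 3 * (h + w + b) + 9 * ν + 3 * L + max (h + v + b - L) (r - L) ≤ 4 * (G - 4 * ν)) :
    ∑ i ∈ Icc 1 H ×ˢ Dd, ∑ b ∈ US m B, ZZ m U (lam m a i * (b : ZMod m)⁻¹) ≤ Real.exp G := by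
  have hmp : (0:ℝ) < m := by rw [hm]; exact Real.exp_pos _
  have h2 : (2:ℝ) ≤ Real.exp ν := by linarith only [h8]
  have hX : H * m * (E * B) ≤ m ^ 20 := by
    apply exp_le_m20 (y := h + L + (v + b)) hm ?_ l1
    push_cast
    rw [Real.exp_add (h + L) (v + b), Real.exp_add h L, Real.exp_add v b, ← hm]
    gcongr
  generalize hu : max (h + v + b - L) (r - L) = u at l3
  obtain ⟨C, hC⟩ : ∃ C, C = G - 4 * ν := ⟨_, rfl⟩
  rw [← hC] at l2 l3
  have e1 : (H:ℝ) * E * B / m + U / m ≤ Real.exp ν * Real.exp u := by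
    refine two_le_mul_exp h2 (Real.exp_pos _).le ?_ ?_
    · calc _ ≤ Real.exp h * Real.exp v * Real.exp b / Real.exp L := by rw [hm]; gcongr
        _ = Real.exp (h + v + b - L) := by simp only [← Real.exp_add, ← Real.exp_sub]
        _ ≤ _ := Real.exp_le_exp.2 (hu ▸ le_max_left _ _)
    · calc _ ≤ Real.exp r / Real.exp L := by rw [hm]; gcongr
        _ = Real.exp (r - L) := by simp only [← Real.exp_sub]
        _ ≤ _ := Real.exp_le_exp.2 (hu ▸ le_max_right _ _)
  have key := ti_core m T H E B hT hX Dd hD a ha U (Real.exp C) hU1 hUm (Real.exp_pos _).le ?_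
  · refine key.trans ?_
    have hsq : √(m:ℝ) = Real.exp (L / 2) := by rw [hm, Real.exp_half]
    have b1 : U / m * (√m * (#Dd * B * (H * T))) ≤ Real.exp C := by
      calc _ ≤ Real.exp r / Real.exp L * (Real.exp (L / 2) * (Real.exp w * Real.exp b * (Real.exp h * Real.exp ν))) := by
            rw [hsq, hm]; gcongr
        _ = Real.exp (r - L + (L / 2 + (w + b + (h + ν)))) := by
            simp only [← Real.exp_add, ← Real.exp_sub]
        _ ≤ Real.exp C := Real.exp_le_exp.2 l2
    have b2 : (Nat.log 2 m : ℝ) + 1 ≤ 2.5 * T := by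
      have h1 : (Nat.log 2 m : ℝ) ≤ Real.log m / Real.log 2 := Real.natLog_le_logb m 2
      rw [hm, Real.log_exp] at h1
      have l2 := Real.log_two_gt_d9
      rw [le_div_iff₀ (by linarith only [l2])] at h1
      have h0 : (0:ℝ) ≤ (Nat.log 2 m : ℝ) := Nat.cast_nonneg _
      have h3 : (Nat.log 2 m : ℝ) * 0.6931471803 ≤ L := le_trans (by gcongr) h1
      linarith only [h3, hL, hTL]
    have b3 : ((Nat.log 2 m : ℝ) + 1) * (4 * Real.exp C) ≤ 10 * Real.exp ν * Real.exp C := by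
      calc _ ≤ (2.5 * Real.exp ν) * (4 * Real.exp C) := by gcongr; linarith only [b2, hTe]
        _ = _ := by ring
    have b5 : Real.exp G = Real.exp ν ^ 4 * Real.exp C := by
      rw [hC, ← Real.exp_nat_mul, ← Real.exp_add]; congr 1; push_cast; ring
    have b6 : 10 * Real.exp ν + 1 ≤ Real.exp ν ^ 4 := by
      have : (8:ℝ) ^ 3 ≤ Real.exp ν ^ 3 := by gcongr
      calc 10 * Real.exp ν + 1 ≤ 8 ^ 3 * Real.exp ν := by linarith only [h8]
        _ ≤ Real.exp ν ^ 3 * Real.exp ν := by gcongr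
        _ = _ := by ring
    rw [b5]
    calc _ ≤ Real.exp C + 10 * Real.exp ν * Real.exp C := add_le_add b1 b3
      _ = (10 * Real.exp ν + 1) * Real.exp C := by ring
      _ ≤ _ := by gcongr
  · calc _ ≤ (Real.exp h * Real.exp w * Real.exp b) ^ 3 * Real.exp ν ^ 7 * (Real.exp ν * Real.exp L ^ 3) * (Real.exp ν * Real.exp u) := by
          gcongr
          exact hm.le
      _ = Real.exp (3 * (h + w + b) + 9 * ν + 3 * L + u) := by
          simp only [← Real.exp_add, ← Real.exp_nat_mul]
          congr 1; push_cast; ring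
      _ ≤ Real.exp C ^ 4 := by
          rw [← Real.exp_nat_mul]
          exact Real.exp_le_exp.2 (by push_cast; exact l3)

theorem Ctx.t2a (c : Ctx m T x H E Dd L t e n v w) [NeZero m] (a : ZMod m) (ha : IsUnit a) (Q R : ℕ) (q : ℝ)
    (hQ1 : 1 ≤ Q) (hQ : (Q:ℝ) ≤ Real.exp q) (hq1 : L / 4 ≤ q) (hq2 : q ≤ L / 2 + e / 10000)
    (hR : (R:ℝ) ≤ Real.exp (3 / 4 * L + n - q + 2 * (e / 10000)))
    (f : ℕ → ℂ) (hf : ∀ q, ‖f q‖ ≤ 1) :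
    ∑ i ∈ Icc 1 H ×ˢ Dd, ∑ r ∈ US m R, ‖∑ q ∈ US m Q, f q *
      ZMod.stdAddChar (lam m a i * (r : ZMod m)⁻¹ * (q : ZMod m)⁻¹)‖ ≤
      Real.exp (v + (3 / 4 * L + n) - e / 400) := by
  obtain ⟨hm, hT, hT3, hTL, hTe, ht, he, h16, hn, hnL, hx, hx2, hD, hE, hF, hv0, hv, hw, hvw, hH⟩ := id c
  have hL := c.L_pos
  have hTp := c.Tpos
  refine t2a_exp m T H E R Q hT Dd hD a ha hQ1 f hf L _ v w _ q _ _ hm hH hE hF hR hQ hTe ?_ ?_ ?_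
    (lin_t2a ht he h16 hn hnL hv0 hv hw hvw hq1 hq2)
  · linarith only [hTp, hTe]
  · linarith only [hv, hL, hnL, hq1, ht, he]
  · linarith only [hL, hq2, ht, he]

theorem Ctx.t2b (c : Ctx m T x H E Dd L t e n v w) [NeZero m] (a : ZMod m) (ha : IsUnit a) (Q R : ℕ) (q : ℝ)
    (hR1 : 1 ≤ R) (hQ : (Q:ℝ) ≤ Real.exp q) (hq1 : L / 8 + 1.5 * n - 1.5 * t - 1.3 * e - e / 100 ≤ q) (hq2 : q ≤ L / 4)
    (hR : (R:ℝ) ≤ Real.exp (3 / 4 * L + n - q + 2 * (e / 10000)))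
    (f : ℕ → ℂ) (hf : ∀ q, ‖f q‖ ≤ 1) :
    ∑ i ∈ Icc 1 H ×ˢ Dd, ∑ r ∈ US m R, ‖∑ q ∈ US m Q, f q *
      ZMod.stdAddChar (lam m a i * (r : ZMod m)⁻¹ * (q : ZMod m)⁻¹)‖ ≤
      Real.exp (v + (3 / 4 * L + n) - e / 400) := by
  obtain ⟨hm, hT, hT3, hTL, hTe, ht, he, h16, hn, hnL, hx, hx2, hD, hE, hF, hv0, hv, hw, hvw, hH⟩ := id c
  have hL := c.L_pos
  have hTp := c.Tpos
  refine t2b_exp m T H E R Q hT Dd hD a ha hR1 f hf L _ v w _ q _ _ hm hH hE hF hR hQ hTe ?_ ?_ ?_ ?_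
    (lin_t2b' ht he h16 hn hnL hv0 hv hw hvw hq1 hq2)
    (lin_t2b ht he h16 hn hnL hv0 hv hw hvw hq1 hq2)
  · linarith only [hTp, hTe]
  · linarith only [hL, hq1, hq2, hn, hv, ht, he]
  · linarith only [hL, hq1, hn, hnL, ht, he]
  · linarith only [hL, hq2, hn, ht, he]

theorem Ctx.ti (c : Ctx m T x H E Dd L t e n v w) [NeZero m] (a : ZMod m) (ha : IsUnit a) (B : ℕ) (b U : ℝ)
    (hB : (B:ℝ) ≤ Real.exp b) (hb1 : b ≤ L / 8 + 1.5 * n - 1.5 * t - 1.3 * e - e / 100) (hb2 : b ≤ L / 4)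
    (hU1 : 1 ≤ U) (hUm : U ≤ m) (hU : U ≤ Real.exp (3 / 4 * L + n - b + 2 * (e / 10000))) :
    ∑ i ∈ Icc 1 H ×ˢ Dd, ∑ b ∈ US m B, ZZ m U (lam m a i * (b : ZMod m)⁻¹) ≤
      Real.exp (v + (3 / 4 * L + n) - e / 400) := by
  obtain ⟨hm, hT, hT3, hTL, hTe, ht, he, h16, hn, hnL, hx, hx2, hD, hE, hF, hv0, hv, hw, hvw, hH⟩ := id c
  have hL := c.L_pos
  have heL := c.e_large
  have hTp := c.Tpos
  refine ti_exp m T H E B hT Dd hD a ha U hU1 hUm L _ v w _ b _ _ hm ?_ hH hE hF hU hB hTe ?_ hTL ?_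
    (lin_ti' ht he h16 hn hnL hv0 hv hw hvw)
    (lin_ti ht he h16 hn hnL hv0 hv hw hvw hb1 hb2)
  · linarith only [hL, heL, ht]
  · linarith only [hTp, hTe]
  · linarith only [hv, hL, hb2, ht, he]

end

section

open Finset

set_option linter.unusedVariables false

variable {m T x H E : ℕ} {Dd : Finset ℕ} {L t e n v w : ℝ}

theorem Ctx.x_le (c : Ctx m T x H E Dd L t e n v w) : x ≤ m := by
  have : (x:ℝ) ≤ m := by
    rw [c.hm]; exact c.hx.trans (Real.exp_le_exp.2 (by have := c.hnL; linarith))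
  exact_mod_cast this

theorem Ctx.log_x (c : Ctx m T x H E Dd L t e n v w) : ((Nat.log 2 x + 1 : ℕ):ℝ) ≤ 3 * T := by
  have h1 : (Nat.log 2 x : ℝ) ≤ Nat.log 2 m := by exact_mod_cast Nat.log_mono_right c.x_le
  have h2 : (Nat.log 2 m : ℝ) ≤ Real.log m / Real.log 2 := Real.natLog_le_logb m 2
  rw [c.hm, Real.log_exp] at h2
  have l2 := Real.log_two_gt_d9
  rw [le_div_iff₀ (by linarith only [l2])] at h2
  have h0 : (0:ℝ) ≤ (Nat.log 2 m : ℝ) := Nat.cast_nonneg _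
  have h3 : (Nat.log 2 m : ℝ) * 0.6931471803 ≤ L := le_trans (by gcongr) h2
  have hTL := c.hTL
  have := c.Tpos
  push_cast
  linarith only [h3, h1, hTL, this]

theorem Ctx.log_le (c : Ctx m T x H E Dd L t e n v w) (r : ℕ) (hr : r ≤ x) : Real.log r ≤ T := by
  rcases Nat.eq_zero_or_pos r with h | h
  · subst h; simp
  · have : Real.log r ≤ Real.log m := Real.log_le_log (by exact_mod_cast h) (by exact_mod_cast hr.trans c.x_le)
    rw [c.hm, Real.log_exp] at this
    exact this.trans c.hTL

theorem Ctx.dy (c : Ctx m T x H E Dd L t e n v w) [NeZero m] (a : ZMod m) (cf bf : ℕ → ℂ) (K : ℝ) (hK : 0 ≤ K)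
    (h : ∀ j q0, q0 ∈ US m x → Nat.log 2 q0 = j → cf q0 ≠ 0 →
      ∑ i ∈ Icc 1 H ×ˢ Dd, ‖∑ q ∈ US m (2 ^ (j+1)), ∑ r ∈ US m (x / q),
        (if Nat.log 2 q = j ∧ 1 ≤ q ∧ q ≤ x then cf q else 0) * bf r *
        ZMod.stdAddChar (lam m a i * (r : ZMod m)⁻¹ * (q : ZMod m)⁻¹)‖ ≤ K) :
    ∑ i ∈ Icc 1 H ×ˢ Dd, ‖∑ q ∈ US m x, ∑ r ∈ US m (x / q), cf q * bf r *
        ZMod.stdAddChar (lam m a i * (r : ZMod m)⁻¹ * (q : ZMod m)⁻¹)‖ ≤ 3 * T * K := by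
  refine (bil_dyadic _ (US m x) (Nat.log 2 x + 1) (fun q hq => Nat.lt_succ_of_le (Nat.log_mono_right (mem_US.1 hq).2.1))
    (fun i q => ∑ r ∈ US m (x / q), cf q * bf r *
        ZMod.stdAddChar (lam m a i * (r : ZMod m)⁻¹ * (q : ZMod m)⁻¹)) K ?_).trans ?_
  · intro j hj
    by_cases hex : ∃ q0 ∈ US m x, Nat.log 2 q0 = j ∧ cf q0 ≠ 0
    · obtain ⟨q0, h1, h2, h3⟩ := hex
      refine le_of_eq_of_le ?_ (h j q0 h1 h2 h3)
      apply Finset.sum_congr rfl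
      intro i _
      congr 1
      have e1 : ∀ q, ∑ r ∈ US m (x / q), (if Nat.log 2 q = j ∧ 1 ≤ q ∧ q ≤ x then cf q else 0) * bf r *
        ZMod.stdAddChar (lam m a i * (r : ZMod m)⁻¹ * (q : ZMod m)⁻¹) =
        if Nat.log 2 q = j ∧ 1 ≤ q ∧ q ≤ x then ∑ r ∈ US m (x / q), cf q * bf r *
        ZMod.stdAddChar (lam m a i * (r : ZMod m)⁻¹ * (q : ZMod m)⁻¹) else 0 := by
        intro q; split_ifs <;> simp
      simp only [e1]
      rw [← Finset.sum_filter]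
      apply Finset.sum_congr _ (fun _ _ => rfl)
      ext q
      simp only [Finset.mem_filter, mem_US]
      constructor
      · rintro ⟨⟨a1, a2, a3⟩, a4⟩
        refine ⟨⟨a1, ?_, a3⟩, a4, a1, a2⟩
        rw [← a4]; exact (Nat.lt_pow_succ_log_self (by norm_num) q).le
      · rintro ⟨⟨a1, a2, a3⟩, a4, _, a5⟩
        exact ⟨⟨a1, a5, a3⟩, a4⟩
    · push Not at hex
      refine le_of_eq_of_le (Finset.sum_eq_zero ?_) hK
      intro i _
      rw [norm_eq_zero]
      apply Finset.sum_eq_zero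
      intro q hq
      rw [Finset.mem_filter] at hq
      rw [hex q hq.1 hq.2]
      simp
  · gcongr
    exact c.log_x

/-- numeric data for a dyadic block -/
theorem Ctx.blk (c : Ctx m T x H E Dd L t e n v w) (j q0 : ℕ) (hq0 : q0 ∈ US m x) (hj : Nat.log 2 q0 = j) :
    ((2 ^ (j+1) : ℕ) : ℝ) = Real.exp ((j+1) * Real.log 2) ∧
    ((x / 2 ^ j : ℕ) : ℝ) ≤ Real.exp (3 / 4 * L + n - (j+1) * Real.log 2 + 2 * (e / 10000)) ∧
    (q0:ℝ) ≤ Real.exp ((j+1) * Real.log 2) ∧ Real.exp (j * Real.log 2) ≤ q0 ∧ 1 ≤ x / 2 ^ j ∧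
    2 + Real.log ((2 ^ (j+1) : ℕ) : ℝ) ≤ 2 * T ∧ Real.log 2 ≤ e / 10000 := by
  have e0 : ∀ k : ℕ, ((2 ^ k : ℕ) : ℝ) = Real.exp (k * Real.log 2) := by
    intro k
    rw [Real.exp_nat_mul, Real.exp_log (by norm_num)]; push_cast; rfl
  have e1 := e0 (j+1)
  push_cast at e1
  obtain ⟨a1, a2, a3⟩ := mem_US.1 hq0
  have h1 : q0 < 2 ^ (j+1) := hj ▸ Nat.lt_pow_succ_log_self (by norm_num) q0
  have h2 : 2 ^ j ≤ q0 := hj ▸ Nat.pow_log_le_self 2 (by omega)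
  have h3 : (2 ^ j : ℕ) ≤ (q0:ℝ) := by exact_mod_cast h2
  have he := c.e_large
  have l2 := Real.log_two_lt_d9
  have hl : Real.log 2 ≤ e / 10000 := by linarith
  refine ⟨by push_cast; exact e1, ?_, ?_, ?_, ?_, ?_, hl⟩
  · calc ((x / 2 ^ j : ℕ) : ℝ) ≤ (x:ℝ) / (2 ^ j : ℕ) := Nat.cast_div_le
      _ ≤ Real.exp (3 / 4 * L + n) / Real.exp (j * Real.log 2) := by rw [e0]; gcongr; exact c.hx
      _ = Real.exp (3 / 4 * L + n - j * Real.log 2) := by rw [← Real.exp_sub]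
      _ ≤ _ := Real.exp_le_exp.2 (by linarith)
  · rw [← e1]; exact_mod_cast h1.le
  · rw [← e0]; exact h3
  · exact (Nat.one_le_div_iff (by positivity)).2 (h2.trans a2)
  · have hx' : Real.log (2 ^ j : ℕ) ≤ Real.log m := Real.log_le_log (by positivity) (h3.trans (by exact_mod_cast a2.trans c.x_le))
    rw [c.hm, Real.log_exp, e0, Real.log_exp] at hx'
    push_cast
    rw [e1, Real.log_exp]
    have := c.hTL; have := c.Tpos
    linarith

theorem Ctx.blk_bil (c : Ctx m T x H E Dd L t e n v w) [NeZero m] (a : ZMod m) (j q0 : ℕ)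
    (hq0 : q0 ∈ US m x) (hj : Nat.log 2 q0 = j) (cf bf : ℕ → ℂ) (Bd : ℝ) (hBd : 0 ≤ Bd)
    (A1 A2 : ℝ) (hA1 : 0 < A1) (hA2 : 0 ≤ A2) (hc : ∀ q ≤ x, ‖cf q‖ ≤ A1)
    (hb : ∀ r ≤ x, ‖bf r‖ ≤ A2)
    (h : ∀ f : ℕ → ℂ, (∀ q, ‖f q‖ ≤ 1) → ∑ i ∈ Icc 1 H ×ˢ Dd, ∑ r ∈ US m (x / 2 ^ j), ‖∑ q ∈ US m (2 ^ (j+1)), f q *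
      ZMod.stdAddChar (lam m a i * (r : ZMod m)⁻¹ * (q : ZMod m)⁻¹)‖ ≤ Bd) :
    ∑ i ∈ Icc 1 H ×ˢ Dd, ‖∑ q ∈ US m (2 ^ (j+1)), ∑ r ∈ US m (x / q),
        (if Nat.log 2 q = j ∧ 1 ≤ q ∧ q ≤ x then cf q else 0) * bf r *
        ZMod.stdAddChar (lam m a i * (r : ZMod m)⁻¹ * (q : ZMod m)⁻¹)‖ ≤ A1 * A2 * (2 * T * Bd) := by
  obtain ⟨b1, b2, b3, b4, b5, b6, b7⟩ := c.blk j q0 hq0 hj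
  refine (bil_block m x (x / 2 ^ j) (2 ^ (j+1)) (2 ^ j) Nat.one_le_two_pow Nat.one_le_two_pow le_rfl
    (Icc 1 H ×ˢ Dd) (lam m a) Bd h A1 A2 hA1 hA2 _ bf ?_ ?_ ?_).trans ?_
  · intro q
    split_ifs with h
    · exact hc q h.2.2
    · simpa using hA1.le
  · intro q hq
    rw [if_neg]
    rintro ⟨h1, hz, h2⟩
    have := Nat.pow_log_le_self 2 (show q ≠ 0 by omega)
    rw [h1] at this; omega
  · intro r hr
    exact hb r ((mem_US.1 hr).2.1.trans (Nat.div_le_self _ _))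
  · gcongr

theorem Ctx.bilgen (c : Ctx m T x H E Dd L t e n v w) [NeZero m] (a : ZMod m) (ha : IsUnit a) (cf bf : ℕ → ℂ)
    (A1 A2 : ℝ) (hA1 : 0 < A1) (hA2 : 0 ≤ A2) (hc : ∀ q ≤ x, ‖cf q‖ ≤ A1)
    (hc0 : ∀ q ≤ x, cf q ≠ 0 → Real.exp (L / 4) ≤ q ∧ (q:ℝ) ≤ Real.exp (L / 2))
    (hb : ∀ r ≤ x, ‖bf r‖ ≤ A2) :
    ∑ i ∈ Icc 1 H ×ˢ Dd, ‖∑ q ∈ US m x, ∑ r ∈ US m (x / q), cf q * bf r *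
        ZMod.stdAddChar (lam m a i * (r : ZMod m)⁻¹ * (q : ZMod m)⁻¹)‖ ≤
      3 * T * (A1 * A2 * (2 * T * Real.exp (v + (3 / 4 * L + n) - e / 400))) := by
  refine c.dy a cf bf _ (by positivity) ?_
  intro j q0 hq0 hj hne
  obtain ⟨b1, b2, b3, b4, b5, b6, b7⟩ := c.blk j q0 hq0 hj
  obtain ⟨d1, d2⟩ := hc0 q0 (mem_US.1 hq0).2.1 hne
  refine c.blk_bil a j q0 hq0 hj cf bf _ (Real.exp_pos _).le A1 A2 hA1 hA2 hc hb ?_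
  intro f hf
  refine c.t2a a ha (2 ^ (j+1)) (x / 2 ^ j) ((j+1) * Real.log 2) Nat.one_le_two_pow b1.le ?_ ?_ b2 f hf
  · exact Real.exp_le_exp.1 (d1.trans b3)
  · have := Real.exp_le_exp.1 (b4.trans d2)
    linarith

theorem Ctx.bilsmooth (c : Ctx m T x H E Dd L t e n v w) [NeZero m] (a : ZMod m) (ha : IsUnit a) (cf bf : ℕ → ℂ)
    (A1 : ℝ) (hA1 : 0 < A1) (hc : ∀ q ≤ x, ‖cf q‖ ≤ A1)
    (hc0 : ∀ q ≤ x, cf q ≠ 0 → (q:ℝ) ≤ Real.exp (L / 2))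
    (hb : (∀ r, bf r = 1) ∨ (∀ r : ℕ, bf r = (Real.log r : ℂ))) :
    ∑ i ∈ Icc 1 H ×ˢ Dd, ‖∑ q ∈ US m x, ∑ r ∈ US m (x / q), cf q * bf r *
        ZMod.stdAddChar (lam m a i * (r : ZMod m)⁻¹ * (q : ZMod m)⁻¹)‖ ≤
      3 * T * (A1 * T * (2 * T * Real.exp (v + (3 / 4 * L + n) - e / 400))) := by
  have hTp := c.Tpos
  have hb' : ∀ r ≤ x, ‖bf r‖ ≤ (T:ℝ) := by
    intro r hr
    rcases hb with h | h
    · rw [h, norm_one]; linarith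
    · rw [h, Complex.norm_real, Real.norm_of_nonneg (Real.log_natCast_nonneg r)]
      exact c.log_le r hr
  refine c.dy a cf bf _ (by positivity) ?_
  intro j q0 hq0 hj hne
  obtain ⟨b1, b2, b3, b4, b5, b6, b7⟩ := c.blk j q0 hq0 hj
  have d2 := hc0 q0 (mem_US.1 hq0).2.1 hne
  have d3 := Real.exp_le_exp.1 (b4.trans d2)
  by_cases hq4 : L / 4 ≤ (j+1) * Real.log 2
  · refine c.blk_bil a j q0 hq0 hj cf bf _ (Real.exp_pos _).le A1 T hA1 (by positivity) hc hb' ?_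
    intro f hf
    refine c.t2a a ha (2 ^ (j+1)) (x / 2 ^ j) ((j+1) * Real.log 2) Nat.one_le_two_pow b1.le hq4 ?_ b2 f hf
    linarith
  push Not at hq4
  by_cases hφ : L / 8 + 1.5 * n - 1.5 * t - 1.3 * e - e / 100 ≤ (j+1) * Real.log 2
  · refine c.blk_bil a j q0 hq0 hj cf bf _ (Real.exp_pos _).le A1 T hA1 (by positivity) hc hb' ?_
    intro f hf
    exact c.t2b a ha (2 ^ (j+1)) (x / 2 ^ j) ((j+1) * Real.log 2) b5 b1.le hφ hq4.le b2 f hf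
  push Not at hφ
  -- Type I
  have hmp : 2 ≤ m := by
    have h1 := c.L_pos
    have h2 := c.e_large
    have h3 := c.ht
    have h4 : (2:ℝ) ≤ m := by
      rw [c.hm]
      have := Real.add_one_le_exp L
      linarith
    exact_mod_cast h4
  obtain ⟨U, hU⟩ : ∃ U, U = Real.exp (3 / 4 * L + n - (j+1) * Real.log 2 + Real.log 2) := ⟨_, rfl⟩
  have hn := c.hn; have hnL := c.hnL; have ht := c.ht; have he := c.he; have hL := c.L_pos
  have l2 : 0 < Real.log 2 := Real.log_pos (by norm_num)
  have hjl : 0 ≤ (j:ℝ) * Real.log 2 := by positivity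
  have hU1 : 1 ≤ U := by
    rw [hU]; exact Real.one_le_exp (by linarith)
  have hUm : U ≤ m := by
    rw [hU, c.hm]; exact Real.exp_le_exp.2 (by linarith)
  have hti := c.ti a ha (2 ^ (j+1)) ((j+1) * Real.log 2) U b1.le hφ.le hq4.le hU1 hUm
    (by rw [hU]; exact Real.exp_le_exp.2 (by linarith))
  have hZ : ∀ l, 0 ≤ ZZ m U l := by
    intro l
    exact Finset.sum_nonneg fun j _ => mul_nonneg (cw_nonneg m U (by linarith) j) (norm_nonneg _)
  calc _ ≤ ∑ i ∈ Icc 1 H ×ˢ Dd, ∑ q ∈ US m (2 ^ (j+1)), A1 * (2 * T * ZZ m U (lam m a i * (q : ZMod m)⁻¹)) := by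
        apply Finset.sum_le_sum
        intro i _
        refine (norm_sum_le _ _).trans (Finset.sum_le_sum ?_)
        intro q hq
        simp only [mul_assoc]
        rw [← Finset.mul_sum, norm_mul]
        split_ifs with hcond
        · obtain ⟨hc1, hc2, hc3⟩ := hcond
          refine mul_le_mul (hc q hc3) ?_ (norm_nonneg _) hA1.le
          have hYm : x / q ≤ m := (Nat.div_le_self _ _).trans c.x_le
          have hYU : ((x / q : ℕ):ℝ) ≤ U := by
            have h1 : 2 ^ j ≤ q := hc1 ▸ Nat.pow_log_le_self 2 (show q ≠ 0 by omega)
            have h2 : x / q ≤ x / 2 ^ j := Nat.div_le_div_left h1 (by positivity)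
            have e0 : ((2 ^ j : ℕ) : ℝ) = Real.exp (j * Real.log 2) := by
              rw [Real.exp_nat_mul, Real.exp_log (by norm_num)]; push_cast; rfl
            calc ((x / q : ℕ):ℝ) ≤ ((x / 2 ^ j : ℕ) : ℝ) := by exact_mod_cast h2
              _ ≤ (x:ℝ) / (2 ^ j : ℕ) := Nat.cast_div_le
              _ ≤ Real.exp (3 / 4 * L + n) / Real.exp (j * Real.log 2) := by rw [e0]; gcongr; exact c.hx
              _ = U := by rw [← Real.exp_sub, hU]; congr 1; ring
          have hcomm : ∀ r : ℕ, lam m a i * ((r : ZMod m)⁻¹ * (q : ZMod m)⁻¹) = lam m a i * (q : ZMod m)⁻¹ * (r : ZMod m)⁻¹ := by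
            intro r; ring
          simp only [hcomm]
          have hZl := hZ (lam m a i * (q : ZMod m)⁻¹)
          rcases hb with h | h
          · simp only [h, one_mul]
            refine (pf_complete m hmp _ _ hYm U hYU).trans ?_
            rw [← mul_assoc]
            exact le_mul_of_one_le_left hZl (by linarith)
          · simp only [h]
            refine (pf_log m hmp _ _ hYm U hYU).trans ?_
            have : Real.log m ≤ T := by rw [c.hm, Real.log_exp]; exact c.hTL
            rw [← mul_assoc]
            gcongr
        · simp only [norm_zero, zero_mul]
          have := hZ (lam m a i * (q : ZMod m)⁻¹)
          positivity
    _ = A1 * (2 * T * ∑ i ∈ Icc 1 H ×ˢ Dd, ∑ q ∈ US m (2 ^ (j+1)), ZZ m U (lam m a i * (q : ZMod m)⁻¹)) := by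
        simp only [Finset.mul_sum]
    _ ≤ A1 * (2 * T * Real.exp (v + (3 / 4 * L + n) - e / 400)) := by gcongr
    _ ≤ A1 * T * (2 * T * Real.exp (v + (3 / 4 * L + n) - e / 400)) := by
        gcongr
        exact le_mul_of_one_le_right hA1.le (by linarith)

end

section

open Finset

set_option linter.unusedVariables false

open ArithmeticFunction in
/-- truncation of an arithmetic function to a set -/
noncomputable def atr (f : ArithmeticFunction ℝ) (P : ℕ → Prop) [DecidablePred P] : ArithmeticFunction ℝ :=
  ⟨fun n => if P n then f n else 0, by simp⟩

theorem atr_apply (f : ArithmeticFunction ℝ) (P : ℕ → Prop) [DecidablePred P] (n : ℕ) :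
    atr f P n = if P n then f n else 0 := rfl

theorem atr_add (f : ArithmeticFunction ℝ) (P : ℕ → Prop) [DecidablePred P] :
    f = atr f P + atr f (fun n => ¬ P n) := by
  ext n
  simp only [ArithmeticFunction.add_apply, atr_apply]
  split_ifs <;> simp

noncomputable def afM : ArithmeticFunction ℝ := ((ArithmeticFunction.moebius : ArithmeticFunction ℤ) : ArithmeticFunction ℝ)
noncomputable def afZ : ArithmeticFunction ℝ := ((ArithmeticFunction.zeta : ArithmeticFunction ℕ) : ArithmeticFunction ℝ)
noncomputable def afL : ArithmeticFunction ℝ := ArithmeticFunction.vonMangoldt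

theorem afL_mul : afL * afZ = ArithmeticFunction.log := ArithmeticFunction.vonMangoldt_mul_zeta
theorem afM_mul : afM * afZ = 1 := ArithmeticFunction.coe_moebius_mul_coe_zeta
theorem afM_le (n : ℕ) : |afM n| ≤ 1 := by
  have := ArithmeticFunction.abs_moebius_le_one (n := n)
  have h : ((|ArithmeticFunction.moebius n| : ℤ) : ℝ) ≤ ((1 : ℤ) : ℝ) := by exact_mod_cast this
  simpa [afM] using h
theorem afZ_apply (n : ℕ) (hn : n ≠ 0) : afZ n = 1 := by
  simp [afZ, ArithmeticFunction.zeta_apply, hn]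
theorem afL_nonneg (n : ℕ) : 0 ≤ afL n := ArithmeticFunction.vonMangoldt_nonneg
theorem afL_le (n : ℕ) : afL n ≤ Real.log n := ArithmeticFunction.vonMangoldt_le_log

theorem vaughan (P : ℕ → Prop) [DecidablePred P] :
    afL = atr afL P + atr afM P * ArithmeticFunction.log -
      (atr afL P * atr afM P) * afZ
      + atr afL (fun n => ¬ P n) * (atr afM (fun n => ¬ P n) * afZ) := by
  have h1 := atr_add afL P
  have h2 := atr_add afM P
  have h3 := afL_mul
  have h4 := afM_mul
  generalize atr afL P = LA at *
  generalize atr afL (fun n => ¬ P n) = LB at *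
  generalize atr afM P = MA at *
  generalize atr afM (fun n => ¬ P n) = MB at *
  have h5 : LB = LB * ((MA + MB) * afZ) := by rw [← h2, h4, mul_one]
  rw [← h3]
  rw [h1]
  linear_combination h5

theorem conv_bound (P : ℕ → Prop) [DecidablePred P] (n : ℕ) : |(atr afL P * atr afM P) n| ≤ Real.log n := by
  rw [ArithmeticFunction.mul_apply]
  have h : Real.log n = (afL * afZ) n := by rw [afL_mul]; rfl
  rw [h, ArithmeticFunction.mul_apply]
  refine (Finset.abs_sum_le_sum_abs _ _).trans (Finset.sum_le_sum ?_)
  rintro ⟨q, r⟩ hz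
  rw [Nat.mem_divisorsAntidiagonal] at hz
  obtain ⟨h1, h2⟩ := hz
  dsimp only at h1 ⊢
  have hr : r ≠ 0 := by rintro rfl; simp at h1; omega
  rw [afZ_apply r hr, abs_mul, mul_one, atr_apply, atr_apply]
  have a1 := afL_nonneg q
  have a2 := afM_le r
  split_ifs <;> simp [abs_of_nonneg a1, a1]
  exact mul_le_of_le_one_right a1 a2

theorem conv_supp (y : ℕ) (n : ℕ) (h : (atr afL (· ≤ y) * atr afM (· ≤ y)) n ≠ 0) : n ≤ y * y := by
  rw [ArithmeticFunction.mul_apply] at h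
  obtain ⟨⟨q, r⟩, hz, hne⟩ := Finset.exists_ne_zero_of_sum_ne_zero h
  rw [Nat.mem_divisorsAntidiagonal] at hz
  simp only [atr_apply] at hne hz
  have h1 : q ≤ y := by by_contra h1; simp [h1] at hne
  have h2 : r ≤ y := by by_contra h2; simp [h2] at hne
  rw [← hz.1]; exact Nat.mul_le_mul h1 h2

theorem hh_bound (P : ℕ → Prop) [DecidablePred P] (n : ℕ) : |(atr afM P * afZ) n| ≤ (n.divisors.card : ℝ) := by
  rw [ArithmeticFunction.mul_apply]
  refine (Finset.abs_sum_le_sum_abs _ _).trans ?_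
  rw [Nat.sum_divisorsAntidiagonal (fun a b => |atr afM P a * afZ b|)]
  refine (Finset.sum_le_card_nsmul _ _ 1 ?_).trans (by simp)
  intro d hd
  have hn : n ≠ 0 := (Nat.mem_divisors.1 hd).2
  have hd' := (Nat.mem_divisors.1 hd).1
  rw [afZ_apply _ (Nat.div_pos (Nat.le_of_dvd (Nat.pos_of_ne_zero hn) hd') (Nat.pos_of_dvd_of_pos hd' (Nat.pos_of_ne_zero hn))).ne', mul_one, atr_apply]
  split_ifs
  · exact afM_le d
  · simp

theorem hh_supp (y : ℕ) (n : ℕ) (h : (atr afM (fun n => ¬ n ≤ y) * afZ) n ≠ 0) : y < n := by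
  rw [ArithmeticFunction.mul_apply] at h
  obtain ⟨⟨q, r⟩, hz, hne⟩ := Finset.exists_ne_zero_of_sum_ne_zero h
  rw [Nat.mem_divisorsAntidiagonal] at hz
  simp only [atr_apply] at hne hz
  by_contra hle
  have h1 : q ≤ n := Nat.le_of_dvd (Nat.pos_of_ne_zero hz.2) ⟨r, hz.1.symm⟩
  rw [if_neg (by omega)] at hne
  simp at hne

/-- hyperbola-type reindexing -/
theorem US_conv {M : Type*} [AddCommMonoid M] (m x : ℕ) (g : ℕ → ℕ → M) :
    ∑ n ∈ US m x, ∑ z ∈ n.divisorsAntidiagonal, g z.1 z.2 = ∑ q ∈ US m x, ∑ r ∈ US m (x / q), g q r := by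
  rw [Finset.sum_sigma', Finset.sum_sigma']
  refine Finset.sum_bij' (fun z _ => ⟨z.2.1, z.2.2⟩) (fun z _ => ⟨z.1 * z.2, (z.1, z.2)⟩) ?_ ?_ ?_ ?_ ?_
  · rintro ⟨n, q, r⟩ h
    simp only [Finset.mem_sigma, mem_US, Nat.mem_divisorsAntidiagonal] at h ⊢
    obtain ⟨⟨h1, h2, h3⟩, h4, h5⟩ := h
    subst h4
    have hq : 1 ≤ q := Nat.one_le_iff_ne_zero.2 (by rintro rfl; simp at h5)
    have hr : 1 ≤ r := Nat.one_le_iff_ne_zero.2 (by rintro rfl; simp at h5)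
    refine ⟨⟨hq, ?_, Nat.Coprime.coprime_mul_right h3⟩, hr, ?_, Nat.Coprime.coprime_mul_left h3⟩
    · exact (Nat.le_mul_of_pos_right q hr).trans h2
    · rw [Nat.le_div_iff_mul_le hq, mul_comm]; exact h2
  · rintro ⟨q, r⟩ h
    simp only [Finset.mem_sigma, mem_US, Nat.mem_divisorsAntidiagonal] at h ⊢
    obtain ⟨⟨h1, h2, h3⟩, h4, h5, h6⟩ := h
    rw [Nat.le_div_iff_mul_le h1] at h5
    refine ⟨⟨Nat.mul_pos h1 h4, by rw [mul_comm]; exact h5, Nat.Coprime.mul_left h3 h6⟩, trivial, ?_⟩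
    exact (Nat.mul_pos h1 h4).ne'
  · rintro ⟨n, q, r⟩ h
    simp only [Finset.mem_sigma, mem_US, Nat.mem_divisorsAntidiagonal] at h ⊢
    obtain ⟨⟨h1, h2, h3⟩, h4, h5⟩ := h
    subst h4; rfl
  · rintro ⟨q, r⟩ h; rfl
  · rintro ⟨n, q, r⟩ h; rfl

theorem inv_mul_cop {m q r : ℕ} (hq : Nat.Coprime q m) (hr : Nat.Coprime r m) :
    (((q * r : ℕ) : ZMod m))⁻¹ = (r : ZMod m)⁻¹ * (q : ZMod m)⁻¹ := by
  have h1 := ZMod.coe_mul_inv_eq_one q hq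
  have h2 := ZMod.coe_mul_inv_eq_one r hr
  have h3 := ZMod.coe_mul_inv_eq_one (q * r) (hq.mul_left hr)
  push_cast at h3 ⊢
  linear_combination (r : ZMod m)⁻¹ * (q : ZMod m)⁻¹ * h3 - ((q : ZMod m) * r)⁻¹ * ((r : ZMod m) * (r : ZMod m)⁻¹ * h1 + h2)

theorem conv_sum (m x : ℕ) [NeZero m] (f g : ArithmeticFunction ℝ) (l : ZMod m) :
    ∑ n ∈ US m x, (((f * g) n : ℝ) : ℂ) * ZMod.stdAddChar (l * (n : ZMod m)⁻¹) =
    ∑ q ∈ US m x, ∑ r ∈ US m (x / q), ((f q : ℝ) : ℂ) * ((g r : ℝ) : ℂ) *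
      ZMod.stdAddChar (l * (r : ZMod m)⁻¹ * (q : ZMod m)⁻¹) := by
  rw [← US_conv m x (fun q r => ((f q : ℝ) : ℂ) * ((g r : ℝ) : ℂ) *
      ZMod.stdAddChar (l * (r : ZMod m)⁻¹ * (q : ZMod m)⁻¹))]
  apply Finset.sum_congr rfl
  intro n hn
  rw [ArithmeticFunction.mul_apply]
  push_cast
  rw [Finset.sum_mul]
  apply Finset.sum_congr rfl
  rintro ⟨q, r⟩ hz
  rw [Nat.mem_divisorsAntidiagonal] at hz
  obtain ⟨h1, h2⟩ := hz
  have h3 := (mem_US.1 hn).2.2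
  dsimp only at h1 ⊢
  subst h1
  rw [inv_mul_cop (Nat.Coprime.coprime_mul_right h3) (Nat.Coprime.coprime_mul_left h3), mul_assoc l]

variable {m T x H E : ℕ} {Dd : Finset ℕ} {L t e n v w : ℝ}

theorem Ctx.card_le (c : Ctx m T x H E Dd L t e n v w) :
    ((#(Icc 1 H ×ˢ Dd) : ℕ) : ℝ) ≤ Real.exp (v + t + e / 1000 + w) := by
  rw [Finset.card_product]
  push_cast
  rw [Real.exp_add _ w]
  have h1 := c.hH
  have h2 := c.hF
  simp only [Nat.card_Icc, add_tsub_cancel_right]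
  gcongr

theorem stdAddChar_norm (m : ℕ) [NeZero m] (l : ZMod m) : ‖(ZMod.stdAddChar l : ℂ)‖ = 1 := pb_norm m l

theorem Ctx.triv (c : Ctx m T x H E Dd L t e n v w) [NeZero m] (a : ZMod m) (f : ℕ → ℂ) (K g : ℝ)
    (hf : ∑ n ∈ US m x, ‖f n‖ ≤ K) (hK : K ≤ Real.exp g) (hg : t + e / 1000 + w + g ≤ 3 / 4 * L + n - e / 400) :
    ∑ i ∈ Icc 1 H ×ˢ Dd, ‖∑ n ∈ US m x, f n * ZMod.stdAddChar (lam m a i * (n : ZMod m)⁻¹)‖ ≤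
      Real.exp (v + (3 / 4 * L + n) - e / 400) := by
  calc _ ≤ ∑ i ∈ Icc 1 H ×ˢ Dd, K := by
        apply Finset.sum_le_sum
        intro i _
        refine (norm_sum_le _ _).trans (le_trans (le_of_eq ?_) hf)
        apply Finset.sum_congr rfl
        intro n _
        rw [norm_mul, stdAddChar_norm, mul_one]
    _ = #(Icc 1 H ×ˢ Dd) * K := by rw [Finset.sum_const, nsmul_eq_mul]
    _ ≤ Real.exp (v + t + e / 1000 + w) * Real.exp g := by
        have h0 : 0 ≤ K := le_trans (Finset.sum_nonneg fun _ _ => norm_nonneg _) hf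
        have := c.card_le
        gcongr
    _ = Real.exp (v + t + e / 1000 + w + g) := (Real.exp_add _ _).symm
    _ ≤ _ := Real.exp_le_exp.2 (by linarith)

theorem af_sub_apply (f g : ArithmeticFunction ℝ) (n : ℕ) : (f - g) n = f n - g n := by
  rw [sub_eq_add_neg, ArithmeticFunction.add_apply, ArithmeticFunction.neg_apply, sub_eq_add_neg]

theorem Ctx.star (c : Ctx m T x H E Dd L t e n v w) [NeZero m] (a : ZMod m) (ha : IsUnit a) :
    ∑ i ∈ Icc 1 H ×ˢ Dd, ‖∑ p ∈ US m x, ((if p.Prime then Real.log p else 0 : ℝ) : ℂ) *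
        ZMod.stdAddChar (lam m a i * (p : ZMod m)⁻¹)‖ ≤
      Real.exp (v + (3 / 4 * L + n) - e / 1000) := by
  obtain ⟨G, hG⟩ : ∃ G, G = v + (3 / 4 * L + n) - e / 400 := ⟨_, rfl⟩
  have hTp := c.Tpos
  have ht := c.ht; have he := c.he; have hL := c.L_pos; have hn := c.hn; have hw := c.hw
  have heL := c.e_large
  have hTe := c.hTe
  have hxm : x ≤ m := c.x_le
  obtain ⟨y, hy⟩ : ∃ y, y = ⌊Real.exp (L / 4)⌋₊ := ⟨_, rfl⟩
  have hy1 : (y:ℝ) ≤ Real.exp (L / 4) := by rw [hy]; exact Nat.floor_le (Real.exp_pos _).le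
  have hy2 : ∀ q : ℕ, y < q → Real.exp (L / 4) ≤ q := by
    intro q hq
    have := Nat.lt_floor_add_one (Real.exp (L / 4))
    rw [← hy] at this
    have h2 : (y:ℝ) + 1 ≤ q := by exact_mod_cast hq
    linarith
  have hexp2 : Real.exp (L / 2) = Real.exp (L / 4) * Real.exp (L / 4) := by
    rw [← Real.exp_add]; congr 1; ring
  have hexp1 : Real.exp L = Real.exp (L / 2) * Real.exp (L / 2) := by
    rw [← Real.exp_add]; congr 1; ring
  -- prime powers
  have hP0 : ∑ i ∈ Icc 1 H ×ˢ Dd, ‖∑ n ∈ US m x, ((if n.Prime then 0 else afL n : ℝ) : ℂ) *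
      ZMod.stdAddChar (lam m a i * (n : ZMod m)⁻¹)‖ ≤ Real.exp G := by
    rw [hG]
    rcases Nat.eq_zero_or_pos x with h0 | h0
    · have := c.hx2
      rw [h0] at this
      have := Real.exp_pos (3 / 4 * L + n)
      simp at *
      linarith
    refine c.triv a _ (2 * √x * Real.log x) ((3 / 4 * L + n) / 2 + 2 * (e / 10000)) ?_ ?_ ?_
    · refine le_trans ?_ (Chebyshev.psi_sub_theta_le (x := x) (by exact_mod_cast h0))
      rw [Chebyshev.psi_sub_theta_eq_sum_not_prime]
      simp only [Nat.floor_natCast]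
      have : ∀ n : ℕ, ‖(((if n.Prime then 0 else afL n : ℝ)) : ℂ)‖ = if ¬ n.Prime then afL n else 0 := by
        intro n
        rw [Complex.norm_real]
        split_ifs <;> simp [afL_nonneg]
      simp only [this]
      rw [← Finset.sum_filter]
      apply Finset.sum_le_sum_of_subset_of_nonneg
      · intro n hn
        simp only [Finset.mem_filter, mem_US, Finset.mem_Ioc] at hn ⊢
        exact ⟨⟨by omega, hn.1.2.1⟩, hn.2⟩
      · intro n _ _; exact afL_nonneg n
    · have h1 : √(x:ℝ) ≤ Real.exp ((3 / 4 * L + n) / 2) := by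
        rw [Real.exp_half]; exact Real.sqrt_le_sqrt c.hx
      have h2 := c.log_le x le_rfl
      calc 2 * √(x:ℝ) * Real.log x ≤ Real.exp (e / 10000) * Real.exp ((3 / 4 * L + n) / 2) * Real.exp (e / 10000) := by
            have h3 : (2:ℝ) ≤ Real.exp (e / 10000) := by linarith
            have h4 : Real.log x ≤ Real.exp (e / 10000) := by linarith
            have h5 := Real.log_natCast_nonneg x
            exact mul_le_mul (mul_le_mul h3 h1 (Real.sqrt_nonneg _) (by linarith)) h4 h5 (by positivity)
        _ = _ := by rw [← Real.exp_add, ← Real.exp_add]; congr 1; ring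
    · linarith
  have hV0 : ∑ i ∈ Icc 1 H ×ˢ Dd, ‖∑ n ∈ US m x, ((atr afL (· ≤ y) n : ℝ) : ℂ) *
      ZMod.stdAddChar (lam m a i * (n : ZMod m)⁻¹)‖ ≤ Real.exp G := by
    rw [hG]
    refine c.triv a _ (Real.exp (L / 4) * T) (L / 4 + e / 10000) ?_ ?_ ?_
    · calc _ ≤ ∑ n ∈ US m x, if n ∈ Icc 1 y then (T:ℝ) else 0 := by
            apply Finset.sum_le_sum
            intro n hn
            obtain ⟨h1, h2, h3⟩ := mem_US.1 hn
            rw [Complex.norm_real, atr_apply]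
            by_cases h : n ≤ y
            · rw [if_pos h, if_pos (Finset.mem_Icc.2 ⟨h1, h⟩), Real.norm_of_nonneg (afL_nonneg n)]
              exact (afL_le n).trans (c.log_le n h2)
            · rw [if_neg h, if_neg (fun h' => h (Finset.mem_Icc.1 h').2)]; simp
        _ = ∑ n ∈ (US m x).filter (· ∈ Icc 1 y), (T:ℝ) := by rw [Finset.sum_filter]
        _ ≤ ∑ n ∈ Icc 1 y, (T:ℝ) := by
            apply Finset.sum_le_sum_of_subset_of_nonneg
            · intro n hn; exact (Finset.mem_filter.1 hn).2
            · intros; positivity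
        _ = y * T := by simp
        _ ≤ _ := by gcongr
    · rw [Real.exp_add]; gcongr
    · linarith
  have hV1 : ∑ i ∈ Icc 1 H ×ˢ Dd, ‖∑ n ∈ US m x, (((atr afM (· ≤ y) * ArithmeticFunction.log) n : ℝ) : ℂ) *
      ZMod.stdAddChar (lam m a i * (n : ZMod m)⁻¹)‖ ≤ 3 * T * (1 * T * (2 * T * Real.exp G)) := by
    simp only [conv_sum]
    rw [hG]
    refine c.bilsmooth a ha _ _ 1 one_pos ?_ ?_ (Or.inr fun r => rfl)
    · intro q hq
      rw [Complex.norm_real, atr_apply]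
      split_ifs
      · exact afM_le q
      · simp
    · intro q hq hne
      rw [atr_apply] at hne
      have : q ≤ y := by by_contra h; simp [h] at hne
      have h1 : (q:ℝ) ≤ y := by exact_mod_cast this
      have h2 : Real.exp (L / 4) ≤ Real.exp (L / 2) := Real.exp_le_exp.2 (by linarith)
      linarith
  have hV2 : ∑ i ∈ Icc 1 H ×ˢ Dd, ‖∑ n ∈ US m x, ((((atr afL (· ≤ y) * atr afM (· ≤ y)) * afZ) n : ℝ) : ℂ) *
      ZMod.stdAddChar (lam m a i * (n : ZMod m)⁻¹)‖ ≤ 3 * T * (T * T * (2 * T * Real.exp G)) := by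
    have : ∀ i, ∑ n ∈ US m x, ((((atr afL (· ≤ y) * atr afM (· ≤ y)) * afZ) n : ℝ) : ℂ) *
      ZMod.stdAddChar (lam m a i * (n : ZMod m)⁻¹) = ∑ q ∈ US m x, ∑ r ∈ US m (x / q),
        (((atr afL (· ≤ y) * atr afM (· ≤ y)) q : ℝ) : ℂ) * (fun _ => (1:ℂ)) r *
        ZMod.stdAddChar (lam m a i * (r : ZMod m)⁻¹ * (q : ZMod m)⁻¹) := by
      intro i
      rw [conv_sum]
      refine Finset.sum_congr rfl fun q hq => Finset.sum_congr rfl fun r hr => ?_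
      rw [afZ_apply r (by have := (mem_US.1 hr).1; omega)]
      simp
    simp only [this]
    rw [hG]
    refine c.bilsmooth a ha _ (fun _ => (1:ℂ)) T (by linarith) ?_ ?_ (Or.inl fun r => rfl)
    · intro q hq
      rw [Complex.norm_real]
      exact (conv_bound _ q).trans (c.log_le q hq)
    · intro q hq hne
      have hne' : (atr afL (· ≤ y) * atr afM (· ≤ y)) q ≠ 0 := by
        intro h; apply hne; rw [h]; simp
      have := conv_supp y q hne'
      have h1 : (q:ℝ) ≤ (y:ℝ) * y := by exact_mod_cast this
      rw [hexp2]
      refine h1.trans ?_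
      gcongr
  have hV3 : ∑ i ∈ Icc 1 H ×ˢ Dd, ‖∑ n ∈ US m x, (((atr afL (fun n => ¬ n ≤ y) * (atr afM (fun n => ¬ n ≤ y) * afZ)) n : ℝ) : ℂ) *
      ZMod.stdAddChar (lam m a i * (n : ZMod m)⁻¹)‖ ≤ 2 * (3 * T * (T * T * (2 * T * Real.exp G))) := by
    classical
    obtain ⟨hf, hhf⟩ : ∃ hf, hf = atr afM (fun n => ¬ n ≤ y) * afZ := ⟨_, rfl⟩
    rw [← hhf]
    have hb : ∀ r ≤ x, |hf r| ≤ T := by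
      intro r hr
      rcases Nat.eq_zero_or_pos r with h0 | h0
      · rw [h0]; simp
      · rw [hhf]
        refine (hh_bound _ r).trans ?_
        exact_mod_cast c.hT r h0 (hr.trans (hxm.trans (Nat.le_self_pow (by norm_num) m)))
    obtain ⟨P, hP⟩ : ∃ P : ℕ → Prop, P = fun q : ℕ => (q:ℝ) ≤ Real.exp (L / 2) := ⟨_, rfl⟩
    have hA : ∀ q ≤ x, ∀ P' : ℕ → Prop, [DecidablePred P'] → ‖((atr (atr afL (fun n => ¬ n ≤ y)) P' q : ℝ) : ℂ)‖ ≤ T := by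
      intro q hq P' _
      rw [Complex.norm_real, atr_apply, atr_apply]
      split_ifs <;> first
        | (simp; done)
        | (rw [Real.norm_of_nonneg (afL_nonneg q)]; exact (afL_le q).trans (c.log_le q hq))
    have hsplit := atr_add (atr afL (fun n => ¬ n ≤ y)) P
    have hB : atr (atr afL (fun n => ¬ n ≤ y)) (fun q => ¬ P q) * hf =
      hf * atr (atr afL (fun n => ¬ n ≤ y)) (fun q => ¬ P q) := mul_comm _ _
    rw [hsplit, add_mul, hB]
    have h1 : ∑ i ∈ Icc 1 H ×ˢ Dd, ‖∑ n ∈ US m x, (((atr (atr afL (fun n => ¬ n ≤ y)) P * hf) n : ℝ) : ℂ) *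
      ZMod.stdAddChar (lam m a i * (n : ZMod m)⁻¹)‖ ≤ 3 * T * (T * T * (2 * T * Real.exp G)) := by
      simp only [conv_sum]
      rw [hG]
      refine c.bilgen a ha _ _ T T (by linarith) (by linarith) (fun q hq => hA q hq P) ?_ ?_
      · intro q hq hne
        rw [atr_apply, atr_apply] at hne
        have h1 : P q := by by_contra h; simp [h] at hne
        have h2 : ¬ q ≤ y := by by_contra h; simp [h] at hne
        rw [hP] at h1
        exact ⟨hy2 q (by omega), h1⟩
      · intro r hr
        rw [Complex.norm_real]; exact hb r hr
    have h2 : ∑ i ∈ Icc 1 H ×ˢ Dd, ‖∑ n ∈ US m x, (((hf * atr (atr afL (fun n => ¬ n ≤ y)) (fun q => ¬ P q)) n : ℝ) : ℂ) *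
      ZMod.stdAddChar (lam m a i * (n : ZMod m)⁻¹)‖ ≤ 3 * T * (T * T * (2 * T * Real.exp G)) := by
      have : ∀ i, ∑ n ∈ US m x, (((hf * atr (atr afL (fun n => ¬ n ≤ y)) (fun q => ¬ P q)) n : ℝ) : ℂ) *
        ZMod.stdAddChar (lam m a i * (n : ZMod m)⁻¹) = ∑ q ∈ US m x, ∑ r ∈ US m (x / q),
        ((atr hf P q : ℝ) : ℂ) * ((atr (atr afL (fun n => ¬ n ≤ y)) (fun q => ¬ P q) r : ℝ) : ℂ) *
        ZMod.stdAddChar (lam m a i * (r : ZMod m)⁻¹ * (q : ZMod m)⁻¹) := by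
        intro i
        rw [conv_sum]
        refine Finset.sum_congr rfl fun q hq => Finset.sum_congr rfl fun r hr => ?_
        by_cases hPq : P q
        · rw [atr_apply hf, if_pos hPq]
        · by_cases hPr : P r
          · have : atr (atr afL (fun n => ¬ n ≤ y)) (fun q => ¬ P q) r = 0 := by
              rw [atr_apply]; simp [hPr]
            rw [this]; simp
          · exfalso
            rw [hP] at hPq hPr
            push Not at hPq hPr
            obtain ⟨q1, q2, q3⟩ := mem_US.1 hq
            have r2 := (mem_US.1 hr).2.1
            rw [Nat.le_div_iff_mul_le q1] at r2
            have h3 : (r:ℝ) * q ≤ m := by exact_mod_cast r2.trans hxm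
            rw [c.hm, hexp1] at h3
            have h4 : Real.exp (L / 2) * Real.exp (L / 2) < r * q :=
              mul_lt_mul'' hPr hPq (Real.exp_pos _).le (Real.exp_pos _).le
            linarith
      simp only [this]
      rw [hG]
      refine c.bilgen a ha _ _ T T (by linarith) (by linarith) ?_ ?_ (fun q hq => hA q hq _)
      · intro q hq
        rw [Complex.norm_real, atr_apply]
        split_ifs
        · exact hb q hq
        · simp
      · intro q hq hne
        rw [atr_apply] at hne
        have h1 : P q := by by_contra h; simp [h] at hne
        have h2 : hf q ≠ 0 := by intro h; simp [h] at hne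
        rw [hhf] at h2
        rw [hP] at h1
        exact ⟨hy2 q (hh_supp y q h2), h1⟩
    refine le_trans ?_ (le_of_le_of_eq (add_le_add h1 h2) (two_mul _).symm)
    rw [← Finset.sum_add_distrib]
    apply Finset.sum_le_sum
    intro i _
    refine le_trans (le_of_eq ?_) (norm_add_le _ _)
    rw [← Finset.sum_add_distrib]
    congr 1
    apply Finset.sum_congr rfl
    intro n _
    rw [ArithmeticFunction.add_apply]
    push_cast; ring
  -- assemble
  have hid : ∀ i, ∑ p ∈ US m x, ((if p.Prime then Real.log p else 0 : ℝ) : ℂ) *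
        ZMod.stdAddChar (lam m a i * (p : ZMod m)⁻¹) =
      (∑ n ∈ US m x, ((atr afL (· ≤ y) n : ℝ) : ℂ) * ZMod.stdAddChar (lam m a i * (n : ZMod m)⁻¹)) +
      (∑ n ∈ US m x, (((atr afM (· ≤ y) * ArithmeticFunction.log) n : ℝ) : ℂ) * ZMod.stdAddChar (lam m a i * (n : ZMod m)⁻¹)) -
      (∑ n ∈ US m x, ((((atr afL (· ≤ y) * atr afM (· ≤ y)) * afZ) n : ℝ) : ℂ) * ZMod.stdAddChar (lam m a i * (n : ZMod m)⁻¹)) +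
      (∑ n ∈ US m x, (((atr afL (fun n => ¬ n ≤ y) * (atr afM (fun n => ¬ n ≤ y) * afZ)) n : ℝ) : ℂ) * ZMod.stdAddChar (lam m a i * (n : ZMod m)⁻¹)) -
      (∑ n ∈ US m x, ((if n.Prime then 0 else afL n : ℝ) : ℂ) * ZMod.stdAddChar (lam m a i * (n : ZMod m)⁻¹)) := by
    intro i
    rw [← Finset.sum_add_distrib, ← Finset.sum_sub_distrib, ← Finset.sum_add_distrib, ← Finset.sum_sub_distrib]
    apply Finset.sum_congr rfl
    intro n _
    have h := congrArg (fun f : ArithmeticFunction ℝ => f n) (vaughan (· ≤ y))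
    simp only [ArithmeticFunction.add_apply, af_sub_apply] at h
    have h2 : (if n.Prime then Real.log n else 0 : ℝ) = afL n - (if n.Prime then 0 else afL n : ℝ) := by
      split_ifs with hp
      · rw [sub_zero]; exact (ArithmeticFunction.vonMangoldt_apply_prime hp).symm
      · simp
    rw [h2]
    generalize (if n.Prime then 0 else afL n : ℝ) = u
    rw [h]
    push_cast; ring
  have htri : ∀ A B C D F : ℂ, ‖A + B - C + D - F‖ ≤ ‖A‖ + ‖B‖ + ‖C‖ + ‖D‖ + ‖F‖ := by
    intro A B C D F
    have h1 := norm_sub_le (A + B - C + D) F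
    have h2 := norm_add_le (A + B - C) D
    have h3 := norm_sub_le (A + B) C
    have h4 := norm_add_le A B
    linarith
  simp only [hid]
  refine (Finset.sum_le_sum fun i _ => htri _ _ _ _ _).trans ?_
  simp only [Finset.sum_add_distrib]
  have hfin : Real.exp G + 3 * T * (1 * T * (2 * T * Real.exp G)) + 3 * T * (T * T * (2 * T * Real.exp G)) +
      2 * (3 * T * (T * T * (2 * T * Real.exp G))) + Real.exp G ≤ (T:ℝ) ^ 5 * Real.exp G := by
    have h1 : (1000:ℝ) * (T:ℝ) ^ 4 ≤ (T:ℝ) ^ 5 := by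
      calc (1000:ℝ) * (T:ℝ) ^ 4 ≤ T * T ^ 4 := by gcongr
        _ = _ := by ring
    have h2 : (T:ℝ) ^ 3 ≤ (T:ℝ) ^ 4 := pow_le_pow_right₀ (by linarith) (by norm_num)
    have h3 : (1:ℝ) ≤ (T:ℝ) ^ 4 := one_le_pow₀ (by linarith)
    have h4 : 2 + 6 * (T:ℝ) ^ 3 + 18 * (T:ℝ) ^ 4 ≤ (T:ℝ) ^ 5 := by linarith
    calc _ = (2 + 6 * (T:ℝ) ^ 3 + 18 * (T:ℝ) ^ 4) * Real.exp G := by ring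
      _ ≤ _ := by gcongr
  have hfin2 : (T:ℝ) ^ 5 * Real.exp G ≤ Real.exp (v + (3 / 4 * L + n) - e / 1000) := by
    calc (T:ℝ) ^ 5 * Real.exp G ≤ Real.exp (e / 10000) ^ 5 * Real.exp G := by gcongr
      _ = Real.exp (5 * (e / 10000) + G) := by rw [← Real.exp_nat_mul, ← Real.exp_add]; norm_num
      _ ≤ _ := Real.exp_le_exp.2 (by rw [hG]; linarith)
  linarith

end

section

open Finset

set_option linter.unusedVariables false

noncomputable def wt (p : ℕ) : ℝ := if p.Prime then Real.log p else 0

theorem wt_nonneg (p : ℕ) : 0 ≤ wt p := by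
  unfold wt; split_ifs
  · exact Real.log_natCast_nonneg p
  · exact le_rfl

noncomputable def Psi (m x : ℕ) : ℝ := ∑ p ∈ US m x, wt p

theorem Psi_nonneg (m x : ℕ) : 0 ≤ Psi m x := Finset.sum_nonneg fun p _ => wt_nonneg p

noncomputable def SS (m x : ℕ) [NeZero m] (z : ZMod m) : ℂ :=
  ∑ p ∈ US m x, ((wt p : ℝ) : ℂ) * ZMod.stdAddChar (z * (p : ZMod m)⁻¹)

theorem SS_zero (m x : ℕ) [NeZero m] : SS m x 0 = ((Psi m x : ℝ) : ℂ) := by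
  unfold SS Psi; simp

theorem SS_le (m x : ℕ) [NeZero m] (z : ZMod m) : ‖SS m x z‖ ≤ Psi m x := by
  unfold SS Psi
  refine (norm_sum_le _ _).trans (Finset.sum_le_sum fun p _ => ?_)
  rw [norm_mul, pb_norm, mul_one, Complex.norm_real, Real.norm_of_nonneg (wt_nonneg p)]

theorem SS_neg (m x : ℕ) [NeZero m] (z : ZMod m) : ‖SS m x (-z)‖ = ‖SS m x z‖ := by
  have : SS m x (-z) = (starRingEnd ℂ) (SS m x z) := by
    unfold SS
    rw [map_sum]
    refine Finset.sum_congr rfl fun p _ => ?_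
    rw [map_mul (starRingEnd ℂ), pb_conj, Complex.conj_ofReal]
    congr 2; ring
  rw [this]; exact RCLike.norm_conj _

def FJ (J K : ℕ) : Finset (Fin J → ℕ) := Fintype.piFinset fun _ => Icc 1 K

noncomputable def Aw (m x J : ℕ) (a : ZMod m) (f : Fin J → ℕ) : ℝ :=
  ∑ p ∈ US m x, if (p : ZMod m) * ((∑ i, f i : ℕ) : ZMod m) = a then wt p else 0

theorem Aw_nonneg (m x J : ℕ) (a : ZMod m) (f : Fin J → ℕ) : 0 ≤ Aw m x J a f := by
  unfold Aw
  refine Finset.sum_nonneg fun p _ => ?_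
  split_ifs
  · exact wt_nonneg p
  · exact le_rfl

noncomputable def Ad (m x J K : ℕ) (a : ZMod m) (d : ℕ) : ℝ :=
  ∑ f ∈ FJ J K with d ∣ ∑ i, f i, Aw m x J a f

theorem psi_lift (m d k c : ℕ) [NeZero m] [NeZero (d * m)] :
    ZMod.stdAddChar (((k * (d * c) : ℕ) : ZMod (d * m))) = ZMod.stdAddChar (((k * c : ℕ) : ZMod m)) := by
  have h1 := ZMod.stdAddChar_coe (N := d * m) ((k * (d * c) : ℕ) : ℤ)
  have h2 := ZMod.stdAddChar_coe (N := m) ((k * c : ℕ) : ℤ)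
  rw [Int.cast_natCast] at h1 h2
  rw [h1, h2]
  have hm : (m:ℂ) ≠ 0 := by exact_mod_cast NeZero.ne m
  have hd : (d:ℂ) ≠ 0 := by
    have := NeZero.ne (d * m)
    exact_mod_cast (mul_ne_zero_iff.1 this).1
  congr 1
  push_cast
  field_simp

theorem psi_lift' (m d c : ℕ) [NeZero m] [NeZero (d * m)] (j : ZMod (d * m)) :
    ZMod.stdAddChar (j * ((d * c : ℕ) : ZMod (d * m))) =
      ZMod.stdAddChar ((ZMod.castHom (Dvd.intro_left d rfl) (ZMod m) j) * (c : ZMod m)) := by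
  have h := psi_lift m d j.val c
  rw [Nat.cast_mul, Nat.cast_mul j.val c] at h
  rw [ZMod.natCast_val, ZMod.cast_id] at h
  rw [h]
  congr 2
  rw [ZMod.castHom_apply, ZMod.natCast_val]

theorem ind_iff (m d s p : ℕ) [NeZero m] [NeZero (d * m)] (hd : d.Coprime m) (hp : p.Coprime m) (a : ZMod m) :
    (s : ZMod (d * m)) - ((d * (a * (d : ZMod m)⁻¹ * (p : ZMod m)⁻¹).val : ℕ) : ZMod (d * m)) = 0 ↔
      d ∣ s ∧ (p : ZMod m) * (s : ZMod m) = a := by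
  obtain ⟨c, hc⟩ : ∃ c, c = (a * (d : ZMod m)⁻¹ * (p : ZMod m)⁻¹).val := ⟨_, rfl⟩
  have hc' : (c : ZMod m) = a * (d : ZMod m)⁻¹ * (p : ZMod m)⁻¹ := by
    rw [hc, ZMod.natCast_val, ZMod.cast_id]
  have hd1 := zm_unit hd
  have hp1 := zm_unit hp
  have hd0 : 0 < d := Nat.pos_of_ne_zero (mul_ne_zero_iff.1 (NeZero.ne (d * m))).1
  rw [← hc, sub_eq_zero, ZMod.natCast_eq_natCast_iff]
  constructor
  · intro h
    have h1 : d ∣ s := (Nat.ModEq.dvd_iff h (Dvd.intro m rfl)).2 (Dvd.intro c rfl)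
    refine ⟨h1, ?_⟩
    have h2 : s ≡ d * c [MOD m] := h.of_mul_left d
    rw [← ZMod.natCast_eq_natCast_iff] at h2
    rw [h2, Nat.cast_mul, hc']
    calc (p : ZMod m) * (d * (a * (d : ZMod m)⁻¹ * (p : ZMod m)⁻¹)) =
        a * (d * (d : ZMod m)⁻¹) * (p * (p : ZMod m)⁻¹) := by ring
      _ = a := by rw [hd1, hp1]; ring
  · rintro ⟨⟨r, rfl⟩, h⟩
    apply Nat.ModEq.mul_left'
    rw [← ZMod.natCast_eq_natCast_iff, hc', ← h, Nat.cast_mul]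
    calc (r : ZMod m) = r * (d * (d : ZMod m)⁻¹) * (p * (p : ZMod m)⁻¹) := by rw [hd1, hp1]; ring
      _ = _ := by ring

theorem ac_sum {M : ℕ} [NeZero M] {I : Type*} (s : Finset I) (ψ : AddChar (ZMod M) ℂ) (g : I → ZMod M) :
    ψ (∑ i ∈ s, g i) = ∏ i ∈ s, ψ (g i) := by
  classical
  induction s using Finset.induction_on with
  | empty => simp
  | insert i s hi ih => rw [Finset.sum_insert hi, Finset.prod_insert hi, AddChar.map_add_eq_mul, ih]

theorem Ad_fourier (m x J K d : ℕ) [NeZero m] [NeZero (d * m)] (hd : d.Coprime m) (a : ZMod m) :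
    (((d * m : ℕ) : ℂ)) * ((Ad m x J K a d : ℝ) : ℂ) = ∑ j : ZMod (d * m),
      (∑ t ∈ Icc 1 K, ZMod.stdAddChar (j * (t : ZMod (d * m)))) ^ J *
        SS m x (-(ZMod.castHom (Dvd.intro_left d rfl) (ZMod m) j * a * (d : ZMod m)⁻¹)) := by
  have hg : ∀ j : ZMod (d * m), (∑ t ∈ Icc 1 K, ZMod.stdAddChar (j * (t : ZMod (d * m)))) ^ J =
      ∑ f ∈ FJ J K, ZMod.stdAddChar (j * ((∑ i, f i : ℕ) : ZMod (d * m))) := by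
    intro j
    have := Finset.prod_univ_sum (fun _ : Fin J => Icc 1 K) (fun _ t => ZMod.stdAddChar (j * (t : ZMod (d * m))))
    rw [Finset.prod_const, Finset.card_univ, Fintype.card_fin] at this
    rw [this]
    unfold FJ
    refine Finset.sum_congr rfl fun f _ => ?_
    rw [Nat.cast_sum, Finset.mul_sum]
    exact (ac_sum _ _ _).symm
  have h1 : ∀ j : ZMod (d * m), (∑ t ∈ Icc 1 K, ZMod.stdAddChar (j * (t : ZMod (d * m)))) ^ J *
        SS m x (-(ZMod.castHom (Dvd.intro_left d rfl) (ZMod m) j * a * (d : ZMod m)⁻¹)) =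
      ∑ f ∈ FJ J K, ∑ p ∈ US m x, ((wt p : ℝ) : ℂ) *
        ZMod.stdAddChar (j * (((∑ i, f i : ℕ) : ZMod (d * m)) -
          ((d * (a * (d : ZMod m)⁻¹ * (p : ZMod m)⁻¹).val : ℕ) : ZMod (d * m)))) := by
    intro j
    rw [hg, Finset.sum_mul]
    refine Finset.sum_congr rfl fun f _ => ?_
    unfold SS
    rw [Finset.mul_sum]
    refine Finset.sum_congr rfl fun p _ => ?_
    have h2 : ZMod.stdAddChar (-(ZMod.castHom (Dvd.intro_left d rfl) (ZMod m) j * a * (d : ZMod m)⁻¹) * (p : ZMod m)⁻¹) =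
        ZMod.stdAddChar (-(j * ((d * (a * (d : ZMod m)⁻¹ * (p : ZMod m)⁻¹).val : ℕ) : ZMod (d * m)))) := by
      rw [← pb_conj (d * m), psi_lift', pb_conj, ZMod.natCast_val, ZMod.cast_id]
      congr 1; ring
    rw [h2, mul_sub, sub_eq_add_neg (j * _), AddChar.map_add_eq_mul]
    ring
  simp only [h1]
  rw [Finset.sum_comm]
  unfold Ad Aw
  rw [Complex.ofReal_sum, Finset.mul_sum, Finset.sum_filter]
  refine Finset.sum_congr rfl fun f _ => ?_
  rw [Finset.sum_comm, Complex.ofReal_sum, Finset.mul_sum]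
  have h3 : ∀ p ∈ US m x, ∑ j : ZMod (d * m), ((wt p : ℝ) : ℂ) *
        ZMod.stdAddChar (j * (((∑ i, f i : ℕ) : ZMod (d * m)) -
          ((d * (a * (d : ZMod m)⁻¹ * (p : ZMod m)⁻¹).val : ℕ) : ZMod (d * m)))) =
      if d ∣ ∑ i, f i ∧ (p : ZMod m) * ((∑ i, f i : ℕ) : ZMod m) = a then ((d * m : ℕ) : ℂ) * ((wt p : ℝ) : ℂ) else 0 := by
    intro p hp
    rw [← Finset.mul_sum, pb_orth, if_congr (ind_iff m d _ p hd (mem_US.1 hp).2.2 a) rfl rfl]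
    split_ifs <;> ring
  rw [Finset.sum_congr rfl h3]
  by_cases hdv : d ∣ ∑ i, f i
  · rw [if_pos hdv]
    refine Finset.sum_congr rfl fun p _ => ?_
    simp only [hdv, true_and]
    split_ifs <;> simp
  · rw [if_neg hdv]
    simp [hdv]

theorem Ad_err (m x J K d H : ℕ) [NeZero m] (hd0 : 0 < d) (hd : d.Coprime m) (a : ZMod m) :
    |Ad m x J K a d - (K:ℝ) ^ J * Psi m x / (d * m)| ≤
      2 / (d * m) * ((K:ℝ) ^ J * ∑ k ∈ Icc 1 H, ‖SS m x (lam m a (k, d))‖ +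
        (d * m) * (((d * m : ℝ)) / (2 * (H + 1))) ^ J * Psi m x) := by
  have hm0 : 0 < m := Nat.pos_of_ne_zero (NeZero.ne m)
  have : NeZero (d * m) := ⟨(Nat.mul_pos hd0 hm0).ne'⟩
  have hP := Psi_nonneg m x
  have h := Ad_fourier m x J K d hd a
  rw [← Finset.add_sum_erase _ _ (Finset.mem_univ (0 : ZMod (d * m)))] at h
  have hz : (∑ t ∈ Icc 1 K, ZMod.stdAddChar ((0 : ZMod (d * m)) * (t : ZMod (d * m)))) ^ J *
        SS m x (-(ZMod.castHom (Dvd.intro_left d rfl) (ZMod m) (0 : ZMod (d * m)) * a * (d : ZMod m)⁻¹)) =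
        (((K:ℝ) ^ J * Psi m x : ℝ) : ℂ) := by
    rw [map_zero, zero_mul, zero_mul, neg_zero, SS_zero]
    simp
  rw [hz] at h
  obtain ⟨M, hM⟩ : ∃ M : ℝ, M = d * m := ⟨_, rfl⟩
  have hMn : ((d * m : ℕ) : ℝ) = M := by rw [hM]; push_cast; ring
  have hMpos : 0 < M := by rw [hM]; positivity
  rw [← hM]
  have h1 : M * |Ad m x J K a d - (K:ℝ) ^ J * Psi m x / M| =
      ‖∑ j ∈ Finset.univ.erase (0 : ZMod (d * m)), (∑ t ∈ Icc 1 K, ZMod.stdAddChar (j * (t : ZMod (d * m)))) ^ J *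
        SS m x (-(ZMod.castHom (Dvd.intro_left d rfl) (ZMod m) j * a * (d : ZMod m)⁻¹))‖ := by
    have h2 : ∑ j ∈ Finset.univ.erase (0 : ZMod (d * m)), (∑ t ∈ Icc 1 K, ZMod.stdAddChar (j * (t : ZMod (d * m)))) ^ J *
        SS m x (-(ZMod.castHom (Dvd.intro_left d rfl) (ZMod m) j * a * (d : ZMod m)⁻¹)) =
        ((M * (Ad m x J K a d - (K:ℝ) ^ J * Psi m x / M) : ℝ) : ℂ) := by
      have h3 : M * (Ad m x J K a d - (K:ℝ) ^ J * Psi m x / M) = M * Ad m x J K a d - (K:ℝ) ^ J * Psi m x := by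
        field_simp
      rw [h3, Complex.ofReal_sub, Complex.ofReal_mul, ← hMn, Complex.ofReal_natCast, h]
      ring
    rw [h2, Complex.norm_real, Real.norm_eq_abs, abs_mul, abs_of_pos hMpos]
  have h4 : ‖∑ j ∈ Finset.univ.erase (0 : ZMod (d * m)), (∑ t ∈ Icc 1 K, ZMod.stdAddChar (j * (t : ZMod (d * m)))) ^ J *
        SS m x (-(ZMod.castHom (Dvd.intro_left d rfl) (ZMod m) j * a * (d : ZMod m)⁻¹))‖ ≤
      2 * ((K:ℝ) ^ J * ∑ k ∈ Icc 1 H, ‖SS m x (lam m a (k, d))‖ + M * (M / (2 * (H + 1))) ^ J * Psi m x) := by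
    refine (norm_sum_le _ _).trans ?_
    refine (pb_sum_zmod (d * m) (fun j => ‖(∑ t ∈ Icc 1 K, ZMod.stdAddChar (j * (t : ZMod (d * m)))) ^ J *
        SS m x (-(ZMod.castHom (Dvd.intro_left d rfl) (ZMod m) j * a * (d : ZMod m)⁻¹))‖) (fun j => norm_nonneg _)).trans ?_
    have h5 : ∀ v ∈ Icc 1 (d * m / 2), ∀ j : ZMod (d * m), (j = v ∨ j = -v) →
        ‖(∑ t ∈ Icc 1 K, ZMod.stdAddChar (j * (t : ZMod (d * m)))) ^ J *
        SS m x (-(ZMod.castHom (Dvd.intro_left d rfl) (ZMod m) j * a * (d : ZMod m)⁻¹))‖ ≤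
        (if v ∈ Icc 1 H then (K:ℝ) ^ J * ‖SS m x (lam m a (v, d))‖ else 0) + (M / (2 * (H + 1))) ^ J * Psi m x := by
      intro v hv j hj
      have hv' := Finset.mem_Icc.1 hv
      have h3 : (v : ZMod (d * m)) ≠ 0 := by
        intro h
        rw [ZMod.natCast_eq_zero_iff] at h
        have := Nat.le_of_dvd (by omega) h
        omega
      have h4 : ((v : ZMod (d * m))).valMinAbs.natAbs = v := by
        rw [ZMod.valMinAbs_natCast_of_le_half hv'.2]; simp
      have hj4 : j.valMinAbs.natAbs = v := by
        rcases hj with rfl | rfl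
        · exact h4
        · rw [ZMod.natAbs_valMinAbs_neg, h4]
      have hj3 : j ≠ 0 := by
        rcases hj with rfl | rfl
        · exact h3
        · exact neg_ne_zero.2 h3
      have hS : ‖SS m x (-(ZMod.castHom (Dvd.intro_left d rfl) (ZMod m) j * a * (d : ZMod m)⁻¹))‖ =
          ‖SS m x (lam m a (v, d))‖ := by
        unfold lam
        rcases hj with rfl | rfl
        · rw [SS_neg, map_natCast]
        · rw [map_neg, map_natCast, neg_mul, neg_mul, neg_neg]
      rw [norm_mul, norm_pow, hS]
      have hSP := SS_le m x (lam m a (v, d))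
      have hS0 := norm_nonneg (SS m x (lam m a (v, d)))
      by_cases hvH : v ∈ Icc 1 H
      · rw [if_pos hvH]
        have hg : ‖∑ t ∈ Icc 1 K, ZMod.stdAddChar (j * (t : ZMod (d * m)))‖ ≤ K := by
          refine (norm_sum_le _ _).trans ?_
          simp only [pb_norm, Finset.sum_const, Nat.card_Icc]
          simp
        have : 0 ≤ (M / (2 * (H + 1))) ^ J * Psi m x := by positivity
        have : ‖∑ t ∈ Icc 1 K, ZMod.stdAddChar (j * (t : ZMod (d * m)))‖ ^ J * ‖SS m x (lam m a (v, d))‖ ≤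
          (K:ℝ) ^ J * ‖SS m x (lam m a (v, d))‖ := by gcongr
        linarith
      · rw [if_neg hvH, zero_add]
        have hg := pb_geom (d * m) j hj3 K
        rw [hj4, hMn] at hg
        have hvH' : H + 1 ≤ v := by
          by_contra hh
          exact hvH (Finset.mem_Icc.2 ⟨hv'.1, by omega⟩)
        have hvH2 : (H:ℝ) + 1 ≤ v := by exact_mod_cast hvH'
        have hg2 : M / (2 * (v:ℝ)) ≤ M / (2 * (H + 1)) := by gcongr
        gcongr
        exact hg.trans hg2
    calc _ ≤ ∑ v ∈ Icc 1 (d * m / 2), (((if v ∈ Icc 1 H then (K:ℝ) ^ J * ‖SS m x (lam m a (v, d))‖ else 0) + (M / (2 * (H + 1))) ^ J * Psi m x) +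
          ((if v ∈ Icc 1 H then (K:ℝ) ^ J * ‖SS m x (lam m a (v, d))‖ else 0) + (M / (2 * (H + 1))) ^ J * Psi m x)) := by
          apply Finset.sum_le_sum
          intro v hv
          exact add_le_add (h5 v hv _ (Or.inl rfl)) (h5 v hv _ (Or.inr rfl))
      _ = 2 * (∑ v ∈ Icc 1 (d * m / 2), (if v ∈ Icc 1 H then (K:ℝ) ^ J * ‖SS m x (lam m a (v, d))‖ else 0) +
          ((d * m / 2 : ℕ) : ℝ) * ((M / (2 * (H + 1))) ^ J * Psi m x)) := by
          rw [Finset.sum_add_distrib, Finset.sum_add_distrib, Finset.sum_const, Nat.card_Icc, nsmul_eq_mul,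
            Nat.add_sub_cancel]
          ring
      _ ≤ _ := by
          have h6 : ((d * m / 2 : ℕ) : ℝ) ≤ M := by
            rw [← hMn]; exact_mod_cast Nat.div_le_self _ _
          have h7 : 0 ≤ (M / (2 * ((H:ℝ) + 1))) ^ J * Psi m x := by positivity
          have h8 : ∑ v ∈ Icc 1 (d * m / 2), (if v ∈ Icc 1 H then (K:ℝ) ^ J * ‖SS m x (lam m a (v, d))‖ else 0) ≤
              (K:ℝ) ^ J * ∑ k ∈ Icc 1 H, ‖SS m x (lam m a (k, d))‖ := by
            rw [← Finset.sum_filter, Finset.mul_sum]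
            apply Finset.sum_le_sum_of_subset_of_nonneg
            · intro v hv; exact (Finset.mem_filter.1 hv).2
            · intros; positivity
          have h9 := mul_le_mul_of_nonneg_right h6 h7
          linarith
  rw [← h1] at h4
  have h5 : |Ad m x J K a d - (K:ℝ) ^ J * Psi m x / M| = (M * |Ad m x J K a d - (K:ℝ) ^ J * Psi m x / M|) / M := by
    field_simp
  rw [h5]
  refine (div_le_div_of_nonneg_right h4 hMpos.le).trans (le_of_eq ?_)
  ring

end

section

open Finset

set_option linter.unusedVariables false

structure Bs (m T x J K : ℕ) (L t e n : ℝ) : Prop where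
  hm : (m:ℝ) = Real.exp L
  hT : DivB m T
  hT3 : 1000 ≤ T
  hTL : L ≤ T
  hTe : (T:ℝ) ≤ Real.exp (e / 10000)
  ht : 0 ≤ t
  he : 0 < e
  h16 : 16 * (t + e) ≤ 3 / 4 * L + n
  hn : 3 * (t + e) ≤ n
  hnL : n ≤ L / 4
  hx : (x:ℝ) ≤ Real.exp (3 / 4 * L + n)
  hx2 : Real.exp (3 / 4 * L + n) ≤ 2 * x
  hK : Real.exp (L - t) ≤ 2 * J * K
  hJ : (2:ℝ) * J ≤ Real.exp (e / 2000)
  hJ5 : 5 * L ≤ J * (e / 2000)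
  hPsi : Real.exp (3 / 4 * L + n) ≤ T ^ 2 * Psi m x

noncomputable def XX (m x J K : ℕ) : ℝ := (K:ℝ) ^ J * Psi m x / m

variable {m T x J K : ℕ} {L t e n : ℝ}

theorem bs_tail {J : ℕ} {K q L e : ℝ} (hq : 0 ≤ q) (hK : 0 ≤ K) (h : q ≤ K * Real.exp (-(e / 2000))) (hJ5 : 5 * L ≤ J * (e / 2000)) :
    q ^ J ≤ K ^ J * Real.exp (-(5 * L)) := by
  calc q ^ J ≤ (K * Real.exp (-(e / 2000))) ^ J := by gcongr
    _ = K ^ J * Real.exp (J * (-(e / 2000))) := by rw [mul_pow, ← Real.exp_nat_mul]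
    _ ≤ _ := by
        gcongr
        linarith

theorem bs_small {e : ℝ} (he : 60000 ≤ e) {q : ℝ} (hq : q ≤ 9 * Real.exp (e / 5000 - e / 1000)) :
    q ≤ Real.exp (-(e / 2000)) := by
  refine hq.trans ?_
  have h1 : (9:ℝ) ≤ Real.exp (3 * e / 10000) := by
    have := Real.add_one_le_exp (3 * e / 10000)
    linarith
  calc 9 * Real.exp (e / 5000 - e / 1000) ≤ Real.exp (3 * e / 10000) * Real.exp (e / 5000 - e / 1000) := by gcongr
    _ = Real.exp (-(e / 2000)) := by rw [← Real.exp_add]; congr 1; ring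

theorem Bs.block (b : Bs m T x J K L t e n) [NeZero m] (a : ZMod m) (ha : IsUnit a) (Dd : Finset ℕ) (E : ℕ) (v w : ℝ)
    (hD : Dd ⊆ US m E) (hE : (E:ℝ) ≤ Real.exp v) (hF : (#Dd : ℝ) ≤ Real.exp w)
    (hv0 : 0 ≤ v) (hv : v ≤ 2.6 * e) (hw : w ≤ 1.3 * e) (hvw : 3 * w ≤ v + 2.6 * e)
    (hlow : ∀ d ∈ Dd, Real.exp v ≤ 4 * d) :
    ∑ d ∈ Dd, |Ad m x J K a d - XX m x J K / d| ≤ XX m x J K * Real.exp (-(e / 2000)) := by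
  obtain ⟨H, hH⟩ : ∃ H, H = ⌊Real.exp (v + t + e / 1000)⌋₊ := ⟨_, rfl⟩
  have hH1 : (H:ℝ) ≤ Real.exp (v + t + e / 1000) := by rw [hH]; exact Nat.floor_le (Real.exp_pos _).le
  have hH2 : Real.exp (v + t + e / 1000) ≤ H + 1 := by rw [hH]; exact (Nat.lt_floor_add_one _).le
  have c : Ctx m T x H E Dd L t e n v w :=
    ⟨b.hm, b.hT, b.hT3, b.hTL, b.hTe, b.ht, b.he, b.h16, b.hn, b.hnL, b.hx, b.hx2, hD, hE, hF, hv0, hv, hw, hvw, hH1⟩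
  have hs := c.star a ha
  have heL := c.e_large
  have hLp := c.L_pos
  have ht := b.ht
  have he := b.he
  have hP := Psi_nonneg m x
  have hmp : (0:ℝ) < m := by rw [b.hm]; exact Real.exp_pos _
  obtain ⟨X, hX⟩ : ∃ X, X = (K:ℝ) ^ J * Psi m x := ⟨_, rfl⟩
  have hX0 : 0 ≤ X := by rw [hX]; positivity
  -- tail
  have htail : ∀ d ∈ Dd, ((d * m : ℝ) / (2 * (H + 1))) ^ J ≤ (K:ℝ) ^ J * Real.exp (-(5 * L)) := by
    intro d hd
    refine bs_tail (by positivity) (by positivity) ?_ b.hJ5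
    have hdE : (d:ℝ) ≤ Real.exp v := le_trans (by exact_mod_cast (mem_US.1 (hD hd)).2.1) hE
    have h1 : (d * m : ℝ) / (2 * (H + 1)) ≤ (Real.exp v * Real.exp L) / (1 * Real.exp (v + t + e / 1000)) := by
      rw [b.hm]
      gcongr
      linarith
    have h2 : (Real.exp v * Real.exp L) / (1 * Real.exp (v + t + e / 1000)) = Real.exp (L - t) * Real.exp (-(e / 1000)) := by
      rw [one_mul, ← Real.exp_add, ← Real.exp_sub, ← Real.exp_add]; congr 1; ring
    have h3 : Real.exp (L - t) ≤ Real.exp (e / 2000) * K := b.hK.trans (by gcongr; exact b.hJ)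
    calc _ ≤ _ := h1
      _ = _ := h2
      _ ≤ Real.exp (e / 2000) * K * Real.exp (-(e / 1000)) := by gcongr
      _ = K * (Real.exp (e / 2000) * Real.exp (-(e / 1000))) := by ring
      _ = _ := by rw [← Real.exp_add]; congr 2; ring
  have h1 : ∀ d ∈ Dd, |Ad m x J K a d - XX m x J K / d| ≤
      8 * Real.exp (-v) / m * (K:ℝ) ^ J * ∑ k ∈ Icc 1 H, ‖SS m x (lam m a (k, d))‖ + 2 * X * Real.exp (-(5 * L)) := by
    intro d hd
    obtain ⟨d1, d2, d3⟩ := mem_US.1 (hD hd)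
    have hdp : (0:ℝ) < d := by exact_mod_cast d1
    have h := Ad_err m x J K d H d1 d3 a
    have hXX : XX m x J K / d = (K:ℝ) ^ J * Psi m x / (d * m) := by
      unfold XX; field_simp
    rw [hXX]
    refine h.trans ?_
    rw [mul_add]
    apply add_le_add
    · have h2 : 2 / ((d:ℝ) * m) ≤ 8 * Real.exp (-v) / m := by
        rw [Real.exp_neg, div_le_div_iff₀ (by positivity) hmp]
        have h3 := hlow d hd
        have h4 := Real.exp_pos v
        have : 2 ≤ 8 * (Real.exp v)⁻¹ * d := by
          rw [← div_eq_mul_inv, div_mul_eq_mul_div, le_div_iff₀ h4]; linarith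
        nlinarith
      have h5 : 0 ≤ ∑ k ∈ Icc 1 H, ‖SS m x (lam m a (k, d))‖ := Finset.sum_nonneg fun _ _ => norm_nonneg _
      calc _ ≤ 8 * Real.exp (-v) / m * ((K:ℝ) ^ J * ∑ k ∈ Icc 1 H, ‖SS m x (lam m a (k, d))‖) := by gcongr
        _ = _ := by ring
    · calc 2 / ((d:ℝ) * m) * (d * m * ((d * m : ℝ) / (2 * (H + 1))) ^ J * Psi m x) =
            2 * (((d * m : ℝ) / (2 * (H + 1))) ^ J * Psi m x) := by field_simp
        _ ≤ 2 * ((K:ℝ) ^ J * Real.exp (-(5 * L)) * Psi m x) := by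
            gcongr
            exact htail d hd
        _ = _ := by rw [hX]; ring
  refine (Finset.sum_le_sum h1).trans ?_
  rw [Finset.sum_add_distrib, ← Finset.mul_sum, Finset.sum_const, nsmul_eq_mul]
  have h2 : ∑ d ∈ Dd, ∑ k ∈ Icc 1 H, ‖SS m x (lam m a (k, d))‖ ≤ Real.exp (v + (3 / 4 * L + n) - e / 1000) := by
    refine le_trans (le_of_eq ?_) hs
    rw [Finset.sum_product_right]
    rfl
  have h3 : 8 * Real.exp (-v) / m * (K:ℝ) ^ J * ∑ d ∈ Dd, ∑ k ∈ Icc 1 H, ‖SS m x (lam m a (k, d))‖ ≤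
      XX m x J K * (8 * Real.exp (e / 5000 - e / 1000)) := by
    have hTT : (T:ℝ) ^ 2 ≤ Real.exp (e / 5000) := by
      calc (T:ℝ) ^ 2 ≤ Real.exp (e / 10000) ^ 2 := by gcongr; exact b.hTe
        _ = _ := by rw [← Real.exp_nat_mul]; congr 1; push_cast; ring
    calc _ ≤ 8 * Real.exp (-v) / m * (K:ℝ) ^ J * Real.exp (v + (3 / 4 * L + n) - e / 1000) := by gcongr
      _ = 8 / m * (K:ℝ) ^ J * (Real.exp (3 / 4 * L + n) * Real.exp (- (e / 1000))) := by
          have : Real.exp (v + (3 / 4 * L + n) - e / 1000) = Real.exp v * (Real.exp (3 / 4 * L + n) * Real.exp (-(e / 1000))) := by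
            rw [← Real.exp_add, ← Real.exp_add]; congr 1; ring
          rw [this, Real.exp_neg v]
          have := (Real.exp_pos v).ne'
          field_simp
      _ ≤ 8 / m * (K:ℝ) ^ J * ((Real.exp (e / 5000) * Psi m x) * Real.exp (- (e / 1000))) := by
          gcongr
          exact b.hPsi.trans (by gcongr)
      _ = _ := by
          unfold XX
          rw [Real.exp_sub, Real.exp_neg]
          ring
  have h4 : (#Dd : ℝ) * (2 * X * Real.exp (-(5 * L))) ≤ XX m x J K * Real.exp (e / 5000 - e / 1000) := by
    have hXm : X = XX m x J K * m := by unfold XX; rw [hX]; field_simp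
    have hXX0 : 0 ≤ XX m x J K := by unfold XX; positivity
    have h2e : (2:ℝ) ≤ Real.exp 1 := by have := Real.add_one_le_exp (1:ℝ); linarith
    rw [hXm, b.hm]
    calc (#Dd : ℝ) * (2 * (XX m x J K * Real.exp L) * Real.exp (-(5 * L))) ≤
          Real.exp w * (Real.exp 1 * (XX m x J K * Real.exp L) * Real.exp (-(5 * L))) := by gcongr
      _ = XX m x J K * (Real.exp w * Real.exp 1 * Real.exp L * Real.exp (-(5 * L))) := by ring
      _ ≤ _ := by
          rw [← Real.exp_add, ← Real.exp_add, ← Real.exp_add]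
          gcongr
          linarith
  have hXX0 : 0 ≤ XX m x J K := by unfold XX; positivity
  calc _ ≤ XX m x J K * (8 * Real.exp (e / 5000 - e / 1000)) + XX m x J K * Real.exp (e / 5000 - e / 1000) := add_le_add h3 h4
    _ = XX m x J K * (9 * Real.exp (e / 5000 - e / 1000)) := by ring
    _ ≤ _ := by
        gcongr
        exact bs_small heL le_rfl

theorem Bs.e_large (b : Bs m T x J K L t e n) : 60000 ≤ e := by
  refine Ctx.e_large (m := m) (T := T) (x := x) (H := 0) (E := 1) (Dd := ∅) (L := L) (t := t) (e := e) (n := n)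
    (v := 0) (w := 0)
    ⟨b.hm, b.hT, b.hT3, b.hTL, b.hTe, b.ht, b.he, b.h16, b.hn, b.hnL, b.hx, b.hx2, by simp, by simp, by simp, le_rfl,
      by have := b.he; linarith, by have := b.he; linarith, by have := b.he; linarith, by simp; positivity⟩

theorem Bs.L_large (b : Bs m T x J K L t e n) : 16 * e ≤ L := by
  have := b.h16; have := b.hnL; have := b.ht; linarith

theorem Bs.level (b : Bs m T x J K L t e n) [NeZero m] (a : ZMod m) (ha : IsUnit a) (D r : ℕ)
    (hr : r = 1 ∨ r = 2) (hD : (D:ℝ) ≤ Real.exp (1.3 * e)) :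
    ∑ d ∈ US m D, |Ad m x J K a (d ^ r) - XX m x J K / (d:ℝ) ^ r| ≤ XX m x J K * Real.exp (-(e / 4000)) := by
  have heL := b.e_large
  have hXX0 : 0 ≤ XX m x J K := by
    have := Psi_nonneg m x
    unfold XX; positivity
  rcases Nat.eq_zero_or_pos D with h0 | hD0
  · have : US m D = ∅ := by
      rw [Finset.eq_empty_iff_forall_notMem]
      intro d hd
      have := mem_US.1 hd
      omega
    rw [this, Finset.sum_empty]; positivity
  have hblk : ∀ i ∈ range (Nat.log 2 D + 1),
      ∑ d ∈ US m D with Nat.log 2 d = i, |Ad m x J K a (d ^ r) - XX m x J K / (d:ℝ) ^ r| ≤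
        XX m x J K * Real.exp (-(e / 2000)) := by
    intro i hi
    obtain ⟨E, hE⟩ : ∃ E, E = min (2 ^ (i + 1)) D := ⟨_, rfl⟩
    have hE1 : 1 ≤ E := by rw [hE]; exact le_min Nat.one_le_two_pow hD0
    have hEp : (0:ℝ) < E := by exact_mod_cast hE1
    have hu0 : 0 ≤ Real.log E := Real.log_natCast_nonneg E
    have hu1 : Real.log E ≤ 1.3 * e := by
      rw [Real.log_le_iff_le_exp hEp]
      refine le_trans ?_ hD
      rw [hE]
      exact_mod_cast min_le_right _ _
    have hmem : ∀ d ∈ (US m D).filter (fun d => Nat.log 2 d = i), d ∈ US m E ∧ E ≤ 2 * d := by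
      intro d hd
      obtain ⟨hd1, hd2⟩ := Finset.mem_filter.1 hd
      obtain ⟨d1, d2, d3⟩ := mem_US.1 hd1
      have h2 : d < 2 ^ (i + 1) := by rw [← hd2]; exact Nat.lt_pow_succ_log_self (by norm_num) d
      have h3 : 2 ^ i ≤ d := by rw [← hd2]; exact Nat.pow_log_le_self 2 (by omega)
      have h4 : E ≤ 2 ^ (i + 1) := by rw [hE]; exact min_le_left _ _
      refine ⟨mem_US.2 ⟨d1, ?_, d3⟩, ?_⟩
      · rw [hE]; exact le_min h2.le d2
      · rw [pow_succ] at h4; omega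
    have hinj : Set.InjOn (fun d : ℕ => d ^ r) (((US m D).filter (fun d => Nat.log 2 d = i) : Finset ℕ) : Set ℕ) := by
      intro d _ d' _ h
      exact Nat.pow_left_injective (by omega) h
    have hsum := Finset.sum_image (f := fun d : ℕ => |Ad m x J K a d - XX m x J K / (d:ℝ)|) hinj
    simp only [Nat.cast_pow] at hsum
    rw [← hsum]
    have hexp : Real.exp (r * Real.log E) = ((E ^ r : ℕ) : ℝ) := by
      rw [Real.exp_nat_mul, Real.exp_log hEp]; push_cast; rfl
    have hr1 : (1:ℝ) ≤ r ∧ (r:ℝ) ≤ 2 := by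
      rcases hr with rfl | rfl <;> norm_num
    refine b.block a ha _ (E ^ r) (r * Real.log E) (Real.log E) ?_ ?_ ?_ ?_ ?_ hu1 ?_ ?_
    · intro q hq
      obtain ⟨d, hd, rfl⟩ := Finset.mem_image.1 hq
      obtain ⟨d1, d2, d3⟩ := mem_US.1 (hmem d hd).1
      exact mem_US.2 ⟨Nat.one_le_pow _ _ d1, Nat.pow_le_pow_left d2 r, Nat.Coprime.pow_left r d3⟩
    · rw [hexp]
    · rw [Real.exp_log hEp]
      have : (US m D).filter (fun d => Nat.log 2 d = i) ⊆ US m E := fun d hd => (hmem d hd).1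
      exact_mod_cast Finset.card_image_le.trans ((Finset.card_le_card this).trans (card_US_le m E))
    · exact mul_nonneg (by linarith) hu0
    · nlinarith
    · nlinarith
    · intro q hq
      obtain ⟨d, hd, rfl⟩ := Finset.mem_image.1 hq
      have h2 := (hmem d hd).2
      rw [hexp]
      have h3 : E ^ r ≤ 4 * d ^ r := by
        rcases hr with rfl | rfl
        · simp; omega
        · nlinarith
      exact_mod_cast h3
  rw [← Finset.sum_fiberwise_of_maps_to (s := US m D) (t := range (Nat.log 2 D + 1)) (g := fun d => Nat.log 2 d)]
  swap
  · intro d hd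
    rw [Finset.mem_range]
    exact Nat.lt_succ_of_le (Nat.log_mono_right (mem_US.1 hd).2.1)
  refine (Finset.sum_le_sum hblk).trans ?_
  rw [Finset.sum_const, Finset.card_range, nsmul_eq_mul]
  have hlog : ((Nat.log 2 D + 1 : ℕ) : ℝ) ≤ Real.exp (e / 10000) := by
    have h1 : (2:ℝ) ^ (Nat.log 2 D) ≤ Real.exp (1.3 * e) := by
      refine le_trans ?_ hD
      exact_mod_cast Nat.pow_log_le_self 2 (by omega)
    have h2 : (Nat.log 2 D : ℝ) * Real.log 2 ≤ 1.3 * e := by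
      rw [← Real.log_pow, Real.log_le_iff_le_exp (by positivity)]; exact h1
    have h3 := Real.log_two_gt_d9
    have h4 : (Nat.log 2 D : ℝ) ≤ 2.6 * e := by
      have : (0:ℝ) ≤ (Nat.log 2 D : ℝ) := by positivity
      nlinarith
    have := b.L_large
    have := b.hTL
    have := b.hTe
    push_cast
    linarith
  calc _ ≤ Real.exp (e / 10000) * (XX m x J K * Real.exp (-(e / 2000))) := by gcongr
    _ = XX m x J K * (Real.exp (e / 10000) * Real.exp (-(e / 2000))) := by ring
    _ ≤ _ := by
        rw [← Real.exp_add]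
        gcongr
        linarith

end

section

open Finset

set_option linter.unusedVariables false

/-- sum of log p / p -/
noncomputable def Mp (x : ℕ) : ℝ := ∑ p ∈ Icc 1 x with p.Prime, Real.log p / p

theorem log_fact_eq (x : ℕ) : Real.log (x.factorial : ℝ) =
    ∑ p ∈ Icc 1 x with p.Prime, (x.factorial.factorization p : ℝ) * Real.log p := by
  have h := Nat.prod_factorization_pow_eq_self (Nat.factorial_ne_zero x)
  have h1 : Real.log (x.factorial : ℝ) = Real.log ((x.factorial.factorization.prod fun p k => p ^ k : ℕ) : ℝ) := by rw [h]
  rw [h1, Finsupp.prod, Nat.cast_prod, Real.log_prod]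
  · have hsub : x.factorial.factorization.support ⊆ (Icc 1 x).filter Nat.Prime := by
      intro p hp
      rw [Nat.support_factorization, Nat.mem_primeFactors] at hp
      rw [Finset.mem_filter, Finset.mem_Icc]
      exact ⟨⟨hp.1.one_lt.le, (hp.1.dvd_factorial).1 hp.2.1⟩, hp.1⟩
    rw [← Finset.sum_subset hsub]
    · refine Finset.sum_congr rfl fun p hp => ?_
      rw [Nat.cast_pow, Real.log_pow]
    · intro p _ hp
      rw [Finsupp.notMem_support_iff] at hp
      rw [hp]; simp
  · intro p hp
    rw [Nat.support_factorization, Nat.mem_primeFactors] at hp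
    have := hp.1.pos
    positivity

theorem Mp_upper (x : ℕ) (hx : 1 ≤ x) : Mp x ≤ Real.log x + Real.log 4 := by
  have hx0 : (0:ℝ) < x := by exact_mod_cast hx
  have h1 : ∀ p ∈ (Icc 1 x).filter Nat.Prime, Real.log p / p * x ≤
      (x.factorial.factorization p : ℝ) * Real.log p + Real.log p := by
    intro p hp
    obtain ⟨hp1, hp2⟩ := Finset.mem_filter.1 hp
    have hdvd : p ^ (x / p) ∣ x.factorial := by
      have h3 : ∀ k, p ^ k ∣ (p * k).factorial := by
        intro k
        induction k with
        | zero => simp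
        | succ k ih =>
          have h4 : p * (k + 1) = p * k + p := by ring
          rw [h4, pow_succ]
          refine dvd_trans (mul_dvd_mul ih ?_) (Nat.factorial_mul_factorial_dvd_factorial_add _ _)
          exact Nat.dvd_factorial hp2.pos le_rfl
      exact (h3 _).trans (Nat.factorial_dvd_factorial (Nat.mul_div_le x p))
    have h2 : x / p ≤ x.factorial.factorization p :=
      (hp2.pow_dvd_iff_le_factorization (Nat.factorial_ne_zero x)).1 hdvd
    have hpp : (0:ℝ) < p := by exact_mod_cast hp2.pos
    have h3 : (x:ℝ) / p ≤ (x.factorial.factorization p : ℝ) + 1 := by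
      rw [div_le_iff₀ hpp]
      have := Nat.lt_mul_div_succ x hp2.pos
      have h5 : x ≤ (x.factorial.factorization p + 1) * p := by
        calc x ≤ p * (x / p + 1) := this.le
          _ = (x / p + 1) * p := by ring
          _ ≤ _ := Nat.mul_le_mul_right _ (by omega)
      exact_mod_cast h5
    have h4 := Real.log_natCast_nonneg p
    calc Real.log p / p * x = (x / p) * Real.log p := by ring
      _ ≤ ((x.factorial.factorization p : ℝ) + 1) * Real.log p := by gcongr
      _ = _ := by ring
  have h2 := Finset.sum_le_sum h1
  rw [← Finset.sum_mul, Finset.sum_add_distrib, ← log_fact_eq] at h2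
  have h3 : ∑ p ∈ Icc 1 x with p.Prime, Real.log p ≤ Real.log 4 * x := by
    have := Chebyshev.theta_le_log4_mul_x (x := x) hx0.le
    refine le_trans (le_of_eq ?_) this
    rw [Chebyshev.theta]
    simp only [Nat.floor_natCast]
    rfl
  have h4 : Real.log (x.factorial : ℝ) ≤ x * Real.log x := by
    rw [← Real.log_pow]
    apply Real.log_le_log (by positivity)
    exact_mod_cast Nat.factorial_le_pow x
  have h5 : Mp x * x ≤ (Real.log x + Real.log 4) * x := by
    unfold Mp
    linarith
  exact le_of_mul_le_mul_right h5 hx0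

theorem log_tele (x : ℕ) (hx : 1 ≤ x) :
    ∑ n ∈ Icc 2 x, Real.log n / (n * (n - 1)) ≤ 2 - (Real.log x + 2) / x := by
  induction x, hx using Nat.le_induction with
  | base => simp
  | succ x hx ih =>
    rw [Finset.sum_Icc_succ_top (by omega)]
    have hx0 : (1:ℝ) ≤ x := by exact_mod_cast hx
    have h1 : Real.log ((x:ℝ) + 1) - Real.log x ≤ 1 / x := by
      rw [← Real.log_div (by positivity) (by positivity)]
      have := Real.log_le_sub_one_of_pos (x := ((x:ℝ) + 1) / x) (by positivity)
      refine this.trans (le_of_eq ?_)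
      field_simp
      ring
    push_cast
    have h2 : Real.log ((x:ℝ) + 1) / (((x:ℝ) + 1) * ((x:ℝ) + 1 - 1)) ≤
        (Real.log x + 2) / x - (Real.log ((x:ℝ) + 1) + 2) / ((x:ℝ) + 1) := by
      rw [div_sub_div _ _ (by positivity) (by positivity), div_le_div_iff₀ (by nlinarith) (by positivity)]
      have h3 : (x:ℝ) * (Real.log ((x:ℝ) + 1) - Real.log x) ≤ 1 := by
        calc _ ≤ (x:ℝ) * (1 / x) := by gcongr
          _ = 1 := by field_simp
      have h4 : Real.log ((x:ℝ) + 1) - Real.log x ≤ 1 := h1.trans (by rw [div_le_one (by linarith)]; exact hx0)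
      have h5 : Real.log ((x:ℝ) + 1) ≤ (Real.log x + 2) * ((x:ℝ) + 1) - x * (Real.log ((x:ℝ) + 1) + 2) := by
        nlinarith
      have h6 : ((x:ℝ) + 1) * ((x:ℝ) + 1 - 1) = x * ((x:ℝ) + 1) := by ring
      rw [h6]
      exact mul_le_mul_of_nonneg_right h5 (by positivity)
    linarith

theorem Mp_lower (x : ℕ) (hx : 1 ≤ x) : Real.log x - 3 ≤ Mp x := by
  have hx0 : (0:ℝ) < x := by exact_mod_cast hx
  have h1 : ∀ p ∈ (Icc 1 x).filter Nat.Prime, (x.factorial.factorization p : ℝ) * Real.log p ≤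
      (Real.log p / p + Real.log p / (p * (p - 1))) * x := by
    intro p hp
    obtain ⟨hp1, hp2⟩ := Finset.mem_filter.1 hp
    have h2 : (p - 1) * x.factorial.factorization p ≤ x := by
      have := Fact.mk hp2
      have h := sub_one_mul_padicValNat_factorial (p := p) x
      rw [Nat.factorization_def _ hp2, h]
      exact Nat.sub_le _ _
    have hpp : (2:ℝ) ≤ p := by exact_mod_cast hp2.two_le
    have h3 : ((p:ℝ) - 1) * (x.factorial.factorization p : ℝ) ≤ x := by
      have : (((p - 1 : ℕ) : ℝ)) * (x.factorial.factorization p : ℝ) ≤ x := by exact_mod_cast h2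
      rwa [Nat.cast_sub hp2.one_lt.le, Nat.cast_one] at this
    have h4 := Real.log_natCast_nonneg p
    have h5 : (x.factorial.factorization p : ℝ) ≤ x / (p - 1) := by
      rw [le_div_iff₀ (by linarith)]; linarith
    calc (x.factorial.factorization p : ℝ) * Real.log p ≤ x / (p - 1) * Real.log p := by gcongr
      _ = _ := by
        have : (p:ℝ) - 1 ≠ 0 := by linarith
        field_simp
        ring
  have h2 := Finset.sum_le_sum h1
  rw [← Finset.sum_mul, Finset.sum_add_distrib, ← log_fact_eq] at h2
  have h3 : ∑ p ∈ Icc 1 x with p.Prime, Real.log p / ((p:ℝ) * (p - 1)) ≤ 2 := by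
    have h := log_tele x hx
    have h0 : 0 ≤ (Real.log x + 2) / x := by
      have := Real.log_natCast_nonneg x
      positivity
    refine le_trans (Finset.sum_le_sum_of_subset_of_nonneg ?_ ?_) (h.trans (by linarith))
    · intro p hp
      obtain ⟨hp1, hp2⟩ := Finset.mem_filter.1 hp
      exact Finset.mem_Icc.2 ⟨hp2.two_le, (Finset.mem_Icc.1 hp1).2⟩
    · intro p hp _
      have : (2:ℝ) ≤ p := by exact_mod_cast (Finset.mem_Icc.1 hp).1
      have := Real.log_natCast_nonneg p
      apply div_nonneg this
      nlinarith
  have h4 : x * Real.log x - x ≤ Real.log (x.factorial : ℝ) := by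
    have h := Real.pow_div_factorial_le_exp (x := (x:ℝ)) hx0.le x
    have h5 := Real.log_le_log (by positivity) h
    rw [Real.log_exp, Real.log_div (by positivity) (by positivity), Real.log_pow] at h5
    linarith
  have h5 : (Real.log x - 3) * x ≤ Mp x * x := by
    have h6 : (∑ p ∈ Icc 1 x with p.Prime, Real.log p / p) = Mp x := rfl
    rw [h6] at h2
    nlinarith
  exact le_of_mul_le_mul_right h5 hx0

theorem mert_nat (w z : ℕ) (hw : 2 ≤ w) (hz : w ≤ z) :
    ∑ p ∈ Ioc w z with p.Prime, (1:ℝ) / p ≤ Real.log (Real.log z) - Real.log (Real.log w) +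
      Mp z / Real.log z - Mp w / Real.log w + Real.log 4 * (1 / Real.log w - 1 / Real.log z) := by
  induction z, hz using Nat.le_induction with
  | base => simp
  | succ z hz ih =>
    have hl4 : 0 ≤ Real.log 4 := Real.log_nonneg (by norm_num)
    have hz2 : (2:ℝ) ≤ z := by exact_mod_cast hw.trans hz
    have hlz : 0 < Real.log z := Real.log_pos (by linarith)
    have hlz1 : 0 < Real.log ((z:ℝ) + 1) := Real.log_pos (by linarith)
    have hmono : Real.log z ≤ Real.log ((z:ℝ) + 1) := Real.log_le_log (by linarith) (by linarith)
    have hM := Mp_upper z (by omega)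
    -- the log log increment
    have h1 : 1 - Real.log z / Real.log ((z:ℝ) + 1) ≤ Real.log (Real.log ((z:ℝ) + 1)) - Real.log (Real.log z) := by
      rw [← Real.log_div hlz1.ne' hlz.ne']
      have := Real.one_sub_inv_le_log_of_pos (x := Real.log ((z:ℝ) + 1) / Real.log z) (by positivity)
      rwa [inv_div] at this
    have h2 : 1 / Real.log ((z:ℝ) + 1) ≤ 1 / Real.log z := one_div_le_one_div_of_le hlz hmono
    have h3 : (Mp z - Real.log 4) * (1 / Real.log z - 1 / Real.log ((z:ℝ) + 1)) ≤ 1 - Real.log z / Real.log ((z:ℝ) + 1) := by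
      calc _ ≤ Real.log z * (1 / Real.log z - 1 / Real.log ((z:ℝ) + 1)) := by
            apply mul_le_mul_of_nonneg_right <;> linarith
        _ = _ := by field_simp
    have hIoc : Ioc w (z + 1) = insert (z + 1) (Ioc w z) := by
      ext q; simp only [Finset.mem_Ioc, Finset.mem_insert]; omega
    have hIcc : Icc 1 (z + 1) = insert (z + 1) (Icc 1 z) := by
      ext q; simp only [Finset.mem_Icc, Finset.mem_insert]; omega
    by_cases hp : (z + 1).Prime
    · have hs : ∑ p ∈ Ioc w (z + 1) with p.Prime, (1:ℝ) / p = 1 / ((z:ℝ) + 1) + ∑ p ∈ Ioc w z with p.Prime, (1:ℝ) / p := by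
        rw [hIoc, Finset.filter_insert, if_pos hp, Finset.sum_insert (by simp)]
        push_cast; rfl
      have hMs : Mp (z + 1) = Real.log ((z:ℝ) + 1) / ((z:ℝ) + 1) + Mp z := by
        unfold Mp
        rw [hIcc, Finset.filter_insert, if_pos hp, Finset.sum_insert (by simp)]
        push_cast; rfl
      rw [hs, hMs]
      push_cast
      have h5 : (Real.log ((z:ℝ) + 1) / ((z:ℝ) + 1) + Mp z) / Real.log ((z:ℝ) + 1) =
          1 / ((z:ℝ) + 1) + Mp z * (1 / Real.log ((z:ℝ) + 1)) := by field_simp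
      have h6 : Mp z / Real.log z = Mp z * (1 / Real.log z) := by ring
      rw [h5]
      rw [h6] at ih
      linarith only [ih, h1, h3]
    · have hs : ∑ p ∈ Ioc w (z + 1) with p.Prime, (1:ℝ) / p = ∑ p ∈ Ioc w z with p.Prime, (1:ℝ) / p := by
        rw [hIoc, Finset.filter_insert, if_neg hp]
      have hMs : Mp (z + 1) = Mp z := by
        unfold Mp
        rw [hIcc, Finset.filter_insert, if_neg hp]
      rw [hs, hMs]
      push_cast
      have h5 : Mp z / Real.log ((z:ℝ) + 1) = Mp z * (1 / Real.log ((z:ℝ) + 1)) := by ring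
      have h6 : Mp z / Real.log z = Mp z * (1 / Real.log z) := by ring
      rw [h5]
      rw [h6] at ih
      linarith only [ih, h1, h3]

/-- Mertens upper bound -/
theorem mert (S : Finset ℕ) (a b : ℝ) (ha : 2 ≤ a) (hab : a ≤ b) (hS : ∀ p ∈ S, p.Prime ∧ a < Real.log p ∧ Real.log p ≤ b) :
    ∑ p ∈ S, (1:ℝ) / p ≤ Real.log (b / a) + 14 / a := by
  obtain ⟨w, hw⟩ : ∃ w, w = ⌊Real.exp a⌋₊ := ⟨_, rfl⟩
  obtain ⟨z, hz⟩ : ∃ z, z = ⌊Real.exp b⌋₊ := ⟨_, rfl⟩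
  have hea : a + 1 ≤ Real.exp a := Real.add_one_le_exp a
  have hw1 : (w:ℝ) ≤ Real.exp a := by rw [hw]; exact Nat.floor_le (Real.exp_pos _).le
  have hw2 : Real.exp a < w + 1 := by rw [hw]; exact Nat.lt_floor_add_one _
  have hz1 : (z:ℝ) ≤ Real.exp b := by rw [hz]; exact Nat.floor_le (Real.exp_pos _).le
  have hwz : w ≤ z := by rw [hw, hz]; exact Nat.floor_mono (Real.exp_le_exp.2 hab)
  have hwr : (2:ℝ) < w := by
    have h0 : (2:ℝ) < w := by linarith
    exact h0
  have hw3 : 2 ≤ w := by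
    have : (2:ℝ) ≤ w := hwr.le
    exact_mod_cast this
  have hzr : (2:ℝ) < z := lt_of_lt_of_le hwr (by exact_mod_cast hwz)
  have h := mert_nat w z hw3 hwz
  have hsub : ∑ p ∈ S, (1:ℝ) / p ≤ ∑ p ∈ Ioc w z with p.Prime, (1:ℝ) / p := by
    apply Finset.sum_le_sum_of_subset_of_nonneg
    · intro p hp
      obtain ⟨h1, h2, h3⟩ := hS p hp
      have hp0 : (0:ℝ) < p := by exact_mod_cast h1.pos
      rw [Finset.mem_filter, Finset.mem_Ioc]
      refine ⟨⟨?_, ?_⟩, h1⟩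
      · rw [Real.lt_log_iff_exp_lt hp0] at h2
        have : (w:ℝ) < p := lt_of_le_of_lt hw1 h2
        exact_mod_cast this
      · rw [Real.log_le_iff_le_exp hp0] at h3
        rw [hz]; exact Nat.le_floor h3
    · intros; positivity
  have hMz := Mp_upper z (by omega)
  have hMw := Mp_lower w (by omega)
  have hlz : 0 < Real.log z := Real.log_pos (by linarith)
  have hlw : a - 7 / 10 ≤ Real.log w := by
    have h1 : Real.exp a / 2 ≤ w := by linarith
    have h2 := Real.log_le_log (by positivity) h1
    rw [Real.log_div (Real.exp_pos _).ne' (by norm_num), Real.log_exp] at h2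
    have := Real.log_two_lt_d9
    linarith
  have hlw0 : 0 < Real.log w := by linarith
  have hlwz : Real.log w ≤ Real.log z := Real.log_le_log (by linarith) (by exact_mod_cast hwz)
  have hlzb : Real.log z ≤ b := by rw [Real.log_le_iff_le_exp (by linarith)]; exact hz1
  have hl4 : Real.log 4 ≤ 1.4 := by
    have : (4:ℝ) = 2 ^ 2 := by norm_num
    rw [this, Real.log_pow]
    have := Real.log_two_lt_d9
    push_cast; linarith
  have hl40 : 0 ≤ Real.log 4 := Real.log_nonneg (by norm_num)
  have e1 : Mp z / Real.log z ≤ 1 + Real.log 4 / Real.log z := by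
    rw [div_le_iff₀ hlz]
    field_simp
    linarith
  have e2 : 1 - 3 / Real.log w ≤ Mp w / Real.log w := by
    rw [le_div_iff₀ hlw0]
    field_simp
    linarith
  have e3 : Real.log 4 / Real.log z + Real.log 4 * (1 / Real.log w - 1 / Real.log z) = Real.log 4 / Real.log w := by ring
  have e4 : Real.log (Real.log z) ≤ Real.log b := Real.log_le_log hlz hlzb
  have e5 : Real.log a - Real.log (Real.log w) ≤ (7/10) / Real.log w := by
    rw [← Real.log_div (by linarith) hlw0.ne']
    have := Real.log_le_sub_one_of_pos (x := a / Real.log w) (by positivity)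
    refine this.trans ?_
    rw [div_sub_one hlw0.ne']
    gcongr
    linarith
  have e6 : Real.log (b / a) = Real.log b - Real.log a := Real.log_div (by linarith) (by linarith)
  have e7 : (7/10) / Real.log w + 3 / Real.log w + Real.log 4 / Real.log w ≤ 14 / a := by
    rw [← add_div, ← add_div, div_le_div_iff₀ hlw0 (by linarith)]
    nlinarith
  rw [e6]
  linarith

end

section

open Finset

set_option linter.unusedVariables false

open Classical in
noncomputable def gs (P : ℕ → Prop) (B : Finset ℕ) (f : ℕ → ℝ) : ℝ :=
  ∑ Q ∈ B.powerset, if P (#Q) then ∏ p ∈ Q, f p else 0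

theorem gs_insert (P : ℕ → Prop) (B : Finset ℕ) (f : ℕ → ℝ) (p : ℕ) (hp : p ∉ B) :
    gs P (insert p B) f = gs P B f + f p * gs (fun n => P (n + 1)) B f := by
  unfold gs
  rw [Finset.sum_powerset_insert hp]
  congr 1
  rw [Finset.mul_sum]
  refine Finset.sum_congr rfl fun Q hQ => ?_
  have hpQ : p ∉ Q := fun h => hp (Finset.mem_powerset.1 hQ h)
  rw [Finset.card_insert_of_notMem hpQ, Finset.prod_insert hpQ]
  split_ifs <;> ring

theorem gs_empty (P : ℕ → Prop) [Decidable (P 0)] (f : ℕ → ℝ) : gs P ∅ f = if P 0 then 1 else 0 := by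
  unfold gs
  by_cases h : P 0 <;> simp [h]

theorem gs_false (P : ℕ → Prop) (B : Finset ℕ) (f : ℕ → ℝ) (h : ∀ n, ¬ P n) : gs P B f = 0 := by
  unfold gs
  apply Finset.sum_eq_zero
  intro Q _
  rw [if_neg (h _)]

theorem gs_nonneg (P : ℕ → Prop) (B : Finset ℕ) (f : ℕ → ℝ) (h : ∀ p ∈ B, 0 ≤ f p) : 0 ≤ gs P B f := by
  unfold gs
  apply Finset.sum_nonneg
  intro Q hQ
  split_ifs
  · exact Finset.prod_nonneg fun p hp => h p (Finset.mem_powerset.1 hQ hp)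
  · exact le_rfl

theorem gs_eq_zero (B : Finset ℕ) (f : ℕ → ℝ) (c : ℕ) (h : #B < c) : gs (fun n => n = c) B f = 0 := by
  unfold gs
  apply Finset.sum_eq_zero
  intro Q hQ
  have := Finset.card_le_card (Finset.mem_powerset.1 hQ)
  rw [if_neg (by omega)]

theorem gs_neg (B : Finset ℕ) (f : ℕ → ℝ) (c : ℕ) :
    gs (fun n => n = c) B (fun p => - f p) = (-1) ^ c * gs (fun n => n = c) B f := by
  unfold gs
  rw [Finset.mul_sum]
  refine Finset.sum_congr rfl fun Q hQ => ?_
  split_ifs with h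
  · rw [← h, Finset.prod_neg]
  · ring

theorem bonf (B : Finset ℕ) (f : ℕ → ℝ) (hf : ∀ p ∈ B, 0 ≤ f p ∧ f p ≤ 1) : ∀ c : ℕ,
    0 ≤ (-1) ^ c * (∏ p ∈ B, (1 - f p) - gs (fun n => n < c) B (fun p => - f p)) ∧
    (-1) ^ c * (∏ p ∈ B, (1 - f p) - gs (fun n => n < c) B (fun p => - f p)) ≤ gs (fun n => n = c) B f := by
  classical
  induction B using Finset.induction_on with
  | empty =>
    intro c
    rw [gs_empty, gs_empty]
    rcases Nat.eq_zero_or_pos c with rfl | hc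
    · simp
    · simp [hc, hc.ne]
  | insert p B hp ih =>
    have hf' : ∀ q ∈ B, 0 ≤ f q ∧ f q ≤ 1 := fun q hq => hf q (Finset.mem_insert_of_mem hq)
    have hfp := hf p (Finset.mem_insert_self p B)
    have ih := ih hf'
    intro c
    rw [gs_insert _ _ _ _ hp, gs_insert _ _ _ _ hp, Finset.prod_insert hp]
    rcases c with _ | c
    · have h0 : gs (fun n => n < 0) B (fun p => - f p) = 0 := gs_false _ _ _ (by omega)
      have h1 : gs (fun n => n + 1 < 0) B (fun p => - f p) = 0 := gs_false _ _ _ (by omega)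
      have h2 : gs (fun n => n + 1 = 0) B f = 0 := gs_false _ _ _ (by omega)
      have := ih 0
      rw [h0] at this
      rw [h0, h1, h2]
      simp only [pow_zero, one_mul, sub_zero, mul_zero, add_zero] at *
      constructor
      · exact mul_nonneg (by linarith) this.1
      · nlinarith
    · have h1 : (fun n => n + 1 < c + 1) = (fun n => n < c) := by funext n; simp
      have h2 : (fun n => n + 1 = c + 1) = (fun n => n = c) := by funext n; simp
      rw [h1, h2]
      obtain ⟨a1, a2⟩ := ih (c + 1)
      obtain ⟨b1, b2⟩ := ih c
      have key : (-1) ^ (c + 1) * ((1 - f p) * ∏ p ∈ B, (1 - f p) - (gs (fun n => n < c + 1) B (fun p => - f p) +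
          - f p * gs (fun n => n < c) B (fun p => - f p))) =
          (-1) ^ (c + 1) * (∏ p ∈ B, (1 - f p) - gs (fun n => n < c + 1) B (fun p => - f p)) +
          f p * ((-1) ^ c * (∏ p ∈ B, (1 - f p) - gs (fun n => n < c) B (fun p => - f p))) := by
        rw [pow_succ]; ring
      rw [key]
      have c1 := mul_nonneg hfp.1 b1
      have c2 := mul_le_mul_of_nonneg_left b2 hfp.1
      constructor <;> linarith

theorem es_bound (B : Finset ℕ) (f : ℕ → ℝ) (hf : ∀ p ∈ B, 0 ≤ f p) : ∀ c : ℕ,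
    gs (fun n => n = c) B f ≤ (∑ p ∈ B, f p) ^ c / c.factorial := by
  classical
  induction B using Finset.induction_on with
  | empty =>
    intro c
    rw [gs_empty]
    rcases Nat.eq_zero_or_pos c with rfl | hc
    · simp
    · simp [hc.ne, hc.ne']
  | insert p B hp ih =>
    have hf' : ∀ q ∈ B, 0 ≤ f q := fun q hq => hf q (Finset.mem_insert_of_mem hq)
    have hfp := hf p (Finset.mem_insert_self p B)
    have ih := ih hf'
    have hS : 0 ≤ ∑ p ∈ B, f p := Finset.sum_nonneg hf'
    intro c
    rw [gs_insert _ _ _ _ hp, Finset.sum_insert hp]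
    rcases c with _ | c
    · have h2 : gs (fun n => n + 1 = 0) B f = 0 := gs_false _ _ _ (by omega)
      rw [h2]
      have := ih 0
      simp at *
      linarith
    · have h2 : (fun n => n + 1 = c + 1) = (fun n => n = c) := by funext n; simp
      rw [h2]
      have a := ih (c + 1)
      have b := mul_le_mul_of_nonneg_left (ih c) hfp
      refine (add_le_add a b).trans ?_
      have h3 : (∑ p ∈ B, f p) ^ (c + 1) + (c + 1) * f p * (∑ p ∈ B, f p) ^ c ≤ (f p + ∑ p ∈ B, f p) ^ (c + 1) := by
        generalize ∑ p ∈ B, f p = S at hS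
        generalize f p = u at hfp
        clear * - hS hfp
        induction c with
        | zero => simp; linarith
        | succ c ih =>
          have h4 := mul_le_mul_of_nonneg_right ih (by linarith : 0 ≤ u + S)
          rw [pow_succ (u + S) (c + 1)]
          refine le_trans ?_ h4
          have : 0 ≤ (c + 1) * u ^ 2 * S ^ c := by positivity
          push_cast
          have e1 : (S ^ (c + 1) + (c + 1) * u * S ^ c) * (u + S) = S ^ (c + 1 + 1) + (c + 1 + 1) * u * S ^ (c + 1) + (c + 1) * u ^ 2 * S ^ c := by ring
          rw [e1]; linarith
      rw [Nat.factorial_succ]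
      push_cast
      have hc : (0:ℝ) < (c.factorial : ℝ) := by positivity
      rw [div_add' _ _ _ (by positivity), div_le_div_iff_of_pos_right (by positivity)]
      refine le_trans (le_of_eq ?_) h3
      field_simp

/-! products over blocks -/

open Classical in
noncomputable def bsum (K : ℕ) (c : ℕ → ℕ → Prop) (P : Finset ℕ) (col : ℕ → ℕ) (f : ℕ → ℝ) : ℝ :=
  ∑ Q ∈ P.powerset, if ∀ j ∈ range K, c j (#(Q.filter fun p => col p = j)) then ∏ p ∈ Q, f p else 0

theorem bsum_insert (K : ℕ) (c : ℕ → ℕ → Prop) (P : Finset ℕ) (col : ℕ → ℕ) (f : ℕ → ℝ) (p : ℕ) (hp : p ∉ P) :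
    bsum K c (insert p P) col f = bsum K c P col f +
      f p * bsum K (Function.update c (col p) (fun n => c (col p) (n + 1))) P col f := by
  unfold bsum
  rw [Finset.sum_powerset_insert hp]
  congr 1
  rw [Finset.mul_sum]
  refine Finset.sum_congr rfl fun Q hQ => ?_
  have hpQ : p ∉ Q := fun h => hp (Finset.mem_powerset.1 hQ h)
  have hiff : (∀ j ∈ range K, c j (#((insert p Q).filter fun q => col q = j))) ↔
      (∀ j ∈ range K, (Function.update c (col p) (fun n => c (col p) (n + 1))) j (#(Q.filter fun q => col q = j))) := by
    refine forall₂_congr fun j hj => ?_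
    by_cases h : col p = j
    · rw [Finset.filter_insert, if_pos h, Finset.card_insert_of_notMem (by simp [hpQ]), ← h, Function.update_self]
    · rw [Finset.filter_insert, if_neg h, Function.update_of_ne (Ne.symm h)]
  rw [Finset.prod_insert hpQ]
  by_cases h : (∀ j ∈ range K, c j (#((insert p Q).filter fun q => col q = j)))
  · rw [if_pos h, if_pos (hiff.1 h)]
  · rw [if_neg h, if_neg (fun h' => h (hiff.2 h'))]; ring

theorem bsum_eq (K : ℕ) (P : Finset ℕ) (col : ℕ → ℕ) (f : ℕ → ℝ) (hcol : ∀ p ∈ P, col p < K) : ∀ c : ℕ → ℕ → Prop,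
    bsum K c P col f = ∏ j ∈ range K, gs (c j) (P.filter fun p => col p = j) f := by
  classical
  induction P using Finset.induction_on with
  | empty =>
    intro c
    have h1 : ∀ j, gs (c j) ((∅ : Finset ℕ).filter fun p => col p = j) f = if c j 0 then 1 else 0 := by
      intro j
      rw [Finset.filter_empty, gs_empty]
    rw [Finset.prod_congr rfl fun j _ => h1 j]
    unfold bsum
    rw [Finset.powerset_empty, Finset.sum_singleton]
    by_cases h : ∀ j ∈ range K, c j 0
    · rw [if_pos (by simpa using h), Finset.prod_empty]
      symm
      exact Finset.prod_eq_one fun j hj => if_pos (h j hj)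
    · rw [if_neg (by simpa using h)]
      push Not at h
      obtain ⟨j, hj, hj2⟩ := h
      exact (Finset.prod_eq_zero hj (if_neg hj2)).symm
  | insert p P hp ih =>
    have ih := ih fun q hq => hcol q (Finset.mem_insert_of_mem hq)
    have hi : col p ∈ range K := Finset.mem_range.2 (hcol p (Finset.mem_insert_self p P))
    intro c
    rw [bsum_insert _ _ _ _ _ _ hp, ih, ih, ← Finset.mul_prod_erase _ _ hi, ← Finset.mul_prod_erase _ _ hi,
      ← Finset.mul_prod_erase _ _ hi]
    have h1 : ∏ j ∈ (range K).erase (col p), gs (Function.update c (col p) (fun n => c (col p) (n + 1)) j)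
        (P.filter fun q => col q = j) f = ∏ j ∈ (range K).erase (col p), gs (c j) (P.filter fun q => col q = j) f := by
      refine Finset.prod_congr rfl fun j hj => ?_
      rw [Function.update_of_ne (Finset.ne_of_mem_erase hj)]
    have h2 : ∏ j ∈ (range K).erase (col p), gs (c j) ((insert p P).filter fun q => col q = j) f =
        ∏ j ∈ (range K).erase (col p), gs (c j) (P.filter fun q => col q = j) f := by
      refine Finset.prod_congr rfl fun j hj => ?_
      rw [Finset.filter_insert, if_neg (Finset.ne_of_mem_erase hj).symm]
    rw [h1, h2, Function.update_self, Finset.filter_insert, if_pos rfl, gs_insert _ _ _ _ (by simp [hp])]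
    ring

theorem prod_tele (s : Finset ℕ) (x y e : ℕ → ℝ) (hx : ∀ j ∈ s, 0 ≤ x j) (hxy : ∀ j ∈ s, x j ≤ y j)
    (hye : ∀ j ∈ s, y j ≤ x j + e j) :
    ∏ j ∈ s, y j - ∑ i ∈ s, e i * ∏ j ∈ s.erase i, y j ≤ ∏ j ∈ s, x j := by
  induction s using Finset.induction_on with
  | empty => simp
  | insert a s ha ih =>
    have ih := ih (fun j hj => hx j (Finset.mem_insert_of_mem hj)) (fun j hj => hxy j (Finset.mem_insert_of_mem hj))
      (fun j hj => hye j (Finset.mem_insert_of_mem hj))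
    have hxa := hx a (Finset.mem_insert_self a s)
    have hxya := hxy a (Finset.mem_insert_self a s)
    have hyea := hye a (Finset.mem_insert_self a s)
    have hy0 : ∀ j ∈ s, 0 ≤ y j := fun j hj =>
      (hx j (Finset.mem_insert_of_mem hj)).trans (hxy j (Finset.mem_insert_of_mem hj))
    have he0 : ∀ j ∈ s, 0 ≤ e j := fun j hj => by
      have := hxy j (Finset.mem_insert_of_mem hj)
      have := hye j (Finset.mem_insert_of_mem hj)
      linarith
    rw [Finset.prod_insert ha, Finset.prod_insert ha, Finset.sum_insert ha, Finset.erase_insert ha]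
    have h1 : ∑ i ∈ s, e i * ∏ j ∈ (insert a s).erase i, y j = y a * ∑ i ∈ s, e i * ∏ j ∈ s.erase i, y j := by
      rw [Finset.mul_sum]
      refine Finset.sum_congr rfl fun i hi => ?_
      have hia : a ≠ i := fun h => ha (h ▸ hi)
      rw [Finset.erase_insert_of_ne hia, Finset.prod_insert (fun h => ha (Finset.mem_of_mem_erase h))]
      ring
    rw [h1]
    have hS : 0 ≤ ∑ i ∈ s, e i * ∏ j ∈ s.erase i, y j := Finset.sum_nonneg fun i hi =>
      mul_nonneg (he0 i hi) (Finset.prod_nonneg fun j hj => hy0 j (Finset.mem_of_mem_erase hj))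
    have hPy : 0 ≤ ∏ j ∈ s, y j := Finset.prod_nonneg hy0
    generalize ∑ i ∈ s, e i * ∏ j ∈ s.erase i, y j = S at *
    generalize ∏ j ∈ s, y j = Py at *
    generalize ∏ j ∈ s, x j = Px at *
    nlinarith [mul_le_mul_of_nonneg_right (by linarith : y a - e a ≤ x a) hPy, mul_le_mul_of_nonneg_right hxya hS,
      mul_le_mul_of_nonneg_left ih hxa]

theorem prod_main (s : Finset ℕ) (V y E : ℕ → ℝ) (η : ℝ) (hV : ∀ j ∈ s, 0 < V j) (hVy : ∀ j ∈ s, V j ≤ y j)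
    (hyE : ∀ j ∈ s, y j ≤ V j + E j) (hη : ∑ j ∈ s, E j / V j ≤ η) :
    ∏ j ∈ s, y j ≤ (∏ j ∈ s, V j) * Real.exp η ∧
    (∏ j ∈ s, V j) * (1 - η * Real.exp η) ≤ ∏ j ∈ s, y j - ∑ i ∈ s, E i * ∏ j ∈ s.erase i, y j := by
  have hy0 : ∀ j ∈ s, 0 < y j := fun j hj => (hV j hj).trans_le (hVy j hj)
  have hE0 : ∀ j ∈ s, 0 ≤ E j := fun j hj => by
    have := hVy j hj; have := hyE j hj; linarith
  have hVP : 0 ≤ ∏ j ∈ s, V j := Finset.prod_nonneg fun j hj => (hV j hj).le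
  have h1 : ∏ j ∈ s, y j ≤ (∏ j ∈ s, V j) * Real.exp η := by
    calc ∏ j ∈ s, y j ≤ ∏ j ∈ s, V j * Real.exp (E j / V j) := by
          apply Finset.prod_le_prod
          · intro j hj; exact (hy0 j hj).le
          · intro j hj
            have := Real.add_one_le_exp (E j / V j)
            calc y j ≤ V j + E j := hyE j hj
              _ = V j * (E j / V j + 1) := by have := (hV j hj).ne'; field_simp; ring
              _ ≤ _ := mul_le_mul_of_nonneg_left this (hV j hj).le
      _ = (∏ j ∈ s, V j) * Real.exp (∑ j ∈ s, E j / V j) := by rw [Finset.prod_mul_distrib, Real.exp_sum]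
      _ ≤ _ := by gcongr
  refine ⟨h1, ?_⟩
  have hη0 : 0 ≤ η := le_trans (Finset.sum_nonneg fun j hj => div_nonneg (hE0 j hj) (hV j hj).le) hη
  have h2 : ∏ j ∈ s, V j ≤ ∏ j ∈ s, y j := Finset.prod_le_prod (fun j hj => (hV j hj).le) hVy
  have h3 : ∑ i ∈ s, E i * ∏ j ∈ s.erase i, y j ≤ η * ∏ j ∈ s, y j := by
    calc _ ≤ ∑ i ∈ s, (E i / V i) * ∏ j ∈ s, y j := by
          apply Finset.sum_le_sum
          intro i hi
          rw [← Finset.mul_prod_erase s y hi, ← mul_assoc]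
          have h4 : 0 ≤ ∏ j ∈ s.erase i, y j := Finset.prod_nonneg fun j hj => (hy0 j (Finset.mem_of_mem_erase hj)).le
          apply mul_le_mul_of_nonneg_right _ h4
          rw [div_mul_eq_mul_div, le_div_iff₀ (hV i hi)]
          exact mul_le_mul_of_nonneg_left (hVy i hi) (hE0 i hi)
      _ = (∑ i ∈ s, (E i / V i)) * ∏ j ∈ s, y j := by rw [Finset.sum_mul]
      _ ≤ _ := mul_le_mul_of_nonneg_right hη (h2.trans' hVP)
  have h4 := mul_le_mul_of_nonneg_left h1 hη0
  nlinarith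

/-- the upper and lower sieve functions -/
noncomputable def bhU (K : ℕ) (c : ℕ → ℕ) (P : Finset ℕ) (col : ℕ → ℕ) (f : ℕ → ℝ) : ℝ :=
  bsum K (fun j n => n < c j) P col (fun p => - f p)

noncomputable def bhL (K : ℕ) (c : ℕ → ℕ) (P : Finset ℕ) (col : ℕ → ℕ) (f : ℕ → ℝ) : ℝ :=
  bsum K (fun j n => n < c j) P col (fun p => - f p) +
    ∑ i ∈ range K, bsum K (Function.update (fun j n => n < c j) i (fun n => n = c i)) P col (fun p => - f p)

theorem bhL_eq (K : ℕ) (c : ℕ → ℕ) (P : Finset ℕ) (col : ℕ → ℕ) (f : ℕ → ℝ) (hcol : ∀ p ∈ P, col p < K)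
    (hc : ∀ j, Odd (c j)) :
    bhL K c P col f = ∏ j ∈ range K, gs (fun n => n < c j) (P.filter fun p => col p = j) (fun p => - f p) -
      ∑ i ∈ range K, gs (fun n => n = c i) (P.filter fun p => col p = i) f *
        ∏ j ∈ (range K).erase i, gs (fun n => n < c j) (P.filter fun p => col p = j) (fun p => - f p) := by
  unfold bhL
  rw [bsum_eq K P col _ hcol, sub_eq_add_neg, ← Finset.sum_neg_distrib]
  congr 1
  refine Finset.sum_congr rfl fun i hi => ?_
  rw [bsum_eq K P col _ hcol, ← Finset.mul_prod_erase _ _ hi, Function.update_self, gs_neg, (hc i).neg_one_pow]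
  have : ∏ j ∈ (range K).erase i, gs (Function.update (fun j n => n < c j) i (fun n => n = c i) j)
      (P.filter fun p => col p = j) (fun p => - f p) =
      ∏ j ∈ (range K).erase i, gs (fun n => n < c j) (P.filter fun p => col p = j) (fun p => - f p) := by
    refine Finset.prod_congr rfl fun j hj => ?_
    rw [Function.update_of_ne (Finset.ne_of_mem_erase hj)]
  rw [this]; ring

theorem bh_bounds (K : ℕ) (c : ℕ → ℕ) (P : Finset ℕ) (col : ℕ → ℕ) (f : ℕ → ℝ) (hcol : ∀ p ∈ P, col p < K)
    (hc : ∀ j, Odd (c j)) (hf : ∀ p ∈ P, 0 ≤ f p ∧ f p ≤ 1) :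
    bhL K c P col f ≤ ∏ p ∈ P, (1 - f p) ∧ ∏ p ∈ P, (1 - f p) ≤ bhU K c P col f := by
  have hx : ∏ p ∈ P, (1 - f p) = ∏ j ∈ range K, ∏ p ∈ P.filter (fun p => col p = j), (1 - f p) :=
    (Finset.prod_fiberwise_of_maps_to (fun p hp => Finset.mem_range.2 (hcol p hp)) _).symm
  have hb := fun j => bonf (P.filter fun p => col p = j) f (fun p hp => hf p (Finset.mem_filter.1 hp).1) (c j)
  have h0 : ∀ j ∈ range K, 0 ≤ ∏ p ∈ P.filter (fun p => col p = j), (1 - f p) := fun j _ =>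
    Finset.prod_nonneg fun p hp => by have := hf p (Finset.mem_filter.1 hp).1; linarith
  have h1 : ∀ j ∈ range K, ∏ p ∈ P.filter (fun p => col p = j), (1 - f p) ≤
      gs (fun n => n < c j) (P.filter fun p => col p = j) (fun p => - f p) := fun j _ => by
    have := (hb j).1
    rw [(hc j).neg_one_pow] at this; linarith
  have h2 : ∀ j ∈ range K, gs (fun n => n < c j) (P.filter fun p => col p = j) (fun p => - f p) ≤
      ∏ p ∈ P.filter (fun p => col p = j), (1 - f p) + gs (fun n => n = c j) (P.filter fun p => col p = j) f := fun j _ => by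
    have := (hb j).2
    rw [(hc j).neg_one_pow] at this; linarith
  rw [hx]
  constructor
  · rw [bhL_eq K c P col f hcol hc]
    exact prod_tele (range K) _ _ _ h0 h1 h2
  · unfold bhU
    rw [bsum_eq K P col _ hcol]
    exact Finset.prod_le_prod h0 h1

theorem bh_main (K : ℕ) (c : ℕ → ℕ) (P : Finset ℕ) (col : ℕ → ℕ) (f : ℕ → ℝ) (η : ℝ) (hcol : ∀ p ∈ P, col p < K)
    (hc : ∀ j, Odd (c j)) (hf : ∀ p ∈ P, 0 ≤ f p ∧ f p < 1)
    (hη : ∑ j ∈ range K, gs (fun n => n = c j) (P.filter fun p => col p = j) f /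
      ∏ p ∈ P.filter (fun p => col p = j), (1 - f p) ≤ η) :
    bhU K c P col f ≤ (∏ p ∈ P, (1 - f p)) * Real.exp η ∧
    (∏ p ∈ P, (1 - f p)) * (1 - η * Real.exp η) ≤ bhL K c P col f := by
  have hx : ∏ p ∈ P, (1 - f p) = ∏ j ∈ range K, ∏ p ∈ P.filter (fun p => col p = j), (1 - f p) :=
    (Finset.prod_fiberwise_of_maps_to (fun p hp => Finset.mem_range.2 (hcol p hp)) _).symm
  have hb := fun j => bonf (P.filter fun p => col p = j) f
    (fun p hp => ⟨(hf p (Finset.mem_filter.1 hp).1).1, (hf p (Finset.mem_filter.1 hp).1).2.le⟩) (c j)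
  have h0 : ∀ j ∈ range K, 0 < ∏ p ∈ P.filter (fun p => col p = j), (1 - f p) := fun j _ =>
    Finset.prod_pos fun p hp => by have := hf p (Finset.mem_filter.1 hp).1; linarith
  have h1 : ∀ j ∈ range K, ∏ p ∈ P.filter (fun p => col p = j), (1 - f p) ≤
      gs (fun n => n < c j) (P.filter fun p => col p = j) (fun p => - f p) := fun j _ => by
    have := (hb j).1
    rw [(hc j).neg_one_pow] at this; linarith
  have h2 : ∀ j ∈ range K, gs (fun n => n < c j) (P.filter fun p => col p = j) (fun p => - f p) ≤
      ∏ p ∈ P.filter (fun p => col p = j), (1 - f p) + gs (fun n => n = c j) (P.filter fun p => col p = j) f := fun j _ => by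
    have := (hb j).2
    rw [(hc j).neg_one_pow] at this; linarith
  rw [hx, bhL_eq K c P col f hcol hc]
  unfold bhU
  rw [bsum_eq K P col _ hcol]
  exact prod_main (range K) _ _ _ η h0 h1 h2 hη

end

section

open Finset

set_option linter.unusedVariables false

def bcond (K : ℕ) (c : ℕ → ℕ → Prop) (col : ℕ → ℕ) (Q : Finset ℕ) : Prop :=
  ∀ j ∈ range K, c j (#(Q.filter fun p => col p = j))

noncomputable def ind (d n : ℕ) : ℝ := if d ∣ n then 1 else 0

theorem ind_nonneg (d n : ℕ) : 0 ≤ ind d n := by unfold ind; split_ifs <;> norm_num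
theorem ind_le (d n : ℕ) : ind d n ≤ 1 := by unfold ind; split_ifs <;> norm_num

theorem ind_prod (q n : ℕ) (Q : Finset ℕ) (hQ : ∀ p ∈ Q, p.Prime) (hq : ∀ p ∈ Q, ¬ p ∣ q) :
    ind q n * ∏ p ∈ Q, ind p n = ind (q * ∏ p ∈ Q, p) n := by
  unfold ind
  rw [Finset.prod_ite_zero]
  simp only [Finset.prod_const_one]
  have hiff : (q * ∏ p ∈ Q, p) ∣ n ↔ q ∣ n ∧ ∀ p ∈ Q, p ∣ n := by
    constructor
    · intro h
      refine ⟨(Dvd.intro _ rfl).trans h, fun p hp => ?_⟩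
      exact ((Finset.dvd_prod_of_mem (fun p => p) hp).trans (Dvd.intro_left _ rfl)).trans h
    · rintro ⟨h1, h2⟩
      refine Nat.Coprime.mul_dvd_of_dvd_of_dvd ?_ h1 ?_
      · refine Nat.Coprime.prod_right fun p hp => ?_
        exact ((Nat.Prime.coprime_iff_not_dvd (hQ p hp)).2 (hq p hp)).symm
      · exact Finset.prod_primes_dvd n (fun p hp => (hQ p hp).prime) h2
  by_cases h1 : q ∣ n <;> by_cases h2 : ∀ p ∈ Q, p ∣ n
  · rw [if_pos h1, if_pos h2, if_pos (hiff.2 ⟨h1, h2⟩)]; norm_num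
  · rw [if_neg h2, if_neg (fun h => h2 (hiff.1 h).2)]; norm_num
  · rw [if_neg h1, if_neg (fun h => h1 (hiff.1 h).1)]; norm_num
  · rw [if_neg h1, if_neg (fun h => h1 (hiff.1 h).1)]; norm_num

theorem bs_apply {ι : Type} (I : Finset ι) (w : ι → ℝ) (s : ι → ℕ) (K : ℕ) (c : ℕ → ℕ → Prop) (P : Finset ℕ)
    (col : ℕ → ℕ) (q : ℕ) (hP : ∀ p ∈ P, p.Prime) (hq : ∀ p ∈ P, ¬ p ∣ q) (X : ℝ) (hq0 : 0 < q)
    (E : ℕ → ℝ) (hE : ∀ d, E d = |∑ i ∈ I, w i * ind d (s i) - X / d|) :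
    open Classical in
    |∑ i ∈ I, w i * (ind q (s i) * bsum K c P col (fun p => - ind p (s i))) - X * (1 / q) * bsum K c P col (fun p => - (1 / (p:ℝ)))|
      ≤ ∑ Q ∈ P.powerset.filter (bcond K c col), E (q * ∏ p ∈ Q, p) := by
  classical
  have h1 : ∀ i, w i * (ind q (s i) * bsum K c P col (fun p => - ind p (s i))) =
      ∑ Q ∈ P.powerset.filter (bcond K c col), (-1) ^ #Q * (w i * ind (q * ∏ p ∈ Q, p) (s i)) := by
    intro i
    unfold bsum
    rw [← Finset.sum_filter, Finset.mul_sum, Finset.mul_sum]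
    refine Finset.sum_congr (by ext Q; simp only [Finset.mem_filter, bcond]) fun Q hQ => ?_
    have hQP := Finset.mem_powerset.1 (Finset.mem_filter.1 hQ).1
    rw [← ind_prod q (s i) Q (fun p hp => hP p (hQP hp)) (fun p hp => hq p (hQP hp)), Finset.prod_neg]
    ring
  have h2 : X * (1 / q) * bsum K c P col (fun p => - (1 / (p:ℝ))) =
      ∑ Q ∈ P.powerset.filter (bcond K c col), (-1) ^ #Q * (X / ((q * ∏ p ∈ Q, p : ℕ) : ℝ)) := by
    unfold bsum
    rw [← Finset.sum_filter, Finset.mul_sum]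
    refine Finset.sum_congr (by ext Q; simp only [Finset.mem_filter, bcond]) fun Q hQ => ?_
    rw [Finset.prod_neg, Finset.prod_div_distrib, Finset.prod_const_one]
    push_cast
    rw [div_eq_mul_inv X, mul_inv, one_div, one_div]; ring
  rw [Finset.sum_congr rfl fun i _ => h1 i, Finset.sum_comm, h2, ← Finset.sum_sub_distrib]
  refine (Finset.abs_sum_le_sum_abs _ _).trans (Finset.sum_le_sum fun Q hQ => ?_)
  rw [hE, ← Finset.mul_sum, ← mul_sub, abs_mul, abs_pow, abs_neg, abs_one, one_pow, one_mul]

theorem bs_err {ι : Type} (m D : ℕ) (I : Finset ι) (w : ι → ℝ) (s : ι → ℕ) (K : ℕ) (c : ℕ → ℕ → Prop) (P : Finset ℕ)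
    (col : ℕ → ℕ) (T : Finset ℕ) (hP : ∀ p ∈ P, p.Prime ∧ p.Coprime m) (hT : ∀ q ∈ T, 0 < q ∧ q.Coprime m ∧ ∀ p ∈ P, ¬ p ∣ q)
    (X : ℝ) (hsize : ∀ q ∈ T, ∀ Q ⊆ P, bcond K c col Q → q * ∏ p ∈ Q, p ≤ D) (R : ℝ)
    (hR : ∑ d ∈ US m D, |∑ i ∈ I, w i * ind d (s i) - X / d| ≤ R) :
    |∑ q ∈ T, ∑ i ∈ I, w i * (ind q (s i) * bsum K c P col (fun p => - ind p (s i))) -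
      X * (∑ q ∈ T, (1:ℝ) / q) * bsum K c P col (fun p => - (1 / (p:ℝ)))| ≤ R := by
  classical
  obtain ⟨E, hE⟩ : ∃ E : ℕ → ℝ, ∀ d, E d = |∑ i ∈ I, w i * ind d (s i) - X / d| := ⟨_, fun d => rfl⟩
  have hE0 : ∀ d, 0 ≤ E d := fun d => by rw [hE]; exact abs_nonneg _
  rw [Finset.mul_sum, Finset.sum_mul, ← Finset.sum_sub_distrib]
  refine (Finset.abs_sum_le_sum_abs _ _).trans ?_
  refine (Finset.sum_le_sum fun q hq => bs_apply I w s K c P col q (fun p hp => (hP p hp).1) (hT q hq).2.2 X (hT q hq).1 E hE).trans ?_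
  refine le_trans ?_ hR
  rw [← Finset.sum_congr rfl fun d _ => hE d, ← Finset.sum_product']
  have hinj : Set.InjOn (fun z : ℕ × Finset ℕ => z.1 * ∏ p ∈ z.2, p) (T ×ˢ P.powerset.filter (bcond K c col) : Finset _) := by
    have key : ∀ q ∈ T, ∀ Q ⊆ P, (q * ∏ p ∈ Q, p).primeFactors.filter (· ∈ P) = Q := by
      intro q hq Q hQ
      ext p
      have hQ0 : ∏ p ∈ Q, p ≠ 0 := Finset.prod_ne_zero_iff.2 fun p hp => (hP p (hQ hp)).1.ne_zero
      simp only [Finset.mem_filter, Nat.mem_primeFactors]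
      constructor
      · rintro ⟨⟨hp, hd, _⟩, hpP⟩
        rcases (Nat.Prime.dvd_mul hp).1 hd with h | h
        · exact absurd h ((hT q hq).2.2 p hpP)
        · obtain ⟨r, hr, hpr⟩ := (hp.prime.dvd_finset_prod_iff _).1 h
          rw [(Nat.prime_dvd_prime_iff_eq hp (hP r (hQ hr)).1).1 hpr]; exact hr
      · intro hp
        exact ⟨⟨(hP p (hQ hp)).1, (Finset.dvd_prod_of_mem (fun p => p) hp).trans (Dvd.intro_left _ rfl),
          mul_ne_zero (hT q hq).1.ne' hQ0⟩, hQ hp⟩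
    rintro ⟨q, Q⟩ h ⟨q', Q'⟩ h' heq
    simp only [Finset.coe_product, Set.mem_prod, Finset.mem_coe, Finset.mem_filter, Finset.mem_powerset] at h h'
    simp only at heq
    have h1 := key q h.1 Q h.2.1
    have h2 := key q' h'.1 Q' h'.2.1
    rw [heq, h2] at h1
    subst h1
    have hQ0 : 0 < ∏ p ∈ Q', p := Finset.prod_pos fun p hp => (hP p (h.2.1 hp)).1.pos
    rw [Nat.eq_of_mul_eq_mul_right hQ0 heq]
  rw [← Finset.sum_image (f := E) hinj]
  refine Finset.sum_le_sum_of_subset_of_nonneg ?_ fun d _ _ => hE0 d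
  intro d hd
  obtain ⟨⟨q, Q⟩, hz, rfl⟩ := Finset.mem_image.1 hd
  simp only [Finset.mem_product, Finset.mem_filter, Finset.mem_powerset] at hz
  have hQ0 : 0 < ∏ p ∈ Q, p := Finset.prod_pos fun p hp => (hP p (hz.2.1 hp)).1.pos
  rw [mem_US]
  refine ⟨Nat.mul_pos (hT q hz.1).1 hQ0, hsize q hz.1 Q hz.2.1 hz.2.2, ?_⟩
  exact Nat.Coprime.mul_left (hT q hz.1).2.1 (Nat.Coprime.prod_left fun p hp => (hP p (hz.2.1 hp)).2)

end

section

open Finset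

set_option linter.unusedVariables false

structure Blk (m k : ℕ) (y : ℝ) (P : Finset ℕ) (col : ℕ → ℕ) : Prop where
  hP : ∀ p ∈ P, p.Prime ∧ p.Coprime m ∧ Real.log p ≤ y
  hk1 : 1000 * (2:ℝ) ^ k ≤ y
  hk2 : y < 2000 * (2:ℝ) ^ k
  hcol : ∀ p ∈ P, col p ≤ k ∧ (2:ℝ) ^ (col p) * Real.log p ≤ y ∧ (col p < k → y < (2:ℝ) ^ (col p + 1) * Real.log p)

theorem natlog_real (z : ℝ) (hz : 1 ≤ z) : (2:ℝ) ^ (Nat.log 2 ⌊z⌋₊) ≤ z ∧ z < (2:ℝ) ^ (Nat.log 2 ⌊z⌋₊ + 1) := by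
  have h1 : 1 ≤ ⌊z⌋₊ := Nat.le_floor (by simpa using hz)
  constructor
  · have h2 := Nat.pow_log_le_self 2 (x := ⌊z⌋₊) (by omega)
    have h3 : ((2 ^ (Nat.log 2 ⌊z⌋₊) : ℕ) : ℝ) ≤ (⌊z⌋₊ : ℝ) := by exact_mod_cast h2
    push_cast at h3
    exact h3.trans (Nat.floor_le (by linarith))
  · have h2 := Nat.lt_pow_succ_log_self (b := 2) (by norm_num) ⌊z⌋₊
    have := (Nat.floor_lt (by linarith)).1 h2
    push_cast at this
    exact this

theorem blk_exists (m : ℕ) (y : ℝ) (hy : 1000 ≤ y) :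
    ∃ k col, Blk m k y ((US m ⌊Real.exp y⌋₊).filter Nat.Prime) col := by
  obtain ⟨k, hk⟩ : ∃ k, k = Nat.log 2 ⌊y / 1000⌋₊ := ⟨_, rfl⟩
  have hk' := natlog_real (y / 1000) (by linarith)
  rw [← hk] at hk'
  refine ⟨k, fun p => min k (Nat.log 2 ⌊y / Real.log p⌋₊), ⟨?_, by linarith, by rw [pow_succ] at hk'; linarith, ?_⟩⟩
  · intro p hp
    obtain ⟨h1, h2⟩ := Finset.mem_filter.1 hp
    rw [mem_US] at h1
    refine ⟨h2, h1.2.2, ?_⟩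
    have hp0 : (0:ℝ) < p := by exact_mod_cast h2.pos
    have : (p:ℝ) ≤ Real.exp y := (Nat.cast_le.2 h1.2.1).trans (Nat.floor_le (Real.exp_pos y).le)
    rwa [Real.log_le_iff_le_exp hp0]
  · intro p hp
    obtain ⟨h1, h2⟩ := Finset.mem_filter.1 hp
    rw [mem_US] at h1
    have hp0 : (0:ℝ) < p := by exact_mod_cast h2.pos
    have : (p:ℝ) ≤ Real.exp y := (Nat.cast_le.2 h1.2.1).trans (Nat.floor_le (Real.exp_pos y).le)
    have hly : Real.log p ≤ y := by rwa [Real.log_le_iff_le_exp hp0]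
    have hl0 : 0 < Real.log p := Real.log_pos (by exact_mod_cast h2.one_lt)
    obtain ⟨a1, a2⟩ := natlog_real (y / Real.log p) (by rwa [le_div_iff₀ hl0, one_mul])
    refine ⟨min_le_left _ _, ?_, ?_⟩
    · rw [le_div_iff₀ hl0] at a1
      refine le_trans (mul_le_mul_of_nonneg_right ?_ hl0.le) a1
      exact pow_le_pow_right₀ (by norm_num) (min_le_right _ _)
    · intro hlt
      have h3 : min k (Nat.log 2 ⌊y / Real.log p⌋₊) = Nat.log 2 ⌊y / Real.log p⌋₊ := by omega
      rw [h3]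
      rwa [div_lt_iff₀ hl0] at a2

theorem Blk.last_card {m k y P col} (b : Blk m k y P col) :
    (#(P.filter fun p => col p = k) : ℝ) ≤ Real.exp 2000 ∧ ∀ p ∈ P.filter (fun p => col p = k), Real.log p ≤ 2000 := by
  have h : ∀ p ∈ P.filter (fun p => col p = k), Real.log p ≤ 2000 := by
    intro p hp
    obtain ⟨h1, h2⟩ := Finset.mem_filter.1 hp
    have h3 := (b.hcol p h1).2.1
    rw [h2] at h3
    have := b.hk2
    have h4 : (0:ℝ) < 2 ^ k := by positivity
    nlinarith
  refine ⟨?_, h⟩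
  have hsub : P.filter (fun p => col p = k) ⊆ Finset.Icc 1 ⌊Real.exp 2000⌋₊ := by
    intro p hp
    have h1 := (b.hP p (Finset.mem_filter.1 hp).1).1
    rw [Finset.mem_Icc]
    refine ⟨h1.pos, Nat.le_floor ?_⟩
    have hp0 : (0:ℝ) < p := by exact_mod_cast h1.pos
    exact (Real.log_le_iff_le_exp hp0).1 (h p hp)
  have := Finset.card_le_card hsub
  rw [Nat.card_Icc, Nat.add_sub_cancel] at this
  exact (Nat.cast_le.2 this).trans (Nat.floor_le (Real.exp_pos _).le)

theorem Blk.size {m k y P col} (b : Blk m k y P col) (Q : Finset ℕ) (hQ : Q ⊆ P) (B : ℕ → ℕ)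
    (hB : ∀ j < k, #(Q.filter fun p => col p = j) ≤ B j) :
    ((∏ p ∈ Q, p : ℕ) : ℝ) ≤ Real.exp (y * ∑ j ∈ range k, (B j : ℝ) / 2 ^ j + 2000 * Real.exp 2000) := by
  have hy : 0 ≤ y := by have := b.hk1; have : (0:ℝ) < 2 ^ k := by positivity
                        linarith
  have hp0 : ∀ p ∈ Q, (0:ℝ) < p := fun p hp => by exact_mod_cast (b.hP p (hQ hp)).1.pos
  have e1 : ((∏ p ∈ Q, p : ℕ) : ℝ) = Real.exp (∑ p ∈ Q, Real.log p) := by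
    rw [Real.exp_sum]; push_cast
    exact Finset.prod_congr rfl fun p hp => (Real.exp_log (hp0 p hp)).symm
  rw [e1, Real.exp_le_exp]
  rw [← Finset.sum_fiberwise_of_maps_to (s := Q) (t := range (k + 1)) (g := col)
    (fun p hp => Finset.mem_range.2 (Nat.lt_succ_of_le (b.hcol p (hQ hp)).1)), Finset.sum_range_succ, Finset.mul_sum]
  apply add_le_add
  · refine Finset.sum_le_sum fun j hj => ?_
    have h2 : ∀ p ∈ Q.filter (fun p => col p = j), Real.log p ≤ y / 2 ^ j := by
      intro p hp
      obtain ⟨a1, a2⟩ := Finset.mem_filter.1 hp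
      have := (b.hcol p (hQ a1)).2.1
      rw [a2] at this
      rw [le_div_iff₀ (by positivity)]; linarith
    refine (Finset.sum_le_card_nsmul _ _ _ h2).trans ?_
    rw [nsmul_eq_mul]
    have h3 : (#(Q.filter fun p => col p = j) : ℝ) ≤ B j := by exact_mod_cast hB j (Finset.mem_range.1 hj)
    calc _ ≤ (B j : ℝ) * (y / 2 ^ j) := mul_le_mul_of_nonneg_right h3 (by positivity)
      _ = _ := by ring
  · have hsub : Q.filter (fun p => col p = k) ⊆ P.filter (fun p => col p = k) := Finset.filter_subset_filter _ hQ
    obtain ⟨c1, c2⟩ := b.last_card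
    refine (Finset.sum_le_card_nsmul _ _ _ fun p hp => c2 p (hsub hp)).trans ?_
    rw [nsmul_eq_mul]
    have h3 : (#(Q.filter fun p => col p = k) : ℝ) ≤ Real.exp 2000 := le_trans (by exact_mod_cast Finset.card_le_card hsub) c1
    linarith

theorem prod_one_sub_ge (s : Finset ℕ) (f : ℕ → ℝ) (hf : ∀ p ∈ s, 0 ≤ f p ∧ f p ≤ 1) :
    1 - ∑ p ∈ s, f p ≤ ∏ p ∈ s, (1 - f p) ∧ ∏ p ∈ s, (1 - f p) ≤ 1 := by
  induction s using Finset.induction_on with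
  | empty => simp
  | insert a s ha ih =>
    have ih := ih fun p hp => hf p (Finset.mem_insert_of_mem hp)
    have h1 := hf a (Finset.mem_insert_self a s)
    have h0 : 0 ≤ ∏ p ∈ s, (1 - f p) := Finset.prod_nonneg fun p hp => by
      have := hf p (Finset.mem_insert_of_mem hp); linarith
    rw [Finset.sum_insert ha, Finset.prod_insert ha]
    constructor <;> nlinarith

theorem Blk.sum_le {m k y P col} (b : Blk m k y P col) (j : ℕ) (hj : j < k) :
    ∑ p ∈ P.filter (fun p => col p = j), 1 / (p:ℝ) ≤ 0.71 := by
  have h2j : (0:ℝ) < 2 ^ j := by positivity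
  have hk : (2:ℝ) ^ (j + 1) ≤ 2 ^ k := pow_le_pow_right₀ (by norm_num) hj
  have h1 := b.hk1
  have ha : 1000 ≤ y / 2 ^ (j + 1) := by rw [le_div_iff₀ (by positivity)]; linarith
  have hy : 0 < y := by have : (0:ℝ) < 2 ^ k := by positivity
                        linarith
  have := mert (P.filter fun p => col p = j) (y / 2 ^ (j + 1)) (y / 2 ^ j) (by linarith)
    (by apply div_le_div_of_nonneg_left hy.le (by positivity); exact pow_le_pow_right₀ (by norm_num) (by omega)) ?_
  · refine this.trans ?_
    have e : y / 2 ^ j / (y / 2 ^ (j + 1)) = 2 := by rw [pow_succ]; field_simp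
    rw [e]
    have := Real.log_two_lt_d9
    have : 14 / (y / 2 ^ (j + 1)) ≤ 14 / 1000 := div_le_div_of_nonneg_left (by norm_num) (by norm_num) ha
    linarith
  · intro p hp
    obtain ⟨a1, a2⟩ := Finset.mem_filter.1 hp
    obtain ⟨b1, b2, b3⟩ := b.hcol p a1
    rw [a2] at b2 b3
    refine ⟨(b.hP p a1).1, ?_, ?_⟩
    · rw [div_lt_iff₀ (by positivity)]; have := b3 hj; linarith
    · rw [le_div_iff₀ (by positivity)]; linarith

theorem Blk.f01 {m k y P col} (b : Blk m k y P col) : ∀ p ∈ P, 0 ≤ 1 / (p:ℝ) ∧ 1 / (p:ℝ) ≤ 1 / 2 := by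
  intro p hp
  have h := (b.hP p hp).1.two_le
  have h2 : (2:ℝ) ≤ p := by exact_mod_cast h
  exact ⟨by positivity, div_le_div_of_nonneg_left (by norm_num) (by norm_num) h2⟩

theorem Blk.V_ge {m k y P col} (b : Blk m k y P col) (j : ℕ) (hj : j < k) :
    0.29 ≤ ∏ p ∈ P.filter (fun p => col p = j), (1 - 1 / (p:ℝ)) := by
  have := (prod_one_sub_ge (P.filter fun p => col p = j) (fun p => 1 / (p:ℝ)) fun p hp => by
    have := b.f01 p (Finset.mem_filter.1 hp).1
    exact ⟨this.1, by linarith⟩).1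
  have h2 := b.sum_le j hj
  linarith

theorem Blk.V_total {m k y P col} (b : Blk m k y P col) :
    (1 / 2 : ℝ) ^ ⌊Real.exp 2000⌋₊ ≤ (∏ p ∈ P, (1 - 1 / (p:ℝ))) * y ^ 2 := by
  have hy : 1000 * (2:ℝ) ^ k ≤ y := b.hk1
  have h2k : (0:ℝ) < 2 ^ k := by positivity
  rw [← Finset.prod_fiberwise_of_maps_to (s := P) (t := range (k + 1)) (g := col)
    (fun p hp => Finset.mem_range.2 (Nat.lt_succ_of_le (b.hcol p hp).1)), Finset.prod_range_succ]
  have h1 : (1 / 4 : ℝ) ^ k ≤ ∏ j ∈ range k, ∏ p ∈ P.filter (fun p => col p = j), (1 - 1 / (p:ℝ)) := by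
    calc (1 / 4 : ℝ) ^ k = ∏ j ∈ range k, (1 / 4 : ℝ) := by simp
      _ ≤ _ := Finset.prod_le_prod (fun _ _ => by norm_num) fun j hj => by
        have := b.V_ge j (Finset.mem_range.1 hj); linarith
  have h2 : (1 / 2 : ℝ) ^ ⌊Real.exp 2000⌋₊ ≤ ∏ p ∈ P.filter (fun p => col p = k), (1 - 1 / (p:ℝ)) := by
    calc (1 / 2 : ℝ) ^ ⌊Real.exp 2000⌋₊ ≤ (1 / 2 : ℝ) ^ (#(P.filter fun p => col p = k)) :=
          pow_le_pow_of_le_one (by norm_num) (by norm_num) (Nat.le_floor b.last_card.1)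
      _ = ∏ p ∈ P.filter (fun p => col p = k), (1 / 2 : ℝ) := by simp
      _ ≤ _ := Finset.prod_le_prod (fun _ _ => by norm_num) fun p hp => by
        have := b.f01 p (Finset.mem_filter.1 hp).1; linarith
  have h3 : (1 / 4 : ℝ) ^ k * y ^ 2 ≥ 1 := by
    have : ((2:ℝ) ^ k) ^ 2 ≤ y ^ 2 := pow_le_pow_left₀ h2k.le (by linarith) 2
    have h40 : (0:ℝ) ≤ (1 / 4) ^ k := pow_nonneg (by norm_num) k
    have e : (1 / 4 : ℝ) ^ k * ((2:ℝ) ^ k) ^ 2 = 1 := by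
      rw [← pow_mul, mul_comm k 2, pow_mul, ← mul_pow]; norm_num
    exact e.symm.le.trans (mul_le_mul_of_nonneg_left this h40)
  have h5 : (0:ℝ) < (1 / 2) ^ ⌊Real.exp 2000⌋₊ := by positivity
  generalize ∏ p ∈ P.filter (fun p => col p = k), (1 - 1 / (p:ℝ)) = B at *
  generalize ∏ j ∈ range k, ∏ p ∈ P.filter (fun p => col p = j), (1 - 1 / (p:ℝ)) = A at *
  have h4 : 1 ≤ A * y ^ 2 := h3.le.trans (mul_le_mul_of_nonneg_right h1 (by positivity))
  calc _ ≤ B := h2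
    _ ≤ B * (A * y ^ 2) := le_mul_of_one_le_right (h5.le.trans h2) h4
    _ = _ := by ring

/-- cutoffs -/
def cut (c0 k N : ℕ) (j : ℕ) : ℕ := if j < k then c0 + 2 * j else 2 * N + 1

theorem cut_odd (c0 k N : ℕ) (h : Odd c0) : ∀ j, Odd (cut c0 k N j) := by
  intro j
  unfold cut
  split_ifs
  · exact h.add_even (even_two_mul j)
  · exact odd_two_mul_add_one N

theorem fact_geom (S : ℝ) (hS : 0 ≤ S) (hS1 : S ≤ 0.71) (c0 : ℕ) (hc : 3 ≤ c0) (j : ℕ) :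
    S ^ (c0 + 2 * j) / ((c0 + 2 * j).factorial : ℝ) ≤ 0.71 ^ c0 / (c0.factorial : ℝ) * (1 / 20) ^ j := by
  have h0 : S ^ (c0 + 2 * j) / ((c0 + 2 * j).factorial : ℝ) ≤ 0.71 ^ (c0 + 2 * j) / ((c0 + 2 * j).factorial : ℝ) := by
    gcongr
  refine h0.trans ?_
  clear h0
  induction j with
  | zero => simp
  | succ j ih =>
    rw [show c0 + 2 * (j + 1) = c0 + 2 * j + 1 + 1 by ring, Nat.factorial_succ, Nat.factorial_succ, pow_succ (1 / 20 : ℝ)]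
    rw [← mul_assoc (_ / _ : ℝ) ((1 / 20 : ℝ) ^ j)]
    have hf : (0:ℝ) < ((c0 + 2 * j).factorial : ℝ) := by positivity
    have hc' : (3:ℝ) ≤ c0 := by exact_mod_cast hc
    refine le_trans ?_ (mul_le_mul_of_nonneg_right ih (by norm_num))
    push_cast
    rw [div_mul_eq_mul_div, div_le_div_iff₀ (by positivity) hf]
    have hj0 : (0:ℝ) ≤ j := by positivity
    have h4 : (20:ℝ) ≤ (c0 + 2 * j + 1 + 1) * (c0 + 2 * j + 1) := by nlinarith
    have h5 : (0:ℝ) < 0.71 ^ (c0 + 2 * j) * ((c0 + 2 * j).factorial : ℝ) := by positivity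
    rw [pow_succ, pow_succ]
    generalize (0.71:ℝ) ^ (c0 + 2 * j) = u at *
    generalize ((c0 + 2 * j).factorial : ℝ) = v at *
    nlinarith [mul_le_mul_of_nonneg_left h4 h5.le]

theorem Blk.eta {m k y P col} (b : Blk m k y P col) (c0 : ℕ) (hc : 3 ≤ c0) :
    ∑ j ∈ range (k + 1), gs (fun n => n = cut c0 k (#(P.filter fun p => col p = k)) j) (P.filter fun p => col p = j) (fun p => 1 / (p:ℝ)) /
      ∏ p ∈ P.filter (fun p => col p = j), (1 - 1 / (p:ℝ)) ≤ 0.71 ^ c0 / (c0.factorial : ℝ) * (20 / 19) / 0.29 := by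
  rw [Finset.sum_range_succ]
  have h1 : gs (fun n => n = cut c0 k (#(P.filter fun p => col p = k)) k) (P.filter fun p => col p = k) (fun p => 1 / (p:ℝ)) = 0 := by
    apply gs_eq_zero
    unfold cut
    rw [if_neg (lt_irrefl k)]; omega
  rw [h1, zero_div, add_zero]
  have h2 : ∀ j ∈ range k, gs (fun n => n = cut c0 k (#(P.filter fun p => col p = k)) j) (P.filter fun p => col p = j) (fun p => 1 / (p:ℝ)) /
      ∏ p ∈ P.filter (fun p => col p = j), (1 - 1 / (p:ℝ)) ≤ 0.71 ^ c0 / (c0.factorial : ℝ) * (1 / 20) ^ j / 0.29 := by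
    intro j hj
    have hj := Finset.mem_range.1 hj
    have hV := b.V_ge j hj
    have hpos : ∀ p ∈ P.filter (fun p => col p = j), 0 ≤ 1 / (p:ℝ) := fun p _ => by positivity
    have h3 := es_bound (P.filter fun p => col p = j) (fun p => 1 / (p:ℝ)) hpos (cut c0 k (#(P.filter fun p => col p = k)) j)
    have h4 := fact_geom (∑ p ∈ P.filter (fun p => col p = j), 1 / (p:ℝ)) (Finset.sum_nonneg hpos) (b.sum_le j hj) c0 hc j
    have e : cut c0 k (#(P.filter fun p => col p = k)) j = c0 + 2 * j := by unfold cut; rw [if_pos hj]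
    rw [e] at h3 ⊢
    exact div_le_div₀ (by positivity) (h3.trans h4) (by norm_num) hV
  refine (Finset.sum_le_sum h2).trans ?_
  rw [← Finset.sum_div, ← Finset.mul_sum]
  have h5 : ∑ j ∈ range k, (1 / 20 : ℝ) ^ j ≤ 20 / 19 := by
    rw [geom_sum_eq (by norm_num)]
    have : (0:ℝ) < (1 / 20) ^ k := by positivity
    rw [div_le_iff_of_neg (by norm_num)]
    linarith
  gcongr

end

section

open Finset

set_option linter.unusedVariables false

theorem sum12 (k : ℕ) : ∑ j ∈ range k, ((4 + 2 * j : ℕ) : ℝ) / 2 ^ j ≤ 12 := by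
  have : ∑ j ∈ range k, ((4 + 2 * j : ℕ) : ℝ) / 2 ^ j = 12 - (12 + 4 * k) / 2 ^ k := by
    induction k with
    | zero => simp
    | succ k ih => rw [Finset.sum_range_succ, ih]; push_cast; rw [pow_succ]; field_simp; ring
  rw [this]
  have : (0:ℝ) ≤ (12 + 4 * k) / 2 ^ k := by positivity
  linarith

theorem sum8 (k : ℕ) : ∑ j ∈ range k, ((2 + 2 * j : ℕ) : ℝ) / 2 ^ j ≤ 8 := by
  have : ∑ j ∈ range k, ((2 + 2 * j : ℕ) : ℝ) / 2 ^ j = 8 - (8 + 4 * k) / 2 ^ k := by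
    induction k with
    | zero => simp
    | succ k ih => rw [Finset.sum_range_succ, ih]; push_cast; rw [pow_succ]; field_simp; ring
  rw [this]
  have : (0:ℝ) ≤ (8 + 4 * k) / 2 ^ k := by positivity
  linarith

theorem sum13 (k i : ℕ) : ∑ j ∈ range k, ((4 + 2 * j + (if j = i then 1 else 0) : ℕ) : ℝ) / 2 ^ j ≤ 13 := by
  have h1 : ∀ j ∈ range k, ((4 + 2 * j + (if j = i then 1 else 0) : ℕ) : ℝ) / 2 ^ j ≤
      ((4 + 2 * j : ℕ) : ℝ) / 2 ^ j + (if j = i then 1 else 0) := by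
    intro j _
    split_ifs
    · rw [Nat.cast_add, add_div]
      have : ((1:ℕ):ℝ) / 2 ^ j ≤ 1 := by
        rw [Nat.cast_one]
        exact div_le_one_of_le₀ (one_le_pow₀ (by norm_num)) (by positivity)
      linarith
    · simp
  refine (Finset.sum_le_sum h1).trans ?_
  rw [Finset.sum_add_distrib]
  have h2 := sum12 k
  have h3 : ∑ j ∈ range k, (if j = i then (1:ℝ) else 0) ≤ 1 := by
    rw [Finset.sum_ite_eq']; split_ifs <;> norm_num
  linarith

theorem Blk.upper {ι : Type} {m k y P col} (b : Blk m k y P col) (I : Finset ι) (w : ι → ℝ) (s : ι → ℕ) (T : Finset ℕ)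
    (hT : ∀ q ∈ T, 0 < q ∧ q.Coprime m ∧ ∀ p ∈ P, ¬ p ∣ q) (X R τ σ η : ℝ) (D c0 : ℕ) (hc0 : 3 ≤ c0) (hodd : Odd c0)
    (hw : ∀ i ∈ I, 0 ≤ w i) (hX : 0 ≤ X)
    (hD : D = ⌊Real.exp (120 * y)⌋₊) (hTs : ∀ q ∈ T, (q:ℝ) ≤ Real.exp (τ * y))
    (hσ : ∑ j ∈ range k, ((c0 - 1 + 2 * j : ℕ) : ℝ) / 2 ^ j ≤ σ) (hτ : τ * y + (y * σ + 2000 * Real.exp 2000) ≤ 120 * y)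
    (hη : 0.71 ^ c0 / (c0.factorial : ℝ) * (20 / 19) / 0.29 ≤ η)
    (hR : ∑ d ∈ US m D, |∑ i ∈ I, w i * ind d (s i) - X / d| ≤ R) :
    ∑ q ∈ T, ∑ i ∈ I, w i * (ind q (s i) * ∏ p ∈ P, (1 - ind p (s i))) ≤
      X * (∑ q ∈ T, (1:ℝ) / q) * ((∏ p ∈ P, (1 - 1 / (p:ℝ))) * Real.exp η) + R := by
  have hy : 0 < y := by
    have := b.hk1
    have : (0:ℝ) < 2 ^ k := by positivity
    linarith
  have hcol : ∀ p ∈ P, col p < k + 1 := fun p hp => Nat.lt_succ_of_le (b.hcol p hp).1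
  obtain ⟨N, hN⟩ : ∃ N, N = #(P.filter fun p => col p = k) := ⟨_, rfl⟩
  have hco := cut_odd c0 k N hodd
  have h1 := bs_err m D I w s (k + 1) (fun j n => n < cut c0 k N j) P col T (fun p hp => ⟨(b.hP p hp).1, (b.hP p hp).2.1⟩) hT X ?_ R hR
  · have h2 := (abs_le.1 h1).2
    have h3 := (bh_main (k + 1) (cut c0 k N) P col (fun p => 1 / (p:ℝ)) η hcol hco
      (fun p hp => ⟨(b.f01 p hp).1, by have := (b.f01 p hp).2; linarith⟩) (by rw [hN]; exact (b.eta c0 hc0).trans hη)).1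
    have h4 : ∑ q ∈ T, ∑ i ∈ I, w i * (ind q (s i) * ∏ p ∈ P, (1 - ind p (s i))) ≤
        ∑ q ∈ T, ∑ i ∈ I, w i * (ind q (s i) * bsum (k + 1) (fun j n => n < cut c0 k N j) P col (fun p => - ind p (s i))) := by
      refine Finset.sum_le_sum fun q _ => Finset.sum_le_sum fun i hi => ?_
      refine mul_le_mul_of_nonneg_left (mul_le_mul_of_nonneg_left ?_ (ind_nonneg _ _)) (hw i hi)
      exact (bh_bounds (k + 1) (cut c0 k N) P col (fun p => ind p (s i)) hcol hco (fun p _ => ⟨ind_nonneg _ _, ind_le _ _⟩)).2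
    unfold bhU at h3
    have h5 : 0 ≤ X * (∑ q ∈ T, (1:ℝ) / q) := mul_nonneg hX (Finset.sum_nonneg fun q _ => by positivity)
    have h6 := mul_le_mul_of_nonneg_left h3 h5
    linarith
  · intro q hq Q hQ hc
    rw [hD]
    apply Nat.le_floor
    push_cast
    have h2 := b.size Q hQ (fun j => c0 - 1 + 2 * j) fun j hj => by
      have := hc j (Finset.mem_range.2 (by omega))
      simp only [cut, if_pos hj] at this
      omega
    have h3 := mul_le_mul (hTs q hq) h2 (by positivity) (Real.exp_pos _).le
    rw [← Real.exp_add] at h3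
    push_cast at h3 ⊢
    refine h3.trans (Real.exp_le_exp.2 ?_)
    push_cast at hσ
    have := mul_le_mul_of_nonneg_left hσ hy.le
    linarith

theorem Blk.lower {ι : Type} {m k y P col} (b : Blk m k y P col) (I : Finset ι) (w : ι → ℝ) (s : ι → ℕ)
    (X R η : ℝ) (D : ℕ) (hw : ∀ i ∈ I, 0 ≤ w i) (hX : 0 ≤ X)
    (hD : D = ⌊Real.exp (120 * y)⌋₊) (hτ : 2000 * Real.exp 2000 ≤ y)
    (hη : 0.71 ^ 5 / ((5:ℕ).factorial : ℝ) * (20 / 19) / 0.29 ≤ η)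
    (hR : ∑ d ∈ US m D, |∑ i ∈ I, w i * ind d (s i) - X / d| ≤ R) :
    X * ((∏ p ∈ P, (1 - 1 / (p:ℝ))) * (1 - η * Real.exp η)) - (k + 2) * R ≤
      ∑ i ∈ I, w i * ∏ p ∈ P, (1 - ind p (s i)) := by
  have hy : 0 < y := by
    have := b.hk1
    have : (0:ℝ) < 2 ^ k := by positivity
    linarith
  have hcol : ∀ p ∈ P, col p < k + 1 := fun p hp => Nat.lt_succ_of_le (b.hcol p hp).1
  obtain ⟨N, hN⟩ : ∃ N, N = #(P.filter fun p => col p = k) := ⟨_, rfl⟩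
  have hco := cut_odd 5 k N (by decide)
  have key : ∀ c : ℕ → ℕ → Prop, (∃ i, ∀ j < k, ∀ n, c j n → n ≤ 4 + 2 * j + (if j = i then 1 else 0)) →
      |∑ i ∈ I, w i * bsum (k + 1) c P col (fun p => - ind p (s i)) - X * bsum (k + 1) c P col (fun p => - (1 / (p:ℝ)))| ≤ R := by
    rintro c ⟨i, hc⟩
    have h1 := bs_err m D I w s (k + 1) c P col {1} (fun p hp => ⟨(b.hP p hp).1, (b.hP p hp).2.1⟩)
      (fun q hq => by
        rw [Finset.mem_singleton] at hq
        subst hq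
        exact ⟨one_pos, Nat.coprime_one_left m, fun p hp h => (b.hP p hp).1.one_lt.ne' (Nat.dvd_one.1 h)⟩) X ?_ R hR
    · rw [Finset.sum_singleton, Finset.sum_singleton, Nat.cast_one, div_one, mul_one] at h1
      simpa only [ind, one_dvd, if_true, one_mul] using h1
    · intro q hq Q hQ hcc
      rw [Finset.mem_singleton] at hq
      subst hq
      rw [hD, one_mul]
      apply Nat.le_floor
      have h2 := b.size Q hQ (fun j => 4 + 2 * j + (if j = i then 1 else 0)) fun j hj =>
        hc j hj _ (hcc j (Finset.mem_range.2 (by omega)))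
      refine h2.trans (Real.exp_le_exp.2 ?_)
      have := mul_le_mul_of_nonneg_left (sum13 k i) hy.le
      linarith
  have h3 := (bh_main (k + 1) (cut 5 k N) P col (fun p => 1 / (p:ℝ)) η hcol hco
    (fun p hp => ⟨(b.f01 p hp).1, by have := (b.f01 p hp).2; linarith⟩) (by rw [hN]; exact (b.eta 5 (by norm_num)).trans hη)).2
  have h4 : ∑ i ∈ I, w i * bhL (k + 1) (cut 5 k N) P col (fun p => ind p (s i)) ≤ ∑ i ∈ I, w i * ∏ p ∈ P, (1 - ind p (s i)) := by
    refine Finset.sum_le_sum fun i hi => mul_le_mul_of_nonneg_left ?_ (hw i hi)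
    exact (bh_bounds (k + 1) (cut 5 k N) P col (fun p => ind p (s i)) hcol hco (fun p _ => ⟨ind_nonneg _ _, ind_le _ _⟩)).1
  have h5 := mul_le_mul_of_nonneg_left h3 hX
  have h6 : X * bhL (k + 1) (cut 5 k N) P col (fun p => 1 / (p:ℝ)) - (k + 2) * R ≤
      ∑ i ∈ I, w i * bhL (k + 1) (cut 5 k N) P col (fun p => ind p (s i)) := by
    unfold bhL
    have e1 : ∑ i ∈ I, w i * (bsum (k + 1) (fun j n => n < cut 5 k N j) P col (fun p => - ind p (s i)) +
        ∑ r ∈ range (k + 1), bsum (k + 1) (Function.update (fun j n => n < cut 5 k N j) r (fun n => n = cut 5 k N r)) P col (fun p => - ind p (s i)))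
        = ∑ i ∈ I, w i * bsum (k + 1) (fun j n => n < cut 5 k N j) P col (fun p => - ind p (s i)) +
        ∑ r ∈ range (k + 1), ∑ i ∈ I, w i * bsum (k + 1) (Function.update (fun j n => n < cut 5 k N j) r (fun n => n = cut 5 k N r)) P col (fun p => - ind p (s i)) := by
      rw [Finset.sum_comm, ← Finset.sum_add_distrib]
      refine Finset.sum_congr rfl fun i _ => ?_
      rw [← Finset.mul_sum]; ring
    rw [e1, mul_add, Finset.mul_sum]
    have a1 := (abs_le.1 (key (fun j n => n < cut 5 k N j) ⟨0, fun j hj n hn => by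
      simp only [cut, if_pos hj] at hn
      omega⟩)).1
    have a2 : ∑ r ∈ range (k + 1), (X * bsum (k + 1) (Function.update (fun j n => n < cut 5 k N j) r (fun n => n = cut 5 k N r)) P col (fun p => - (1 / (p:ℝ))) - R) ≤
        ∑ r ∈ range (k + 1), ∑ i ∈ I, w i * bsum (k + 1) (Function.update (fun j n => n < cut 5 k N j) r (fun n => n = cut 5 k N r)) P col (fun p => - ind p (s i)) := by
      refine Finset.sum_le_sum fun r _ => ?_
      have := (abs_le.1 (key (Function.update (fun j n => n < cut 5 k N j) r (fun n => n = cut 5 k N r)) ⟨r, fun j hj n hn => by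
        by_cases hjr : j = r
        · subst hjr
          rw [Function.update_self] at hn
          simp only [cut, if_pos hj] at hn
          rw [if_pos rfl]; omega
        · rw [Function.update_of_ne hjr] at hn
          simp only [cut, if_pos hj] at hn
          omega⟩)).1
      linarith
    rw [Finset.sum_sub_distrib, Finset.sum_const, Finset.card_range, nsmul_eq_mul] at a2
    push_cast at a2
    linarith
  linarith

end

section

open Finset

set_option linter.unusedVariables false

theorem y_large (v : ℝ) (hv : 0 < v) : ∃ y0 : ℝ, ∀ y ≥ y0, 60 * y ^ 3 * Real.exp (-(y / 50)) < v := by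
  have h := (Real.tendsto_pow_mul_exp_neg_atTop_nhds_zero 3).comp (Filter.tendsto_id.atTop_div_const (r := (50:ℝ)) (by norm_num))
  have h2 := h.eventually (gt_mem_nhds (show (0:ℝ) < v / (60 * 125000) by positivity))
  obtain ⟨y0, h3⟩ := Filter.eventually_atTop.1 h2
  refine ⟨y0, fun y hy => ?_⟩
  have := h3 y hy
  simp only [Function.comp, id] at this
  rw [lt_div_iff₀ (by norm_num)] at this
  refine lt_of_le_of_lt (le_of_eq ?_) this
  ring

theorem log102 : Real.log 102 ≤ 4.63 := by
  rw [Real.log_le_iff_le_exp (by norm_num)]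
  have h := Real.exp_one_gt_d9
  have h1 := Real.sum_le_exp_of_nonneg (x := 0.63) (by norm_num) 4
  rw [show (4.63:ℝ) = ((4:ℕ):ℝ) * 1 + 0.63 by norm_num, Real.exp_add, Real.exp_nat_mul]
  have h2 : (1.87:ℝ) ≤ Real.exp 0.63 := by
    refine le_trans ?_ h1
    norm_num [Finset.sum_range_succ, Nat.factorial]
  have h3 : (2.7182 : ℝ) ^ 4 ≤ Real.exp 1 ^ 4 := pow_le_pow_left₀ (by norm_num) (by linarith) 4
  calc (102:ℝ) ≤ 2.7182 ^ 4 * 1.87 := by norm_num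
    _ ≤ _ := mul_le_mul h3 h2 (by norm_num) (by positivity)

theorem num_main (u1 u2 : ℝ) (h1 : u1 ≤ 4.631) (h2 : u2 ≤ 0.0943) (hu1 : 0 ≤ u1) (hu2 : 0 ≤ u2) :
    0.1 ≤ 5 * (1 - 0.0055 * Real.exp 0.0055) - u1 * Real.exp 0.0055 - u2 * Real.exp 0.22 := by
  have a1 : Real.exp 0.0055 ≤ 1.0056 := by
    refine (Real.exp_bound_div_one_sub_of_interval (by norm_num) (by norm_num)).trans ?_
    norm_num
  have a2 : Real.exp 0.22 ≤ 1.283 := by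
    refine (Real.exp_bound_div_one_sub_of_interval (by norm_num) (by norm_num)).trans ?_
    norm_num
  have b1 : u1 * Real.exp 0.0055 ≤ 4.631 * 1.0056 := mul_le_mul h1 a1 (Real.exp_pos _).le (by norm_num)
  have b2 : u2 * Real.exp 0.22 ≤ 0.0943 * 1.283 := mul_le_mul h2 a2 (Real.exp_pos _).le (by norm_num)
  norm_num at *
  linarith

noncomputable def Tq (m : ℕ) (y : ℝ) : Finset ℕ := by
  classical
  exact (US m ⌊Real.exp (111.6 * y)⌋₊).filter fun q => q.Prime ∧ y < Real.log q

theorem mem_Tq {m : ℕ} {y : ℝ} {q : ℕ} : q ∈ Tq m y ↔ q.Prime ∧ q.Coprime m ∧ y < Real.log q ∧ Real.log q ≤ 111.6 * y := by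
  unfold Tq
  rw [Finset.mem_filter, mem_US]
  constructor
  · rintro ⟨⟨h1, h2, h3⟩, h4, h5⟩
    refine ⟨h4, h3, h5, ?_⟩
    have hp0 : (0:ℝ) < q := by exact_mod_cast h4.pos
    rw [Real.log_le_iff_le_exp hp0]
    exact (Nat.cast_le.2 h2).trans (Nat.floor_le (Real.exp_pos _).le)
  · rintro ⟨h4, h3, h5, h6⟩
    have hp0 : (0:ℝ) < q := by exact_mod_cast h4.pos
    rw [Real.log_le_iff_le_exp hp0] at h6
    exact ⟨⟨h4.pos, Nat.le_floor h6, h3⟩, h4, h5⟩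

theorem sieve_main : ∃ y0 : ℝ, ∀ y : ℝ, y0 ≤ y → ∀ (ι : Type) (m : ℕ) (I : Finset ι) (w : ι → ℝ) (s : ι → ℕ) (X : ℝ),
    0 < X → (∀ i ∈ I, 0 ≤ w i) →
    (∑ d ∈ US m ⌊Real.exp (120 * y)⌋₊, |∑ i ∈ I, w i * ind d (s i) - X / d| ≤ X * Real.exp (-(y / 50))) →
    (∑ d ∈ US m ⌊Real.exp (120 * y)⌋₊, |∑ i ∈ I, w i * ind (d ^ 2) (s i) - X / (d:ℝ) ^ 2| ≤ X * Real.exp (-(y / 50))) →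
    ∃ i ∈ I, 0 < w i ∧ (∀ p : ℕ, p.Prime → p.Coprime m → Real.log p ≤ y → ¬ p ∣ s i) ∧
      #((Tq m y).filter fun q => q ∣ s i) ≤ 4 ∧ ∀ q ∈ Tq m y, ¬ q ^ 2 ∣ s i := by
  classical
  obtain ⟨v, hv⟩ : ∃ v : ℝ, v = (1 / 2 : ℝ) ^ ⌊Real.exp 2000⌋₊ := ⟨_, rfl⟩
  have hv0 : 0 < v := by rw [hv]; positivity
  obtain ⟨y1, hy1⟩ := y_large (0.1 * v) (by positivity)
  refine ⟨max y1 (max 1000000 (2.5 * (2000 * Real.exp 2000))), ?_⟩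
  intro y hy ι m I w s X hX hw hlev1 hlev2
  have hyy1 : y1 ≤ y := (le_max_left _ _).trans hy
  have hy6 : 1000000 ≤ y := ((le_max_left _ _).trans (le_max_right _ _)).trans hy
  have hyC : 2.5 * (2000 * Real.exp 2000) ≤ y := ((le_max_right _ _).trans (le_max_right _ _)).trans hy
  have hC0 : 0 < 2000 * Real.exp 2000 := by positivity
  have hylim := hy1 y hyy1
  obtain ⟨R, hR⟩ : ∃ R, R = X * Real.exp (-(y / 50)) := ⟨_, rfl⟩
  rw [← hR] at hlev1 hlev2
  obtain ⟨D, hD⟩ : ∃ D, D = ⌊Real.exp (120 * y)⌋₊ := ⟨_, rfl⟩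
  rw [← hD] at hlev1 hlev2
  obtain ⟨k, col, b⟩ := blk_exists m y (by linarith)
  obtain ⟨P, hP⟩ : ∃ P, P = (US m ⌊Real.exp y⌋₊).filter Nat.Prime := ⟨_, rfl⟩
  rw [← hP] at b
  obtain ⟨T, hT⟩ : ∃ T, T = Tq m y := ⟨_, rfl⟩
  have memP : ∀ p : ℕ, p.Prime → p.Coprime m → Real.log p ≤ y → p ∈ P := by
    intro p h1 h2 h3
    have hp0 : (0:ℝ) < p := by exact_mod_cast h1.pos
    rw [Real.log_le_iff_le_exp hp0] at h3
    rw [hP, Finset.mem_filter, mem_US]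
    exact ⟨⟨h1.pos, Nat.le_floor h3, h2⟩, h1⟩
  have memT : ∀ q, q ∈ T ↔ q.Prime ∧ q.Coprime m ∧ y < Real.log q ∧ Real.log q ≤ 111.6 * y := fun q => by
    rw [hT]; exact mem_Tq
  rw [← hT]
  have hTP : ∀ q ∈ T, 0 < q ∧ q.Coprime m ∧ ∀ p ∈ P, ¬ p ∣ q := by
    intro q hq
    obtain ⟨a1, a2, a3, a4⟩ := (memT q).1 hq
    refine ⟨a1.pos, a2, fun p hp hpq => ?_⟩
    have := (b.hP p hp)
    rw [(Nat.prime_dvd_prime_iff_eq this.1 a1).1 hpq] at this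
    linarith [this.2.2]
  obtain ⟨T1, hT1⟩ : ∃ T1, T1 = T.filter fun q : ℕ => Real.log q ≤ 102 * y := ⟨_, rfl⟩
  obtain ⟨T2, hT2⟩ : ∃ T2, T2 = T.filter fun q : ℕ => ¬ (Real.log q ≤ 102 * y) := ⟨_, rfl⟩
  have hsplit : ∀ F : ℕ → ℝ, ∑ q ∈ T, F q = ∑ q ∈ T1, F q + ∑ q ∈ T2, F q := fun F => by
    rw [hT1, hT2, Finset.sum_filter_add_sum_filter_not]
  have hT1T : ∀ q ∈ T1, q ∈ T ∧ Real.log q ≤ 102 * y := fun q hq => by rw [hT1] at hq; exact Finset.mem_filter.1 hq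
  have hT2T : ∀ q ∈ T2, q ∈ T ∧ 102 * y < Real.log q := fun q hq => by
    rw [hT2] at hq; have := Finset.mem_filter.1 hq; exact ⟨this.1, not_le.1 this.2⟩
  have hexp : ∀ q ∈ T, ∀ z, Real.log q ≤ z → (q:ℝ) ≤ Real.exp z := fun q hq z hz => by
    have hp0 : (0:ℝ) < q := by exact_mod_cast (hTP q hq).1
    rwa [Real.log_le_iff_le_exp hp0] at hz
  obtain ⟨u1, hu1⟩ : ∃ u1, u1 = ∑ q ∈ T1, (1:ℝ) / q := ⟨_, rfl⟩
  obtain ⟨u2, hu2⟩ : ∃ u2, u2 = ∑ q ∈ T2, (1:ℝ) / q := ⟨_, rfl⟩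
  have hu1n : 0 ≤ u1 := by rw [hu1]; exact Finset.sum_nonneg fun q _ => by positivity
  have hu2n : 0 ≤ u2 := by rw [hu2]; exact Finset.sum_nonneg fun q _ => by positivity
  have hy0 : 0 < y := by linarith
  have b14 : 14 / y ≤ 0.00005 := by rw [div_le_iff₀ hy0]; linarith
  have hu1b : u1 ≤ 4.631 := by
    rw [hu1]
    refine (mert T1 y (102 * y) (by linarith) (by linarith) fun q hq => ?_).trans ?_
    · obtain ⟨a, c⟩ := hT1T q hq
      exact ⟨((memT q).1 a).1, ((memT q).1 a).2.2.1, c⟩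
    · rw [mul_div_assoc, div_self hy0.ne', mul_one]
      linarith [log102]
  have hu2b : u2 ≤ 0.0943 := by
    rw [hu2]
    refine (mert T2 (102 * y) (111.6 * y) (by linarith) (by linarith) fun q hq => ?_).trans ?_
    · obtain ⟨a, c⟩ := hT2T q hq
      exact ⟨((memT q).1 a).1, c, ((memT q).1 a).2.2.2⟩
    · rw [mul_div_mul_right _ _ hy0.ne']
      have h1 := Real.log_le_sub_one_of_pos (show (0:ℝ) < 111.6 / 102 by norm_num)
      have h2 : 14 / (102 * y) ≤ 14 / y := div_le_div_of_nonneg_left (by norm_num) hy0 (by linarith)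
      have h3 : (111.6 / 102 - 1 : ℝ) ≤ 0.0942 := by norm_num
      linarith
  obtain ⟨V, hV⟩ : ∃ V, V = ∏ p ∈ P, (1 - 1 / (p:ℝ)) := ⟨_, rfl⟩
  obtain ⟨x, hx⟩ : ∃ x : ι → ℝ, ∀ i, x i = ∏ p ∈ P, (1 - ind p (s i)) := ⟨_, fun i => rfl⟩
  have hx01 : ∀ i, 0 ≤ x i ∧ x i ≤ 1 := fun i => by
    rw [hx]
    exact ⟨Finset.prod_nonneg fun p _ => by linarith [ind_le p (s i)],
      (prod_one_sub_ge P (fun p => ind p (s i)) fun p _ => ⟨ind_nonneg _ _, ind_le _ _⟩).2⟩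
  have hlow := b.lower I w s X R 0.0055 D hw hX.le hD (by linarith) (by norm_num [Nat.factorial]) hlev1
  have hup1 := b.upper I w s T1 (fun q hq => hTP q (hT1T q hq).1) X R 102 12 0.0055 D 5 (by norm_num) (by decide) hw hX.le hD
    (fun q hq => hexp q (hT1T q hq).1 _ (hT1T q hq).2) (by simpa using sum12 k) (by linarith) (by norm_num [Nat.factorial]) hlev1
  have hup2 := b.upper I w s T2 (fun q hq => hTP q (hT2T q hq).1) X R 111.6 8 0.22 D 3 (by norm_num) (by decide) hw hX.le hD
    (fun q hq => hexp q (hT2T q hq).1 _ ((memT q).1 (hT2T q hq).1).2.2.2) (by simpa using sum8 k) (by linarith) (by norm_num [Nat.factorial]) hlev1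
  have hVt := b.V_total
  rw [← hv, ← hV] at hVt
  rw [← hV, ← hu1] at hup1
  rw [← hV, ← hu2] at hup2
  rw [← hV] at hlow
  simp only [← hx] at hlow hup1 hup2
  -- squares
  have hsq : ∑ q ∈ T, ∑ i ∈ I, w i * ind (q ^ 2) (s i) ≤ X * (6 * Real.exp (-y)) + R := by
    have hsub : T ⊆ US m D := by
      intro q hq
      obtain ⟨a1, a2, a3, a4⟩ := (memT q).1 hq
      rw [mem_US, hD]
      exact ⟨a1.pos, Nat.le_floor (hexp q hq _ (by linarith)), a2⟩
    have h1 : ∑ q ∈ T, |∑ i ∈ I, w i * ind (q ^ 2) (s i) - X / (q:ℝ) ^ 2| ≤ R :=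
      (Finset.sum_le_sum_of_subset_of_nonneg hsub fun _ _ _ => abs_nonneg _).trans hlev2
    have h2 : ∑ q ∈ T, X / (q:ℝ) ^ 2 ≤ X * (6 * Real.exp (-y)) := by
      calc ∑ q ∈ T, X / (q:ℝ) ^ 2 ≤ ∑ q ∈ T, X * Real.exp (-y) * (1 / q) := by
            refine Finset.sum_le_sum fun q hq => ?_
            obtain ⟨a1, a2, a3, a4⟩ := (memT q).1 hq
            have hp0 : (0:ℝ) < q := by exact_mod_cast a1.pos
            rw [Real.lt_log_iff_exp_lt hp0] at a3
            have h3 : 1 / (q:ℝ) ≤ Real.exp (-y) := by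
              rw [Real.exp_neg, one_div]; exact inv_anti₀ (Real.exp_pos y) a3.le
            calc X / (q:ℝ) ^ 2 = X * (1 / q) * (1 / q) := by field_simp
              _ ≤ _ := by gcongr
        _ = X * Real.exp (-y) * (u1 + u2) := by rw [← Finset.mul_sum, hsplit, hu1, hu2]
        _ ≤ X * Real.exp (-y) * 6 := by gcongr; linarith
        _ = _ := by ring
    calc _ ≤ ∑ q ∈ T, (|∑ i ∈ I, w i * ind (q ^ 2) (s i) - X / (q:ℝ) ^ 2| + X / (q:ℝ) ^ 2) :=
          Finset.sum_le_sum fun q _ => by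
            have := le_abs_self (∑ i ∈ I, w i * ind (q ^ 2) (s i) - X / (q:ℝ) ^ 2); linarith
      _ ≤ _ := by rw [Finset.sum_add_distrib]; linarith
  by_contra hcon
  push Not at hcon
  have hneg : ∀ i ∈ I, w i * (5 * x i) - ∑ q ∈ T, w i * (ind q (s i) * x i) - 5 * ∑ q ∈ T, w i * ind (q ^ 2) (s i) ≤ 0 := by
    intro i hi
    have hwi := hw i hi
    rw [← Finset.mul_sum, ← Finset.mul_sum, ← Finset.sum_mul]
    have e : w i * (5 * x i) - w i * ((∑ q ∈ T, ind q (s i)) * x i) - 5 * (w i * ∑ q ∈ T, ind (q ^ 2) (s i)) =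
      w i * (x i * (5 - ∑ q ∈ T, ind q (s i)) - 5 * ∑ q ∈ T, ind (q ^ 2) (s i)) := by ring
    rw [e]
    rcases hwi.eq_or_lt with h0 | h0
    · rw [← h0, zero_mul]
    apply mul_nonpos_of_nonneg_of_nonpos hwi
    have hs1 : ∑ q ∈ T, ind q (s i) = (#(T.filter fun q => q ∣ s i) : ℝ) := by
      unfold ind; rw [Finset.sum_boole]
    have hs2 : 0 ≤ ∑ q ∈ T, ind (q ^ 2) (s i) := Finset.sum_nonneg fun q _ => ind_nonneg _ _
    have hs3 : 0 ≤ ∑ q ∈ T, ind q (s i) := Finset.sum_nonneg fun q _ => ind_nonneg _ _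
    obtain ⟨hx0, hx1⟩ := hx01 i
    by_cases c1 : ∀ p : ℕ, p.Prime → p.Coprime m → Real.log p ≤ y → ¬ p ∣ s i
    · by_cases c2 : #(T.filter fun q => q ∣ s i) ≤ 4
      · obtain ⟨q, hq, hq2⟩ := hcon i hi h0 c1 c2
        have : 1 ≤ ∑ q ∈ T, ind (q ^ 2) (s i) := by
          calc (1:ℝ) = ind (q ^ 2) (s i) := by unfold ind; rw [if_pos hq2]
            _ ≤ _ := Finset.single_le_sum (f := fun q => ind (q ^ 2) (s i)) (fun q _ => ind_nonneg _ _) hq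
        nlinarith
      · have : (5:ℝ) ≤ #(T.filter fun q => q ∣ s i) := by exact_mod_cast (by omega : 5 ≤ #(T.filter fun q => q ∣ s i))
        rw [← hs1] at this
        nlinarith
    · push Not at c1
      obtain ⟨p, p1, p2, p3, p4⟩ := c1
      have : x i = 0 := by
        rw [hx]
        apply Finset.prod_eq_zero (memP p p1 p2 p3)
        unfold ind; rw [if_pos p4]; norm_num
      rw [this]; linarith
  have hsum := Finset.sum_nonpos hneg
  rw [Finset.sum_sub_distrib, Finset.sum_sub_distrib, ← Finset.mul_sum, Finset.sum_comm, Finset.sum_comm (s := I) (t := T), hsplit] at hsum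
  have e5 : ∑ i ∈ I, w i * (5 * x i) = 5 * ∑ i ∈ I, w i * x i := by
    rw [Finset.mul_sum]; exact Finset.sum_congr rfl fun i _ => by ring
  rw [e5] at hsum
  have hnum := num_main u1 u2 hu1b hu2b hu1n hu2n
  have hy2 : 0 < y ^ 2 := by positivity
  have hVpos : 0 < V := by
    by_contra h
    have := mul_nonpos_of_nonpos_of_nonneg (not_lt.1 h) hy2.le
    linarith
  have hXV := mul_le_mul_of_nonneg_left hnum (mul_pos hX hVpos).le
  -- combine
  have hfin : X * V * 0.1 ≤ (5 * (k + 2) + 7) * R + 30 * (X * Real.exp (-y)) := by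
    linarith only [hXV, hsum, hlow, hup1, hup2, hsq]
  have hk : (k:ℝ) ≤ y := by
    have h1 : (k:ℝ) ≤ 2 ^ k := by exact_mod_cast (Nat.lt_two_pow_self (n := k)).le
    have h2 : (0:ℝ) < 2 ^ k := by positivity
    linarith [b.hk1]
  have hexpy : Real.exp (-y) ≤ Real.exp (-(y / 50)) := Real.exp_le_exp.2 (by linarith)
  have hE := Real.exp_pos (-(y / 50))
  rw [hR] at hfin
  generalize Real.exp (-(y / 50)) = E at *
  have hfin2 : V * 0.1 ≤ (5 * (k + 2) + 7) * E + 30 * E := by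
    refine le_of_mul_le_mul_left ?_ hX
    have := mul_le_mul_of_nonneg_left hexpy hX.le
    linarith
  have hfin3 : V * 0.1 ≤ 60 * y * E := by
    refine hfin2.trans ?_
    have : (5 * (k + 2) + 7 + 30 : ℝ) ≤ 60 * y := by linarith
    have := mul_le_mul_of_nonneg_right this hE.le
    linarith
  have := mul_le_mul_of_nonneg_right hfin3 hy2.le
  have e6 : 60 * y * E * y ^ 2 = 60 * y ^ 3 * E := by ring
  rw [e6] at this
  linarith

end

section

open Finset

set_option linter.unusedVariables false

theorem theta_lower (x : ℕ) (hx : 16777216 ≤ x) : (x:ℝ) / 2 ≤ Chebyshev.theta x := by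
  refine le_trans ?_ (Chebyshev.theta_ge x)
  have hx' : (16777216:ℝ) ≤ x := by exact_mod_cast hx
  obtain ⟨v, hv⟩ : ∃ v : ℝ, v = √(√(x:ℝ)) := ⟨_, rfl⟩
  have hv2 : v ^ 2 = √(x:ℝ) := by rw [hv]; exact Real.sq_sqrt (Real.sqrt_nonneg _)
  have hv4 : v ^ 4 = x := by
    rw [show v ^ 4 = (v ^ 2) ^ 2 by ring, hv2]; exact Real.sq_sqrt (by linarith)
  have hv0 : 0 ≤ v := by rw [hv]; exact Real.sqrt_nonneg _
  have hv64 : 64 ≤ v := by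
    by_contra h
    have : v ^ 4 < 64 ^ 4 := pow_lt_pow_left₀ (not_le.1 h) hv0 (by norm_num)
    rw [hv4] at this
    norm_num at this
    linarith
  have hlog : Real.log x ≤ 4 * v := by
    rw [← hv4, Real.log_pow]
    have := Real.log_le_sub_one_of_pos (show 0 < v by linarith)
    push_cast
    linarith
  have hlog1 : Real.log (x + 1) ≤ 1 + 4 * v := by
    have h1 : Real.log (x + 1) ≤ Real.log (2 * x) := Real.log_le_log (by linarith) (by linarith)
    rw [Real.log_mul (by norm_num) (by linarith)] at h1
    linarith [Real.log_two_lt_d9]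
  have h2 : 2 * √(x:ℝ) * Real.log x ≤ 8 * v ^ 3 := by
    rw [← hv2]
    have := mul_le_mul_of_nonneg_left hlog (show 0 ≤ 2 * v ^ 2 by positivity)
    linarith
  have h3 : v ^ 3 * 64 ≤ v ^ 4 := by
    rw [pow_succ v 3]; exact mul_le_mul_of_nonneg_left hv64 (by positivity)
  have h4 : v * 4096 ≤ v ^ 3 := by nlinarith
  have h5 := mul_le_mul_of_nonneg_left Real.log_two_gt_d9.le (show (0:ℝ) ≤ x by linarith)
  rw [hv4] at h3
  linarith

theorem Psi_lower (m x : ℕ) (hm : 0 < m) (hx : 16777216 ≤ x) : (x:ℝ) / 2 - Real.log m ≤ Psi m x := by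
  have h1 := theta_lower x hx
  unfold Chebyshev.theta at h1
  rw [Nat.floor_natCast] at h1
  have h2 : ∑ p ∈ m.primeFactors, Real.log p ≤ Real.log m := by
    have h3 := Nat.le_of_dvd hm (Nat.prod_primeFactors_dvd m)
    have h4 : 0 < ∏ p ∈ m.primeFactors, p := Finset.prod_pos fun p hp => (Nat.prime_of_mem_primeFactors hp).pos
    have h5 : Real.log ((∏ p ∈ m.primeFactors, p : ℕ) : ℝ) = ∑ p ∈ m.primeFactors, Real.log p := by
      rw [Nat.cast_prod]
      exact Real.log_prod (fun p hp => by exact_mod_cast (Nat.prime_of_mem_primeFactors hp).ne_zero)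
    rw [← h5]
    exact Real.log_le_log (Nat.cast_pos.2 h4) (Nat.cast_le.2 h3)
  have h3 : ∑ p ∈ Ioc 0 x with p.Prime, Real.log p ≤ Psi m x + ∑ p ∈ m.primeFactors, Real.log p := by
    unfold Psi
    calc ∑ p ∈ Ioc 0 x with p.Prime, Real.log p ≤ ∑ p ∈ US m x ∪ m.primeFactors, wt p := by
          refine le_trans (le_of_eq (Finset.sum_congr rfl fun p hp => ?_)) (Finset.sum_le_sum_of_subset_of_nonneg (f := wt) ?_ fun p _ _ => wt_nonneg p)
          · unfold wt; rw [if_pos (Finset.mem_filter.1 hp).2]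
          · intro p hp
            obtain ⟨a1, a2⟩ := Finset.mem_filter.1 hp
            rw [Finset.mem_Ioc] at a1
            rw [Finset.mem_union, mem_US, Nat.mem_primeFactors]
            by_cases h : p ∣ m
            · right; exact ⟨a2, h, hm.ne'⟩
            · left; exact ⟨a1.1, a1.2, (Nat.Prime.coprime_iff_not_dvd a2).2 h⟩
      _ ≤ ∑ p ∈ US m x, wt p + ∑ p ∈ m.primeFactors, wt p := by
          rw [← Finset.sum_union_inter]
          have := Finset.sum_nonneg (s := US m x ∩ m.primeFactors) (f := wt) fun p _ => wt_nonneg p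
          linarith
      _ = _ := by
          congr 1
          refine Finset.sum_congr rfl fun p hp => ?_
          unfold wt; rw [if_pos (Nat.prime_of_mem_primeFactors hp)]
  linarith

theorem list_log (T : Finset ℕ) (c : ℝ) (l : List ℕ) (h : ∀ a ∈ l, 1 ≤ a ∧ (a ∉ T → c ≤ Real.log a)) :
    1 ≤ l.prod ∧ ((l.filter fun a => a ∉ T).length : ℝ) * c ≤ Real.log l.prod := by
  induction l with
  | nil => simp
  | cons a l ih =>
    obtain ⟨i1, i2⟩ := ih fun b hb => h b (List.mem_cons_of_mem _ hb)
    obtain ⟨a1, a2⟩ := h a List.mem_cons_self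
    rw [List.prod_cons]
    refine ⟨Nat.mul_pos a1 i1, ?_⟩
    have ha : (a:ℝ) ≠ 0 := by exact_mod_cast (by omega : a ≠ 0)
    have hl : (l.prod:ℝ) ≠ 0 := by exact_mod_cast (by omega : l.prod ≠ 0)
    rw [Nat.cast_mul, Real.log_mul ha hl]
    by_cases hT : a ∈ T
    · rw [List.filter_cons_of_neg (by simpa using hT)]
      have := Real.log_natCast_nonneg a
      linarith
    · rw [List.filter_cons_of_pos (by simpa using hT), List.length_cons, Nat.cast_add, Nat.cast_one]
      linarith [a2 hT]

theorem omega_bound (m s l : ℕ) (y B : ℝ) (hs : 0 < s) (hsm : s.Coprime m) (hB : Real.log s ≤ B)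
    (h1 : ∀ p : ℕ, p.Prime → p.Coprime m → Real.log p ≤ y → ¬ p ∣ s)
    (h2 : #((Tq m y).filter fun q => q ∣ s) ≤ 4) (h3 : ∀ q ∈ Tq m y, ¬ q ^ 2 ∣ s) (hy : 0 < y)
    (hl : B < (l - 3) * (111.6 * y)) : s.primeFactorsList.length ≤ l := by
  classical
  rw [List.length_eq_length_filter_add (fun a => decide (a ∈ Tq m y))]
  have e1 : (s.primeFactorsList.filter fun a => decide (a ∈ Tq m y)).length ≤ 4 := by
    have hnd : (s.primeFactorsList.filter fun a => decide (a ∈ Tq m y)).Nodup := by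
      rw [List.nodup_iff_count_le_one]
      intro q
      by_cases hq : q ∈ Tq m y
      · refine (List.Sublist.count_le q List.filter_sublist).trans ?_
        rw [Nat.primeFactorsList_count_eq]
        by_contra hc
        exact h3 q hq ((Nat.Prime.pow_dvd_iff_le_factorization (mem_Tq.1 hq).1 hs.ne').2 (by omega))
      · rw [List.count_eq_zero_of_not_mem]
        · omega
        · intro h; exact hq (by simpa using (List.mem_filter.1 h).2)
    rw [← List.toFinset_card_of_nodup hnd]
    refine (Finset.card_le_card ?_).trans h2
    intro q hq
    rw [List.mem_toFinset, List.mem_filter] at hq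
    rw [Finset.mem_filter]
    exact ⟨by simpa using hq.2, Nat.dvd_of_mem_primeFactorsList hq.1⟩
  have e2 := (list_log (Tq m y) (111.6 * y) s.primeFactorsList fun a ha => by
    have hp := Nat.prime_of_mem_primeFactorsList ha
    have hd := Nat.dvd_of_mem_primeFactorsList ha
    have hc : a.Coprime m := Nat.Coprime.coprime_dvd_left hd hsm
    refine ⟨hp.pos, fun hT => ?_⟩
    by_contra hlt
    have hlo : y < Real.log a := by
      by_contra h
      exact h1 a hp hc (not_lt.1 h) hd
    exact hT (mem_Tq.2 ⟨hp, hc, hlo, (not_le.1 hlt).le⟩)).2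
  rw [Nat.prod_primeFactorsList hs.ne'] at e2
  have e3 : ((s.primeFactorsList.filter fun a => a ∉ Tq m y).length : ℝ) < l - 3 := by
    have := (e2.trans hB).trans_lt hl
    exact lt_of_mul_lt_mul_right this (by positivity)
  have e4 : (s.primeFactorsList.filter fun a => a ∉ Tq m y).length + 4 ≤ l := by
    have : (s.primeFactorsList.filter fun a => a ∉ Tq m y).length + 3 < l := by
      have : ((s.primeFactorsList.filter fun a => a ∉ Tq m y).length : ℝ) + 3 < l := by linarith
      exact_mod_cast this
    omega
  have e5 : (s.primeFactorsList.filter fun a => !decide (a ∈ Tq m y)) = s.primeFactorsList.filter fun a => a ∉ Tq m y := by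
    congr 1; funext a; simp
  rw [e5]
  omega

end

section

open Finset

set_option linter.unusedVariables false

theorem final_core (e0 : ℝ) (he0 : 0 < e0) (α β : ℝ) (hα : 1 / 2 ≤ α) (hα1 : α ≤ 1) (hβ : 1 / 2 ≤ β) (hβ1 : β ≤ 1)
    (h16 : e0 ≤ α / 16 + β - 1) (h3 : e0 ≤ α / 3 + β - 5 / 4) (l : ℕ) (hl : β < (l - 3) * (1.209 * e0)) :
    ∃ M : ℕ, ∀ m : ℕ, M ≤ m → ∀ a : ℤ, Int.gcd a m = 1 →
      ∃ p s : ℕ, p.Prime ∧ (p : ℝ) ≤ (m : ℝ) ^ α ∧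
        0 < s ∧ (s : ℝ) ≤ (m : ℝ) ^ β ∧ s.primeFactorsList.length ≤ l ∧
        ((p * s : ℕ) : ℤ) ≡ a [ZMOD (m : ℤ)] := by
  obtain ⟨y0, hsieve⟩ := sieve_main
  obtain ⟨J, hJ⟩ : ∃ J : ℕ, J = ⌈10000 / e0⌉₊ := ⟨_, rfl⟩
  have hJ1 : 10000 / e0 ≤ J := by rw [hJ]; exact Nat.le_ceil _
  have hJ2 : 10000 ≤ J * e0 := by rwa [div_le_iff₀ he0] at hJ1
  obtain ⟨c, hc⟩ : ∃ c, c = e0 / 10000 := ⟨_, rfl⟩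
  have hc0 : 0 < c := by rw [hc]; positivity
  have hc1 : c ≤ 1 / 2 := by rw [hc]; linarith
  obtain ⟨M1, hM1⟩ := pa_divisor_large c hc0 20
  obtain ⟨L0, hL0⟩ : ∃ L0 : ℝ, 4 / c ^ 2 ≤ L0 ∧ 40000000 ≤ L0 ∧ 2 * (J:ℝ) ≤ L0 ∧ 120 * y0 / (1.3 * e0) ≤ L0 :=
    ⟨max (4 / c ^ 2) (max 40000000 (max (2 * (J:ℝ)) (120 * y0 / (1.3 * e0)))), by simp, by simp, by simp, by simp⟩
  obtain ⟨k1, k2, k3, k4⟩ := hL0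
  refine ⟨max M1 ⌈Real.exp L0⌉₊, ?_⟩
  intro m hm a ha
  have hmM1 : M1 ≤ m := (le_max_left _ _).trans hm
  have hmexp : Real.exp L0 ≤ m := (Nat.le_ceil _).trans (Nat.cast_le.2 ((le_max_right _ _).trans hm))
  have hmpos : (0:ℝ) < m := (Real.exp_pos _).trans_le hmexp
  obtain ⟨L, hL⟩ : ∃ L, L = Real.log m := ⟨_, rfl⟩
  have hmL : (m:ℝ) = Real.exp L := by rw [hL, Real.exp_log hmpos]
  have hLL : L0 ≤ L := by rw [hmL] at hmexp; exact Real.exp_le_exp.1 hmexp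
  have hm0 : 0 < m := by exact_mod_cast hmpos
  have hm1 : 1 < m := by
    have : (1:ℝ) < m := by rw [hmL]; exact Real.one_lt_exp_iff.2 (by linarith)
    exact_mod_cast this
  haveI : NeZero m := ⟨hm0.ne'⟩
  have hpow : ∀ z : ℝ, (m:ℝ) ^ z = Real.exp (z * L) := fun z => by
    rw [Real.rpow_def_of_pos hmpos, ← hL, mul_comm]
  have hLpos : 0 < L := by linarith
  -- growth
  have hgr : ∀ z, c ≤ z → L + 1001 ≤ Real.exp (z * L) := by
    intro z hz
    have h1 : 0 ≤ c * L := by positivity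
    have h2 := Real.quadratic_le_exp_of_nonneg h1
    have h3 : Real.exp (c * L) ≤ Real.exp (z * L) := Real.exp_le_exp.2 (mul_le_mul_of_nonneg_right hz hLpos.le)
    have h4 : 4 ≤ L * c ^ 2 := by
      have := k1.trans hLL
      rwa [div_le_iff₀ (by positivity)] at this
    have h5 : 2 * L ≤ (c * L) ^ 2 / 2 := by
      have := mul_le_mul_of_nonneg_right h4 hLpos.le
      nlinarith only [this]
    linarith
  have gα := hgr α (by linarith)
  have gβ := hgr β (by linarith)
  have gc := hgr c le_rfl
  have gc5 := hgr (e0 / 2000) (by rw [hc]; linarith)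
  obtain ⟨x, hx⟩ : ∃ x, x = ⌊(m:ℝ) ^ α⌋₊ := ⟨_, rfl⟩
  obtain ⟨T, hT⟩ : ∃ T, T = ⌊(m:ℝ) ^ c⌋₊ := ⟨_, rfl⟩
  obtain ⟨K, hK⟩ : ∃ K, K = ⌊(m:ℝ) ^ β / J⌋₊ := ⟨_, rfl⟩
  have hJpos : (0:ℝ) < J := by
    by_contra h
    have : (J:ℝ) * e0 ≤ 0 := mul_nonpos_of_nonpos_of_nonneg (not_lt.1 h) he0.le
    linarith
  have hx1 : (x:ℝ) ≤ Real.exp (α * L) := by rw [hx, ← hpow]; exact Nat.floor_le (by positivity)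
  have hx2 : Real.exp (α * L) < x + 1 := by rw [hx, ← hpow]; exact Nat.lt_floor_add_one _
  have hT1 : (T:ℝ) ≤ Real.exp (c * L) := by rw [hT, ← hpow]; exact Nat.floor_le (by positivity)
  have hT2 : Real.exp (c * L) < T + 1 := by rw [hT, ← hpow]; exact Nat.lt_floor_add_one _
  have hK1 : (K:ℝ) ≤ Real.exp (β * L) / J := by rw [hK, ← hpow]; exact Nat.floor_le (by positivity)
  have hK2 : Real.exp (β * L) / J < K + 1 := by rw [hK, ← hpow]; exact Nat.lt_floor_add_one _
  have hKge : (1:ℝ) ≤ K := by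
    have h1 : 1 ≤ K := by
      rw [hK, hpow]
      apply Nat.le_floor
      rw [Nat.cast_one, le_div_iff₀ hJpos]; linarith
    exact_mod_cast h1
  have hJK : (J:ℝ) * K ≤ Real.exp (β * L) := by rw [le_div_iff₀ hJpos] at hK1; linarith
  have hJK2 : Real.exp (β * L) ≤ 2 * J * K := by
    rw [div_lt_iff₀ hJpos] at hK2
    nlinarith only [hK2, hKge, hJpos]
  have hxbig : 16777216 ≤ x := by
    have : (16777216:ℝ) ≤ x := by linarith
    exact_mod_cast this
  have hPsi := Psi_lower m x hm0 hxbig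
  rw [← hL] at hPsi
  have hT1000 : (1000:ℝ) ≤ T := by linarith
  have hxL : L * 10 ≤ 4 * x := by
    have h1 : 0 ≤ L / 2 := by linarith
    have h2 := Real.quadratic_le_exp_of_nonneg h1
    have h3 : Real.exp (L / 2) ≤ Real.exp (α * L) := Real.exp_le_exp.2 (by nlinarith only [hα, hLpos])
    nlinarith only [h2, h3, hx2, hLL, k2]
  have hPsi10 : (x:ℝ) / 10 ≤ Psi m x := by linarith
  have hx0 : (16777216:ℝ) ≤ x := by exact_mod_cast hxbig
  have bs : Bs m T x J K L ((1 - β) * L) (e0 * L) ((α - 3 / 4) * L) := by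
    have eα : 3 / 4 * L + (α - 3 / 4) * L = α * L := by ring
    refine ⟨hmL, ?_, by exact_mod_cast hT1000, by linarith, ?_, ?_, by positivity, ?_, ?_, ?_, ?_, ?_, ?_, ?_, ?_, ?_⟩
    · intro n hn hn2
      rw [hT]
      exact Nat.le_floor (hM1 m hmM1 n hn hn2)
    · rw [show e0 * L / 10000 = c * L by rw [hc]; ring]; exact hT1
    · exact mul_nonneg (by linarith) hLpos.le
    · rw [eα]; nlinarith only [mul_le_mul_of_nonneg_right h16 hLpos.le]
    · nlinarith only [mul_le_mul_of_nonneg_right h3 hLpos.le]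
    · nlinarith only [mul_le_mul_of_nonneg_right hα1 hLpos.le]
    · rw [eα]; exact hx1
    · rw [eα]; linarith
    · rw [show L - (1 - β) * L = β * L by ring]; exact hJK2
    · rw [show e0 * L / 2000 = e0 / 2000 * L by ring]; linarith
    · nlinarith only [mul_le_mul_of_nonneg_right hJ2 hLpos.le]
    · rw [eα]
      have h1 : (1000:ℝ) ^ 2 ≤ (T:ℝ) ^ 2 := pow_le_pow_left₀ (by norm_num) hT1000 2
      have h2 : (1000:ℝ) ^ 2 * (x / 10) ≤ (T:ℝ) ^ 2 * Psi m x := mul_le_mul h1 hPsi10 (by positivity) (by positivity)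
      linarith
  -- sieve
  obtain ⟨y, hy⟩ : ∃ y, y = 1.3 * (e0 * L) / 120 := ⟨_, rfl⟩
  have hy120 : 120 * y = 1.3 * (e0 * L) := by rw [hy]; ring
  have heL : 0 < e0 * L := by positivity
  have hypos : 0 < y := by rw [hy]; positivity
  have hyy0 : y0 ≤ y := by
    have := k4.trans hLL
    rw [div_le_iff₀ (by positivity)] at this
    linarith
  obtain ⟨az, haz⟩ : ∃ az : ZMod m, az = (a : ZMod m) := ⟨_, rfl⟩
  have hunit : IsUnit az := by
    rw [haz, ZMod.coe_int_isUnit_iff_isCoprime, isCoprime_comm]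
    exact Int.isCoprime_iff_gcd_eq_one.2 ha
  have hX : 0 < XX m x J K := by
    unfold XX
    have : 0 < Psi m x := by linarith
    positivity
  have hDle : ((⌊Real.exp (120 * y)⌋₊ : ℕ) : ℝ) ≤ Real.exp (1.3 * (e0 * L)) := by
    rw [hy120]; exact Nat.floor_le (Real.exp_pos _).le
  have hAd : ∀ d, ∑ f ∈ FJ J K, Aw m x J az f * ind d (∑ i, f i) = Ad m x J K az d := by
    intro d
    unfold Ad ind
    rw [Finset.sum_filter]
    exact Finset.sum_congr rfl fun f _ => by rw [mul_ite, mul_one, mul_zero]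
  have hexp : XX m x J K * Real.exp (-(e0 * L / 4000)) ≤ XX m x J K * Real.exp (-(y / 50)) := by
    refine mul_le_mul_of_nonneg_left (Real.exp_le_exp.2 ?_) hX.le
    linarith
  obtain ⟨f, hf, hw, c1, c2, c3⟩ := hsieve y hyy0 (Fin J → ℕ) m (FJ J K) (Aw m x J az) (fun f => ∑ i, f i) (XX m x J K) hX
    (fun f _ => Aw_nonneg m x J az f)
    (by
      simp only [hAd]
      have := bs.level az hunit _ 1 (Or.inl rfl) hDle
      simp only [pow_one] at this
      exact this.trans hexp)
    (by
      simp only [hAd]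
      exact (bs.level az hunit _ 2 (Or.inr rfl) hDle).trans hexp)
  obtain ⟨s, hs⟩ : ∃ s : ℕ, s = ∑ i, f i := ⟨_, rfl⟩
  simp only [← hs] at c1 c2 c3
  unfold Aw at hw
  rw [← hs] at hw
  obtain ⟨p, hp, hp2⟩ := Finset.exists_ne_zero_of_sum_ne_zero hw.ne'
  have hps : (p : ZMod m) * (s : ZMod m) = az := by
    by_contra h; rw [if_neg h] at hp2; exact hp2 rfl
  rw [if_pos hps] at hp2
  have hpp : p.Prime := by
    by_contra h; unfold wt at hp2; rw [if_neg h] at hp2; exact hp2 rfl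
  rw [mem_US] at hp
  have hscop : s.Coprime m := by
    have : IsUnit (s : ZMod m) := by
      rw [← hps] at hunit
      exact isUnit_of_mul_isUnit_right hunit
    exact (ZMod.isUnit_iff_coprime s m).1 this
  have hspos : 0 < s := by
    rcases Nat.eq_zero_or_pos s with h | h
    · rw [h, Nat.coprime_zero_left] at hscop; omega
    · exact h
  have hsle : (s:ℝ) ≤ Real.exp (β * L) := by
    refine le_trans ?_ hJK
    have h1 : s ≤ J * K := by
      rw [hs]
      have : ∀ i ∈ (Finset.univ : Finset (Fin J)), f i ≤ K := fun i _ => by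
        have := Fintype.mem_piFinset.1 hf i
        exact (Finset.mem_Icc.1 this).2
      simpa using Finset.sum_le_card_nsmul _ _ _ this
    exact_mod_cast h1
  have hs0 : (0:ℝ) < s := by exact_mod_cast hspos
  refine ⟨p, s, hpp, ?_, hspos, ?_, ?_, ?_⟩
  · rw [hpow]; exact (Nat.cast_le.2 hp.2.1).trans hx1
  · rw [hpow]; exact hsle
  · refine omega_bound m s l y (β * L) hspos hscop ?_ c1 c2 c3 hypos ?_
    · rwa [Real.log_le_iff_le_exp hs0]
    · have := mul_lt_mul_of_pos_right hl hLpos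
      refine this.trans_le (le_of_eq ?_)
      rw [hy]; ring
  · rw [← ZMod.intCast_eq_intCast_iff]
    push_cast
    rw [hps, haz]

end

theorem stmt_0 (l : ℕ) (hl : 2 ≤ l) (α β : ℝ)
    (hα : 1/2 ≤ α) (hβ : 0 ≤ β) (hα1 : α ≤ 1) (hβ1 : β ≤ 1)
    (h1 : α / 16 + β > 1) (h2 : α / 3 + β > 5/4)
    (h3 : max (β / (α / 16 + β - 1)) (β / (α / 3 + β - 5/4)) ≤ greavesTheta l) :
    ∀ ε : ℝ, 0 < ε → ∃ M : ℕ, ∀ m : ℕ, M ≤ m → ∀ a : ℤ, Int.gcd a m = 1 →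
      ∃ p s : ℕ, p.Prime ∧ (p : ℝ) ≤ (m : ℝ) ^ (α + ε) ∧
        0 < s ∧ (s : ℝ) ≤ (m : ℝ) ^ (β + ε) ∧ s.primeFactorsList.length ≤ l ∧
        ((p * s : ℕ) : ℤ) ≡ a [ZMOD (m : ℤ)] := by
  intro ε hε
  have d1 : 0 < α / 16 + β - 1 := by linarith
  have d2 : 0 < α / 3 + β - 5/4 := by linarith
  have hb0 : 0 < β := by linarith
  have t1 : β / (α / 16 + β - 1) ≤ greavesTheta l := le_trans (le_max_left _ _) h3
  have t2 : β / (α / 3 + β - 5/4) ≤ greavesTheta l := le_trans (le_max_right _ _) h3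
  have t16 : 16 ≤ greavesTheta l := by
    refine le_trans ?_ t1
    rw [le_div_iff₀ d1]
    linarith
  have hd : 0 < greavesDelta l := by
    unfold greavesDelta
    split_ifs <;> norm_num
  have hl17 : 17 ≤ l := by
    have hlt : (16 : ℝ) < (l : ℝ) := by
      unfold greavesTheta at t16
      linarith
    have hlt' : 16 < l := by exact_mod_cast hlt
    omega
  have hth : greavesTheta l = (l : ℝ) - 0.124821 := by
    unfold greavesTheta greavesDelta
    rw [if_neg (by omega), if_neg (by omega), if_neg (by omega)]
  have hlR : (17 : ℝ) ≤ (l : ℝ) := by exact_mod_cast hl17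
  have hthpos : 0 < greavesTheta l := by linarith
  have he0 : 0 < β / greavesTheta l := div_pos hb0 hthpos
  have e1 : β / greavesTheta l ≤ α / 16 + β - 1 := by
    rw [div_le_iff₀ hthpos]
    rw [div_le_iff₀ d1] at t1
    linarith
  have e2 : β / greavesTheta l ≤ α / 3 + β - 5/4 := by
    rw [div_le_iff₀ hthpos]
    rw [div_le_iff₀ d2] at t2
    linarith
  have hlt : β < ((l : ℝ) - 3) * (1.209 * (β / greavesTheta l)) := by
    have hβe : β = greavesTheta l * (β / greavesTheta l) := by
      field_simp
    have hlt2 : greavesTheta l < ((l : ℝ) - 3) * 1.209 := by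
      rw [hth]
      linarith
    calc β = greavesTheta l * (β / greavesTheta l) := hβe
      _ < (((l : ℝ) - 3) * 1.209) * (β / greavesTheta l) :=
        mul_lt_mul_of_pos_right hlt2 he0
      _ = _ := by ring
  obtain ⟨M, hM⟩ := final_core (β / greavesTheta l) he0 α β hα hα1 (by linarith) hβ1 e1 e2 l hlt
  refine ⟨max M 1, fun m hm a ha => ?_⟩
  obtain ⟨p, s, hp, hpm, hs, hsm, hsl, hc⟩ := hM m (le_trans (le_max_left _ _) hm) a ha
  have hm1 : (1 : ℝ) ≤ (m : ℝ) := by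
    exact_mod_cast le_trans (le_max_right M 1) hm
  exact ⟨p, s, hp,
    hpm.trans (Real.rpow_le_rpow_of_exponent_le hm1 (by linarith)), hs,
    hsm.trans (Real.rpow_le_rpow_of_exponent_le hm1 (by linarith)), hsl, hc⟩
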